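/- Let 1 < c < 37/18 with c ≠ 2, let N be sufficiently large, and set X = (2N/3)^{1/c}. Define B₁(R) = ∫_{−∞}^{+∞} S(x)³ e(−Rx) Φ(x) dx and H(R) = ∫_{−∞}^{+∞} I(x)³ e(−Rx) Φ(x) dx. Then ∫_N^{2N} |B₁(R) − H(R)|² dR ≪ ε² N^{6/c − 1} exp(−(1/3)·((1/c)·log(2N/3))^{1/5}), where the implied constant depends only on c and η. -/

import Mathlib

open MeasureTheory

noncomputable def e (t : ℝ) : ℂ := Complex.exp (2 * Real.pi * Complex.I * t)

/-- The exponential sum `S(x) = Σ_{X/2 < p ≤ X} (log p) e(p^c x)` over primes. -/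
noncomputable def S (X c : ℝ) (x : ℝ) : ℂ :=
  ∑ p ∈ (Finset.range (⌈X⌉₊ + 1)).filter
      (fun p : ℕ => p.Prime ∧ X / 2 < (p : ℝ) ∧ (p : ℝ) ≤ X),
    (Real.log p : ℂ) * e ((p : ℝ) ^ c * x)

/-- The integral `I(x) = ∫_{X/2}^X e(t^c x) dt`. -/
noncomputable def I (X c : ℝ) (x : ℝ) : ℂ := ∫ t in (X / 2)..X, e (t ^ c * x)

theorem e_norm (t : ℝ) : ‖e t‖ = 1 := by
  have h : (2 * Real.pi * Complex.I * t : ℂ) = ((2 * Real.pi * t : ℝ) : ℂ) * Complex.I := by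
    push_cast; ring
  rw [e, h, Complex.norm_exp_ofReal_mul_I]

theorem e_add (a b : ℝ) : e (a + b) = e a * e b := by
  rw [e, e, e, ← Complex.exp_add]; congr 1; push_cast; ring

theorem e_zero : e 0 = 1 := by simp [e]

theorem e_neg (a : ℝ) : e (-a) = (starRingEnd ℂ) (e a) := by
  rw [e, e, ← Complex.exp_conj]; congr 1; simp [Complex.conj_ofNat]

theorem e_neg_mul (a : ℝ) : e (-a) * e a = 1 := by
  rw [← e_add]; simp [e_zero]

theorem e_int (n : ℤ) : e n = 1 := by
  rw [e, Complex.exp_eq_one_iff]; exact ⟨n, by push_cast; ring⟩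

theorem e_ne (t : ℝ) : e t ≠ 0 := Complex.exp_ne_zero _

theorem e_cont : Continuous e := by unfold e; fun_prop

theorem e_hasDerivAt (t : ℝ) : HasDerivAt e (2 * Real.pi * Complex.I * e t) t := by
  have h : HasDerivAt (fun z : ℂ => Complex.exp (2 * Real.pi * Complex.I * z))
      (Complex.exp (2 * Real.pi * Complex.I * t) * (2 * Real.pi * Complex.I * 1)) (t : ℂ) :=
    ((hasDerivAt_id (t : ℂ)).const_mul _).cexp
  have h2 : HasDerivAt e _ t := h.comp_ofReal
  exact h2.congr_deriv (by unfold e; ring)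


theorem e_sum_neg {ι : Type*} (s : Finset ι) (f : ι → ℝ) :
    ‖∑ n ∈ s, e (-(f n))‖ = ‖∑ n ∈ s, e (f n)‖ := by
  simp_rw [e_neg, ← map_sum]; exact RCLike.norm_conj _

theorem e_sum_le {ι : Type*} (s : Finset ι) (f : ι → ℝ) : ‖∑ n ∈ s, e (f n)‖ ≤ s.card := by
  refine (norm_sum_le _ _).trans ?_; simp [e_norm]

theorem KL_aux (f δ ct : ℕ → ℝ) (μ : ℝ) (hμ : 0 < μ) (hδ : ∀ n, δ n = f (n + 1) - f n)
    (hct : ∀ n, ct n = Real.cos (Real.pi * δ n) / Real.sin (Real.pi * δ n)) (N : ℕ)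
    (h1 : ∀ n ≤ N, μ ≤ δ n ∧ δ n ≤ 1 - μ) (h2 : ∀ n < N, δ n ≤ δ (n + 1)) :
    ‖∑ n ∈ Finset.range (N + 1), e (f n) - (-1 / 2 - Complex.I / 2 * ct N) * e (f (N + 1))
      + (-1 / 2 - Complex.I / 2 * ct 0) * e (f 0)‖ ≤ (ct 0 - ct N) / 2 := by
  have key : ∀ n ≤ N, e (f n) = (-1 / 2 - Complex.I / 2 * ct n) * (e (f (n + 1)) - e (f n)) := by
    intro n hn
    obtain ⟨ha, hb⟩ := h1 n hn
    have hs : 0 < Real.sin (Real.pi * δ n) :=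
      Real.sin_pos_of_pos_of_lt_pi (by nlinarith only [hμ, ha, Real.pi_pos])
        (by nlinarith only [hμ, hb, Real.pi_pos])
    have hf : f (n + 1) = f n + δ n := by rw [hδ]; ring
    rw [hf, e_add]
    have hed : e (δ n) = ((Real.cos (Real.pi * δ n) : ℂ) + Real.sin (Real.pi * δ n) * Complex.I) ^ 2 := by
      rw [e]; push_cast
      rw [← Complex.exp_mul_I, ← Complex.exp_nat_mul]; congr 1; push_cast; ring
    have hcs : (Real.cos (Real.pi * δ n) : ℂ) ^ 2 + (Real.sin (Real.pi * δ n) : ℂ) ^ 2 = 1 := by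
      norm_cast; rw [add_comm]; exact Real.sin_sq_add_cos_sq _
    have hs' : (Real.sin (Real.pi * δ n) : ℂ) ≠ 0 := by exact_mod_cast hs.ne'
    have : (-1 / 2 - Complex.I / 2 * ct n) * (e (δ n) - 1) = 1 := by
      rw [hed, hct]; push_cast at *
      field_simp
      have hI := Complex.I_sq
      generalize Complex.cos (Real.pi * δ n) = C at *
      generalize Complex.sin (Real.pi * δ n) = D at *
      linear_combination (-Complex.I * C + D) * hcs + (-D^3-2*C^2*D - Complex.I * C * D^2) * hI
    linear_combination (-e (f n)) * this
  induction N with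
  | zero => 
    have := key 0 le_rfl
    have h : ∑ n ∈ Finset.range (0 + 1), e (f n) - (-1 / 2 - Complex.I / 2 * ct 0) * e (f (0 + 1))
      + (-1 / 2 - Complex.I / 2 * ct 0) * e (f 0) = 0 := by
      simp only [zero_add, Finset.range_one, Finset.sum_singleton]
      linear_combination this
    rw [h]; simp
  | succ N ih =>
    have ih' := ih (fun n hn => h1 n (by omega)) (fun n hn => h2 n (by omega))
      (fun n hn => key n (by omega))
    have k2 := key (N + 1) le_rfl
    rw [Finset.sum_range_succ]
    have hle : ct (N + 1) ≤ ct N := by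
      have a1 := h1 N (by omega); have a2 := h1 (N + 1) le_rfl
      have a3 := h2 N (by omega)
      have hp := Real.pi_pos
      have s1 : 0 < Real.sin (Real.pi * δ N) :=
        Real.sin_pos_of_pos_of_lt_pi (by have := a1.1; nlinarith) (by nlinarith)
      have s2 : 0 < Real.sin (Real.pi * δ (N + 1)) :=
        Real.sin_pos_of_pos_of_lt_pi (by have := a2.1; nlinarith) (by nlinarith)
      rw [hct, hct, div_le_div_iff₀ s2 s1]
      have : 0 ≤ Real.sin (Real.pi * δ (N + 1) - Real.pi * δ N) :=
        Real.sin_nonneg_of_nonneg_of_le_pi (by nlinarith only [a3, hp]) (by nlinarith)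
      rw [Real.sin_sub] at this
      linarith only [this]
    have e1 : ∑ n ∈ Finset.range (N + 1), e (f n) + e (f (N + 1))
        - (-1 / 2 - Complex.I / 2 * ct (N + 1)) * e (f (N + 1 + 1))
        + (-1 / 2 - Complex.I / 2 * ct 0) * e (f 0) =
        (∑ n ∈ Finset.range (N + 1), e (f n) - (-1 / 2 - Complex.I / 2 * ct N) * e (f (N + 1))
      + (-1 / 2 - Complex.I / 2 * ct 0) * e (f 0)) +
        (Complex.I / 2 * ((ct (N + 1) - ct N : ℝ) : ℂ)) * e (f (N + 1)) := by
      push_cast; linear_combination k2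
    rw [e1]
    refine (norm_add_le _ _).trans ?_
    have : ‖(Complex.I / 2 * ((ct (N + 1) - ct N : ℝ) : ℂ)) * e (f (N + 1))‖ = (ct N - ct (N + 1)) / 2 := by
      rw [norm_mul, norm_mul, e_norm, Complex.norm_real, Real.norm_eq_abs, abs_of_nonpos (by linarith only [hle])]
      simp; ring
    rw [this]; linarith only [ih']

theorem KL (f : ℕ → ℝ) (m : ℤ) (μ : ℝ) (hμ : 0 < μ) (N : ℕ)
    (h1 : ∀ n < N, m + μ ≤ f (n + 1) - f n ∧ f (n + 1) - f n ≤ m + 1 - μ)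
    (h2 : ∀ n, n + 1 < N → f (n + 1) - f n ≤ f (n + 2) - f (n + 1)) :
    ‖∑ n ∈ Finset.range N, e (f n)‖ ≤ 2 / μ := by
  rcases N with _ | N
  · simp; positivity
  set g : ℕ → ℝ := fun n => f n - m * n with hg
  have hgf : ∀ n, e (f n) = e (g n) := by
    intro n
    have : f n = g n + ((m * n : ℤ) : ℝ) := by simp [hg]
    rw [this, e_add, e_int, mul_one]
  simp_rw [hgf]
  set δ : ℕ → ℝ := fun n => g (n + 1) - g n with hδ
  have hd : ∀ n, δ n = f (n + 1) - f n - m := by intro n; simp [hδ, hg]; ring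
  set ct : ℕ → ℝ := fun n => Real.cos (Real.pi * δ n) / Real.sin (Real.pi * δ n) with hct
  have H1 : ∀ n ≤ N, μ ≤ δ n ∧ δ n ≤ 1 - μ := by
    intro n hn; rw [hd]; have := h1 n (by omega); constructor <;> linarith
  have main := KL_aux g δ ct μ hμ (fun _ => rfl) (fun _ => rfl) N H1 (by
    intro n hn; rw [hd, hd]; have := h2 n (by omega); linarith)
  have hctb : ∀ n ≤ N, |ct n| ≤ 1 / (2 * μ) := by
    intro n hn
    obtain ⟨ha, hb⟩ := H1 n hn
    have hp := Real.pi_pos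
    have hs : 2 * μ ≤ Real.sin (Real.pi * δ n) := by
      rcases le_total (δ n) (1 / 2) with h | h
      · have := Real.mul_le_sin (x := Real.pi * δ n) (by nlinarith only [hμ, hp, ha]) (by nlinarith only [hp, h])
        have h3 : 2 / Real.pi * (Real.pi * δ n) = 2 * δ n := by field_simp
        linarith only [ha, this, h3]
      · have := Real.mul_le_sin (x := Real.pi * (1 - δ n)) (by nlinarith only [hμ, hp, hb]) (by nlinarith only [hp, h])
        have h3 : 2 / Real.pi * (Real.pi * (1 - δ n)) = 2 * (1 - δ n) := by field_simp
        have h4 : Real.sin (Real.pi * (1 - δ n)) = Real.sin (Real.pi * δ n) := by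
          rw [← Real.sin_pi_sub]; congr 1; ring
        linarith only [hb, this, h3, h4]
    simp only [hct]
    rw [abs_div, abs_of_pos (show 0 < Real.sin (Real.pi * δ n) by linarith only [hμ, hs])]
    exact div_le_div₀ zero_le_one (Real.abs_cos_le_one _) (by positivity) hs
  have hμ2 : μ ≤ 1 / 2 := by have := H1 0 (by omega); linarith
  have hq : ∀ n ≤ N, ∀ t, ‖(-1 / 2 - Complex.I / 2 * ct n) * e t‖ ≤ 1 / 2 + 1 / (4 * μ) := by
    intro n hn t
    rw [norm_mul, e_norm, mul_one]
    refine (norm_sub_le _ _).trans ?_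
    rw [norm_mul, Complex.norm_real, Real.norm_eq_abs]
    have := hctb n hn
    have e1 : ‖Complex.I / 2‖ = 1 / 2 := by simp
    have e2 : ‖(-1 / 2 : ℂ)‖ = 1 / 2 := by simp
    have e3 : 1 / (4 * μ) = 1 / 2 * (1 / (2 * μ)) := by field_simp; norm_num
    rw [e1, e2, e3]; linarith only [this]
  set A := ∑ n ∈ Finset.range (N + 1), e (g n)
  have a1 := hq N le_rfl (g (N + 1))
  have a2 := hq 0 (by omega) (g 0)
  have b1 := hctb N le_rfl
  have b2 := hctb 0 (by omega)
  rw [abs_le] at b1 b2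
  have c1 : A = (A - (-1 / 2 - Complex.I / 2 * ct N) * e (g (N + 1))
      + (-1 / 2 - Complex.I / 2 * ct 0) * e (g 0)) + (-1 / 2 - Complex.I / 2 * ct N) * e (g (N + 1))
      - (-1 / 2 - Complex.I / 2 * ct 0) * e (g 0) := by ring
  rw [c1]
  refine (norm_sub_le _ _).trans ((add_le_add_left (norm_add_le _ _) _).trans ?_)
  have e4 : 2 / μ = 4 * (1 / (2 * μ)) := by field_simp; norm_num
  have e3 : 1 / (4 * μ) = 1 / 2 * (1 / (2 * μ)) := by field_simp; norm_num
  have e5 : 1 ≤ 1 / (2 * μ) := by rw [le_div_iff₀ (by positivity)]; linarith only [hμ2]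
  rw [e3] at a1 a2
  rw [e4]
  linarith

theorem mono_split (δ : ℕ → ℝ) (N : ℕ) (hm : ∀ n, n + 1 < N → δ n ≤ δ (n + 1)) (t : ℝ) :
    ∃ k ≤ N, (∀ n < k, δ n < t) ∧ ∀ n, k ≤ n → n < N → t ≤ δ n := by
  induction N with
  | zero => exact ⟨0, le_rfl, by simp, by omega⟩
  | succ N ih =>
    obtain ⟨k, hk, a, b⟩ := ih (fun n hn => hm n (by omega))
    by_cases h : k = N
    · by_cases h2 : δ N < t
      · refine ⟨N + 1, le_rfl, fun n hn => ?_, by omega⟩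
        rcases Nat.lt_succ_iff_lt_or_eq.1 hn with h3 | h3
        · exact a n (by omega)
        · rw [h3]; exact h2
      · refine ⟨k, by omega, a, fun n h1 h3 => ?_⟩
        have : n = N := by omega
        rw [this]; linarith only [h2]
    · refine ⟨k, by omega, a, fun n h1 h3 => ?_⟩
      by_cases h4 : n = N
      · obtain ⟨M, rfl⟩ : ∃ M, N = M + 1 := ⟨N - 1, by omega⟩
        rw [h4]; exact (b M (by omega) (by omega)).trans (hm M (by omega))
      · exact b n h1 (by omega)

theorem sum_split (f : ℕ → ℝ) {k N : ℕ} (hk : k ≤ N) :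
    ∑ n ∈ Finset.range N, e (f n) = ∑ n ∈ Finset.range k, e (f n) +
      ∑ n ∈ Finset.range (N - k), e (f (k + n)) := by
  obtain ⟨m, rfl⟩ := Nat.exists_eq_add_of_le hk
  rw [Finset.sum_range_add, Nat.add_sub_cancel_left]

theorem short_count (δ : ℕ → ℝ) (N : ℕ) (lam t μ : ℝ) (hl : 0 < lam)
    (h : ∀ n, n + 1 < N → lam ≤ δ (n + 1) - δ n) (hμ : 0 ≤ μ)
    (hw : ∀ n < N, t ≤ δ n ∧ δ n ≤ t + μ) : (N : ℝ) ≤ μ / lam + 1 := by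
  rcases N with _ | N
  · simp; positivity
  have : ∀ n ≤ N, δ 0 + n * lam ≤ δ n := by
    intro n; induction n with
    | zero => simp
    | succ n ih => intro hn; have := ih (by omega); have := h n (by omega); push_cast; linarith
  have a := this N le_rfl
  have b := hw 0 (by omega); have c := hw N (by omega)
  push_cast; rw [add_le_add_iff_right, le_div_iff₀ hl]; linarith

theorem SD_block (f : ℕ → ℝ) (N : ℕ) (lam μ : ℝ) (hl : 0 < lam) (hμ : 0 < μ) (m : ℤ)
    (h : ∀ n, n + 1 < N → lam ≤ (f (n + 2) - f (n + 1)) - (f (n + 1) - f n))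
    (hw : ∀ n < N, m ≤ f (n + 1) - f n ∧ f (n + 1) - f n ≤ m + 1) :
    ‖∑ n ∈ Finset.range N, e (f n)‖ ≤ 2 * (μ / lam + 1) + 2 / μ := by
  set δ : ℕ → ℝ := fun n => f (n + 1) - f n with hδ
  have hm : ∀ n, n + 1 < N → δ n ≤ δ (n + 1) := fun n hn => by
    have := h n hn; simp only [hδ]; linarith
  obtain ⟨k, hk, a, b⟩ := mono_split δ N hm (m + μ)
  have s1 : (k : ℝ) ≤ μ / lam + 1 := short_count δ k lam m μ hl (fun n hn => h n (by omega)) hμ.le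
    (fun n hn => ⟨(hw n (by omega)).1, (a n hn).le⟩)
  obtain ⟨l, hl', c, d⟩ := mono_split (fun n => δ (k + n)) (N - k)
    (fun n hn => hm (k + n) (by omega)) (m + 1 - μ)
  have s2 : ((N - k - l : ℕ) : ℝ) ≤ μ / lam + 1 :=
    short_count (fun n => δ (k + (l + n))) (N - k - l) lam (m + 1 - μ) μ hl
      (fun n hn => h (k + (l + n)) (by omega)) hμ.le
      (fun n hn => ⟨d (l + n) (by omega) (by omega), by
        have := (hw (k + (l + n)) (by omega)).2; simp only [hδ]; linarith only [this]⟩)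
  rw [sum_split f hk, sum_split (fun n => f (k + n)) hl']
  have t1 := e_sum_le (Finset.range k) f
  have t2 := e_sum_le (Finset.range (N - k - l)) (fun n => f (k + (l + n)))
  rw [Finset.card_range] at t1 t2
  have t3 := KL (fun n => f (k + n)) m μ hμ l
    (fun n hn => ⟨b (k + n) (by omega) (by omega), (c n hn).le⟩)
    (fun n hn => hm (k + n) (by omega))
  refine (norm_add_le _ _).trans ((add_le_add_right (norm_add_le _ _) _).trans ?_)
  linarith only [s1, s2, t1, t2, t3]

theorem SD_count (lam μ : ℝ) (hl : 0 < lam) (hμ : 0 < μ) (j : ℕ) : ∀ (f : ℕ → ℝ) (N : ℕ) (m : ℤ)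
    (_ : ∀ n, n + 1 < N → lam ≤ (f (n + 2) - f (n + 1)) - (f (n + 1) - f n))
    (_ : ∀ n < N, m ≤ f (n + 1) - f n ∧ f (n + 1) - f n < m + j),
    ‖∑ n ∈ Finset.range N, e (f n)‖ ≤ j * (2 * (μ / lam + 1) + 2 / μ) := by
  induction j with
  | zero =>
    intro f N m h hw
    rcases N with _ | N
    · simp
    · have := hw 0 (by omega); simp at this; linarith
  | succ j ih =>
    intro f N m h hw
    obtain ⟨k, hk, a, b⟩ := mono_split (fun n => f (n + 1) - f n) N
      (fun n hn => by have := h n hn; linarith) (m + 1)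
    rw [sum_split f hk]
    refine (norm_add_le _ _).trans ?_
    have t1 := SD_block f k lam μ hl hμ m (fun n hn => h n (by omega))
      (fun n hn => ⟨(hw n (by omega)).1, (a n hn).le⟩)
    have t2 := ih (fun n => f (k + n)) (N - k) (m + 1) (fun n hn => h (k + n) (by omega))
      (fun n hn => ⟨by have := b (k + n) (by omega) (by omega); push_cast; exact this, by
        have := (hw (k + n) (by omega)).2; push_cast at this ⊢; simp only [← add_assoc] at *; linarith only [this]⟩)
    push_cast; linarith

theorem SD (f : ℕ → ℝ) (N : ℕ) (lam C : ℝ) (hl : 0 < lam) (hC : 1 ≤ C)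
    (h : ∀ n < N, lam ≤ (f (n + 2) - f (n + 1)) - (f (n + 1) - f n) ∧
      (f (n + 2) - f (n + 1)) - (f (n + 1) - f n) ≤ C * lam) :
    ‖∑ n ∈ Finset.range N, e (f n)‖ ≤ 6 * C * N * √lam + 12 / √lam := by
  have hs : 0 < √lam := Real.sqrt_pos.2 hl
  have hss : √lam * √lam = lam := Real.mul_self_sqrt hl.le
  have hup : ∀ n ≤ N, f (n + 1) - f n ≤ f 1 - f 0 + n * (C * lam) := by
    intro n; induction n with
    | zero => simp
    | succ n ih => intro hn; have := ih (by omega); have := (h n (by omega)).2; push_cast; linarith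
  have hlo : ∀ n ≤ N, f 1 - f 0 ≤ f (n + 1) - f n := by
    intro n; induction n with
    | zero => simp
    | succ n ih => intro hn; have := ih (by omega); have := (h n (by omega)).1; linarith
  rcases le_total 1 (√lam) with h4 | h4
  · refine (e_sum_le _ _).trans ?_
    rw [Finset.card_range]
    have : (N : ℝ) ≤ 6 * C * N * √lam := by
      nlinarith only [mul_nonneg (Nat.cast_nonneg (α := ℝ) N) (mul_nonneg (sub_nonneg.2 hC) hs.le), mul_nonneg (Nat.cast_nonneg (α := ℝ) N) (sub_nonneg.2 h4), (Nat.cast_nonneg N : (0:ℝ) ≤ N)]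
    have : 0 < 12 / √lam := by positivity
    linarith
  · have key := SD_count lam (√lam) hl hs (⌈C * lam * N⌉₊ + 1) f N ⌊f 1 - f 0⌋
      (fun n hn => (h n (by omega)).1)
      (fun n hn => ⟨(Int.floor_le _).trans (hlo n hn.le), by
        have a := hup n hn.le
        have b := Int.lt_floor_add_one (f 1 - f 0)
        have c := Nat.le_ceil (C * lam * N)
        have d : (n : ℝ) * (C * lam) ≤ C * lam * N := by
          have : (n : ℝ) ≤ N := by exact_mod_cast hn.le
          rw [mul_comm]; gcongr
        push_cast; linarith⟩)
    refine key.trans ?_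
    have c := (Nat.ceil_lt_add_one (show 0 ≤ C * lam * N by positivity)).le
    have e1 : √lam / lam = 1 / √lam := by rw [div_eq_div_iff hl.ne' hs.ne']; linarith only [hss]
    have e2 : 1 ≤ 1 / √lam := by rw [le_div_iff₀ hs]; linarith
    rw [e1]
    have e3 : 2 * (1 / √lam + 1) + 2 / √lam ≤ 6 * (1 / √lam) := by
      have : 2 / √lam = 2 * (1 / √lam) := by ring
      linarith
    calc _ ≤ (C * lam * N + 2) * (6 * (1 / √lam)) := by
          exact mul_le_mul (by push_cast; linarith) e3 (by positivity) (by positivity)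
      _ = 6 * C * N * (lam / √lam) + 12 / √lam := by ring
      _ = _ := by rw [Real.div_sqrt]


def Dl : ℕ → (ℕ → ℝ) → ℕ → ℝ
  | 0, f => f
  | k + 1, f => Dl k (fun n => f (n + 1) - f n)

theorem Dl_shift (k : ℕ) : ∀ (f : ℕ → ℝ) (a n : ℕ), Dl k (fun n => f (n + a)) n = Dl k f (n + a) := by
  induction k with
  | zero => intro f a n; rfl
  | succ k ih =>
    intro f a n
    simp only [Dl]
    rw [← ih (fun n => f (n + 1) - f n) a n]
    congr 1; funext m; rw [add_right_comm]

theorem Dl_sub (k : ℕ) : ∀ (f g : ℕ → ℝ) (n : ℕ), Dl k (fun n => f n - g n) n = Dl k f n - Dl k g n := by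
  induction k with
  | zero => intro f a n; rfl
  | succ k ih =>
    intro f g n
    simp only [Dl]
    rw [← ih]; congr 1; funext m; ring

theorem Dl_neg (k : ℕ) (f : ℕ → ℝ) (n : ℕ) : Dl k (fun n => -f n) n = -Dl k f n := by
  have h0 : Dl k (fun _ => 0) n = 0 := by
    have := Dl_sub k f f n; simpa using this
  have := Dl_sub k (fun _ => 0) f n
  rw [h0] at this; simpa using this

theorem Dl_succ (k : ℕ) (f : ℕ → ℝ) (n : ℕ) : Dl (k + 1) f n = Dl k f (n + 1) - Dl k f n := by
  rw [← Dl_shift k f 1 n, ← Dl_sub]; rfl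

theorem Dl_tel (k : ℕ) (f : ℕ → ℝ) (n a : ℕ) (d : ℕ) (lam C : ℝ)
    (h : ∀ i < d, lam ≤ Dl (k + 1) f (n + a + i) ∧ Dl (k + 1) f (n + a + i) ≤ C * lam) :
    d * lam ≤ Dl k (fun n => f (n + (a + d)) - f (n + a)) n ∧
     Dl k (fun n => f (n + (a + d)) - f (n + a)) n ≤ C * (d * lam) := by
  rw [Dl_sub, Dl_shift, Dl_shift]
  induction d with
  | zero => simp
  | succ d ih =>
    have a1 := ih (fun i hi => h i (by omega))
    have a2 := h d (by omega)
    rw [Dl_succ] at a2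
    have e1 : n + (a + (d + 1)) = n + a + d + 1 := by ring
    have e2 : n + (a + d) = n + a + d := by ring
    rw [e1]; rw [e2] at a1; push_cast
    constructor <;> linarith only [a1.1, a1.2, a2.1, a2.2]

theorem vdC (f : ℕ → ℝ) (N H : ℕ) (hH : 1 ≤ H) (B : ℝ) (hB : 0 ≤ B)
    (h : ∀ a d, 1 ≤ d → a + d < H → ‖∑ n ∈ Finset.range N, e (f (n + (a + d)) - f (n + a))‖ ≤ B) :
    ‖∑ n ∈ Finset.range (N + H), e (f n)‖ ≤ 3 * H + √(N ^ 2 / H + N * B) := by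
  have hH0 : (0 : ℝ) < H := by exact_mod_cast hH
  -- shifts
  have sh : ∀ a < H, ‖∑ n ∈ Finset.range N, e (f n) - ∑ n ∈ Finset.range N, e (f (n + a))‖ ≤ 2 * H := by
    intro a ha
    have e1 := Finset.sum_range_add (fun n => e (f n)) a N
    have e2 := Finset.sum_range_add (fun n => e (f n)) N a
    rw [add_comm a N] at e1
    have e3 : ∑ n ∈ Finset.range N, e (f (n + a)) = ∑ n ∈ Finset.range N, e (f (a + n)) := by
      simp_rw [add_comm]
    have e4 : ∑ n ∈ Finset.range N, e (f n) - ∑ n ∈ Finset.range N, e (f (n + a)) =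
      ∑ n ∈ Finset.range a, e (f n) - ∑ n ∈ Finset.range a, e (f (N + n)) := by
      rw [e3]; linear_combination e1 - e2
    rw [e4]
    have t1 := e_sum_le (Finset.range a) f
    have t2 := e_sum_le (Finset.range a) (fun n => f (N + n))
    rw [Finset.card_range] at t1 t2
    have : (a : ℝ) ≤ H := by exact_mod_cast ha.le
    exact (norm_sub_le _ _).trans (by linarith)
  have hcor : ∀ a b, a < H → b < H →
      ‖∑ n ∈ Finset.range N, e (f (n + a)) * (starRingEnd ℂ) (e (f (n + b)))‖ ≤
        (if a = b then (N : ℝ) else 0) + B := by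
    intro a b ha hb
    have e1 : ∀ n, e (f (n + a)) * (starRingEnd ℂ) (e (f (n + b))) = e (f (n + a) - f (n + b)) := by
      intro n; rw [← e_neg, ← e_add]; ring_nf
    simp_rw [e1]
    rcases lt_trichotomy a b with hab | hab | hab
    · obtain ⟨d, rfl⟩ := Nat.exists_eq_add_of_lt hab
      have := h a (d + 1) (by omega) (by omega)
      rw [← e_sum_neg] at this
      simp only [neg_sub] at this
      have h3 : ¬ a = a + d + 1 := by omega
      rw [if_neg h3, zero_add]; exact this
    · subst hab; simp [e_zero]; linarith
    · obtain ⟨d, rfl⟩ := Nat.exists_eq_add_of_lt hab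
      have := h b (d + 1) (by omega) (by omega)
      have h3 : ¬ b + d + 1 = b := by omega
      rw [if_neg h3, zero_add]; exact this
  set V := ∑ a ∈ Finset.range H, ∑ n ∈ Finset.range N, e (f (n + a)) with hV
  have hV2 : ‖V‖ ^ 2 ≤ N * (H * N + H ^ 2 * B) := by
    have e1 : V = ∑ n ∈ Finset.range N, ∑ a ∈ Finset.range H, e (f (n + a)) := Finset.sum_comm
    have e2 : ‖V‖ ^ 2 ≤ N * ∑ n ∈ Finset.range N, ‖∑ a ∈ Finset.range H, e (f (n + a))‖ ^ 2 := by
      rw [e1]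
      refine (pow_le_pow_left₀ (norm_nonneg _) (norm_sum_le _ _) 2).trans ?_
      simpa using sq_sum_le_card_mul_sum_sq (s := Finset.range N)
        (f := fun n => ‖∑ a ∈ Finset.range H, e (f (n + a))‖)
    refine e2.trans (mul_le_mul_of_nonneg_left ?_ (Nat.cast_nonneg _))
    have e3 : ((∑ n ∈ Finset.range N, ‖∑ a ∈ Finset.range H, e (f (n + a))‖ ^ 2 : ℝ) : ℂ) =
      ∑ a ∈ Finset.range H, ∑ b ∈ Finset.range H,
        ∑ n ∈ Finset.range N, e (f (n + a)) * (starRingEnd ℂ) (e (f (n + b))) := by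
      push_cast
      have : ∀ n, ((‖∑ a ∈ Finset.range H, e (f (n + a))‖ : ℂ)) ^ 2 = ∑ a ∈ Finset.range H,
          ∑ b ∈ Finset.range H, e (f (n + a)) * (starRingEnd ℂ) (e (f (n + b))) := by
        intro n
        rw [← Complex.mul_conj', map_sum, Finset.sum_mul_sum]
      simp_rw [this]
      rw [Finset.sum_comm]
      refine Finset.sum_congr rfl fun a _ => Finset.sum_comm
    have e4 : (∑ n ∈ Finset.range N, ‖∑ a ∈ Finset.range H, e (f (n + a))‖ ^ 2 : ℝ) =
        ‖((∑ n ∈ Finset.range N, ‖∑ a ∈ Finset.range H, e (f (n + a))‖ ^ 2 : ℝ) : ℂ)‖ := by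
      rw [Complex.norm_real, Real.norm_of_nonneg (Finset.sum_nonneg fun _ _ => by positivity)]
    rw [e4, e3]
    refine (norm_sum_le _ _).trans ((Finset.sum_le_sum fun a ha => norm_sum_le _ _).trans ?_)
    refine (Finset.sum_le_sum fun a ha => Finset.sum_le_sum fun b hb =>
      hcor a b (Finset.mem_range.1 ha) (Finset.mem_range.1 hb)).trans ?_
    simp only [Finset.sum_add_distrib, Finset.sum_ite_eq, Finset.sum_const, Finset.card_range]
    rw [Finset.sum_congr rfl (g := fun _ => (N : ℝ)) (fun x hx => if_pos hx)]
    simp; nlinarith only []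
  have hVa : ‖H * ∑ n ∈ Finset.range N, e (f n) - V‖ ≤ H * (2 * H) := by
    have : (H : ℂ) * ∑ n ∈ Finset.range N, e (f n) - V = ∑ a ∈ Finset.range H,
      (∑ n ∈ Finset.range N, e (f n) - ∑ n ∈ Finset.range N, e (f (n + a))) := by
      rw [Finset.sum_sub_distrib]; simp [hV]
    rw [this]
    refine (norm_sum_le _ _).trans ((Finset.sum_le_sum fun a ha => sh a (Finset.mem_range.1 ha)).trans ?_)
    simp
  have hVs : ‖V‖ ≤ H * √(N ^ 2 / H + N * B) := by
    have e1 : (H : ℝ) * √(N ^ 2 / H + N * B) = √(N * (H * N + H ^ 2 * B)) := by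
      have e0 : (N : ℝ) * (H * N + H ^ 2 * B) = H ^ 2 * (N ^ 2 / H + N * B) := by field_simp
      rw [e0, Real.sqrt_mul (by positivity), Real.sqrt_sq hH0.le]
    rw [e1]; exact Real.le_sqrt_of_sq_le hV2
  have hS : ‖∑ n ∈ Finset.range N, e (f n)‖ ≤ 2 * H + √(N ^ 2 / H + N * B) := by
    have : ‖(H : ℂ) * ∑ n ∈ Finset.range N, e (f n)‖ ≤ H * (2 * H) + H * √(N ^ 2 / H + N * B) := by
      calc _ = ‖(H * ∑ n ∈ Finset.range N, e (f n) - V) + V‖ := by ring_nf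
        _ ≤ _ := (norm_add_le _ _).trans (add_le_add hVa hVs)
    rw [norm_mul, Complex.norm_natCast, ← mul_add] at this
    exact le_of_mul_le_mul_left this hH0
  rw [Finset.sum_range_add]
  have t2 := e_sum_le (Finset.range H) (fun n => f (N + n))
  rw [Finset.card_range] at t2
  exact (norm_add_le _ _).trans (by linarith)

def PWx (k : ℕ) (ρ₁ ρ₂ σ : ℝ) : Prop := ∀ C : ℝ, 1 ≤ C → ∃ C' : ℝ, C' ≥ 0 ∧ ∀ N : ℝ, 1 ≤ N → ∀ M : ℕ, (M : ℝ) ≤ N → ∀ lam : ℝ, ∀ f : ℕ → ℝ,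
    N ^ (-ρ₂) ≤ lam → lam ≤ N ^ (-ρ₁) → (∀ n < M, lam ≤ Dl k f n ∧ Dl k f n ≤ C * lam) →
    ‖∑ n ∈ Finset.range M, e (f n)‖ ≤ C' * N ^ (1 - σ)

theorem PW_two (ρ₁ ρ₂ : ℝ) : PWx 2 ρ₁ ρ₂ (min (ρ₁ / 2) (1 - ρ₂ / 2)) := by
  intro C hC
  refine ⟨6 * C + 12, by linarith, ?_⟩
  intro N hN M hM lam f hl1 hl2 hf
  have hN0 : 0 < N := by linarith
  have hl : 0 < lam := lt_of_lt_of_le (by positivity) hl1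
  have key := SD f M lam C hl hC (by
    intro n hn; have := hf n hn; simpa [Dl] using this)
  refine key.trans ?_
  have a1 : √lam ≤ N ^ (-(ρ₁ / 2)) := by
    rw [Real.sqrt_le_left (by positivity), ← Real.rpow_natCast, ← Real.rpow_mul hN0.le]
    convert hl2 using 2; push_cast; ring
  have a2 : N ^ (-(ρ₂ / 2)) ≤ √lam := by
    apply Real.le_sqrt_of_sq_le
    rw [← Real.rpow_natCast, ← Real.rpow_mul hN0.le]
    convert hl1 using 2; push_cast; ring
  have a3 : 12 / √lam ≤ 12 * N ^ (1 - min (ρ₁ / 2) (1 - ρ₂ / 2)) := by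
    have : 12 / √lam ≤ 12 / N ^ (-(ρ₂ / 2)) := by gcongr
    refine this.trans ?_
    rw [Real.rpow_neg hN0.le, div_inv_eq_mul]
    gcongr
    have := min_le_right (ρ₁ / 2) (1 - ρ₂ / 2); linarith only [this]
  have a4 : 6 * C * M * √lam ≤ 6 * C * N ^ (1 - min (ρ₁ / 2) (1 - ρ₂ / 2)) := by
    calc 6 * C * M * √lam ≤ 6 * C * N * N ^ (-(ρ₁ / 2)) := by gcongr
      _ = 6 * C * N ^ (1 - ρ₁ / 2) := by
        rw [mul_assoc, sub_eq_add_neg, Real.rpow_add hN0, Real.rpow_one]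
      _ ≤ _ := by
        gcongr
        exact min_le_left _ _
  linarith

theorem PW_succ (k : ℕ) (ρ₁ ρ₂ σ : ℝ) (h1 : 0 < ρ₁) (_ : ρ₁ < ρ₂) (_ : ρ₂ < 2) (ih : PWx k (ρ₁ / 2) ρ₂ σ) : PWx (k + 1) ρ₁ ρ₂ (min (1 - ρ₁ / 2) (min (ρ₁ / 4) (σ / 2))) := by
  intro C hC
  obtain ⟨C', hC', key⟩ := ih C hC
  set s := min (1 - ρ₁ / 2) (min (ρ₁ / 4) (σ / 2)) with hs
  have s1 : s ≤ 1 - ρ₁ / 2 := min_le_left _ _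
  have s2 : s ≤ ρ₁ / 4 := (min_le_right _ _).trans (min_le_left _ _)
  have s3 : s ≤ σ / 2 := (min_le_right _ _).trans (min_le_right _ _)
  refine ⟨3 + √(2 + C'), by positivity, ?_⟩
  intro N hN M hM lam f hl1 hl2 hf
  have hN0 : 0 < N := by linarith only [hN]
  set H := ⌊N ^ (ρ₁ / 2)⌋₊ with hH
  have hN1 : 1 ≤ N ^ (ρ₁ / 2) := Real.one_le_rpow hN (by linarith only [h1])
  have hH1 : 1 ≤ H := Nat.le_floor (by simpa using hN1)
  have hHle : (H : ℝ) ≤ N ^ (ρ₁ / 2) := Nat.floor_le (by positivity)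
  have hHge : N ^ (ρ₁ / 2) / 2 ≤ H := by
    have := Nat.lt_floor_add_one (N ^ (ρ₁ / 2))
    have h5 : (1 : ℝ) ≤ H := by exact_mod_cast hH1
    rw [← hH] at this; linarith only [this, h5]
  have hHs : (H : ℝ) ≤ N ^ (1 - s) := hHle.trans (Real.rpow_le_rpow_of_exponent_le hN (by linarith only [s1]))
  have hpos : 0 ≤ N ^ (1 - s) := by positivity
  have hsq : 0 ≤ √(2 + C') := Real.sqrt_nonneg _
  rcases lt_or_ge M H with hMH | hMH
  · have t := e_sum_le (Finset.range M) f
    rw [Finset.card_range] at t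
    have : (M : ℝ) ≤ H := by exact_mod_cast hMH.le
    nlinarith only [hHs, t, this, hsq]
  obtain ⟨M', rfl⟩ := Nat.exists_eq_add_of_le' hMH
  have hM' : (M' : ℝ) ≤ N := by push_cast at hM; linarith only [hM, (Nat.cast_nonneg H : (0:ℝ) ≤ H)]
  have main := vdC f M' H hH1 (C' * N ^ (1 - σ)) (by positivity) (by
    intro a d hd had
    have hd1 : (1 : ℝ) ≤ d := by exact_mod_cast hd
    have hlam : 0 < lam := lt_of_lt_of_le (by positivity) hl1
    refine key N hN M' hM' (d * lam) _ (hl1.trans (by nlinarith only [hd1, hlam])) ?_ ?_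
    · have hdH : (d : ℝ) ≤ H := by exact_mod_cast (by omega : d ≤ H)
      calc (d : ℝ) * lam ≤ N ^ (ρ₁ / 2) * N ^ (-ρ₁) := by gcongr; linarith only [hHle, hdH]
        _ = N ^ (-(ρ₁ / 2)) := by rw [← Real.rpow_add hN0]; ring_nf
    · intro n hn
      exact Dl_tel k f n a d lam C (fun i hi => hf (n + a + i) (by omega)))
  refine main.trans ?_
  have : √((M' : ℝ) ^ 2 / H + M' * (C' * N ^ (1 - σ))) ≤ √(2 + C') * N ^ (1 - s) := by
    rw [← Real.sqrt_sq hpos, ← Real.sqrt_mul (by positivity)]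
    apply Real.sqrt_le_sqrt
    have b1 : (M' : ℝ) ^ 2 / H ≤ 2 * (N ^ (1 - s)) ^ 2 := by
      calc (M' : ℝ) ^ 2 / H ≤ N ^ 2 / (N ^ (ρ₁ / 2) / 2) := by gcongr
        _ = 2 * N ^ (2 - ρ₁ / 2) := by
          rw [Real.rpow_sub hN0]; norm_num; field_simp
        _ ≤ 2 * (N ^ (1 - s)) ^ 2 := by
          rw [← Real.rpow_natCast, ← Real.rpow_mul hN0.le]
          gcongr
          push_cast; linarith only [s2]
    have b2 : (M' : ℝ) * (C' * N ^ (1 - σ)) ≤ C' * (N ^ (1 - s)) ^ 2 := by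
      calc (M' : ℝ) * (C' * N ^ (1 - σ)) ≤ N * (C' * N ^ (1 - σ)) := by gcongr
        _ = C' * N ^ (2 - σ) := by
          rw [show 2 - σ = 1 + (1 - σ) by ring, Real.rpow_add hN0 1, Real.rpow_one]; ring
        _ ≤ C' * (N ^ (1 - s)) ^ 2 := by
          rw [← Real.rpow_natCast, ← Real.rpow_mul hN0.le]
          gcongr
          push_cast; linarith only [s3]
    linarith only [b1, b2]
  linarith only [hHs, this]

theorem PW_all (k : ℕ) : ∀ ρ₁ ρ₂ : ℝ, 0 < ρ₁ → ρ₁ < ρ₂ → ρ₂ < 2 → ∃ σ > 0, PWx (k + 2) ρ₁ ρ₂ σ := by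
  induction k with
  | zero => exact fun ρ₁ ρ₂ h1 h2 h3 => ⟨_, lt_min (by linarith) (by linarith), PW_two ρ₁ ρ₂⟩
  | succ k ih =>
    intro ρ₁ ρ₂ h1 h2 h3
    obtain ⟨σ, hσ, h⟩ := ih (ρ₁ / 2) ρ₂ (by linarith) (by linarith) h3
    exact ⟨_, lt_min (by linarith) (lt_min (by linarith) (by linarith)), PW_succ _ ρ₁ ρ₂ σ h1 h2 h3 h⟩


noncomputable def pf (c : ℝ) (k : ℕ) : ℝ := ∏ j ∈ Finset.range k, (c - j)

theorem Dl_mvt (k : ℕ) : ∀ (G : ℕ → ℝ → ℝ) (_ : ∀ i, ∀ x > 0, HasDerivAt (G i) (G (i + 1) x) x)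
    (a : ℝ) (_ : 0 < a) (n : ℕ), ∃ ξ, a + n ≤ ξ ∧ ξ ≤ a + n + k ∧ Dl k (fun n => G 0 (a + n)) n = G k ξ := by
  induction k with
  | zero => intro G hG a ha n; exact ⟨a + n, le_rfl, by simp, rfl⟩
  | succ k ih =>
    intro G hG a ha n
    obtain ⟨ξ, h1, h2, h3⟩ := ih (fun i x => G i (x + 1) - G i x) (fun i x hx =>
      ((hG i (x + 1) (by linarith)).comp_add_const x 1).sub (hG i x hx)) a ha n
    have hξ : 0 < ξ := by have : (0 : ℝ) ≤ n := Nat.cast_nonneg n; linarith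
    obtain ⟨z, ⟨hz1, hz2⟩, hz3⟩ := exists_hasDerivAt_eq_slope (G k) (G (k + 1)) (show ξ < ξ + 1 by linarith)
      (fun x hx => (hG k x (by linarith [hx.1])).continuousAt.continuousWithinAt)
      (fun x hx => hG k x (by linarith [hx.1]))
    refine ⟨z, by linarith, by push_cast; linarith, ?_⟩
    rw [hz3, add_sub_cancel_left, div_one, ← h3]
    simp only [Dl]; congr 1; funext m; push_cast; ring_nf

theorem ES_diff (c : ℝ) (k : ℕ) (hp : pf c k ≠ 0) : ∃ A > 0, ∃ C ≥ (1 : ℝ), ∀ N : ℝ, 1 ≤ N → ∀ a M : ℕ,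
    N ≤ a → (a + M : ℝ) ≤ 4 * N → ∀ y : ℝ, y ≠ 0 → ∃ s : ℝ, (s = 1 ∨ s = -1) ∧ ∀ n < M,
      A * (|y| * N ^ c * N ^ (-(k : ℝ))) ≤ s * Dl k (fun n => y * (a + n : ℝ) ^ c) n ∧
      s * Dl k (fun n => y * (a + n : ℝ) ^ c) n ≤ C * (A * (|y| * N ^ c * N ^ (-(k : ℝ)))) := by
  set D : ℝ := (4 + k : ℝ) ^ |c - k| with hD
  have hk : (0 : ℝ) ≤ k := Nat.cast_nonneg k
  have hD1 : 1 ≤ D := Real.one_le_rpow (by linarith) (abs_nonneg _)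
  refine ⟨|pf c k| / D, by positivity, D ^ 2, by nlinarith only [hD1], ?_⟩
  intro N hN a M ha haM y hy
  have hN0 : 0 < N := by linarith
  have h0 : y * pf c k ≠ 0 := mul_ne_zero hy hp
  set s : ℝ := if 0 < y * pf c k then 1 else -1 with hs
  have hsp : s * (y * pf c k) = |y| * |pf c k| := by
    rw [← abs_mul]
    by_cases h : 0 < y * pf c k
    · rw [hs, if_pos h, abs_of_pos h, one_mul]
    · rw [hs, if_neg h, abs_of_nonpos (not_lt.1 h)]; ring
  refine ⟨s, by rw [hs]; split_ifs <;> simp, ?_⟩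
  intro n hn
  obtain ⟨ξ, h1, h2, h3⟩ := Dl_mvt k (fun i x => y * pf c i * x ^ (c - i)) (by
    intro i x hx
    have := (Real.hasDerivAt_rpow_const (x := x) (p := c - i) (Or.inl hx.ne')).const_mul (y * pf c i)
    refine this.congr_deriv ?_
    rw [pf, pf, Finset.prod_range_succ]; push_cast; rw [sub_sub]; ring) a (by linarith) n
  have e0 : (fun n : ℕ => y * (a + n : ℝ) ^ c) = fun n : ℕ => y * pf c 0 * (a + n : ℝ) ^ (c - (0 : ℕ)) := by
    funext n; simp [pf]
  rw [e0, h3]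
  have hnn : (0 : ℝ) ≤ n := Nat.cast_nonneg n
  have hnM : (n : ℝ) ≤ M := by exact_mod_cast hn.le
  have r1 : 1 ≤ ξ / N := by rw [le_div_iff₀ hN0]; linarith
  have r2 : ξ / N ≤ 4 + k := by rw [div_le_iff₀ hN0]; nlinarith only [haM, h2, hnM, hN]
  have e1 : ξ ^ (c - k) = N ^ c * N ^ (-(k : ℝ)) * (ξ / N) ^ (c - k) := by
    rw [← Real.rpow_add hN0, ← sub_eq_add_neg, Real.div_rpow (by linarith) hN0.le]
    field_simp
  have b1 : (ξ / N) ^ (c - k) ≤ D := by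
    calc (ξ / N) ^ (c - k) ≤ (ξ / N) ^ |c - k| := Real.rpow_le_rpow_of_exponent_le r1 (le_abs_self _)
      _ ≤ D := by rw [hD]; gcongr
  have b2 : 1 / D ≤ (ξ / N) ^ (c - k) := by
    rw [div_le_iff₀ (by positivity)]
    have : (ξ / N) ^ (-|c - k|) ≤ (ξ / N) ^ (c - k) :=
      Real.rpow_le_rpow_of_exponent_le r1 (neg_abs_le _)
    have h6 : (ξ / N) ^ |c - k| ≤ D := by rw [hD]; gcongr
    calc 1 = (ξ / N) ^ (-|c - k|) * (ξ / N) ^ |c - k| := by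
          rw [← Real.rpow_add (by linarith only [r1])]; simp
      _ ≤ (ξ / N) ^ (c - k) * D := by gcongr
  have e2 : s * (y * pf c k * ξ ^ (c - k)) = |y| * |pf c k| * (N ^ c * N ^ (-(k : ℝ))) * (ξ / N) ^ (c - k) := by
    rw [e1, ← hsp]; ring
  simp only [e2]
  have hQ : 0 ≤ |y| * |pf c k| * (N ^ c * N ^ (-(k : ℝ))) := by positivity
  constructor
  · calc _ = |y| * |pf c k| * (N ^ c * N ^ (-(k : ℝ))) * (1 / D) := by ring
      _ ≤ _ := by gcongr
  · calc _ ≤ |y| * |pf c k| * (N ^ c * N ^ (-(k : ℝ))) * D := by gcongr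
      _ = _ := by field_simp

theorem pf_ne (c : ℝ) (hc : ∀ j : ℕ, c ≠ j) (k : ℕ) : pf c k ≠ 0 :=
  Finset.prod_ne_zero_iff.2 fun j _ => sub_ne_zero.2 (hc j)

theorem e_sum_s (s : ℝ) (hs : s = 1 ∨ s = -1) (M : ℕ) (f : ℕ → ℝ) :
    ‖∑ n ∈ Finset.range M, e (f n)‖ = ‖∑ n ∈ Finset.range M, e (s * f n)‖ := by
  rcases hs with rfl | rfl
  · simp
  · simp only [neg_one_mul]; rw [e_sum_neg]

theorem Dl_s (s : ℝ) (hs : s = 1 ∨ s = -1) (k : ℕ) (f : ℕ → ℝ) (n : ℕ) :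
    Dl k (fun n => s * f n) n = s * Dl k f n := by
  rcases hs with rfl | rfl
  · simp
  · simp only [neg_one_mul]; rw [Dl_neg]

theorem ES_step (c : ℝ) (k : ℕ) (hp : pf c k ≠ 0) (ρ₁ ρ₂ σ η : ℝ) (_ : 0 ≤ ρ₁) (_ : ρ₁ ≤ 1) (_ : 0 ≤ ρ₂) (hη : 0 < η) (hσ : 0 ≤ σ) (W : PWx k ρ₁ ρ₂ σ) :
    ∃ C : ℝ, C > 0 ∧ ∀ N : ℝ, 1 ≤ N → ∀ a M : ℕ, N ≤ a → (a + M : ℝ) ≤ 4 * N → ∀ y : ℝ, y ≠ 0 →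
      N ^ (η - ρ₂) ≤ |y| * N ^ c * N ^ (-(k : ℝ)) → |y| * N ^ c * N ^ (-(k : ℝ)) ≤ N ^ (-(ρ₁ + η)) →
      ‖∑ n ∈ Finset.range M, e (y * (a + n : ℝ) ^ c)‖ ≤ C * N * N ^ (-σ) := by
  obtain ⟨A, hA, C, hC, key⟩ := ES_diff c k hp
  obtain ⟨C₂, hC₂, W⟩ := W C hC
  set m := max (1 / A) (4 * A) with hm
  have hm0 : 0 < m := lt_max_of_lt_left (by positivity)
  set N₀ : ℝ := m ^ (1 / η) with hN₀
  have hN₀p : 0 < N₀ := by positivity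
  refine ⟨4 * C₂ + 3 * N₀ ^ σ, by positivity, ?_⟩
  intro N hN a M ha haM y hy hT1 hT2
  have hN0 : 0 < N := by linarith
  have hM : (M : ℝ) ≤ 3 * N := by linarith
  have hQ : 0 < N ^ (-σ) := by positivity
  rcases lt_or_ge N N₀ with h2 | h2
  · have t := e_sum_le (Finset.range M) (fun n : ℕ => y * (a + n : ℝ) ^ c)
    rw [Finset.card_range] at t
    refine t.trans (hM.trans ?_)
    have : 1 ≤ N₀ ^ σ * N ^ (-σ) := by
      rw [Real.rpow_neg hN0.le, ← div_eq_mul_inv, one_le_div (by positivity)]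
      gcongr
    have h5 : 0 ≤ 4 * C₂ * N * N ^ (-σ) := by positivity
    nlinarith only [this, h5, hN]
  · obtain ⟨s, hs, h⟩ := key N hN a M ha haM y hy
    rw [e_sum_s s hs]
    have hN4 : m ≤ N ^ η := by
      have : m = N₀ ^ η := by rw [hN₀, ← Real.rpow_mul hm0.le, one_div_mul_cancel hη.ne', Real.rpow_one]
      rw [this]; gcongr
    have g1 : 1 ≤ N ^ η * A := by rw [← div_le_iff₀ hA]; exact (le_max_left _ _).trans hN4
    have g2 : 4 * A ≤ N ^ η := (le_max_right _ _).trans hN4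
    have main := W (4 * N) (by linarith) M (by linarith) (A * (|y| * N ^ c * N ^ (-(k : ℝ))))
      (fun n => s * (y * (a + n : ℝ) ^ c)) (by
        calc (4 * N) ^ (-ρ₂) ≤ N ^ (-ρ₂) := Real.rpow_le_rpow_of_nonpos hN0 (by linarith) (by linarith)
          _ ≤ N ^ (-ρ₂) * (N ^ η * A) := le_mul_of_one_le_right (by positivity) g1
          _ = A * N ^ (η - ρ₂) := by rw [sub_eq_neg_add, Real.rpow_add hN0]; ring
          _ ≤ _ := by gcongr) (by
        have u5 : (4 : ℝ)⁻¹ ≤ 4 ^ (-ρ₁) := by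
          rw [← Real.rpow_neg_one]; exact Real.rpow_le_rpow_of_exponent_le (by norm_num) (by linarith)
        calc _ ≤ N ^ η / 4 * N ^ (-(ρ₁ + η)) := by gcongr; linarith only [g2]
          _ = 4⁻¹ * N ^ (-ρ₁) := by rw [neg_add, Real.rpow_add hN0, Real.rpow_neg hN0.le η]; field_simp
          _ ≤ _ := by rw [Real.mul_rpow (by norm_num) hN0.le]; gcongr)
      (by intro n hn; have := h n hn; rw [← Dl_s s hs] at this; exact this)
    refine main.trans ?_
    have v1 : (4 * N) ^ (1 - σ) = 4 * N * (4 * N) ^ (-σ) := by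
      rw [sub_eq_add_neg, Real.rpow_add (by positivity), Real.rpow_one]
    have v2 : (4 * N) ^ (-σ) ≤ N ^ (-σ) := Real.rpow_le_rpow_of_nonpos hN0 (by linarith) (by linarith)
    rw [v1]
    calc C₂ * (4 * N * (4 * N) ^ (-σ)) ≤ C₂ * (4 * N * N ^ (-σ)) := by gcongr
      _ ≤ _ := by
        have : 0 ≤ 3 * N₀ ^ σ * N * N ^ (-σ) := by positivity
        linarith

theorem ES0 (c : ℝ) (hc : ∀ j : ℕ, c ≠ j) : ∃ C : ℝ, C > 0 ∧
    ∀ N : ℝ, 1 ≤ N → ∀ a M : ℕ, N ≤ a → (a + M : ℝ) ≤ 4 * N → ∀ y : ℝ, y ≠ 0 → |y| * N ^ c ≤ N ^ (3 / 2 : ℝ) →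
      ‖∑ n ∈ Finset.range M, e (y * (a + n : ℝ) ^ c)‖ ≤ C * N * ((|y| * N ^ c) ^ (-(1 / 2) : ℝ) + N ^ (-(1 / 4) : ℝ)) := by
  obtain ⟨A, hA, C, hC, key⟩ := ES_diff c 2 (pf_ne c hc 2)
  refine ⟨18 * C * √A + 12 / √A, by positivity, ?_⟩
  intro N hN a M ha haM y hy hT
  have hN0 : 0 < N := by linarith
  obtain ⟨s, hs, h⟩ := key N hN a M ha haM y hy
  have hT0 : 0 < |y| * N ^ c := by positivity
  set T := |y| * N ^ c with hTd
  rw [e_sum_s s hs]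
  have := SD (fun n => s * (y * (a + n : ℝ) ^ c)) M (A * (T * N ^ (-((2 : ℕ) : ℝ)))) C (by positivity) hC
    (by
      intro n hn; have := h n hn; rw [← Dl_s s hs] at this
      simpa only [Dl, add_assoc, one_add_one_eq_two] using this)
  refine this.trans ?_
  have e1 : √(A * (T * N ^ (-((2 : ℕ) : ℝ)))) = √A * √T / N := by
    rw [Real.sqrt_mul hA.le, Real.sqrt_mul hT0.le, Real.rpow_neg hN0.le, Real.rpow_natCast,
      Real.sqrt_inv, Real.sqrt_sq hN0.le]; ring
  have e2 : √T ≤ N * N ^ (-(1 / 4) : ℝ) := by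
    have : √T ≤ √(N ^ (3 / 2 : ℝ)) := Real.sqrt_le_sqrt hT
    refine this.trans (le_of_eq ?_)
    rw [Real.sqrt_eq_rpow, ← Real.rpow_mul hN0.le]
    nth_rewrite 2 [← Real.rpow_one N]
    rw [← Real.rpow_add hN0]; norm_num
  have e3 : T ^ (-(1 / 2) : ℝ) = 1 / √T := by
    rw [Real.rpow_neg hT0.le, ← Real.sqrt_eq_rpow, one_div]
  have hM : (M : ℝ) ≤ 3 * N := by linarith only [ha, haM]
  have hsT : 0 < √T := Real.sqrt_pos.2 hT0
  have hsA : 0 < √A := Real.sqrt_pos.2 hA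
  rw [e1, e3]
  have p1 : 6 * C * M * (√A * √T / N) ≤ 18 * C * √A * (N * N ^ (-(1 / 4) : ℝ)) := by
    calc 6 * C * M * (√A * √T / N) ≤ 6 * C * (3 * N) * (√A * √T / N) := by gcongr
      _ = 18 * C * √A * √T := by field_simp; norm_num
      _ ≤ _ := by gcongr
  have p2 : 12 / (√A * √T / N) = 12 / √A * (N * (1 / √T)) := by field_simp
  have q1 : 0 ≤ 18 * C * √A * (N * (1 / √T)) := by positivity
  have q2 : 0 ≤ 12 / √A * (N * N ^ (-(1 / 4) : ℝ)) := by positivity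
  rw [p2]
  calc _ ≤ 18 * C * √A * (N * N ^ (-(1 / 4) : ℝ)) + 12 / √A * (N * (1 / √T)) := by linarith only [p1]
    _ ≤ _ := by linarith only [q1, q2]

theorem ES (c : ℝ) (hc : ∀ j : ℕ, c ≠ j) (j : ℕ) : ∃ σ : ℝ, σ > 0 ∧ ∃ C : ℝ, C > 0 ∧
    ∀ N : ℝ, 1 ≤ N → ∀ a M : ℕ, N ≤ a → (a + M : ℝ) ≤ 4 * N → ∀ y : ℝ, y ≠ 0 →
      |y| * N ^ c ≤ N ^ (3 / 2 + j : ℝ) →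
      ‖∑ n ∈ Finset.range M, e (y * (a + n : ℝ) ^ c)‖ ≤
        C * N * ((|y| * N ^ c) ^ (-(1 / 2) : ℝ) + N ^ (-σ)) := by
  induction j with
  | zero =>
    obtain ⟨C, hC, h⟩ := ES0 c hc
    exact ⟨1 / 4, by norm_num, C, hC, fun N hN a M ha haM y hy hT => h N hN a M ha haM y hy (by simpa using hT)⟩
  | succ j ih =>
    obtain ⟨σ₁, hσ₁, C₁, hC₁, H⟩ := ih
    obtain ⟨σ₂, hσ₂, W⟩ := PW_all (j + 1) (1 / 4) (7 / 4) (by norm_num) (by norm_num) (by norm_num)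
    obtain ⟨C₂, hC₂, W⟩ := ES_step c (j + 3) (pf_ne c hc _) (1 / 4) (7 / 4) σ₂ (1 / 4) (by norm_num) (by norm_num) (by norm_num) (by norm_num) hσ₂.le W
    refine ⟨min σ₁ σ₂, lt_min hσ₁ hσ₂, C₁ + C₂, by positivity, ?_⟩
    intro N hN a M ha haM y hy hT
    have hN0 : 0 < N := by linarith
    have hT0 : 0 < |y| * N ^ c := by positivity
    have hP : 0 ≤ (|y| * N ^ c) ^ (-(1 / 2) : ℝ) := by positivity
    have m1 : N ^ (-σ₁) ≤ N ^ (-min σ₁ σ₂) := Real.rpow_le_rpow_of_exponent_le hN (by have := min_le_left σ₁ σ₂; linarith only [this])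
    have m2 : N ^ (-σ₂) ≤ N ^ (-min σ₁ σ₂) := Real.rpow_le_rpow_of_exponent_le hN (by have := min_le_right σ₁ σ₂; linarith)
    rcases le_total (|y| * N ^ c) (N ^ (3 / 2 + j : ℝ)) with h1 | h1
    · refine (H N hN a M ha haM y hy h1).trans ?_
      gcongr
      linarith only [hC₂]
    · refine (W N hN a M ha haM y hy ?_ ?_).trans ?_
      · calc _ = N ^ (3 / 2 + j : ℝ) * N ^ (-((j + 3 : ℕ) : ℝ)) := by rw [← Real.rpow_add hN0]; push_cast; ring_nf
          _ ≤ _ := by gcongr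
      · calc _ ≤ N ^ (3 / 2 + (j + 1 : ℕ) : ℝ) * N ^ (-((j + 3 : ℕ) : ℝ)) := by gcongr
          _ = _ := by rw [← Real.rpow_add hN0]; push_cast; ring_nf
      · gcongr <;> linarith only [hC₁, hP, m2]


theorem ES1 (c : ℝ) (hc : ∀ j : ℕ, c ≠ j) : ∃ c₀ : ℝ, c₀ > 0 ∧ ∃ C : ℝ, C > 0 ∧
    ∀ N : ℝ, 1 ≤ N → ∀ a M : ℕ, N ≤ a → (a + M : ℝ) ≤ 4 * N → ∀ y : ℝ, y ≠ 0 →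
      |y| * N ^ c ≤ c₀ * N →
      ‖∑ n ∈ Finset.range M, e (y * (a + n : ℝ) ^ c)‖ ≤ C * (N / (|y| * N ^ c)) := by
  obtain ⟨A, hA, C, hC, key⟩ := ES_diff c 1 (pf_ne c hc 1)
  obtain ⟨A', hA', C', hC', key'⟩ := ES_diff c 2 (pf_ne c hc 2)
  refine ⟨1 / (2 * C * A), by positivity, 2 / A, by positivity, ?_⟩
  intro N hN a M ha haM y hy hT
  have hN0 : 0 < N := by linarith
  have hT0 : 0 < |y| * N ^ c := by positivity
  set T := |y| * N ^ c with hTd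
  obtain ⟨s, hs, h⟩ := key N hN a M ha haM y hy
  obtain ⟨t, ht, h'⟩ := key' N hN a M ha haM y hy
  rw [e_sum_s t ht]
  set f : ℕ → ℝ := fun n => y * (a + n : ℝ) ^ c with hf
  set mu := A * (T * N ^ (-((1 : ℕ) : ℝ))) with hmu
  have hmu' : mu = A * T / N := by
    rw [hmu, Real.rpow_neg hN0.le, Real.rpow_natCast, pow_one]; ring
  have hmup : 0 < mu := by positivity
  have hC2 : C * mu ≤ 1 / 2 := by
    rw [hmu']
    have : C * (A * T / N) ≤ C * (A * (1 / (2 * C * A) * N) / N) := by gcongr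
    refine this.trans (le_of_eq ?_); field_simp
  have hmu2 : mu ≤ 1 / 2 := by nlinarith only [hC2, hC]
  have e1 : 2 / A * (N / T) = 2 / mu := by rw [hmu']; field_simp
  rw [e1]
  have hmono : ∀ n < M, t * f (n + 1) - t * f n ≤ t * f (n + 2) - t * f (n + 1) := by
    intro n hn
    have := (h' n hn).1
    have h0 : 0 ≤ A' * (T * N ^ (-((2 : ℕ) : ℝ))) := by positivity
    have e2 : Dl 2 f n = (f (n + 2) - f (n + 1)) - (f (n + 1) - f n) := by simp [Dl]
    rw [e2] at this; nlinarith only [this, h0]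
  have hd : ∀ n < M, mu ≤ s * (f (n + 1) - f n) ∧ s * (f (n + 1) - f n) ≤ 1 / 2 := by
    intro n hn; have := h n hn
    have e2 : Dl 1 f n = (f (n + 1) - f n) := by simp [Dl]
    rw [e2] at this; exact ⟨this.1, this.2.trans hC2⟩
  by_cases hst : s = t
  · refine KL (fun n => t * f n) 0 mu hmup M (fun n hn => ?_) (fun n hn => hmono n (by omega))
    have := hd n hn; rw [hst] at this; simp only [← mul_sub]
    constructor <;> push_cast <;> linarith
  · refine KL (fun n => t * f n) (-1) mu hmup M (fun n hn => ?_) (fun n hn => hmono n (by omega))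
    have := hd n hn
    have hs' : s = -t := by 
      rcases hs with h3 | h3 <;> rcases ht with h4 | h4 <;>
        first | exact absurd (h3.trans h4.symm) hst | linarith only [h3, h4]
    rw [hs'] at this; simp only [← mul_sub]
    constructor <;> push_cast <;> linarith


theorem abel_mono (w : ℕ → ℝ) (z : ℕ → ℂ) (B : ℝ) (M : ℕ) (hw : ∀ n, n < M → w n ≤ w (n + 1))
    (hw0 : 0 ≤ w 0) (hB : ∀ k ≤ M, ‖∑ n ∈ Finset.range k, z n‖ ≤ B) :
    ‖∑ n ∈ Finset.range M, (w n : ℂ) * z n‖ ≤ 2 * w M * B := by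
  have hB0 : 0 ≤ B := (norm_nonneg _).trans (hB 0 (by omega))
  have key : ∀ k ≤ M, 0 ≤ w k ∧ ‖∑ n ∈ Finset.range k, (w n : ℂ) * z n - w k * ∑ n ∈ Finset.range k, z n‖
      ≤ (w k - w 0) * B := by
    intro k; induction k with
    | zero => intro _; simp [hw0]
    | succ k ih =>
      intro hk
      obtain ⟨i0, i1⟩ := ih (by omega)
      have h1 := hw k (by omega)
      refine ⟨i0.trans h1, ?_⟩
      have e1 : ∑ n ∈ Finset.range (k + 1), (w n : ℂ) * z n - w (k + 1) * ∑ n ∈ Finset.range (k + 1), z n =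
        (∑ n ∈ Finset.range k, (w n : ℂ) * z n - w k * ∑ n ∈ Finset.range k, z n)
        - ((w (k + 1) - w k : ℝ) : ℂ) * ∑ n ∈ Finset.range (k + 1), z n := by
        rw [Finset.sum_range_succ, Finset.sum_range_succ]; push_cast; ring
      rw [e1]
      refine (norm_sub_le _ _).trans ?_
      rw [norm_mul, Complex.norm_real, Real.norm_of_nonneg (by linarith)]
      have := mul_le_mul_of_nonneg_left (hB (k + 1) hk) (sub_nonneg.2 h1)
      linarith
  obtain ⟨k0, k1⟩ := key M le_rfl
  have e2 : ∑ n ∈ Finset.range M, (w n : ℂ) * z n = (∑ n ∈ Finset.range M, (w n : ℂ) * z n -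
    w M * ∑ n ∈ Finset.range M, z n) + w M * ∑ n ∈ Finset.range M, z n := by ring
  rw [e2]
  refine (norm_add_le _ _).trans ?_
  rw [norm_mul, Complex.norm_real, Real.norm_of_nonneg k0]
  have := mul_le_mul_of_nonneg_left (hB M le_rfl) k0
  nlinarith only [k1, this, hw0, hB0]

theorem sum_Ioc_range {E : Type*} [AddCommMonoid E] (g : ℕ → E) (p q : ℕ) :
    ∑ n ∈ Finset.Ioc p q, g n = ∑ n ∈ Finset.range (q - p), g (p + 1 + n) := by
  have : Finset.Ioc p q = Finset.Ico (p + 1) (q + 1) := by ext; simp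
  rw [this, Finset.sum_Ico_eq_sum_range, Nat.add_sub_add_right]

/-- pairs `m * n ∈ (Q/2, Q]` -/
def Rp (Q : ℕ) : Finset (ℕ × ℕ) :=
  (Finset.Icc 1 Q ×ˢ Finset.Icc 1 Q).filter (fun p => Q / 2 < p.1 * p.2 ∧ p.1 * p.2 ≤ Q)

theorem conv_sum (Q : ℕ) (f h : ArithmeticFunction ℝ) (g : ℕ → ℂ) :
    ∑ k ∈ Finset.Ioc (Q / 2) Q, ((f * h) k : ℂ) * g k =
      ∑ p ∈ Rp Q, (f p.1 : ℂ) * h p.2 * g (p.1 * p.2) := by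
  have : ∀ k, ((f * h) k : ℂ) * g k = ∑ p ∈ k.divisorsAntidiagonal, (f p.1 : ℂ) * h p.2 * g (p.1 * p.2) := by
    intro k
    rw [ArithmeticFunction.mul_apply]; push_cast; rw [Finset.sum_mul]
    refine Finset.sum_congr rfl fun p hp => ?_
    rw [(Nat.mem_divisorsAntidiagonal.1 hp).1]
  simp_rw [this]
  rw [Finset.sum_sigma']
  refine Finset.sum_bij' (fun x _ => x.2) (fun p _ => ⟨p.1 * p.2, p⟩) ?_ ?_ ?_ ?_ ?_
  · rintro ⟨k, p⟩ h
    simp only [Finset.mem_sigma, Finset.mem_Ioc, Nat.mem_divisorsAntidiagonal] at h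
    obtain ⟨⟨h1, h2⟩, h3, h4⟩ := h
    have p1 : 1 ≤ p.1 := Nat.pos_of_ne_zero fun h => by simp [h] at h3; omega
    have p2 : 1 ≤ p.2 := Nat.pos_of_ne_zero fun h => by simp [h] at h3; omega
    simp only [Rp, Finset.mem_filter, Finset.mem_product, Finset.mem_Icc]
    refine ⟨⟨⟨p1, ?_⟩, ⟨p2, ?_⟩⟩, by omega⟩ <;> nlinarith only [h2, h3, p2, p1]
  · rintro p h
    simp only [Rp, Finset.mem_filter, Finset.mem_product, Finset.mem_Icc] at h
    simp only [Finset.mem_sigma, Finset.mem_Ioc, Nat.mem_divisorsAntidiagonal]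
    refine ⟨h.2, ?_, ?_⟩
    · trivial
    · have := h.2.1; omega
  · rintro ⟨k, p⟩ h
    simp only [Finset.mem_sigma, Finset.mem_Ioc, Nat.mem_divisorsAntidiagonal] at h
    rw [← h.2.1]
  · rintro p h; rfl
  · rintro p h; rfl

theorem Rp_sum (Q : ℕ) (F : ℕ → ℕ → ℂ) :
    ∑ p ∈ Rp Q, F p.1 p.2 = ∑ m ∈ Finset.Icc 1 Q, ∑ n ∈ Finset.Ioc (Q / 2 / m) (Q / m), F m n := by
  rw [Rp, Finset.sum_filter, Finset.sum_product]
  refine Finset.sum_congr rfl fun m hm => ?_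
  rw [← Finset.sum_filter]
  refine Finset.sum_congr ?_ fun _ _ => rfl
  ext n
  rw [Finset.mem_Icc] at hm
  simp only [Finset.mem_filter, Finset.mem_Icc, Finset.mem_Ioc]
  have i1 : Q / 2 / m < n ↔ Q / 2 < n * m := Nat.div_lt_iff_lt_mul (by omega)
  rw [i1, Nat.le_div_iff_mul_le (by omega), mul_comm n m]
  constructor
  · rintro ⟨-, h⟩; exact h
  · rintro ⟨h1, h2⟩
    have : n ≠ 0 := by rintro rfl; simp at h1
    exact ⟨⟨by omega, by nlinarith⟩, h1, h2⟩

theorem CS2 (𝓜 𝓝 : Finset ℕ) (P : ℕ → ℕ → Prop) [∀ m n, Decidable (P m n)] (a b : ℕ → ℂ) (g : ℕ → ℕ → ℂ)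
    (D : ℝ) (hD : 0 ≤ D) (ha : ∀ m ∈ 𝓜, ‖a m‖ ≤ D) (hb : ∀ n ∈ 𝓝, ‖b n‖ ≤ D) :
    ‖∑ m ∈ 𝓜, ∑ n ∈ 𝓝, (if P m n then a m * b n * g m n else 0)‖ ^ 2 ≤
      D ^ 4 * (𝓜.card * ∑ n ∈ 𝓝, ∑ n' ∈ 𝓝,
        ‖∑ m ∈ 𝓜, (if P m n ∧ P m n' then g m n * (starRingEnd ℂ) (g m n') else 0)‖) := by
  set u : ℕ → ℂ := fun m => ∑ n ∈ 𝓝, (if P m n then b n * g m n else 0) with hu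
  have e1 : ∑ m ∈ 𝓜, ∑ n ∈ 𝓝, (if P m n then a m * b n * g m n else 0) = ∑ m ∈ 𝓜, a m * u m := by
    refine Finset.sum_congr rfl fun m _ => ?_
    rw [hu, Finset.mul_sum]
    refine Finset.sum_congr rfl fun n _ => ?_
    split_ifs <;> ring
  have e2 : ‖∑ m ∈ 𝓜, a m * u m‖ ^ 2 ≤ (D ^ 2 * 𝓜.card) * ∑ m ∈ 𝓜, ‖u m‖ ^ 2 := by
    have h1 : ‖∑ m ∈ 𝓜, a m * u m‖ ≤ D * ∑ m ∈ 𝓜, ‖u m‖ := by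
      rw [Finset.mul_sum]
      refine (norm_sum_le _ _).trans (Finset.sum_le_sum fun m hm => ?_)
      rw [norm_mul]; exact mul_le_mul_of_nonneg_right (ha m hm) (norm_nonneg _)
    have h2 := sq_sum_le_card_mul_sum_sq (s := 𝓜) (f := fun m => ‖u m‖)
    calc _ ≤ (D * ∑ m ∈ 𝓜, ‖u m‖) ^ 2 := by gcongr
      _ = D ^ 2 * (∑ m ∈ 𝓜, ‖u m‖) ^ 2 := by ring
      _ ≤ D ^ 2 * (𝓜.card * ∑ m ∈ 𝓜, ‖u m‖ ^ 2) := by gcongr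
      _ = _ := by ring
  have e3 : ((∑ m ∈ 𝓜, ‖u m‖ ^ 2 : ℝ) : ℂ) = ∑ n ∈ 𝓝, ∑ n' ∈ 𝓝, b n * (starRingEnd ℂ) (b n') *
      ∑ m ∈ 𝓜, (if P m n ∧ P m n' then g m n * (starRingEnd ℂ) (g m n') else 0) := by
    push_cast
    have : ∀ m, ((‖u m‖ : ℂ)) ^ 2 = ∑ n ∈ 𝓝, ∑ n' ∈ 𝓝, b n * (starRingEnd ℂ) (b n') *
        (if P m n ∧ P m n' then g m n * (starRingEnd ℂ) (g m n') else 0) := by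
      intro m
      rw [← Complex.mul_conj', hu, map_sum, Finset.sum_mul_sum]
      refine Finset.sum_congr rfl fun n _ => Finset.sum_congr rfl fun n' _ => ?_
      by_cases h1 : P m n <;> by_cases h2 : P m n' <;> simp [h1, h2]
      ring
    simp_rw [this]
    rw [Finset.sum_comm]
    refine Finset.sum_congr rfl fun n _ => ?_
    rw [Finset.sum_comm]
    refine Finset.sum_congr rfl fun n' _ => ?_
    rw [Finset.mul_sum]
  have e4 : (∑ m ∈ 𝓜, ‖u m‖ ^ 2 : ℝ) ≤ D ^ 2 * ∑ n ∈ 𝓝, ∑ n' ∈ 𝓝,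
      ‖∑ m ∈ 𝓜, (if P m n ∧ P m n' then g m n * (starRingEnd ℂ) (g m n') else 0)‖ := by
    have : (∑ m ∈ 𝓜, ‖u m‖ ^ 2 : ℝ) = ‖((∑ m ∈ 𝓜, ‖u m‖ ^ 2 : ℝ) : ℂ)‖ := by
      rw [Complex.norm_real, Real.norm_of_nonneg (Finset.sum_nonneg fun _ _ => by positivity)]
    rw [this, e3, Finset.mul_sum]
    refine (norm_sum_le _ _).trans (Finset.sum_le_sum fun n hn => ?_)
    rw [Finset.mul_sum]
    refine (norm_sum_le _ _).trans (Finset.sum_le_sum fun n' hn' => ?_)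
    rw [norm_mul, norm_mul, RCLike.norm_conj, sq]
    have := hb n hn; have := hb n' hn'
    gcongr
  rw [e1]
  calc _ ≤ _ := e2
    _ ≤ (D ^ 2 * 𝓜.card) * (D ^ 2 * _) := mul_le_mul_of_nonneg_left e4 (by positivity)
    _ = _ := by ring


theorem sum_inv_sqrt (D : ℕ) : ∑ d ∈ Finset.range D, 1 / √((d : ℝ) + 1) ≤ 2 * √D := by
  induction D with
  | zero => simp
  | succ D ih =>
    rw [Finset.sum_range_succ]
    push_cast
    have h1 : 0 < √((D : ℝ) + 1) := by positivity
    have h2 : 0 ≤ √(D : ℝ) := by positivity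
    have h3 : √((D : ℝ) + 1) ^ 2 = D + 1 := Real.sq_sqrt (by positivity)
    have h4 : √(D : ℝ) ^ 2 = D := Real.sq_sqrt (by positivity)
    have : 1 / √((D : ℝ) + 1) ≤ 2 * √((D : ℝ) + 1) - 2 * √D := by
      rw [div_le_iff₀ h1]; nlinarith only [h3, h4, sq_nonneg (√((D : ℝ) + 1) - √D)]
    linarith

theorem sum_dist (R n : ℕ) (hn : n ≤ R) (s : Finset ℕ) (hs : ∀ m ∈ s, m ≤ R) :
    ∑ m ∈ s, (if m = n then 0 else 1 / √|(n : ℝ) - m|) ≤ 4 * √R := by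
  have h0 : ∀ m, 0 ≤ (if m = n then 0 else 1 / √|(n : ℝ) - m|) := fun m => by positivity
  have h1 : ∑ m ∈ s, (if m = n then 0 else 1 / √|(n : ℝ) - m|) ≤
      ∑ m ∈ Finset.range (n + (1 + (R - n))), (if m = n then 0 else 1 / √|(n : ℝ) - m|) := by
    refine Finset.sum_le_sum_of_subset_of_nonneg (fun m hm => ?_) fun m _ _ => h0 m
    have := hs m hm; simp; omega
  refine h1.trans ?_
  rw [Finset.sum_range_add, Finset.sum_range_add, Finset.sum_range_one]
  have h2 : ∑ m ∈ Finset.range n, (if m = n then 0 else 1 / √|(n : ℝ) - m|) =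
      ∑ d ∈ Finset.range n, 1 / √((d : ℝ) + 1) := by
    rw [← Finset.sum_range_reflect]
    refine Finset.sum_congr rfl fun m hm => ?_
    have := Finset.mem_range.1 hm
    rw [if_neg (by omega), Nat.sub_sub, Nat.cast_sub (by omega), abs_of_nonneg (by simp; positivity)]
    congr 2; push_cast; ring
  have h3 : ∑ d ∈ Finset.range (R - n), (if n + (1 + d) = n then 0 else 1 / √|(n : ℝ) - ((n + (1 + d) : ℕ) : ℝ)|) =
      ∑ d ∈ Finset.range (R - n), 1 / √((d : ℝ) + 1) := by
    refine Finset.sum_congr rfl fun d _ => ?_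
    rw [if_neg (by omega), abs_sub_comm]
    push_cast
    rw [show (n : ℝ) + (1 + d) - n = d + 1 by ring, abs_of_nonneg (by positivity)]
  rw [h2, h3]
  have a1 := sum_inv_sqrt n
  have a2 := sum_inv_sqrt (R - n)
  have a3 : √(n : ℝ) ≤ √R := Real.sqrt_le_sqrt (by exact_mod_cast hn)
  have a4 : √((R - n : ℕ) : ℝ) ≤ √R := Real.sqrt_le_sqrt (by exact_mod_cast Nat.sub_le _ _)
  simp; simp at a1 a2; linarith only [a3, a4, a1, a2]

theorem rpow_diff (c : ℝ) (hc : 1 < c) (ν a b : ℝ) (hν : 0 < ν) (ha : ν ≤ a) (hb : ν ≤ b) :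
    |a - b| * ν ^ (c - 1) ≤ |a ^ c - b ^ c| := by
  wlog h : b ≤ a generalizing a b
  · rw [abs_sub_comm, abs_sub_comm (a ^ c)]; exact this b a hb ha (by linarith)
  have hb0 : 0 < b := by linarith
  have ha0 : 0 < a := by linarith
  have h1 : ν ^ (c - 1) ≤ b ^ (c - 1) := Real.rpow_le_rpow hν.le hb (by linarith)
  have h2 : b ^ (c - 1) ≤ a ^ (c - 1) := Real.rpow_le_rpow hb0.le h (by linarith)
  have h3 : a ^ c = a ^ (c - 1) * a := by rw [← Real.rpow_add_one ha0.ne']; ring_nf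
  have h4 : b ^ c = b ^ (c - 1) * b := by rw [← Real.rpow_add_one hb0.ne']; ring_nf
  have h5 : (a - b) * ν ^ (c - 1) ≤ a ^ c - b ^ c := by
    rw [h3, h4]; nlinarith only [hν, h2, ha, h, h1]
  rw [abs_of_nonneg (by linarith)]
  exact h5.trans (le_abs_self _)

/-- Type I inner sums -/
theorem T1_inner (c : ℝ) (hc0 : 1 < c) (hc : ∀ j : ℕ, c ≠ j) : ∃ σ : ℝ, σ > 0 ∧ ∃ C : ℝ, C > 0 ∧ ∀ Q : ℕ, 16 ≤ Q →
    ∀ x : ℝ, x ≠ 0 → |x| * (Q : ℝ) ^ c ≤ (Q : ℝ) ^ (4 : ℝ) → ∀ m q : ℕ, 1 ≤ m → m * m ≤ Q → q ≤ Q / m →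
    ‖∑ n ∈ Finset.Ioc (Q / 2 / m) q, e (x * (m * n : ℝ) ^ c)‖ ≤
      C * (Q / m) * ((|x| * (Q : ℝ) ^ c) ^ (-(1 / 2) : ℝ) + (Q : ℝ) ^ (-σ)) := by
  obtain ⟨σ, hσ, C, hC, key⟩ := ES c hc 16
  refine ⟨σ / 4, by linarith, C * (2 ^ (c / 2) + 1), by positivity, ?_⟩
  intro Q hQ x hx hT m q hm hmQ hq
  have hQ' : (16 : ℝ) ≤ Q := by exact_mod_cast hQ
  have hQ0 : (0 : ℝ) < Q := by linarith only [hQ']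
  have hm' : (1 : ℝ) ≤ m := by exact_mod_cast hm
  have hmQ' : (m : ℝ) * m ≤ Q := by exact_mod_cast hmQ
  set N : ℝ := Q / (2 * m) with hN
  have hN4 : (Q : ℝ) ^ (1 / 4 : ℝ) ≤ N := by
    have h1 : ((Q : ℝ) ^ (1 / 4 : ℝ)) ^ 4 = Q := by
      rw [← Real.rpow_natCast, ← Real.rpow_mul hQ0.le]; norm_num
    set r := (Q : ℝ) ^ (1 / 4 : ℝ)
    have hr : 0 < r := by positivity
    have hr2 : 2 ≤ r := by by_contra h; push Not at h; have : r ^ 4 < 2 ^ 4 := by gcongr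
                           linarith only [hQ', h1, this]
    have hmr : (m : ℝ) ≤ r ^ 2 := by nlinarith only [hmQ', h1]
    rw [hN, le_div_iff₀ (by positivity), ← h1]
    calc r * (2 * m) ≤ r * (r * r ^ 2) := by gcongr
      _ = r ^ 4 := by ring
  have hN1 : 1 ≤ N := le_trans (Real.one_le_rpow (by linarith only [hQ']) (by norm_num)) hN4
  rw [sum_Ioc_range]
  have hy : |x * (m : ℝ) ^ c| * N ^ c = |x| * (Q : ℝ) ^ c * (2 ^ c)⁻¹ := by
    rw [abs_mul, abs_of_nonneg (by positivity : 0 ≤ (m : ℝ) ^ c), hN, Real.div_rpow (by positivity) (by positivity),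
      Real.mul_rpow (by positivity) (by positivity)]
    field_simp
  have h2c : 1 ≤ (2 : ℝ) ^ c := Real.one_le_rpow (by norm_num) (by linarith only [hc0])
  have hp : Q / 2 / m = Q / (2 * m) := Nat.div_div_eq_div_mul _ _ _
  have ha : N ≤ ((Q / 2 / m + 1 : ℕ) : ℝ) := by
    rw [hp, hN]; push_cast
    have := Nat.lt_floor_add_one ((Q : ℝ) / ((2 * m : ℕ) : ℝ))
    rw [Nat.floor_div_eq_div] at this
    push_cast at this ⊢; exact this.le
  have hqr : (q : ℝ) ≤ 2 * N := by
    have h1 : ((Q / m : ℕ) : ℝ) ≤ Q / m := Nat.cast_div_le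
    have h2 : (q : ℝ) ≤ ((Q / m : ℕ) : ℝ) := by exact_mod_cast hq
    have : (2 : ℝ) * N = Q / m := by rw [hN]; field_simp
    linarith only [h1, h2, this]
  have e1 : ∑ n ∈ Finset.range (q - Q / 2 / m), e (x * (m * ((Q / 2 / m + 1 + n : ℕ) : ℝ)) ^ c) =
      ∑ n ∈ Finset.range (q - Q / 2 / m), e ((x * (m : ℝ) ^ c) * (((Q / 2 / m + 1 : ℕ) : ℝ) + n) ^ c) := by
    refine Finset.sum_congr rfl fun n _ => ?_
    rw [Real.mul_rpow (by positivity) (by positivity)]; push_cast; congr 1; ring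
  rw [e1]
  have hle : ((Q / 2 / m + 1 : ℕ) : ℝ) + ((q - Q / 2 / m : ℕ) : ℝ) ≤ 4 * N := by
    rcases le_total (Q / 2 / m) q with h | h
    · rw [Nat.cast_sub h]; push_cast; linarith only [hN1, hqr]
    · rw [Nat.sub_eq_zero_of_le h]
      have h1 : ((Q / 2 / m : ℕ) : ℝ) ≤ N := by
        rw [hp, hN]; have := @Nat.cast_div_le ℝ _ _ _ Q (2 * m); push_cast at this ⊢; exact this
      push_cast at *; linarith only [hN1, h1]
  have hT' : |x * (m : ℝ) ^ c| * N ^ c ≤ N ^ (3 / 2 + (16 : ℕ) : ℝ) := by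
    rw [hy]
    calc |x| * (Q : ℝ) ^ c * (2 ^ c)⁻¹ ≤ |x| * (Q : ℝ) ^ c * 1 := by
          gcongr; exact inv_le_one_of_one_le₀ h2c
      _ ≤ (Q : ℝ) ^ (4 : ℝ) := by linarith only [hT]
      _ = ((Q : ℝ) ^ (1 / 4 : ℝ)) ^ (16 : ℝ) := by rw [← Real.rpow_mul hQ0.le]; norm_num
      _ ≤ N ^ (16 : ℝ) := by gcongr
      _ ≤ _ := Real.rpow_le_rpow_of_exponent_le hN1 (by norm_num)
  refine (key N hN1 _ _ ha hle _ (by positivity) hT').trans ?_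
  rw [hy]
  have hTp : 0 < |x| * (Q : ℝ) ^ c := by positivity
  have e2 : (|x| * (Q : ℝ) ^ c * (2 ^ c)⁻¹) ^ (-(1 / 2) : ℝ) = 2 ^ (c / 2) * (|x| * (Q : ℝ) ^ c) ^ (-(1 / 2) : ℝ) := by
    rw [Real.mul_rpow hTp.le (by positivity), ← Real.rpow_neg (by norm_num), ← Real.rpow_mul (by norm_num)]
    ring_nf
  have e3 : N ^ (-σ) ≤ (Q : ℝ) ^ (-(σ / 4)) := by
    calc N ^ (-σ) ≤ ((Q : ℝ) ^ (1 / 4 : ℝ)) ^ (-σ) :=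
          Real.rpow_le_rpow_of_nonpos (by positivity) hN4 (by linarith only [hσ])
      _ = _ := by rw [← Real.rpow_mul hQ0.le]; ring_nf
  rw [e2]
  have hNle : N ≤ Q / m := by rw [hN]; gcongr; linarith only []
  set U := (|x| * (Q : ℝ) ^ c) ^ (-(1 / 2) : ℝ)
  set W := (Q : ℝ) ^ (-(σ / 4))
  have hU : 0 ≤ U := by positivity
  have hW : 0 ≤ W := by positivity
  have hk : 0 ≤ (2 : ℝ) ^ (c / 2) := by positivity
  calc C * N * (2 ^ (c / 2) * U + N ^ (-σ)) ≤ C * (Q / m) * ((2 ^ (c / 2) + 1) * (U + W)) := by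
        gcongr; nlinarith only [e3, hU, mul_nonneg hk hW]
    _ = _ := by ring

theorem T1 (c : ℝ) (hc0 : 1 < c) (hc : ∀ j : ℕ, c ≠ j) : ∃ σ : ℝ, σ > 0 ∧ ∃ C : ℝ, C > 0 ∧ ∀ Q : ℕ, 16 ≤ Q →
    ∀ x : ℝ, x ≠ 0 → |x| * (Q : ℝ) ^ c ≤ (Q : ℝ) ^ (4 : ℝ) → ∀ (f h : ArithmeticFunction ℝ) (D W : ℝ), 0 ≤ W →
    (∀ m ≤ Q, |f m| ≤ D) → (∀ m, Q < m * m → f m = 0) → (∀ n ≤ Q + 1, 0 ≤ h n ∧ h n ≤ W) →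
    (∀ n, 1 ≤ n → h n ≤ h (n + 1)) →
    ‖∑ k ∈ Finset.Ioc (Q / 2) Q, ((f * h) k : ℂ) * e (x * (k : ℝ) ^ c)‖ ≤
      C * D * W * (1 + Real.log Q) * Q * ((|x| * (Q : ℝ) ^ c) ^ (-(1 / 2) : ℝ) + (Q : ℝ) ^ (-σ)) := by
  obtain ⟨σ, hσ, C, hC, key⟩ := T1_inner c hc0 hc
  refine ⟨σ, hσ, 2 * C, by positivity, ?_⟩
  intro Q hQ x hx hT f h D W hW hf hf0 hh hmono
  have hD : 0 ≤ D := (abs_nonneg _).trans (hf 0 (by omega))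
  rw [conv_sum Q f h (fun k => e (x * (k : ℝ) ^ c)),
    Rp_sum Q (fun m n => (f m : ℂ) * h n * e (x * ((m * n : ℕ) : ℝ) ^ c))]
  set U := (|x| * (Q : ℝ) ^ c) ^ (-(1 / 2) : ℝ) + (Q : ℝ) ^ (-σ) with hU
  have hU0 : 0 ≤ U := by positivity
  have hm1 : ∀ m ∈ Finset.Icc 1 Q, ‖∑ n ∈ Finset.Ioc (Q / 2 / m) (Q / m), (f m : ℂ) * h n * e (x * ((m * n : ℕ) : ℝ) ^ c)‖ ≤
      (2 * C * D * W * Q * U) * ((m : ℝ))⁻¹ := by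
    intro m hm
    rw [Finset.mem_Icc] at hm
    by_cases hmm : m * m ≤ Q
    swap
    · rw [Finset.sum_eq_zero]
      · rw [norm_zero]; positivity
      · intro n _; rw [hf0 m (by omega)]; simp
    have e1 : ∑ n ∈ Finset.Ioc (Q / 2 / m) (Q / m), (f m : ℂ) * h n * e (x * ((m * n : ℕ) : ℝ) ^ c) =
      f m * ∑ n ∈ Finset.range (Q / m - Q / 2 / m), (h (Q / 2 / m + 1 + n) : ℂ) *
        e (x * (m * ((Q / 2 / m + 1 + n : ℕ) : ℝ)) ^ c) := by
      rw [sum_Ioc_range, Finset.mul_sum]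
      refine Finset.sum_congr rfl fun n _ => ?_
      push_cast; ring
    have hQm : Q / m ≤ Q := Nat.div_le_self _ _
    have b1 := abel_mono (fun n => h (Q / 2 / m + 1 + n)) (fun n => e (x * (m * ((Q / 2 / m + 1 + n : ℕ) : ℝ)) ^ c))
      (C * (Q / m) * U) (Q / m - Q / 2 / m) (fun n _ => hmono _ (by rw [Nat.add_assoc, Nat.add_comm 1, ← Nat.add_assoc]; exact Nat.le_add_left 1 _))
      (hh _ (by have : Q / 2 / m ≤ Q := (Nat.div_le_self _ _).trans (Nat.div_le_self _ _)
                omega)).1 (by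
        intro k hk
        have := key Q hQ x hx hT m (Q / 2 / m + k) hm.1 hmm (by
          have : Q / 2 / m ≤ Q / m := Nat.div_le_div_right (Nat.div_le_self _ _)
          omega)
        rw [sum_Ioc_range, Nat.add_sub_cancel_left] at this
        exact this)
    rw [e1, norm_mul, Complex.norm_real, Real.norm_eq_abs]
    have hw := hh (Q / 2 / m + 1 + (Q / m - Q / 2 / m)) (by
      have : Q / 2 / m ≤ Q / m := Nat.div_le_div_right (Nat.div_le_self _ _)
      omega)
    have hm0 : (0 : ℝ) < m := by exact_mod_cast hm.1
    calc |f m| * _ ≤ D * (2 * W * (C * (Q / m) * U)) := by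
          refine mul_le_mul (hf m hm.2) (b1.trans ?_) (norm_nonneg _) hD
          gcongr; exact hw.2
      _ = _ := by field_simp
  refine (norm_sum_le _ _).trans ((Finset.sum_le_sum hm1).trans ?_)
  rw [← Finset.mul_sum]
  have hH : ∑ m ∈ Finset.Icc 1 Q, ((m : ℝ))⁻¹ ≤ 1 + Real.log Q := by
    have := harmonic_le_one_add_log Q
    rw [harmonic_eq_sum_Icc] at this; push_cast at this; exact this
  calc _ ≤ (2 * C * D * W * Q * U) * (1 + Real.log Q) := by gcongr
    _ = _ := by ring


/-- dyadic type II block -/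
theorem T2_block (c : ℝ) (hc0 : 1 < c) (hc : ∀ j : ℕ, c ≠ j) : ∃ σ : ℝ, σ > 0 ∧ ∃ C : ℝ, C > 0 ∧
    ∀ Q M t : ℕ, 64 ≤ Q → Q ≤ 8 * M * M → 4 * M ≤ Q →
    ∀ x : ℝ, x ≠ 0 → |x| * (Q : ℝ) ^ c ≤ (Q : ℝ) ^ (4 : ℝ) → ∀ (f h : ℕ → ℂ) (D : ℝ), 0 ≤ D →
    (∀ m ≤ Q, ‖f m‖ ≤ D) → (∀ n ≤ Q, ‖h n‖ ≤ D) →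
    ‖∑ m ∈ Finset.Ico M (2 * M), ∑ n ∈ Finset.Ioc (Q / (4 * M)) (Q / M),
      (if Q / 2 < m * n ∧ m * n ≤ Q ∧ n + t ≤ m then f m * h n * e (x * (m * n : ℝ) ^ c) else 0)‖ ^ 2 ≤
      C * D ^ 4 * (Q : ℝ) ^ 2 * (M / Q + (|x| * (Q : ℝ) ^ c) ^ (-(1 / 2) : ℝ) + (Q : ℝ) ^ (-σ)) := by
  obtain ⟨σ, hσ, C, hC, key⟩ := ES c hc 16
  refine ⟨σ / 4, by linarith, 1 + C * (2 * 4 ^ (c / 2) + 1), by positivity, ?_⟩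
  intro Q M t hQ hM hMQ x hx hT f h D hD hf hh
  have hQ' : (64 : ℝ) ≤ Q := by exact_mod_cast hQ
  have hQ0 : (0 : ℝ) < Q := by linarith only [hQ']
  have hM0 : 0 < M := by
    rcases Nat.eq_zero_or_pos M with h | h
    · rw [h] at hM; omega
    · exact h
  have hM1 : (1 : ℝ) ≤ M := by exact_mod_cast hM0
  have hMQ' : 4 * (M : ℝ) ≤ Q := by exact_mod_cast hMQ
  have hM' : (Q : ℝ) ≤ 8 * M * M := by exact_mod_cast hM
  set ν : ℝ := Q / (4 * M) with hν
  have hν1 : 1 ≤ ν := by rw [hν, le_div_iff₀ (by positivity)]; linarith only [hMQ']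
  have hMν : (M : ℝ) * ν = Q / 4 := by rw [hν]; field_simp
  have hM4 : (Q : ℝ) ^ (1 / 4 : ℝ) ≤ M := by
    have h1 : ((Q : ℝ) ^ (1 / 4 : ℝ)) ^ 4 = Q := by
      rw [← Real.rpow_natCast, ← Real.rpow_mul hQ0.le]; norm_num
    have hr : 0 < (Q : ℝ) ^ (1 / 4 : ℝ) := by positivity
    set r := (Q : ℝ) ^ (1 / 4 : ℝ)
    by_contra hcon; push Not at hcon
    have hr8 : (8 : ℝ) ≤ r ^ 2 := by
      by_contra h; push Not at h
      have : (r ^ 2) ^ 2 < 8 ^ 2 := by gcongr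
      have : (r ^ 2) ^ 2 = r ^ 4 := by ring
      linarith
    have : (M : ℝ) * M < r * r := by gcongr
    nlinarith only [hM', h1, this, hr8]
  have hcs := CS2 (Finset.Ico M (2 * M)) (Finset.Ioc (Q / (4 * M)) (Q / M))
    (fun m n => Q / 2 < m * n ∧ m * n ≤ Q ∧ n + t ≤ m) f h (fun m n => e (x * (m * n : ℝ) ^ c)) D hD
    (fun m hm => hf m (by rw [Finset.mem_Ico] at hm; omega))
    (fun n hn => hh n (by rw [Finset.mem_Ioc] at hn; have := Nat.div_le_self Q M; omega))
  refine hcs.trans ?_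
  set TT := |x| * (Q : ℝ) ^ c with hTT
  have hTp : 0 < TT := by positivity
  -- bounds on n
  have hn1 : ∀ n ∈ Finset.Ioc (Q / (4 * M)) (Q / M), ν ≤ n ∧ (n : ℝ) ≤ 4 * ν ∧ 0 < n ∧ n ≤ Q / M := by
    intro n hn
    rw [Finset.mem_Ioc] at hn
    refine ⟨?_, ?_, (Nat.zero_le _).trans_lt hn.1, hn.2⟩
    · have h1 := Nat.lt_floor_add_one ((Q : ℝ) / ((4 * M : ℕ) : ℝ))
      rw [Nat.floor_div_eq_div] at h1
      have h2 : ((Q / (4 * M) : ℕ) : ℝ) + 1 ≤ n := by exact_mod_cast hn.1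
      rw [hν]; push_cast at h1 h2 ⊢; linarith only [h2, h1]
    · have h1 : ((Q / M : ℕ) : ℝ) ≤ Q / M := Nat.cast_div_le
      have h2 : (n : ℝ) ≤ ((Q / M : ℕ) : ℝ) := by exact_mod_cast hn.2
      have : 4 * ν = Q / M := by rw [hν]; field_simp
      linarith only [h1, h2, this]
  set A := C * M * (4 ^ (c / 2) * √ν * TT ^ (-(1 / 2) : ℝ)) with hA
  set B := C * M * (Q : ℝ) ^ (-(σ / 4)) with hB
  have hA0 : 0 ≤ A := by positivity
  have hB0 : 0 ≤ B := by positivity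
  have inner : ∀ n ∈ Finset.Ioc (Q / (4 * M)) (Q / M), ∀ n' ∈ Finset.Ioc (Q / (4 * M)) (Q / M),
      ‖∑ m ∈ Finset.Ico M (2 * M), (if (Q / 2 < m * n ∧ m * n ≤ Q ∧ n + t ≤ m) ∧ (Q / 2 < m * n' ∧ m * n' ≤ Q ∧ n' + t ≤ m)
        then e (x * (m * n : ℝ) ^ c) * (starRingEnd ℂ) (e (x * (m * n' : ℝ) ^ c)) else 0)‖ ≤
      (if n' = n then (M : ℝ) else 0) + A * (if n' = n then 0 else 1 / √|(n : ℝ) - n'|) + B := by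
    intro n hn n' hn'
    obtain ⟨a1, a2, a3, a4⟩ := hn1 n hn
    obtain ⟨b1, b2, b3, b4⟩ := hn1 n' hn'
    by_cases hnn : n' = n
    · rw [if_pos hnn, if_pos hnn]
      have : ‖∑ m ∈ Finset.Ico M (2 * M), (if (Q / 2 < m * n ∧ m * n ≤ Q ∧ n + t ≤ m) ∧ (Q / 2 < m * n' ∧ m * n' ≤ Q ∧ n' + t ≤ m)
        then e (x * (m * n : ℝ) ^ c) * (starRingEnd ℂ) (e (x * (m * n' : ℝ) ^ c)) else 0)‖ ≤ ∑ m ∈ Finset.Ico M (2 * M), (1 : ℝ) := by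
        refine (norm_sum_le _ _).trans (Finset.sum_le_sum fun m _ => ?_)
        split_ifs
        · rw [norm_mul, RCLike.norm_conj, e_norm, e_norm]; norm_num
        · simp
      refine this.trans ?_
      rw [Finset.sum_const, Nat.card_Ico, show 2 * M - M = M by omega]
      simp; linarith only [hB0]
    rw [if_neg hnn, if_neg hnn]
    set α := max M (max (max (Q / 2 / n + 1) (n + t)) (max (Q / 2 / n' + 1) (n' + t))) with hα
    set β := min (2 * M) (min (Q / n + 1) (Q / n' + 1)) with hβ
    have e1 : ∑ m ∈ Finset.Ico M (2 * M), (if (Q / 2 < m * n ∧ m * n ≤ Q ∧ n + t ≤ m) ∧ (Q / 2 < m * n' ∧ m * n' ≤ Q ∧ n' + t ≤ m)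
        then e (x * (m * n : ℝ) ^ c) * (starRingEnd ℂ) (e (x * (m * n' : ℝ) ^ c)) else 0) =
        ∑ m ∈ Finset.range (β - α), e ((x * ((n : ℝ) ^ c - (n' : ℝ) ^ c)) * ((α : ℝ) + m) ^ c) := by
      rw [← Finset.sum_filter]
      have : (Finset.Ico M (2 * M)).filter (fun m => (Q / 2 < m * n ∧ m * n ≤ Q ∧ n + t ≤ m) ∧ (Q / 2 < m * n' ∧ m * n' ≤ Q ∧ n' + t ≤ m)) =
          Finset.Ico α β := by
        ext m
        have i1 : Q / 2 / n < m ↔ Q / 2 < m * n := Nat.div_lt_iff_lt_mul a3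
        have i2 : Q / 2 / n' < m ↔ Q / 2 < m * n' := Nat.div_lt_iff_lt_mul b3
        have i3 : m ≤ Q / n ↔ m * n ≤ Q := Nat.le_div_iff_mul_le a3
        have i4 : m ≤ Q / n' ↔ m * n' ≤ Q := Nat.le_div_iff_mul_le b3
        rw [Finset.mem_filter, Finset.mem_Ico, Finset.mem_Ico, ← i1, ← i2, ← i3, ← i4, hα, hβ]
        simp only [max_le_iff, lt_min_iff]
        omega
      rw [this, Finset.sum_Ico_eq_sum_range]
      refine Finset.sum_congr rfl fun m _ => ?_
      rw [← e_neg, ← e_add]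
      push_cast
      rw [Real.mul_rpow (by positivity) (by positivity), Real.mul_rpow (by positivity) (by positivity)]
      congr 1; ring
    rw [e1]
    have hd := rpow_diff c hc0 ν n n' (by linarith only [hν1]) a1 b1
    have hnn0 : 0 < |(n : ℝ) - n'| := abs_pos.2 (sub_ne_zero.2 (Nat.cast_injective.ne (Ne.symm hnn)))
    have hy0 : x * ((n : ℝ) ^ c - (n' : ℝ) ^ c) ≠ 0 := by
      refine mul_ne_zero hx (abs_pos.1 (lt_of_lt_of_le ?_ hd)); positivity
    have hαM : (M : ℝ) ≤ α := by exact_mod_cast le_max_left _ _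
    rcases Nat.le_total β α with hba | hab
    · rw [Nat.sub_eq_zero_of_le hba]; simp; positivity
    have hβM : (β : ℝ) ≤ 2 * M := by exact_mod_cast min_le_left _ _
    have hlow : TT * (4 ^ c)⁻¹ * (|(n : ℝ) - n'| / ν) ≤ |x * ((n : ℝ) ^ c - (n' : ℝ) ^ c)| * (M : ℝ) ^ c := by
      have : TT * (4 ^ c)⁻¹ = |x| * ((M : ℝ) ^ c * ν ^ c) := by
        rw [← Real.mul_rpow (by positivity) (by positivity), hMν, Real.div_rpow (by positivity) (by positivity), hTT]; ring
      rw [this, abs_mul]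
      have h3 : ν ^ c = ν ^ (c - 1) * ν := by rw [← Real.rpow_add_one (by linarith only [hν1])]; ring_nf
      calc |x| * ((M : ℝ) ^ c * ν ^ c) * (|(n : ℝ) - n'| / ν) = |x| * (|(n : ℝ) - n'| * ν ^ (c - 1)) * (M : ℝ) ^ c := by
            rw [h3]; field_simp
        _ ≤ _ := by gcongr
    have hup : |x * ((n : ℝ) ^ c - (n' : ℝ) ^ c)| * (M : ℝ) ^ c ≤ (M : ℝ) ^ (3 / 2 + (16 : ℕ) : ℝ) := by
      have h4 : |(n : ℝ) ^ c - (n' : ℝ) ^ c| ≤ (4 * ν) ^ c := by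
        have q1 : (n : ℝ) ^ c ≤ (4 * ν) ^ c := by gcongr
        have q2 : (n' : ℝ) ^ c ≤ (4 * ν) ^ c := by gcongr
        have q3 : 0 ≤ (n : ℝ) ^ c := by positivity
        have q4 : 0 ≤ (n' : ℝ) ^ c := by positivity
        rw [abs_le]; constructor <;> linarith only [q2, q3, q1, q4]
      calc |x * ((n : ℝ) ^ c - (n' : ℝ) ^ c)| * (M : ℝ) ^ c ≤ |x| * (4 * ν) ^ c * (M : ℝ) ^ c := by
            rw [abs_mul]; gcongr
        _ = TT := by
            rw [mul_assoc, ← Real.mul_rpow (by positivity) (by positivity), hTT]; congr 2; linarith only [hMν]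
        _ ≤ (Q : ℝ) ^ (4 : ℝ) := hT
        _ = ((Q : ℝ) ^ (1 / 4 : ℝ)) ^ (16 : ℝ) := by rw [← Real.rpow_mul hQ0.le]; norm_num
        _ ≤ (M : ℝ) ^ (16 : ℝ) := by gcongr
        _ ≤ _ := Real.rpow_le_rpow_of_exponent_le hM1 (by norm_num)
    refine (key M hM1 α (β - α) hαM (by rw [Nat.cast_sub hab]; linarith only [hβM]) _ hy0 hup).trans ?_
    have g1 : (|x * ((n : ℝ) ^ c - (n' : ℝ) ^ c)| * (M : ℝ) ^ c) ^ (-(1 / 2) : ℝ) ≤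
        4 ^ (c / 2) * √ν * TT ^ (-(1 / 2) : ℝ) * (1 / √|(n : ℝ) - n'|) := by
      refine (Real.rpow_le_rpow_of_nonpos (by positivity) hlow (by norm_num)).trans (le_of_eq ?_)
      rw [Real.mul_rpow (by positivity) (by positivity), Real.mul_rpow (by positivity) (by positivity),
        Real.div_rpow (by positivity) (by positivity), ← Real.rpow_neg (by positivity), ← Real.rpow_mul (by norm_num),
        Real.sqrt_eq_rpow, Real.sqrt_eq_rpow, Real.rpow_neg (by positivity : 0 ≤ |(n : ℝ) - n'|), Real.rpow_neg (by positivity : 0 ≤ ν)]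
      field_simp
    have g2 : (M : ℝ) ^ (-σ) ≤ (Q : ℝ) ^ (-(σ / 4)) := by
      calc (M : ℝ) ^ (-σ) ≤ ((Q : ℝ) ^ (1 / 4 : ℝ)) ^ (-σ) :=
            Real.rpow_le_rpow_of_nonpos (by positivity) hM4 (by linarith only [hσ])
        _ = _ := by rw [← Real.rpow_mul hQ0.le]; ring_nf
    calc _ ≤ C * M * (4 ^ (c / 2) * √ν * TT ^ (-(1 / 2) : ℝ) * (1 / √|(n : ℝ) - n'|) + (Q : ℝ) ^ (-(σ / 4))) := by gcongr
      _ = _ := by rw [hA, hB]; ring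
  have hcard : ((Finset.Ioc (Q / (4 * M)) (Q / M)).card : ℝ) ≤ 4 * ν := by
    rw [Nat.card_Ioc]
    have h1 : ((Q / M : ℕ) : ℝ) ≤ Q / M := Nat.cast_div_le
    have h2 : ((Q / M - Q / (4 * M) : ℕ) : ℝ) ≤ ((Q / M : ℕ) : ℝ) := by exact_mod_cast Nat.sub_le _ _
    have : 4 * ν = Q / M := by rw [hν]; field_simp
    linarith only [h1, h2, this]
  have hsum : ∑ n ∈ Finset.Ioc (Q / (4 * M)) (Q / M), ∑ n' ∈ Finset.Ioc (Q / (4 * M)) (Q / M),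
      ‖∑ m ∈ Finset.Ico M (2 * M), (if (Q / 2 < m * n ∧ m * n ≤ Q ∧ n + t ≤ m) ∧ (Q / 2 < m * n' ∧ m * n' ≤ Q ∧ n' + t ≤ m)
        then e (x * (m * n : ℝ) ^ c) * (starRingEnd ℂ) (e (x * (m * n' : ℝ) ^ c)) else 0)‖ ≤
      4 * ν * (M + A * (4 * √(4 * ν)) + B * (4 * ν)) := by
    have : ∀ n ∈ Finset.Ioc (Q / (4 * M)) (Q / M), ∑ n' ∈ Finset.Ioc (Q / (4 * M)) (Q / M),
      ‖∑ m ∈ Finset.Ico M (2 * M), (if (Q / 2 < m * n ∧ m * n ≤ Q ∧ n + t ≤ m) ∧ (Q / 2 < m * n' ∧ m * n' ≤ Q ∧ n' + t ≤ m)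
        then e (x * (m * n : ℝ) ^ c) * (starRingEnd ℂ) (e (x * (m * n' : ℝ) ^ c)) else 0)‖ ≤
      (M + A * (4 * √(4 * ν)) + B * (4 * ν)) := by
      intro n hn
      refine (Finset.sum_le_sum (inner n hn)).trans ?_
      rw [Finset.sum_add_distrib, Finset.sum_add_distrib, Finset.sum_ite_eq' , if_pos hn, ← Finset.mul_sum, Finset.sum_const, nsmul_eq_mul]
      have s1 := sum_dist (Q / M) n (hn1 n hn).2.2.2 (Finset.Ioc (Q / (4 * M)) (Q / M)) (fun m hm => (Finset.mem_Ioc.1 hm).2)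
      have s2 : √((Q / M : ℕ) : ℝ) ≤ √(4 * ν) := by
        refine Real.sqrt_le_sqrt (Nat.cast_div_le.trans (le_of_eq ?_)); rw [hν]; field_simp
      rw [mul_comm _ B]
      gcongr
      exact s1.trans (by gcongr)
    refine (Finset.sum_le_sum this).trans ?_
    rw [Finset.sum_const, nsmul_eq_mul]
    gcongr
  rw [Nat.card_Ico, show 2 * M - M = M by omega]
  have hs2 : √ν * √(4 * ν) = 2 * ν := by
    rw [Real.sqrt_mul (by norm_num), show (4 : ℝ) = 2 ^ 2 by norm_num, Real.sqrt_sq (by norm_num)]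
    have := Real.mul_self_sqrt (by linarith only [hν1] : 0 ≤ ν)
    linear_combination 2 * this
  have hMQ2 : (M : ℝ) / Q = 1 / (4 * ν) := by rw [hν]; field_simp
  have hQ2 : (Q : ℝ) = 4 * (M * ν) := by linarith only [hMν]
  set U := TT ^ (-(1 / 2) : ℝ)
  set W := (Q : ℝ) ^ (-(σ / 4))
  have hU : 0 ≤ U := by positivity
  have hW : 0 ≤ W := by positivity
  calc D ^ 4 * (M * _) ≤ D ^ 4 * (M * (4 * ν * (M + A * (4 * √(4 * ν)) + B * (4 * ν)))) := by gcongr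
    _ = D ^ 4 * (Q : ℝ) ^ 2 * (M / Q + C * (2 * 4 ^ (c / 2)) * U + C * W) := by
        rw [hMQ2, hQ2, hA, hB]
        have : C * M * (4 ^ (c / 2) * √ν * U) * (4 * √(4 * ν)) = C * M * (4 ^ (c / 2) * U) * (4 * (2 * ν)) := by
          rw [← hs2]; ring
        rw [this]; field_simp
    _ ≤ D ^ 4 * (Q : ℝ) ^ 2 * ((1 + C * (2 * 4 ^ (c / 2) + 1)) * (M / Q + U + W)) := by
        gcongr
        have h0 : (0 : ℝ) ≤ M / Q := by positivity
        have h2 : (1 + C * (2 * 4 ^ (c / 2) + 1)) * (M / Q + U + W) - (M / Q + C * (2 * 4 ^ (c / 2)) * U + C * W) =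
          C * (2 * 4 ^ (c / 2) + 1) * (M / Q) + (1 + C) * U + (1 + C * (2 * 4 ^ (c / 2))) * W := by ring
        have h3 : 0 ≤ C * (2 * 4 ^ (c / 2) + 1) * (M / Q) + (1 + C) * U + (1 + C * (2 * 4 ^ (c / 2))) * W := by positivity
        linarith only [h3]
    _ = _ := by ring


theorem T2_half (c : ℝ) (hc0 : 1 < c) (hc : ∀ j : ℕ, c ≠ j) : ∃ σ : ℝ, σ > 0 ∧ ∃ C : ℝ, C > 0 ∧
    ∀ Q u t : ℕ, 64 ≤ Q → 3 ≤ u →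
    ∀ x : ℝ, x ≠ 0 → |x| * (Q : ℝ) ^ c ≤ (Q : ℝ) ^ (4 : ℝ) → ∀ (f h : ℕ → ℂ) (D : ℝ), 0 ≤ D →
    (∀ m ≤ Q, ‖f m‖ ≤ D) → (∀ n ≤ Q, ‖h n‖ ≤ D) → (∀ n ≤ u, h n = 0) →
    ‖∑ p ∈ (Rp Q).filter (fun p => p.2 + t ≤ p.1), f p.1 * h p.2 * e (x * (p.1 * p.2 : ℝ) ^ c)‖ ≤
      C * D ^ 2 * Q * (Nat.log 2 Q + 1) * √(1 / u + (|x| * (Q : ℝ) ^ c) ^ (-(1 / 2) : ℝ) + (Q : ℝ) ^ (-σ)) := by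
  obtain ⟨σ, hσ, C, hC, key⟩ := T2_block c hc0 hc
  refine ⟨σ, hσ, √C, by positivity, ?_⟩
  intro Q u t hQ hu x hx hT f h D hD hf hh hhu
  set F : ℕ × ℕ → ℂ := fun p => f p.1 * h p.2 * e (x * (p.1 * p.2 : ℝ) ^ c) with hF
  rw [← Finset.sum_fiberwise_of_maps_to (s := (Rp Q).filter (fun p => p.2 + t ≤ p.1))
    (t := Finset.range (Nat.log 2 Q + 1)) (g := fun p => Nat.log 2 p.1) (by
      intro p hp
      simp only [Rp, Finset.mem_filter, Finset.mem_product, Finset.mem_Icc] at hp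
      rw [Finset.mem_range]
      exact Nat.lt_succ_of_le (Nat.log_mono_right hp.1.1.1.2))]
  have hu' : (3 : ℝ) ≤ u := by exact_mod_cast hu
  have hQ' : (64 : ℝ) ≤ Q := by exact_mod_cast hQ
  have hblock : ∀ i ∈ Finset.range (Nat.log 2 Q + 1),
      ‖∑ p ∈ ((Rp Q).filter (fun p => p.2 + t ≤ p.1)).filter (fun p => Nat.log 2 p.1 = i), F p‖ ≤
      √C * D ^ 2 * Q * √(1 / u + (|x| * (Q : ℝ) ^ c) ^ (-(1 / 2) : ℝ) + (Q : ℝ) ^ (-σ)) := by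
    intro i _
    set M := 2 ^ i with hM
    have hM0 : 0 < M := by positivity
    have hset : ((Rp Q).filter (fun p => p.2 + t ≤ p.1)).filter (fun p => Nat.log 2 p.1 = i) =
        (Finset.Ico M (2 * M) ×ˢ Finset.Ioc (Q / (4 * M)) (Q / M)).filter
          (fun p => Q / 2 < p.1 * p.2 ∧ p.1 * p.2 ≤ Q ∧ p.2 + t ≤ p.1) := by
      ext ⟨m, n⟩
      simp only [Rp, Finset.mem_filter, Finset.mem_product, Finset.mem_Icc, Finset.mem_Ico, Finset.mem_Ioc]
      have i1 : Q / (4 * M) < n ↔ Q < n * (4 * M) := Nat.div_lt_iff_lt_mul (by omega)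
      have i2 : n ≤ Q / M ↔ n * M ≤ Q := Nat.le_div_iff_mul_le hM0
      rw [i1, i2]
      constructor
      · rintro ⟨⟨⟨⟨⟨a1, a2⟩, a3, a4⟩, a5, a6⟩, a7⟩, a8⟩
        have := (Nat.log_eq_iff (Or.inr ⟨by norm_num, by omega⟩)).1 a8
        rw [pow_succ] at this
        have h1 : M ≤ m := this.1
        have h2 : m < M * 2 := this.2
        refine ⟨⟨⟨h1, by omega⟩, ?_, ?_⟩, a5, a6, a7⟩
        · have : n * m + n * 1 ≤ n * (M * 2) := by rw [← Nat.mul_add]; exact Nat.mul_le_mul_left _ h2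
          have : m * n = n * m := Nat.mul_comm _ _
          have : n * (4 * M) = 2 * (n * (M * 2)) := by ring
          omega
        · calc n * M ≤ n * m := Nat.mul_le_mul_left _ h1
            _ = m * n := Nat.mul_comm _ _
            _ ≤ Q := a6
      · rintro ⟨⟨⟨a1, a2⟩, a3, a4⟩, a5, a6, a7⟩
        have n0 : 1 ≤ n := by rcases Nat.eq_zero_or_pos n with h | h
                              · rw [h] at a5; omega
                              · exact h
        have m0 : 1 ≤ m := hM0.trans_le a1
        refine ⟨⟨⟨⟨⟨m0, ?_⟩, n0, ?_⟩, a5, a6⟩, a7⟩, ?_⟩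
        · exact (Nat.le_mul_of_pos_right m n0).trans a6
        · exact (Nat.le_mul_of_pos_left n m0).trans a6
        · rw [Nat.log_eq_iff (Or.inr ⟨by norm_num, by omega⟩), pow_succ]; exact ⟨a1, by omega⟩
    have hz : 0 ≤ √C * D ^ 2 * Q * √(1 / u + (|x| * (Q : ℝ) ^ c) ^ (-(1 / 2) : ℝ) + (Q : ℝ) ^ (-σ)) := by positivity
    rw [hset]
    by_cases c1 : 8 * M * M < Q
    · rw [Finset.filter_false_of_mem, Finset.sum_empty, norm_zero]
      · exact hz
      · rintro ⟨m, n⟩ hp ⟨h1, h2, h3⟩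
        simp only [Finset.mem_product, Finset.mem_Ico] at hp h1 h2 h3
        have a1 : m * n ≤ m * m := Nat.mul_le_mul_left _ (by omega)
        have a2 : m * m ≤ (2 * M) * (2 * M) := Nat.mul_le_mul (by omega) (by omega)
        have : (2 * M) * (2 * M) = 4 * (M * M) := by ring
        have : 8 * M * M = 8 * (M * M) := by ring
        omega
    by_cases c2 : Q / M ≤ u
    · rw [Finset.sum_eq_zero, norm_zero]
      · exact hz
      · rintro ⟨m, n⟩ hp
        simp only [Finset.mem_filter, Finset.mem_product, Finset.mem_Ioc] at hp
        rw [hF]; simp only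
        rw [hhu n (hp.1.2.2.trans c2)]; ring
    push Not at c1 c2
    have c3 : (u + 1) * M ≤ Q := (Nat.le_div_iff_mul_le hM0).1 c2
    have := key Q M t hQ c1 (le_trans (Nat.mul_le_mul_right M (by omega)) c3) x hx hT f h D hD hf hh
    rw [Finset.sum_filter, Finset.sum_product]
    refine Real.le_sqrt_of_sq_le this |>.trans ?_
    have hMu : (M : ℝ) / Q ≤ 1 / u := by
      rw [div_le_div_iff₀ (by linarith only [hQ']) (by linarith only [hu'])]
      have : ((u + 1 : ℕ) : ℝ) * M ≤ Q := by exact_mod_cast c3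
      push_cast at this; have : (0 : ℝ) ≤ M := by positivity
      nlinarith
    rw [show √C * D ^ 2 * Q * √(1 / u + (|x| * (Q : ℝ) ^ c) ^ (-(1 / 2) : ℝ) + (Q : ℝ) ^ (-σ)) =
      √(C * (D ^ 2 * Q) ^ 2 * (1 / u + (|x| * (Q : ℝ) ^ c) ^ (-(1 / 2) : ℝ) + (Q : ℝ) ^ (-σ))) by
        rw [Real.sqrt_mul (by positivity), Real.sqrt_mul (by positivity), Real.sqrt_sq (by positivity)]; ring]
    apply Real.sqrt_le_sqrt
    calc _ ≤ C * D ^ 4 * (Q : ℝ) ^ 2 * (1 / u + (|x| * (Q : ℝ) ^ c) ^ (-(1 / 2) : ℝ) + (Q : ℝ) ^ (-σ)) := by gcongr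
      _ = _ := by ring
  refine (norm_sum_le _ _).trans ((Finset.sum_le_sum hblock).trans (le_of_eq ?_))
  rw [Finset.sum_const, Finset.card_range, nsmul_eq_mul]; push_cast; ring

theorem T2 (c : ℝ) (hc0 : 1 < c) (hc : ∀ j : ℕ, c ≠ j) : ∃ σ : ℝ, σ > 0 ∧ ∃ C : ℝ, C > 0 ∧
    ∀ Q u : ℕ, 64 ≤ Q → 3 ≤ u →
    ∀ x : ℝ, x ≠ 0 → |x| * (Q : ℝ) ^ c ≤ (Q : ℝ) ^ (4 : ℝ) → ∀ (f h : ArithmeticFunction ℝ) (D : ℝ), 0 ≤ D →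
    (∀ m ≤ Q, |f m| ≤ D) → (∀ n ≤ Q, |h n| ≤ D) → (∀ n ≤ u, f n = 0) → (∀ n ≤ u, h n = 0) →
    ‖∑ k ∈ Finset.Ioc (Q / 2) Q, ((f * h) k : ℂ) * e (x * (k : ℝ) ^ c)‖ ≤
      C * D ^ 2 * Q * (Nat.log 2 Q + 1) * √(1 / u + (|x| * (Q : ℝ) ^ c) ^ (-(1 / 2) : ℝ) + (Q : ℝ) ^ (-σ)) := by
  obtain ⟨σ, hσ, C, hC, key⟩ := T2_half c hc0 hc
  refine ⟨σ, hσ, 2 * C, by positivity, ?_⟩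
  intro Q u hQ hu x hx hT f h D hD hf hh hfu hhu
  have nf : ∀ m ≤ Q, ‖(f m : ℂ)‖ ≤ D := fun m hm => by rw [Complex.norm_real]; exact hf m hm
  have nh : ∀ m ≤ Q, ‖(h m : ℂ)‖ ≤ D := fun m hm => by rw [Complex.norm_real]; exact hh m hm
  have k1 := key Q u 0 hQ hu x hx hT (fun m => (f m : ℂ)) (fun m => (h m : ℂ)) D hD nf nh
    (fun n hn => by simp [hhu n hn])
  have k2 := key Q u 1 hQ hu x hx hT (fun m => (h m : ℂ)) (fun m => (f m : ℂ)) D hD nh nf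
    (fun n hn => by simp [hfu n hn])
  rw [conv_sum Q f h (fun k => e (x * (k : ℝ) ^ c)), ← Finset.sum_filter_add_sum_filter_not _ (fun p => p.2 + 0 ≤ p.1)]
  have e1 : ∑ p ∈ (Rp Q).filter (fun p => ¬ p.2 + 0 ≤ p.1), (f p.1 : ℂ) * h p.2 * e (x * ((p.1 * p.2 : ℕ) : ℝ) ^ c) =
      ∑ p ∈ (Rp Q).filter (fun p => p.2 + 1 ≤ p.1), (h p.1 : ℂ) * f p.2 * e (x * (p.1 * p.2 : ℝ) ^ c) := by
    refine Finset.sum_bij' (fun p _ => p.swap) (fun p _ => p.swap) ?_ ?_ ?_ ?_ ?_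
    · rintro ⟨m, n⟩ hp
      simp only [Rp, Finset.mem_filter, Finset.mem_product, Finset.mem_Icc, Prod.swap, Nat.mul_comm n m] at hp ⊢
      omega
    · rintro ⟨m, n⟩ hp
      simp only [Rp, Finset.mem_filter, Finset.mem_product, Finset.mem_Icc, Prod.swap, Nat.mul_comm n m] at hp ⊢
      omega
    · intros; simp
    · intros; simp
    · rintro ⟨m, n⟩ hp
      simp only [Prod.swap]; push_cast; rw [mul_comm (n : ℝ)]; ring
  rw [e1]
  refine (norm_add_le _ _).trans ?_
  push_cast at k1 k2 ⊢
  linarith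

open ArithmeticFunction in
/-- truncated arithmetic function -/
noncomputable def cut (u : ℕ) (f : ArithmeticFunction ℝ) : ArithmeticFunction ℝ :=
  ⟨fun n => if n ≤ u then f n else 0, by simp⟩

theorem cut_apply (u : ℕ) (f : ArithmeticFunction ℝ) (n : ℕ) : cut u f n = if n ≤ u then f n else 0 := rfl

open ArithmeticFunction ArithmeticFunction.Moebius ArithmeticFunction.zeta in
theorem vaughan (u : ℕ) : (Λ : ArithmeticFunction ℝ) = cut u Λ + cut u (μ : ArithmeticFunction ℝ) * log
    - (cut u (μ : ArithmeticFunction ℝ) * cut u Λ) * (ζ : ArithmeticFunction ℝ)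
    + ((Λ - cut u Λ) * (ζ : ArithmeticFunction ℝ)) * ((μ : ArithmeticFunction ℝ) - cut u (μ : ArithmeticFunction ℝ)) := by
  have h1 : (Λ : ArithmeticFunction ℝ) * (ζ : ArithmeticFunction ℝ) = log := vonMangoldt_mul_zeta
  have h2 : (ζ : ArithmeticFunction ℝ) * (μ : ArithmeticFunction ℝ) = 1 := coe_zeta_mul_coe_moebius
  rw [← h1]
  linear_combination (cut u Λ - Λ) * h2

open ArithmeticFunction ArithmeticFunction.Moebius ArithmeticFunction.zeta in
theorem vonM_sum (g : ArithmeticFunction ℝ) (hg : ∀ d, |g d| ≤ Λ d) (h : ArithmeticFunction ℝ) (hh : ∀ d, |h d| ≤ 1)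
    (n : ℕ) : |(g * h) n| ≤ Real.log n := by
  rw [ArithmeticFunction.mul_apply]
  have h1 : (Λ * (ζ : ArithmeticFunction ℝ)) n = Real.log n := by rw [vonMangoldt_mul_zeta]; rfl
  rw [← h1, ArithmeticFunction.mul_apply]
  refine (Finset.abs_sum_le_sum_abs _ _).trans (Finset.sum_le_sum fun p hp => ?_)
  have hp2 : p.2 ≠ 0 := by
    rintro h; have := Nat.mem_divisorsAntidiagonal.1 hp; rw [h] at this; omega
  rw [abs_mul, natCoe_apply, zeta_apply_ne hp2]
  have := hg p.1; have := hh p.2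
  push_cast
  exact mul_le_mul (hg _) (hh _) (abs_nonneg _) ((abs_nonneg _).trans (hg _))


theorem af_sub (f g : ArithmeticFunction ℝ) (n : ℕ) : (f - g) n = f n - g n := rfl

open ArithmeticFunction ArithmeticFunction.Moebius ArithmeticFunction.zeta in
theorem VinoQ (c : ℝ) (hc0 : 1 < c) (hc : ∀ j : ℕ, c ≠ j) : ∃ σ : ℝ, σ > 0 ∧ σ ≤ 1 / 4 ∧ ∃ C : ℝ, C > 0 ∧ ∀ Q : ℕ, 4096 ≤ Q →
    ∀ x : ℝ, x ≠ 0 → 2 ^ (-c) ≤ |x| * (Q : ℝ) ^ c → |x| * (Q : ℝ) ^ c ≤ (Q : ℝ) ^ (4 : ℝ) →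
    ‖∑ k ∈ Finset.Ioc (Q / 2) Q, ((Λ k : ℝ) : ℂ) * e (x * (k : ℝ) ^ c)‖ ≤
      C * Q * (1 + Real.log Q) ^ 3 * √((|x| * (Q : ℝ) ^ c) ^ (-(1 / 2) : ℝ) + (Q : ℝ) ^ (-σ)) := by
  obtain ⟨σ₁, hσ₁, C₁, hC₁, k1⟩ := T1 c hc0 hc
  obtain ⟨σ₂, hσ₂, C₂, hC₂, k2⟩ := T2 c hc0 hc
  set σ := min (1 / 4) (min σ₁ σ₂) with hσ
  have s1 : σ ≤ 1 / 4 := min_le_left _ _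
  have s2 : σ ≤ σ₁ := (min_le_right _ _).trans (min_le_left _ _)
  have s3 : σ ≤ σ₂ := (min_le_right _ _).trans (min_le_right _ _)
  have s0 : 0 < σ := lt_min (by norm_num) (lt_min hσ₁ hσ₂)
  refine ⟨σ, s0, s1, 3 * C₁ * √(2 ^ (c / 2) + 1) + 4 * C₂, by positivity, ?_⟩
  intro Q hQ x hx hT1 hT
  have hQ' : (4096 : ℝ) ≤ Q := by exact_mod_cast hQ
  have hQ1 : (1 : ℝ) ≤ Q := by linarith only [hQ']
  have hl0 : 0 ≤ Real.log Q := Real.log_nonneg hQ1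
  set TT := |x| * (Q : ℝ) ^ c with hTT
  have hTp : 0 < TT := by positivity
  set u := Nat.sqrt (Nat.sqrt Q) with hu
  have hu4 : (u * u) * (u * u) ≤ Q := by
    calc (u * u) * (u * u) ≤ Nat.sqrt Q * Nat.sqrt Q := Nat.mul_le_mul (Nat.sqrt_le _) (Nat.sqrt_le _)
      _ ≤ Q := Nat.sqrt_le _
  have hu8 : 8 ≤ u := by
    rw [hu, Nat.le_sqrt]; rw [Nat.le_sqrt]; omega
  have hu' : (8 : ℝ) ≤ u := by exact_mod_cast hu8
  have huQ : (Q : ℝ) ^ (1 / 4 : ℝ) ≤ 2 * u := by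
    have h1 : Q < (Nat.sqrt Q + 1) * (Nat.sqrt Q + 1) := Nat.lt_succ_sqrt Q
    have h2 : Nat.sqrt Q + 1 ≤ (u + 1) * (u + 1) := Nat.lt_succ_sqrt _
    have h3 : (Q : ℝ) ≤ (2 * u) ^ (4 : ℝ) := by
      have : Q ≤ ((u + 1) * (u + 1)) * ((u + 1) * (u + 1)) := h1.le.trans (Nat.mul_le_mul h2 h2)
      have h4 : (Q : ℝ) ≤ ((u + 1) * (u + 1)) * ((u + 1) * (u + 1)) := by exact_mod_cast this
      calc (Q : ℝ) ≤ ((u + 1) * (u + 1)) * ((u + 1) * (u + 1)) := h4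
        _ = (u + 1) ^ 4 := by ring
        _ ≤ (2 * u) ^ 4 := by gcongr; linarith only [hu']
        _ = _ := by norm_num
    calc (Q : ℝ) ^ (1 / 4 : ℝ) ≤ ((2 * u) ^ (4 : ℝ)) ^ (1 / 4 : ℝ) := by gcongr
      _ = _ := by rw [← Real.rpow_mul (by positivity)]; norm_num
  set E := TT ^ (-(1 / 2) : ℝ) + (Q : ℝ) ^ (-σ) with hE
  have hE0 : 0 < E := by positivity
  have mono : ∀ s, σ ≤ s → (Q : ℝ) ^ (-s) ≤ (Q : ℝ) ^ (-σ) := fun s hs =>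
    Real.rpow_le_rpow_of_exponent_le hQ1 (by linarith only [hs])
  have hEK : E ≤ √(2 ^ (c / 2) + 1) * √E := by
    have : E ≤ 2 ^ (c / 2) + 1 := by
      have a1 : TT ^ (-(1 / 2) : ℝ) ≤ (2 ^ (-c)) ^ (-(1 / 2) : ℝ) :=
        Real.rpow_le_rpow_of_nonpos (by positivity) hT1 (by norm_num)
      rw [← Real.rpow_mul (by norm_num)] at a1
      have a2 : (Q : ℝ) ^ (-σ) ≤ 1 := Real.rpow_le_one_of_one_le_of_nonpos hQ1 (by linarith only [s0])
      rw [show -c * -(1 / 2) = c / 2 by ring] at a1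
      linarith only [a1, a2]
    calc E = √E * √E := (Real.mul_self_sqrt hE0.le).symm
      _ ≤ _ := by gcongr
  have hlQ : Real.log (Q + 1) ≤ 2 * (1 + Real.log Q) := by
    have : Real.log (Q + 1) ≤ Real.log (Q * Q) := Real.log_le_log (by linarith only []) (by nlinarith only [hQ'])
    rw [Real.log_mul (by linarith only [hQ']) (by linarith only [hQ'])] at this; linarith only [this]
  have hlog2 : (Nat.log 2 Q : ℝ) + 1 ≤ 2 * (1 + Real.log Q) := by
    have : ((2 ^ Nat.log 2 Q : ℕ) : ℝ) ≤ Q := by exact_mod_cast Nat.pow_log_le_self 2 (by omega)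
    have := Real.log_le_log (by positivity) this
    push_cast at this
    rw [Real.log_pow] at this
    have := Real.log_two_gt_d9
    have h0 : (0 : ℝ) ≤ Nat.log 2 Q := by positivity
    nlinarith
  have hμ : ∀ n, |(μ : ArithmeticFunction ℝ) n| ≤ 1 := by
    intro n; have := @abs_moebius_le_one n; rw [intCoe_apply]; exact_mod_cast this
  have hcμ : ∀ n, |cut u (μ : ArithmeticFunction ℝ) n| ≤ 1 := by
    intro n; rw [cut_apply]; split_ifs
    · exact hμ n
    · simp
  have hcΛ : ∀ n, |cut u Λ n| ≤ Λ n := by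
    intro n; rw [cut_apply]; split_ifs
    · rw [abs_of_nonneg vonMangoldt_nonneg]
    · simp
  have hlogle : ∀ n ≤ Q, Real.log n ≤ 1 + Real.log Q := by
    intro n hn
    rcases Nat.eq_zero_or_pos n with h | h
    · rw [h]; simp; linarith only [hl0]
    · have := Real.log_le_log (by exact_mod_cast h) (by exact_mod_cast hn : (n : ℝ) ≤ Q); linarith only [this]
  -- type I
  have b1 := k1 Q (by omega) x hx hT (cut u (μ : ArithmeticFunction ℝ)) log 1 (2 * (1 + Real.log Q)) (by positivity)
    (fun m _ => hcμ m)
    (fun m hm => by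
      rw [cut_apply, if_neg]; intro h
      have : m * m ≤ (u * u) * (u * u) := by
        calc m * m ≤ u * u := Nat.mul_le_mul h h
          _ ≤ (u * u) * (u * u) := Nat.le_mul_of_pos_left _ (by positivity)
      omega)
    (fun n hn => ⟨by rw [log_apply]; exact Real.log_natCast_nonneg n, by
      rw [log_apply]
      rcases Nat.eq_zero_or_pos n with h | h
      · rw [h]; simp; linarith only [hl0]
      · exact (Real.log_le_log (by exact_mod_cast h) (by exact_mod_cast hn : (n : ℝ) ≤ ((Q + 1 : ℕ) : ℝ))).trans
          (by push_cast; exact hlQ)⟩)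
    (fun n hn => by
      rw [log_apply, log_apply]; exact Real.log_le_log (by exact_mod_cast hn) (by push_cast; linarith only []))
  have b2 := k1 Q (by omega) x hx hT (cut u (μ : ArithmeticFunction ℝ) * cut u Λ) (ζ : ArithmeticFunction ℝ) (1 + Real.log Q) 1
    (by norm_num)
    (fun m hm => by rw [mul_comm]; exact (vonM_sum _ hcΛ _ hcμ m).trans (hlogle m hm))
    (fun m hm => by
      rw [mul_apply]
      refine Finset.sum_eq_zero fun p hp => ?_
      rw [cut_apply, cut_apply]
      by_cases h1 : p.1 ≤ u
      · by_cases h2 : p.2 ≤ u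
        · exfalso
          have := (Nat.mem_divisorsAntidiagonal.1 hp).1
          have h3 : m ≤ u * u := by rw [← this]; exact Nat.mul_le_mul h1 h2
          have := Nat.mul_le_mul h3 h3
          omega
        · rw [if_neg h2]; simp
      · rw [if_neg h1]; simp)
    (fun n hn => by rw [natCoe_apply, zeta_apply]; split_ifs <;> simp)
    (fun n hn => by rw [natCoe_apply, natCoe_apply, zeta_apply_ne (by omega), zeta_apply_ne (by omega)])
  have b3 := k2 Q u (by omega) (by omega) x hx hT ((Λ - cut u Λ) * (ζ : ArithmeticFunction ℝ))
    ((μ : ArithmeticFunction ℝ) - cut u (μ : ArithmeticFunction ℝ)) (1 + Real.log Q) (by positivity)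
    (fun m hm => (vonM_sum _ (fun d => by
      rw [af_sub, cut_apply]; split_ifs
      · simp
      · rw [sub_zero, abs_of_nonneg vonMangoldt_nonneg]) _ (fun d => by
        rw [natCoe_apply, zeta_apply]; split_ifs <;> simp) m).trans (hlogle m hm))
    (fun n hn => by
      rw [af_sub, cut_apply]; split_ifs
      · simp; linarith only [hl0]
      · rw [sub_zero]; exact (hμ n).trans (by linarith only [hl0]))
    (fun n hn => by
      rw [mul_apply]
      refine Finset.sum_eq_zero fun p hp => ?_
      have hp' := Nat.mem_divisorsAntidiagonal.1 hp
      have : p.1 ≤ n := Nat.le_of_dvd (by omega) ⟨p.2, hp'.1.symm⟩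
      rw [af_sub, cut_apply, if_pos (by omega)]; simp)
    (fun n hn => by rw [af_sub, cut_apply, if_pos hn]; simp)
  have hsplit : ∑ k ∈ Finset.Ioc (Q / 2) Q, ((Λ k : ℝ) : ℂ) * e (x * (k : ℝ) ^ c) =
      ∑ k ∈ Finset.Ioc (Q / 2) Q, (((cut u (μ : ArithmeticFunction ℝ) * log) k : ℝ) : ℂ) * e (x * (k : ℝ) ^ c)
      - ∑ k ∈ Finset.Ioc (Q / 2) Q, ((((cut u (μ : ArithmeticFunction ℝ) * cut u Λ) * (ζ : ArithmeticFunction ℝ)) k : ℝ) : ℂ) * e (x * (k : ℝ) ^ c)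
      + ∑ k ∈ Finset.Ioc (Q / 2) Q, ((((Λ - cut u Λ) * (ζ : ArithmeticFunction ℝ)) * ((μ : ArithmeticFunction ℝ) - cut u (μ : ArithmeticFunction ℝ))) k : ℂ) * e (x * (k : ℝ) ^ c) := by
    rw [← Finset.sum_sub_distrib, ← Finset.sum_add_distrib]
    refine Finset.sum_congr rfl fun k hk => ?_
    have hk' : ¬ k ≤ u := by
      rw [Finset.mem_Ioc] at hk
      have h1 : u * 8 ≤ u * u := Nat.mul_le_mul_left u hu8
      have h2 : (u * u) * 1 ≤ (u * u) * (u * u) := Nat.mul_le_mul_left _ (by omega)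
      omega
    have hv := congrArg (fun f : ArithmeticFunction ℝ => f k) (vaughan u)
    simp only [ArithmeticFunction.add_apply, af_sub] at hv
    rw [cut_apply, if_neg hk', zero_add] at hv
    rw [hv]; push_cast; ring
  rw [hsplit]
  refine (norm_add_le _ _).trans ?_
  refine (add_le_add (norm_sub_le _ _) le_rfl).trans ?_
  have hE1 : TT ^ (-(1 / 2) : ℝ) + (Q : ℝ) ^ (-σ₁) ≤ E := by have := mono σ₁ s2; rw [hE]; linarith only [this]
  have hE2 : √(1 / u + TT ^ (-(1 / 2) : ℝ) + (Q : ℝ) ^ (-σ₂)) ≤ 2 * √E := by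
    rw [show 2 * √E = √(4 * E) by rw [Real.sqrt_mul (by norm_num), show (4 : ℝ) = 2 ^ 2 by norm_num, Real.sqrt_sq (by norm_num)]]
    apply Real.sqrt_le_sqrt
    have := mono σ₂ s3
    have h1 := mono (1 / 4) s1
    have h2 : 1 / (u : ℝ) ≤ 2 * (Q : ℝ) ^ (-(1 / 4) : ℝ) := by
      rw [Real.rpow_neg (by linarith only []), ← div_eq_mul_inv, div_le_div_iff₀ (by linarith only [hu']) (by positivity)]; linarith only [huQ]
    have : 0 ≤ TT ^ (-(1 / 2) : ℝ) := by positivity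
    rw [hE]; linarith
  set l := 1 + Real.log Q with hl
  have hl1 : 1 ≤ l := by linarith only [hl0]
  set R := √(2 ^ (c / 2) + 1) with hR
  have hsE : 0 ≤ √E := Real.sqrt_nonneg _
  have f1 : C₁ * 1 * (2 * l) * l * Q * (TT ^ (-(1 / 2) : ℝ) + (Q : ℝ) ^ (-σ₁)) ≤ 2 * C₁ * R * Q * l ^ 3 * √E := by
    calc _ ≤ C₁ * 1 * (2 * l) * l * Q * (R * √E) := by gcongr; exact hE1.trans hEK
      _ = 2 * C₁ * R * Q * l ^ 2 * √E := by ring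
      _ ≤ _ := by gcongr <;> norm_num
  have f2 : C₁ * l * 1 * l * Q * (TT ^ (-(1 / 2) : ℝ) + (Q : ℝ) ^ (-σ₁)) ≤ C₁ * R * Q * l ^ 3 * √E := by
    calc _ ≤ C₁ * l * 1 * l * Q * (R * √E) := by gcongr; exact hE1.trans hEK
      _ = C₁ * R * Q * l ^ 2 * √E := by ring
      _ ≤ _ := by gcongr <;> norm_num
  have f3 : C₂ * l ^ 2 * Q * (Nat.log 2 Q + 1) * √(1 / u + TT ^ (-(1 / 2) : ℝ) + (Q : ℝ) ^ (-σ₂)) ≤ 4 * C₂ * Q * l ^ 3 * √E := by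
    calc _ ≤ C₂ * l ^ 2 * Q * (2 * l) * (2 * √E) := by gcongr
      _ = _ := by ring
  calc _ ≤ 2 * C₁ * R * Q * l ^ 3 * √E + C₁ * R * Q * l ^ 3 * √E + 4 * C₂ * Q * l ^ 3 * √E :=
        add_le_add (add_le_add (b1.trans f1) (b2.trans f2)) (b3.trans f3)
    _ = _ := by ring

open ArithmeticFunction in
theorem S_psi (X c x : ℝ) (hX : 2 ≤ X) : ‖∑ k ∈ Finset.Ioc (⌊X⌋₊ / 2) ⌊X⌋₊, ((Λ k : ℝ) : ℂ) * e (x * (k : ℝ) ^ c) - S X c x‖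
    ≤ 2 * √X * Real.log X := by
  have hset : (Finset.range (⌈X⌉₊ + 1)).filter (fun p : ℕ => p.Prime ∧ X / 2 < (p : ℝ) ∧ (p : ℝ) ≤ X) =
      (Finset.Ioc (⌊X⌋₊ / 2) ⌊X⌋₊).filter Nat.Prime := by
    ext p
    rw [Finset.mem_filter, Finset.mem_filter, Finset.mem_range, Finset.mem_Ioc, Nat.le_floor_iff (by linarith)]
    have h1 : X / 2 < p ↔ ⌊X⌋₊ / 2 < p := by
      rw [show X / 2 < p ↔ X < ((2 * p : ℕ) : ℝ) by push_cast; constructor <;> intro <;> linarith,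
        ← Nat.floor_lt (by linarith)]; omega
    rw [h1]
    constructor
    · rintro ⟨-, a, b, c⟩; exact ⟨⟨b, c⟩, a⟩
    · rintro ⟨⟨b, c⟩, a⟩
      refine ⟨?_, a, b, c⟩
      have : (p : ℝ) ≤ ⌈X⌉₊ := c.trans (Nat.le_ceil X)
      have : p ≤ ⌈X⌉₊ := by exact_mod_cast this
      omega
  have hS : S X c x = ∑ k ∈ (Finset.Ioc (⌊X⌋₊ / 2) ⌊X⌋₊).filter Nat.Prime, ((Λ k : ℝ) : ℂ) * e (x * (k : ℝ) ^ c) := by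
    rw [S, hset]
    refine Finset.sum_congr rfl fun p hp => ?_
    rw [vonMangoldt_apply_prime (Finset.mem_filter.1 hp).2, mul_comm x]
  rw [hS, ← Finset.sum_filter_add_sum_filter_not _ Nat.Prime, add_sub_cancel_left]
  refine (norm_sum_le _ _).trans ?_
  refine le_trans ?_ (Chebyshev.psi_sub_theta_le (by linarith : 1 ≤ X))
  rw [Chebyshev.psi_sub_theta_eq_sum_not_prime]
  calc _ ≤ ∑ k ∈ (Finset.Ioc (⌊X⌋₊ / 2) ⌊X⌋₊).filter (fun p => ¬ Nat.Prime p), Λ k := by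
        refine Finset.sum_le_sum fun k _ => ?_
        rw [norm_mul, e_norm, mul_one, Complex.norm_real, Real.norm_of_nonneg vonMangoldt_nonneg]
    _ ≤ _ := by
        refine Finset.sum_le_sum_of_subset_of_nonneg ?_ fun _ _ _ => vonMangoldt_nonneg
        refine Finset.filter_subset_filter _ (Finset.Ioc_subset_Ioc (Nat.zero_le _) le_rfl)

/-- Vinogradov-type bound for `S` -/
theorem Vino (c : ℝ) (hc0 : 1 < c) (hc : ∀ j : ℕ, c ≠ j) : ∃ σ : ℝ, σ > 0 ∧ ∃ C : ℝ, C > 0 ∧ ∃ X₀ : ℝ, X₀ ≥ 1 ∧ ∀ X : ℝ, X₀ ≤ X →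
    ∀ x : ℝ, 1 ≤ |x| * X ^ c → |x| * X ^ c ≤ X ^ (7 / 2 : ℝ) →
    ‖S X c x‖ ≤ C * X * (1 + Real.log X) ^ 3 * ((|x| * X ^ c) ^ (-(1 / 4) : ℝ) + X ^ (-σ)) := by
  obtain ⟨σ, hσ, hσ4, C, hC, key⟩ := VinoQ c hc0 hc
  refine ⟨σ / 2, by linarith, C * (2 ^ (c / 4) + 2) + 2, by positivity, 8192, by norm_num, ?_⟩
  intro X hX x hT1 hT
  have hX0 : 0 < X := by linarith
  have hx : x ≠ 0 := by rintro rfl; simp at hT1; linarith only [hT1]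
  set Q := ⌊X⌋₊ with hQ
  have hQX : (Q : ℝ) ≤ X := Nat.floor_le hX0.le
  have hXQ : X / 2 ≤ Q := by have := Nat.lt_floor_add_one X; linarith only [hX, this]
  have hQ1 : 4096 ≤ Q := by rw [hQ]; exact Nat.le_floor (by norm_num; linarith only [hX])
  have hQr : (4096 : ℝ) ≤ Q := by exact_mod_cast hQ1
  have hl : Real.log Q ≤ Real.log X := Real.log_le_log (by linarith only [hX, hXQ]) hQX
  have hl0 : 0 ≤ Real.log Q := Real.log_nonneg (by linarith only [hX, hXQ])
  have hTQ : 2 ^ (-c) * (|x| * X ^ c) ≤ |x| * (Q : ℝ) ^ c := by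
    have : (X / 2) ^ c ≤ (Q : ℝ) ^ c := by gcongr
    rw [Real.div_rpow hX0.le (by norm_num)] at this
    rw [Real.rpow_neg (by norm_num)]
    calc _ = |x| * (X ^ c / 2 ^ c) := by ring
      _ ≤ _ := by gcongr
  have h2c : 0 < (2 : ℝ) ^ (-c) := by positivity
  have k1 := key Q hQ1 x hx (by nlinarith only [hTQ, hT1, h2c]) (by
    calc |x| * (Q : ℝ) ^ c ≤ |x| * X ^ c := by gcongr
      _ ≤ X ^ (7 / 2 : ℝ) := hT
      _ ≤ (2 * Q) ^ (7 / 2 : ℝ) := by gcongr; linarith only [hXQ]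
      _ = 2 ^ (7 / 2 : ℝ) * (Q : ℝ) ^ (7 / 2 : ℝ) := Real.mul_rpow (by norm_num) (by positivity)
      _ ≤ (Q : ℝ) ^ (1 / 2 : ℝ) * (Q : ℝ) ^ (7 / 2 : ℝ) := by
          gcongr
          calc (2 : ℝ) ^ (7 / 2 : ℝ) = (2 ^ (7 : ℝ)) ^ (1 / 2 : ℝ) := by rw [← Real.rpow_mul (by norm_num)]; norm_num
            _ ≤ (Q : ℝ) ^ (1 / 2 : ℝ) := by gcongr; norm_num; linarith only [hQ1]
      _ = _ := by rw [← Real.rpow_add (by linarith)]; norm_num)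
  have k2 := S_psi X c x (by linarith only [hX])
  rw [norm_sub_rev] at k2
  have k3 : ‖S X c x‖ ≤ C * X * (1 + Real.log X) ^ 3 * √((|x| * (Q : ℝ) ^ c) ^ (-(1 / 2) : ℝ) + (Q : ℝ) ^ (-σ)) + 2 * √X * Real.log X := by
    have := norm_le_norm_add_norm_sub' (S X c x) (∑ k ∈ Finset.Ioc (Q / 2) Q, ((ArithmeticFunction.vonMangoldt k : ℝ) : ℂ) * e (x * (k : ℝ) ^ c))
    refine this.trans (add_le_add (k1.trans ?_) k2)
    gcongr
  set T := |x| * X ^ c with hTd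
  have hTp : 0 < T := by linarith only [hT1]
  have g1 : √((|x| * (Q : ℝ) ^ c) ^ (-(1 / 2) : ℝ) + (Q : ℝ) ^ (-σ)) ≤ 2 ^ (c / 4) * T ^ (-(1 / 4) : ℝ) + 2 * X ^ (-(σ / 2)) := by
    have a1 : (|x| * (Q : ℝ) ^ c) ^ (-(1 / 2) : ℝ) ≤ (2 ^ (c / 4) * T ^ (-(1 / 4) : ℝ)) ^ 2 := by
      refine (Real.rpow_le_rpow_of_nonpos (by positivity) hTQ (by norm_num)).trans (le_of_eq ?_)
      rw [Real.mul_rpow (by positivity) (by positivity), mul_pow, ← Real.rpow_natCast, ← Real.rpow_natCast,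
        ← Real.rpow_mul (by positivity), ← Real.rpow_mul (by positivity), ← Real.rpow_mul (by positivity)]
      congr 2 <;> push_cast <;> ring
    have a2 : (Q : ℝ) ^ (-σ) ≤ (2 * X ^ (-(σ / 2))) ^ 2 := by
      calc (Q : ℝ) ^ (-σ) ≤ (X / 2) ^ (-σ) := Real.rpow_le_rpow_of_nonpos (by positivity) hXQ (by linarith only [hσ])
        _ = 2 ^ σ * X ^ (-σ) := by
            rw [Real.div_rpow hX0.le (by norm_num), Real.rpow_neg (by norm_num : (0:ℝ) ≤ 2)]; field_simp
        _ ≤ 2 ^ (2 : ℝ) * X ^ (-σ) := by gcongr <;> linarith only [hσ4]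
        _ = _ := by rw [mul_pow, ← Real.rpow_natCast (X ^ _), ← Real.rpow_mul hX0.le]; norm_num
    have p1 : 0 ≤ 2 ^ (c / 4) * T ^ (-(1 / 4) : ℝ) := by positivity
    have p2 : 0 ≤ 2 * X ^ (-(σ / 2)) := by positivity
    apply Real.sqrt_le_iff.2 ⟨by positivity, ?_⟩
    nlinarith only [a1, a2, mul_nonneg p1 p2]
  have hlX : 0 ≤ Real.log X := by linarith only [hl, hl0]
  have g2 : 2 * √X * Real.log X ≤ 2 * X * (1 + Real.log X) ^ 3 * X ^ (-(σ / 2)) := by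
    have a1 : √X ≤ X * X ^ (-(σ / 2)) := by
      rw [Real.sqrt_eq_rpow]
      calc X ^ (1 / 2 : ℝ) ≤ X ^ (1 + -(σ / 2)) := Real.rpow_le_rpow_of_exponent_le (by linarith only [hX]) (by linarith only [hσ4])
        _ = _ := by rw [Real.rpow_add hX0, Real.rpow_one]
    have a2 : Real.log X ≤ (1 + Real.log X) ^ 3 := by
      calc Real.log X ≤ 1 + Real.log X := by linarith only []
        _ = (1 + Real.log X) ^ 1 := by ring
        _ ≤ _ := by gcongr <;> [linarith only [hl, hl0]; norm_num]
    calc _ ≤ 2 * (X * X ^ (-(σ / 2))) * (1 + Real.log X) ^ 3 := by gcongr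
      _ = _ := by ring
  set P := X * (1 + Real.log X) ^ 3
  set U := T ^ (-(1 / 4) : ℝ)
  set W := X ^ (-(σ / 2))
  have hU : 0 ≤ U := by positivity
  have hW : 0 ≤ W := by positivity
  have hP : 0 ≤ P := by positivity
  have f1 : C * X * (1 + Real.log X) ^ 3 * √((|x| * (Q : ℝ) ^ c) ^ (-(1 / 2) : ℝ) + (Q : ℝ) ^ (-σ)) ≤ C * P * (2 ^ (c / 4) * U + 2 * W) := by
    calc _ = C * P * √((|x| * (Q : ℝ) ^ c) ^ (-(1 / 2) : ℝ) + (Q : ℝ) ^ (-σ)) := by ring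
      _ ≤ _ := by gcongr
  have f2 : (C * (2 ^ (c / 4) + 2) + 2) * X * (1 + Real.log X) ^ 3 * (U + W) - (C * P * (2 ^ (c / 4) * U + 2 * W) + 2 * P * W) =
     P * (C * 2 * U + C * 2 ^ (c / 4) * W + 2 * U) := by ring
  have f3 : 0 ≤ P * (C * 2 * U + C * 2 ^ (c / 4) * W + 2 * U) := by positivity
  have f4 : 2 * X * (1 + Real.log X) ^ 3 * W = 2 * P * W := by ring
  linarith only [k3, g2, f1, f3]


theorem cont_es {ι : Type*} (A : Finset ι) (μ : ι → ℝ) (z : ι → ℂ) : Continuous fun t : ℝ => ∑ i ∈ A, z i * e (t * μ i) :=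
  continuous_finsetSum _ fun i _ => continuous_const.mul (e_cont.comp (by fun_prop))

theorem MJ_id {ι : Type*} (A : Finset ι) (μ : ι → ℝ) (z : ι → ℂ) (T : ℝ) :
    (((∫ t in (0:ℝ)..T, ∫ s in (0:ℝ)..T, ‖∑ i ∈ A, z i * e ((s - t) * μ i)‖ ^ 2) : ℝ) : ℂ) =
      ∑ i ∈ A, ∑ j ∈ A, z i * starRingEnd ℂ (z j) * ((‖∫ s in (0:ℝ)..T, e (s * (μ i - μ j))‖ ^ 2 : ℝ) : ℂ) := by
  have h1 : ∀ t s : ℝ, ((‖∑ i ∈ A, z i * e ((s - t) * μ i)‖ ^ 2 : ℝ) : ℂ) =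
      ∑ i ∈ A, ∑ j ∈ A, z i * starRingEnd ℂ (z j) * (e (-(t * (μ i - μ j))) * e (s * (μ i - μ j))) := by
    intro t s
    push_cast
    rw [← Complex.mul_conj', map_sum, Finset.sum_mul_sum]
    refine Finset.sum_congr rfl fun i _ => Finset.sum_congr rfl fun j _ => ?_
    rw [map_mul, ← e_neg, ← e_add, show -(t * (μ i - μ j)) + s * (μ i - μ j) = (s - t) * μ i + -((s - t) * μ j) by ring, e_add]; ring
  have hi : ∀ (f : ℝ → ℂ) (a b : ℝ), Continuous f → IntervalIntegrable f volume a b := fun f a b h => h.intervalIntegrable a b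
  have h2 : ∀ t : ℝ, ∫ s in (0:ℝ)..T, ((‖∑ i ∈ A, z i * e ((s - t) * μ i)‖ ^ 2 : ℝ) : ℂ) =
      ∑ i ∈ A, ∑ j ∈ A, z i * starRingEnd ℂ (z j) * (e (-(t * (μ i - μ j))) * ∫ s in (0:ℝ)..T, e (s * (μ i - μ j))) := by
    intro t
    simp_rw [h1]
    have hc : ∀ i j, Continuous fun s : ℝ => z i * starRingEnd ℂ (z j) * (e (-(t * (μ i - μ j))) * e (s * (μ i - μ j))) := fun i j =>
      continuous_const.mul (continuous_const.mul (e_cont.comp (by fun_prop)))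
    rw [intervalIntegral.integral_finsetSum fun i _ => hi _ _ _ (continuous_finsetSum _ fun j _ => hc i j)]
    refine Finset.sum_congr rfl fun i _ => ?_
    rw [intervalIntegral.integral_finsetSum fun j _ => hi _ _ _ (hc i j)]
    refine Finset.sum_congr rfl fun j _ => ?_
    rw [intervalIntegral.integral_const_mul, intervalIntegral.integral_const_mul]
  rw [← intervalIntegral.integral_ofReal]
  simp_rw [← intervalIntegral.integral_ofReal]
  simp_rw [h2]
  have hc : ∀ i j, Continuous fun t : ℝ => z i * starRingEnd ℂ (z j) * (e (-(t * (μ i - μ j))) * ∫ s in (0:ℝ)..T, e (s * (μ i - μ j))) := fun i j =>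
    continuous_const.mul ((e_cont.comp (by fun_prop)).mul continuous_const)
  rw [intervalIntegral.integral_finsetSum fun i _ => hi _ _ _ (continuous_finsetSum _ fun j _ => hc i j)]
  refine Finset.sum_congr rfl fun i _ => ?_
  rw [intervalIntegral.integral_finsetSum fun j _ => hi _ _ _ (hc i j)]
  refine Finset.sum_congr rfl fun j _ => ?_
  rw [intervalIntegral.integral_const_mul, intervalIntegral.integral_mul_const]
  congr 1
  simp_rw [e_neg]
  push_cast
  rw [← Complex.conj_mul']
  congr 1
  simp only [intervalIntegral, ← integral_conj, map_sub]

theorem inner_c (h : ℝ → ℝ) (hh : Continuous h) (T : ℝ) : Continuous fun t : ℝ => ∫ s in (0 - t)..(2 * T - t), h s := by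
  have hi : ∀ a b, IntervalIntegrable h volume a b := fun a b => hh.intervalIntegrable a b
  have : (fun t : ℝ => ∫ s in (0 - t)..(2 * T - t), h s) = fun t => (∫ s in (0:ℝ)..(2 * T - t), h s) - ∫ s in (0:ℝ)..(0 - t), h s := by
    ext t; rw [intervalIntegral.integral_interval_sub_left (hi _ _) (hi _ _)]
  rw [this]
  have hd : Continuous fun x : ℝ => ∫ s in (0:ℝ)..x, h s := intervalIntegral.continuous_primitive hi 0
  exact (hd.comp (by fun_prop)).sub (hd.comp (by fun_prop))

theorem MJ_lo {ι : Type*} (A : Finset ι) (μ : ι → ℝ) (z : ι → ℂ) (w : ι → ℝ) (hz : ∀ i ∈ A, ‖z i‖ ≤ w i) (T t₀ : ℝ) (hT : 0 < T) :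
    T * ∫ t in t₀..(t₀ + T), ‖∑ i ∈ A, z i * e (t * μ i)‖ ^ 2 ≤
      ∑ i ∈ A, ∑ j ∈ A, w i * w j * ‖∫ s in (0:ℝ)..(2 * T), e (s * (μ i - μ j))‖ ^ 2 := by
  set z' : ι → ℂ := fun i => z i * e ((t₀ + T / 2) * μ i) with hz'
  set g : ℝ → ℝ := fun t => ‖∑ i ∈ A, z' i * e (t * μ i)‖ ^ 2 with hg
  have gc : Continuous g := (cont_es A μ z').norm.pow 2
  have hzn : ∀ i ∈ A, ‖z' i‖ ≤ w i := fun i hi => by rw [hz', norm_mul, e_norm, mul_one]; exact hz i hi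
  have sh : ∀ (h : ℝ → ℝ) (t : ℝ), ∫ s in (0:ℝ)..(2 * T), h (s - t) = ∫ s in (0 - t)..(2 * T - t), h s := fun h t =>
    intervalIntegral.integral_comp_sub_right h t
  have lo : T * ∫ s in (-(T / 2))..(T / 2), g s ≤ ∫ t in (0:ℝ)..(2 * T), ∫ s in (0 - t)..(2 * T - t), g s := by
    calc T * ∫ s in (-(T / 2))..(T / 2), g s = ∫ t in (T / 2)..(3 * T / 2), ∫ s in (-(T / 2))..(T / 2), g s := by
          rw [intervalIntegral.integral_const, smul_eq_mul]; ring
      _ ≤ ∫ t in (T / 2)..(3 * T / 2), ∫ s in (0 - t)..(2 * T - t), g s := by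
          refine intervalIntegral.integral_mono_on (by linarith) (continuous_const.intervalIntegrable _ _) ((inner_c g gc T).intervalIntegrable _ _) fun t ht => ?_
          refine intervalIntegral.integral_mono_interval (by linarith [ht.1]) (by linarith) (by linarith [ht.2]) ?_ (gc.intervalIntegrable _ _)
          exact Filter.Eventually.of_forall fun x => by positivity
      _ ≤ _ := by
          refine intervalIntegral.integral_mono_interval (by linarith) (by linarith) (by linarith) ?_ ((inner_c g gc T).intervalIntegrable _ _)
          refine (ae_restrict_iff' measurableSet_Ioc).2 (Filter.Eventually.of_forall fun t ht => ?_)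
          exact intervalIntegral.integral_nonneg (by linarith) fun x _ => by positivity
  have e1 : ∫ t in t₀..(t₀ + T), ‖∑ i ∈ A, z i * e (t * μ i)‖ ^ 2 = ∫ s in (-(T / 2))..(T / 2), g s := by
    have : ∀ s, g s = (fun t => ‖∑ i ∈ A, z i * e (t * μ i)‖ ^ 2) (s + (t₀ + T / 2)) := by
      intro s; simp only [hg, hz']; congr 2
      refine Finset.sum_congr rfl fun i _ => ?_
      rw [add_mul s, e_add]; ring
    simp_rw [this]
    rw [intervalIntegral.integral_comp_add_right (fun t => ‖∑ i ∈ A, z i * e (t * μ i)‖ ^ 2)]; congr 1 <;> ring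
  rw [e1]
  refine lo.trans ?_
  have i1 := MJ_id A μ z' (2 * T)
  simp_rw [← sh]
  refine (le_abs_self _).trans ?_
  rw [← Real.norm_eq_abs, ← Complex.norm_real, i1]
  refine (norm_sum_le _ _).trans (Finset.sum_le_sum fun i hi => (norm_sum_le _ _).trans (Finset.sum_le_sum fun j hj => ?_))
  rw [norm_mul, norm_mul, RCLike.norm_conj, Complex.norm_real, Real.norm_of_nonneg (by positivity)]
  have := hzn i hi
  have := hzn j hj
  have := (norm_nonneg _).trans (hzn i hi)
  gcongr

theorem MJ2 {ι : Type*} (A : Finset ι) (μ : ι → ℝ) (z : ι → ℂ) (w : ι → ℝ) (hz : ∀ i ∈ A, ‖z i‖ ≤ w i) (T t₀ : ℝ) (hT : 0 < T) :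
    ∫ t in t₀..(t₀ + T), ‖∑ i ∈ A, z i * e (t * μ i)‖ ^ 2 ≤ 2 * ∫ t in (-(2 * T))..(2 * T), ‖∑ i ∈ A, (w i : ℂ) * e (t * μ i)‖ ^ 2 := by
  set f : ℝ → ℝ := fun t => ‖∑ i ∈ A, (w i : ℂ) * e (t * μ i)‖ ^ 2 with hf
  have fc : Continuous f := (cont_es A μ fun i => (w i : ℂ)).norm.pow 2
  have sh : ∀ (h : ℝ → ℝ) (t : ℝ), ∫ s in (0:ℝ)..(2 * T), h (s - t) = ∫ s in (0 - t)..(2 * T - t), h s := fun h t =>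
    intervalIntegral.integral_comp_sub_right h t
  have up : ∫ t in (0:ℝ)..(2 * T), ∫ s in (0 - t)..(2 * T - t), f s ≤ 2 * T * ∫ s in (-(2 * T))..(2 * T), f s := by
    have := intervalIntegral.integral_mono_on (by linarith : (0:ℝ) ≤ 2 * T) ((inner_c f fc T).intervalIntegrable 0 (2 * T))
      (continuous_const.intervalIntegrable (μ := volume) 0 (2 * T)) (g := fun _ => ∫ s in (-(2 * T))..(2 * T), f s) (fun t ht => by
        refine intervalIntegral.integral_mono_interval (by linarith [ht.2]) (by linarith) (by linarith [ht.1]) ?_ (fc.intervalIntegrable _ _)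
        exact Filter.Eventually.of_forall fun x => by positivity)
    rwa [intervalIntegral.integral_const, smul_eq_mul, sub_zero] at this
  have i2 := MJ_id A μ (fun i => (w i : ℂ)) (2 * T)
  simp only [Complex.conj_ofReal] at i2
  have i3 : ∫ t in (0:ℝ)..(2 * T), ∫ s in (0:ℝ)..(2 * T), f (s - t) =
    ∑ i ∈ A, ∑ j ∈ A, w i * w j * ‖∫ s in (0:ℝ)..(2 * T), e (s * (μ i - μ j))‖ ^ 2 := by exact_mod_cast i2
  have lo := MJ_lo A μ z w hz T t₀ hT
  rw [← i3] at lo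
  simp_rw [sh] at lo
  refine le_of_mul_le_mul_left ((lo.trans up).trans (le_of_eq (by ring))) hT

theorem MJ4 (A : Finset ℕ) (μ : ℕ → ℝ) (z : ℕ → ℂ) (w : ℕ → ℝ) (hz : ∀ i ∈ A, ‖z i‖ ≤ w i) (T t₀ : ℝ) (hT : 0 < T) :
    ∫ t in t₀..(t₀ + T), ‖∑ i ∈ A, z i * e (t * μ i)‖ ^ 4 ≤ 2 * ∫ t in (-(2 * T))..(2 * T), ‖∑ i ∈ A, (w i : ℂ) * e (t * μ i)‖ ^ 4 := by
  have key : ∀ (y : ℕ → ℂ) (t : ℝ), ‖∑ i ∈ A, y i * e (t * μ i)‖ ^ 4 = ‖∑ p ∈ A ×ˢ A, (y p.1 * y p.2) * e (t * (μ p.1 + μ p.2))‖ ^ 2 := by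
    intro y t
    rw [show (4 : ℕ) = 2 * 2 by norm_num, pow_mul, ← norm_pow, sq (∑ i ∈ A, y i * e (t * μ i)), Finset.sum_mul_sum, Finset.sum_product]
    congr 2
    refine Finset.sum_congr rfl fun i _ => Finset.sum_congr rfl fun j _ => ?_
    rw [mul_add, e_add]; ring
  simp_rw [key]
  have := MJ2 (A ×ˢ A) (fun p => μ p.1 + μ p.2) (fun p => z p.1 * z p.2) (fun p => w p.1 * w p.2) (fun p hp => by
    have hp' := Finset.mem_product.1 hp
    rw [norm_mul]
    exact mul_le_mul (hz _ hp'.1) (hz _ hp'.2) (norm_nonneg _) ((norm_nonneg _).trans (hz _ hp'.1))) T t₀ hT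
  simpa using this

theorem e_int_le (l T : ℝ) (hl : l ≠ 0) : ‖∫ s in (0:ℝ)..T, e (s * l)‖ ≤ 1 / |l| := by
  have hd : ∀ s : ℝ, HasDerivAt (fun s => e (s * l) / (2 * Real.pi * Complex.I * l)) (e (s * l)) s := by
    intro s
    have h := ((e_hasDerivAt (s * l)).scomp s ((hasDerivAt_id s).mul_const l)).div_const (2 * Real.pi * Complex.I * l)
    have h3 : (2 * Real.pi * Complex.I * l : ℂ) ≠ 0 := by simp [hl, Real.pi_ne_zero]
    refine h.congr_deriv ?_
    rw [Complex.real_smul, one_mul, div_eq_iff h3]; ring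
  rw [intervalIntegral.integral_eq_sub_of_hasDerivAt (fun s _ => hd s) ((e_cont.comp (by fun_prop)).intervalIntegrable _ _)]
  refine (norm_sub_le _ _).trans ?_
  rw [norm_div, norm_div, e_norm, e_norm]
  have : ‖(2 * Real.pi * Complex.I * l : ℂ)‖ = 2 * Real.pi * |l| := by simp [Real.pi_pos.le]
  rw [this]
  have hp := Real.pi_gt_three
  have h0 : 0 < |l| := abs_pos.2 hl
  rw [← add_div, div_le_div_iff₀ (by positivity) h0]; nlinarith

theorem sum_sq (A : Finset ℕ) (n : ℕ) : ∑ m ∈ A, 1 / ((n : ℝ) - m) ^ 2 ≤ 4 := by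
  have hp : Real.pi ^ 2 / 6 ≤ 2 := by have := Real.pi_lt_d2; have := Real.pi_pos; nlinarith
  have key : ∀ (B : Finset ℕ) (g : ℕ → ℕ), Set.InjOn g B → ∑ m ∈ B, 1 / ((g m : ℕ) : ℝ) ^ 2 ≤ 2 := by
    intro B g hg
    rw [← Finset.sum_image (f := fun k : ℕ => 1 / (k : ℝ) ^ 2) hg]
    exact (sum_le_hasSum _ (fun i _ => by positivity) hasSum_zeta_two).trans hp
  rw [← Finset.sum_filter_add_sum_filter_not A (fun m => m ≤ n)]
  have a1 := key (A.filter (fun m => m ≤ n)) (fun m => n - m) (fun a ha b hb h => by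
    have := (Finset.mem_filter.1 ha).2; have := (Finset.mem_filter.1 hb).2; simp only at h; omega)
  have a2 := key (A.filter (fun m => ¬ m ≤ n)) (fun m => m - n) (fun a ha b hb h => by
    have := (Finset.mem_filter.1 ha).2; have := (Finset.mem_filter.1 hb).2; simp only at h; omega)
  have b1 : ∑ m ∈ A.filter (fun m => m ≤ n), 1 / ((n : ℝ) - m) ^ 2 = ∑ m ∈ A.filter (fun m => m ≤ n), 1 / ((n - m : ℕ) : ℝ) ^ 2 :=
    Finset.sum_congr rfl fun m hm => by rw [Nat.cast_sub (Finset.mem_filter.1 hm).2]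
  have b2 : ∑ m ∈ A.filter (fun m => ¬ m ≤ n), 1 / ((n : ℝ) - m) ^ 2 = ∑ m ∈ A.filter (fun m => ¬ m ≤ n), 1 / ((m - n : ℕ) : ℝ) ^ 2 :=
    Finset.sum_congr rfl fun m hm => by rw [Nat.cast_sub (by have := (Finset.mem_filter.1 hm).2; omega)]; congr 1; ring
  rw [b1, b2]; linarith only [a1, a2]

/-- mean square -/
theorem M2 (c : ℝ) (hc : 1 < c) (X W : ℝ) (hX : 0 < X) (hW : 0 ≤ W) (A : Finset ℕ) (hA : ∀ n ∈ A, X ≤ n) (z : ℕ → ℂ) (hz : ∀ n ∈ A, ‖z n‖ ≤ W) (t₀ : ℝ) :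
    ∫ t in t₀..(t₀ + X), ‖∑ n ∈ A, z n * e (t * ((n : ℝ) / X) ^ c)‖ ^ 2 ≤ 8 * W ^ 2 * A.card * X := by
  have h1 := MJ_lo A (fun n => ((n : ℝ) / X) ^ c) z (fun _ => W) hz X t₀ hX
  refine le_of_mul_le_mul_left (h1.trans ?_) hX
  have h2 : ∀ n ∈ A, ∑ m ∈ A, W * W * ‖∫ s in (0:ℝ)..(2 * X), e (s * (((n : ℝ) / X) ^ c - ((m : ℝ) / X) ^ c))‖ ^ 2 ≤ 8 * W ^ 2 * X ^ 2 := by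
    intro n hn
    have h3 : ∀ m ∈ A, W * W * ‖∫ s in (0:ℝ)..(2 * X), e (s * (((n : ℝ) / X) ^ c - ((m : ℝ) / X) ^ c))‖ ^ 2 ≤
        (if m = n then 4 * W ^ 2 * X ^ 2 else 0) + W ^ 2 * X ^ 2 * (1 / ((n : ℝ) - m) ^ 2) := by
      intro m hm
      split_ifs with h
      · have : ‖∫ s in (0:ℝ)..(2 * X), e (s * (((n : ℝ) / X) ^ c - ((m : ℝ) / X) ^ c))‖ ≤ 1 * |2 * X - 0| :=
          intervalIntegral.norm_integral_le_of_norm_le_const fun s _ => (e_norm _).le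
        rw [sub_zero, abs_of_pos (by linarith), one_mul] at this
        have h0 : 0 ≤ W ^ 2 * X ^ 2 * (1 / ((n : ℝ) - m) ^ 2) := by positivity
        calc _ ≤ W * W * (2 * X) ^ 2 := by gcongr
          _ ≤ _ := by linarith only [h0]
      · rw [zero_add]
        have hd := rpow_diff c hc 1 (n / X) (m / X) one_pos ((one_le_div hX).2 (hA n hn)) ((one_le_div hX).2 (hA m hm))
        rw [Real.one_rpow, mul_one, ← sub_div, abs_div, abs_of_pos hX] at hd
        have hnm : 0 < |(n : ℝ) - m| := abs_pos.2 (sub_ne_zero.2 (by exact_mod_cast (Ne.symm h)))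
        have hp : 0 < |(n : ℝ) - m| / X := by positivity
        have h4 := e_int_le (((n : ℝ) / X) ^ c - ((m : ℝ) / X) ^ c) (2 * X) (abs_pos.1 (hp.trans_le hd))
        calc _ ≤ W * W * (1 / (|(n : ℝ) - m| / X)) ^ 2 := by
              gcongr; exact h4.trans (one_div_le_one_div_of_le hp hd)
          _ = _ := by rw [← sq_abs ((n : ℝ) - m)]; field_simp
    refine (Finset.sum_le_sum h3).trans ?_
    rw [Finset.sum_add_distrib, Finset.sum_ite_eq' A n, if_pos hn, ← Finset.mul_sum]
    have := mul_le_mul_of_nonneg_left (sum_sq A n) (by positivity : 0 ≤ W ^ 2 * X ^ 2)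
    linarith
  refine (Finset.sum_le_sum h2).trans ?_
  rw [Finset.sum_const, nsmul_eq_mul]; apply le_of_eq; ring

/-- fourth moment property -/
def MM (c τ : ℝ) : Prop := ∀ B δ : ℝ, 1 ≤ B → 0 < δ → ∃ C : ℝ, C > 0 ∧ ∀ X T : ℝ, 1 ≤ X → 0 < T → T ≤ X ^ τ → ∀ A : Finset ℕ,
  (∀ n ∈ A, X ≤ n ∧ n ≤ B * X) → ∀ z : ℕ → ℂ, (∀ n ∈ A, ‖z n‖ ≤ 1) → ∀ t₀ : ℝ,
  ∫ t in t₀..(t₀ + T), ‖∑ n ∈ A, z n * e (t * ((n : ℝ) / X) ^ c)‖ ^ 4 ≤ C * X ^ (4 + δ)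

theorem card_le (A : Finset ℕ) (Y : ℝ) (hY : 1 ≤ Y) (h : ∀ n ∈ A, (n : ℝ) ≤ Y) : (A.card : ℝ) ≤ 2 * Y := by
  have : A ⊆ Finset.range (⌊Y⌋₊ + 1) := fun n hn => Finset.mem_range.2 (Nat.lt_succ_of_le (Nat.le_floor (h n hn)))
  have h1 := Finset.card_le_card this
  rw [Finset.card_range] at h1
  have h2 : (A.card : ℝ) ≤ ⌊Y⌋₊ + 1 := by exact_mod_cast h1
  have := Nat.floor_le (by linarith : 0 ≤ Y)
  linarith

theorem MM_one (c : ℝ) (hc : 1 < c) : MM c 1 := by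
  intro B δ hB hδ
  refine ⟨64 * B ^ 3, by positivity, fun X T hX hT0 hT A hA z hz t₀ => ?_⟩
  rw [Real.rpow_one] at hT
  have hX0 : 0 < X := by linarith
  have hcard : (A.card : ℝ) ≤ 2 * (B * X) := card_le A _ (by nlinarith only [hB, hX]) fun n hn => (hA n hn).2
  have hcs := cont_es A (fun n => ((n : ℝ) / X) ^ c) z
  have hF : ∀ t : ℝ, ‖∑ n ∈ A, z n * e (t * ((n : ℝ) / X) ^ c)‖ ≤ 2 * (B * X) := by
    intro t
    refine (norm_sum_le_of_le A (f := fun n => z n * e (t * ((n : ℝ) / X) ^ c)) (n := fun _ => 1) fun n hn => by rw [norm_mul, e_norm, mul_one]; exact hz n hn).trans ?_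
    simpa using hcard
  calc _ ≤ ∫ t in t₀..(t₀ + X), ‖∑ n ∈ A, z n * e (t * ((n : ℝ) / X) ^ c)‖ ^ 4 :=
        intervalIntegral.integral_mono_interval le_rfl (by linarith) (by linarith)
          (Filter.Eventually.of_forall fun x => by positivity) ((hcs.norm.pow 4).intervalIntegrable _ _)
    _ ≤ ∫ t in t₀..(t₀ + X), (2 * (B * X)) ^ 2 * ‖∑ n ∈ A, z n * e (t * ((n : ℝ) / X) ^ c)‖ ^ 2 := by
        refine intervalIntegral.integral_mono_on (by linarith) ((hcs.norm.pow 4).intervalIntegrable _ _)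
          ((continuous_const.mul (hcs.norm.pow 2)).intervalIntegrable _ _) fun t _ => ?_
        rw [show (4 : ℕ) = 2 + 2 by norm_num, pow_add]; gcongr; exact hF t
    _ ≤ (2 * (B * X)) ^ 2 * (8 * 1 ^ 2 * A.card * X) := by
        rw [intervalIntegral.integral_const_mul]; gcongr
        exact M2 c hc X 1 hX0 zero_le_one A (fun n hn => (hA n hn).1) z hz t₀
    _ ≤ (2 * (B * X)) ^ 2 * (8 * 1 ^ 2 * (2 * (B * X)) * X) := by gcongr
    _ = 64 * B ^ 3 * X ^ (4 : ℝ) := by norm_num; ring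
    _ ≤ _ := by gcongr; linarith


theorem e_comp {φ : ℝ → ℝ} {d v : ℝ} (h : HasDerivAt φ d v) : HasDerivAt (fun v => e (φ v)) (2 * Real.pi * Complex.I * ((d : ℂ) * e (φ v))) v :=
  ((e_hasDerivAt (φ v)).scomp v h).congr_deriv (by rw [Complex.real_smul]; ring)

theorem tpi_ne : (2 * Real.pi * Complex.I : ℂ) ≠ 0 := by simp [Real.pi_ne_zero]

theorem tpi_norm : ‖(2 * Real.pi * Complex.I : ℂ)‖ = 2 * Real.pi := by simp [Real.pi_pos.le]

/-- integration by parts against `φ' e(φ)` -/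
theorem IBP (φ φ1 : ℝ → ℝ) (F F1 : ℝ → ℂ) (x y : ℝ) (hxy : x ≤ y) (h1 : ∀ v ∈ Set.Icc x y, HasDerivAt φ (φ1 v) v)
    (h2 : ∀ v ∈ Set.Icc x y, HasDerivAt F (F1 v) v) (c1 : ContinuousOn φ1 (Set.Icc x y)) (c2 : ContinuousOn F1 (Set.Icc x y)) :
    2 * Real.pi * Complex.I * ∫ v in x..y, F v * ((φ1 v : ℂ) * e (φ v)) = F y * e (φ y) - F x * e (φ x) - ∫ v in x..y, F1 v * e (φ v) := by
  have hu : Set.uIcc x y = Set.Icc x y := Set.uIcc_of_le hxy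
  have ce : ContinuousOn (fun v => e (φ v)) (Set.Icc x y) := e_cont.comp_continuousOn fun v hv => (h1 v hv).continuousAt.continuousWithinAt
  have := intervalIntegral.integral_mul_deriv_eq_deriv_mul (a := x) (b := y) (u := F) (u' := F1) (v := fun v => e (φ v))
    (v' := fun v => 2 * Real.pi * Complex.I * ((φ1 v : ℂ) * e (φ v))) (fun v hv => h2 v (hu ▸ hv)) (fun v hv => e_comp (h1 v (hu ▸ hv)))
    (ContinuousOn.intervalIntegrable (hu ▸ c2)) (ContinuousOn.intervalIntegrable (hu ▸ continuousOn_const.mul ((Complex.continuous_ofReal.comp_continuousOn c1).mul ce)))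
  rw [← this, ← intervalIntegral.integral_const_mul]
  exact intervalIntegral.integral_congr fun v _ => by ring

theorem int_le (f : ℝ → ℂ) (x y M : ℝ) (hxy : x ≤ y) (h : ∀ v ∈ Set.Icc x y, ‖f v‖ ≤ M) : ‖∫ v in x..y, f v‖ ≤ M * (y - x) := by
  have := intervalIntegral.norm_integral_le_of_norm_le_const (a := x) (b := y) (f := f) (C := M) fun v hv => h v (by
    rw [Set.uIoc_of_le hxy] at hv; exact Set.Ioc_subset_Icc_self hv)
  rwa [abs_of_nonneg (by linarith)] at this

/-- non-stationary phase, two integrations by parts -/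
theorem NS2 (g g1 g2 φ φ1 φ2 φ3 : ℝ → ℝ) (x y M H Q : ℝ) (hxy : x ≤ y) (hM : 0 ≤ M) (hH : 0 ≤ H)
    (a0 : ∀ v ∈ Set.Icc x y, HasDerivAt φ (φ1 v) v) (a1 : ∀ v ∈ Set.Icc x y, HasDerivAt φ1 (φ2 v) v) (a2 : ∀ v ∈ Set.Icc x y, HasDerivAt φ2 (φ3 v) v)
    (a3 : ContinuousOn φ3 (Set.Icc x y))
    (b0 : ∀ v ∈ Set.Icc x y, HasDerivAt g (g1 v) v) (b1 : ∀ v ∈ Set.Icc x y, HasDerivAt g1 (g2 v) v) (b2 : ContinuousOn g2 (Set.Icc x y))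
    (z0 : g x = 0) (z1 : g y = 0) (z2 : g1 x = 0) (z3 : g1 y = 0)
    (hg : ∀ v ∈ Set.Icc x y, |g v| ≤ M ∧ |g1 v| ≤ M ∧ |g2 v| ≤ M) (hφ : ∀ v ∈ Set.Icc x y, 1 ≤ H * |φ1 v| ∧ H * |φ2 v| ≤ Q ∧ H * |φ3 v| ≤ Q) :
    ‖∫ v in x..y, (g v : ℂ) * e (φ v)‖ ≤ M * H ^ 2 * (1 + 4 * Q + 3 * Q ^ 2) * (y - x) := by
  have nz : ∀ v ∈ Set.Icc x y, φ1 v ≠ 0 := fun v hv h => by have := (hφ v hv).1; rw [h] at this; simp at this; linarith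
  have nzc : ∀ v ∈ Set.Icc x y, (φ1 v : ℂ) ≠ 0 := fun v hv => by exact_mod_cast nz v hv
  set G : ℝ → ℝ := fun v => g1 v / φ1 v - g v * φ2 v / φ1 v ^ 2 with hG
  set K : ℝ → ℝ := fun v => g2 v / φ1 v ^ 2 - 3 * g1 v * φ2 v / φ1 v ^ 3 - g v * φ3 v / φ1 v ^ 3 + 3 * g v * φ2 v ^ 2 / φ1 v ^ 4 with hK
  have d1 : ∀ v ∈ Set.Icc x y, HasDerivAt (fun v => ((g v / φ1 v : ℝ) : ℂ)) (G v : ℂ) v := fun v hv => by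
    refine (((b0 v hv).div (a1 v hv) (nz v hv)).congr_deriv ?_).ofReal_comp
    have := nz v hv; rw [hG]; field_simp
  have d2 : ∀ v ∈ Set.Icc x y, HasDerivAt (fun v => ((G v / φ1 v : ℝ) : ℂ)) (K v : ℂ) v := fun v hv => by
    have n := nz v hv
    refine (((((b1 v hv).div (a1 v hv) n).sub (((b0 v hv).mul (a2 v hv)).div ((a1 v hv).pow 2) (pow_ne_zero 2 n))).div (a1 v hv) n).congr_deriv ?_).ofReal_comp
    simp only [hK, Pi.div_apply, Pi.mul_apply, Pi.sub_apply, Pi.pow_apply]; field_simp; push_cast; ring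
  have cφ1 : ContinuousOn φ1 (Set.Icc x y) := fun v hv => (a1 v hv).continuousAt.continuousWithinAt
  have cφ2 : ContinuousOn φ2 (Set.Icc x y) := fun v hv => (a2 v hv).continuousAt.continuousWithinAt
  have cg : ContinuousOn g (Set.Icc x y) := fun v hv => (b0 v hv).continuousAt.continuousWithinAt
  have cg1 : ContinuousOn g1 (Set.Icc x y) := fun v hv => (b1 v hv).continuousAt.continuousWithinAt
  have cp : ∀ n : ℕ, ∀ v ∈ Set.Icc x y, φ1 v ^ n ≠ 0 := fun n v hv => pow_ne_zero n (nz v hv)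
  have cG : ContinuousOn (fun v => (G v : ℂ)) (Set.Icc x y) := Complex.continuous_ofReal.comp_continuousOn
    ((cg1.div cφ1 nz).sub ((cg.mul cφ2).div (cφ1.pow 2) (cp 2)))
  have cK : ContinuousOn (fun v => (K v : ℂ)) (Set.Icc x y) := Complex.continuous_ofReal.comp_continuousOn
    ((((b2.div (cφ1.pow 2) (cp 2)).sub (((continuousOn_const.mul cg1).mul cφ2).div (cφ1.pow 3) (cp 3))).sub ((cg.mul a3).div (cφ1.pow 3) (cp 3))).add
      (((continuousOn_const.mul cg).mul (cφ2.pow 2)).div (cφ1.pow 4) (cp 4)))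
  have i1 := IBP φ φ1 _ _ x y hxy a0 d1 cφ1 cG
  have i2 := IBP φ φ1 _ _ x y hxy a0 d2 cφ1 cK
  have e1 : ∫ v in x..y, ((g v / φ1 v : ℝ) : ℂ) * ((φ1 v : ℂ) * e (φ v)) = ∫ v in x..y, (g v : ℂ) * e (φ v) :=
    intervalIntegral.integral_congr fun v hv => by
      have := nzc v (Set.uIcc_of_le hxy ▸ hv); push_cast; field_simp
  have e2 : ∫ v in x..y, ((G v / φ1 v : ℝ) : ℂ) * ((φ1 v : ℂ) * e (φ v)) = ∫ v in x..y, (G v : ℂ) * e (φ v) :=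
    intervalIntegral.integral_congr fun v hv => by
      have := nzc v (Set.uIcc_of_le hxy ▸ hv); push_cast; field_simp
  have zG : ∀ v, g v = 0 → g1 v = 0 → G v = 0 := fun v h h' => by rw [hG]; simp [h, h']
  rw [e1] at i1; rw [e2] at i2
  rw [z0, z1] at i1; rw [zG x z0 z2, zG y z1 z3] at i2
  simp only [zero_div, Complex.ofReal_zero, zero_mul, sub_zero, zero_sub] at i1 i2
  have hb : ∀ v ∈ Set.Icc x y, ‖(K v : ℂ) * e (φ v)‖ ≤ M * H ^ 2 * (1 + 4 * Q + 3 * Q ^ 2) := by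
    intro v hv
    obtain ⟨m0, m1, m2⟩ := hg v hv
    obtain ⟨q1, q2, q3⟩ := hφ v hv
    have hi : |φ1 v|⁻¹ ≤ H := by rw [inv_le_iff_one_le_mul₀ (abs_pos.2 (nz v hv))]; exact q1
    have hQ : 0 ≤ Q := le_trans (by positivity) q2
    rw [norm_mul, e_norm, mul_one, Complex.norm_real, Real.norm_eq_abs]
    have t1 : |g2 v / φ1 v ^ 2| ≤ M * H ^ 2 := by rw [abs_div, abs_pow, div_eq_mul_inv, ← inv_pow]; gcongr
    have t2 : |3 * g1 v * φ2 v / φ1 v ^ 3| ≤ 3 * M * H ^ 2 * Q := by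
      rw [abs_div, abs_mul, abs_mul, abs_pow, div_eq_mul_inv, ← inv_pow, abs_of_pos (by norm_num : (0:ℝ) < 3)]
      calc 3 * |g1 v| * |φ2 v| * |φ1 v|⁻¹ ^ 3 ≤ 3 * M * |φ2 v| * H ^ 3 := by gcongr
        _ = 3 * M * H ^ 2 * (H * |φ2 v|) := by ring
        _ ≤ _ := by gcongr
    have t3 : |g v * φ3 v / φ1 v ^ 3| ≤ M * H ^ 2 * Q := by
      rw [abs_div, abs_mul, abs_pow, div_eq_mul_inv, ← inv_pow]
      calc |g v| * |φ3 v| * |φ1 v|⁻¹ ^ 3 ≤ M * |φ3 v| * H ^ 3 := by gcongr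
        _ = M * H ^ 2 * (H * |φ3 v|) := by ring
        _ ≤ _ := by gcongr
    have t4 : |3 * g v * φ2 v ^ 2 / φ1 v ^ 4| ≤ 3 * M * H ^ 2 * Q ^ 2 := by
      rw [abs_div, abs_mul, abs_mul, abs_pow, abs_pow, div_eq_mul_inv, ← inv_pow, abs_of_pos (by norm_num : (0:ℝ) < 3)]
      calc 3 * |g v| * |φ2 v| ^ 2 * |φ1 v|⁻¹ ^ 4 ≤ 3 * M * |φ2 v| ^ 2 * H ^ 4 := by gcongr
        _ = 3 * M * H ^ 2 * (H * |φ2 v|) ^ 2 := by ring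
        _ ≤ _ := by gcongr
    calc |K v| ≤ |g2 v / φ1 v ^ 2| + |3 * g1 v * φ2 v / φ1 v ^ 3| + |g v * φ3 v / φ1 v ^ 3| + |3 * g v * φ2 v ^ 2 / φ1 v ^ 4| :=
          (abs_add_le _ _).trans (add_le_add ((abs_sub _ _).trans (add_le_add (abs_sub _ _) le_rfl)) le_rfl)
      _ ≤ _ := by linarith only [t1, t2, t3, t4]
  have fin := int_le _ x y _ hxy hb
  have n1 := congrArg norm i1
  have n2 := congrArg norm i2
  rw [norm_mul, tpi_norm, norm_neg] at n1 n2
  have hp := Real.pi_gt_three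
  have p1 := norm_nonneg (∫ v in x..y, (g v : ℂ) * e (φ v))
  have p2 := norm_nonneg (∫ v in x..y, (G v : ℂ) * e (φ v))
  nlinarith only [fin, n1, n2, p2, hp, p1]

theorem FD (φ φ1 φ2 : ℝ → ℝ) (x y μ : ℝ) (hxy : x ≤ y) (hμ : 0 < μ)
    (a0 : ∀ v ∈ Set.Icc x y, HasDerivAt φ (φ1 v) v) (a1 : ∀ v ∈ Set.Icc x y, HasDerivAt φ1 (φ2 v) v) (a2 : ContinuousOn φ2 (Set.Icc x y))
    (p2 : ∀ v ∈ Set.Icc x y, 0 ≤ φ2 v) (hφ : ∀ v ∈ Set.Icc x y, μ ≤ |φ1 v|) : ‖∫ v in x..y, e (φ v)‖ ≤ 1 / μ := by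
  have nz : ∀ v ∈ Set.Icc x y, φ1 v ≠ 0 := fun v hv h => by have := hφ v hv; rw [h] at this; simp at this; linarith
  have cφ1 : ContinuousOn φ1 (Set.Icc x y) := fun v hv => (a1 v hv).continuousAt.continuousWithinAt
  have d0 : ∀ v ∈ Set.Icc x y, HasDerivAt (fun v => (φ1 v)⁻¹) (-φ2 v / φ1 v ^ 2) v := fun v hv => (a1 v hv).inv (nz v hv)
  have c0 : ContinuousOn (fun v => -φ2 v / φ1 v ^ 2) (Set.Icc x y) := a2.neg.div (cφ1.pow 2) fun v hv => pow_ne_zero 2 (nz v hv)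
  have i1 := IBP φ φ1 (fun v => (((φ1 v)⁻¹ : ℝ) : ℂ)) _ x y hxy a0 (fun v hv => (d0 v hv).ofReal_comp) cφ1 (Complex.continuous_ofReal.comp_continuousOn c0)
  have e1 : ∫ v in x..y, (((φ1 v)⁻¹ : ℝ) : ℂ) * ((φ1 v : ℂ) * e (φ v)) = ∫ v in x..y, e (φ v) :=
    intervalIntegral.integral_congr fun v hv => by
      have : (φ1 v : ℂ) ≠ 0 := by exact_mod_cast nz v (Set.uIcc_of_le hxy ▸ hv)
      push_cast; field_simp
  rw [e1] at i1
  have hu : Set.uIcc x y = Set.Icc x y := Set.uIcc_of_le hxy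
  have j := intervalIntegral.integral_eq_sub_of_hasDerivAt (fun v hv => d0 v (hu ▸ hv)) (ContinuousOn.intervalIntegrable (hu ▸ c0))
  have b1 : ∀ v ∈ Set.Icc x y, |(φ1 v)⁻¹| ≤ 1 / μ := fun v hv => by
    rw [abs_inv, one_div]; exact inv_anti₀ hμ (hφ v hv)
  have bx := b1 x ⟨le_rfl, hxy⟩
  have by' := b1 y ⟨hxy, le_rfl⟩
  have k : ‖∫ v in x..y, ((-φ2 v / φ1 v ^ 2 : ℝ) : ℂ) * e (φ v)‖ ≤ 2 / μ := by
    refine (intervalIntegral.norm_integral_le_integral_norm hxy).trans ?_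
    have : ∫ v in x..y, ‖((-φ2 v / φ1 v ^ 2 : ℝ) : ℂ) * e (φ v)‖ = ∫ v in x..y, -(-φ2 v / φ1 v ^ 2) :=
      intervalIntegral.integral_congr fun v hv => by
        have := p2 v (hu ▸ hv)
        simp only [norm_mul, e_norm, mul_one, Complex.norm_real, Real.norm_eq_abs]
        rw [abs_of_nonpos]; rw [neg_div]; exact neg_nonpos.2 (by positivity)
    rw [this, intervalIntegral.integral_neg, j]
    have := neg_abs_le (φ1 y)⁻¹
    have := le_abs_self (φ1 x)⁻¹
    rw [show 2 / μ = 1 / μ + 1 / μ by ring]; linarith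
  have n := congrArg norm i1
  rw [norm_mul, tpi_norm] at n
  have hh : ‖(((φ1 y)⁻¹ : ℝ) : ℂ) * e (φ y) - (((φ1 x)⁻¹ : ℝ) : ℂ) * e (φ x) - ∫ v in x..y, ((-φ2 v / φ1 v ^ 2 : ℝ) : ℂ) * e (φ v)‖ ≤ 1 / μ + 1 / μ + 2 / μ := by
    refine (norm_sub_le _ _).trans (add_le_add ((norm_sub_le _ _).trans (add_le_add ?_ ?_)) k) <;>
    rw [norm_mul, e_norm, mul_one, Complex.norm_real, Real.norm_eq_abs] <;> assumption
  have hp := Real.pi_gt_three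
  have p1 := norm_nonneg (∫ v in x..y, e (φ v))
  have : 1 / μ + 1 / μ + 2 / μ = 4 * (1 / μ) := by ring
  nlinarith only [n, hh, p1, this, hp]

theorem VC (φ φ1 φ2 : ℝ → ℝ) (x y l z : ℝ) (hxy : x ≤ y) (hl : 0 < l)
    (a0 : ∀ v ∈ Set.Icc x y, HasDerivAt φ (φ1 v) v) (a1 : ∀ v ∈ Set.Icc x y, HasDerivAt φ1 (φ2 v) v) (a2 : ContinuousOn φ2 (Set.Icc x y))
    (p2 : ∀ v ∈ Set.Icc x y, 0 ≤ φ2 v) (hφ : ∀ v ∈ Set.Icc x y, l * |v - z| ≤ |φ1 v|) : ‖∫ v in x..y, e (φ v)‖ ≤ 4 / √l := by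
  set d := 1 / √l with hd
  have hs : 0 < √l := Real.sqrt_pos.2 hl
  have hd0 : 0 < d := by positivity
  have hld : l * d = √l := by rw [hd]; field_simp; exact (Real.sq_sqrt hl.le).symm
  have hci : ∀ a b, x ≤ a → b ≤ y → a ≤ b → IntervalIntegrable (fun v => e (φ v)) volume a b := fun a b ha hb hab => by
    apply ContinuousOn.intervalIntegrable
    rw [Set.uIcc_of_le hab]
    exact e_cont.comp_continuousOn fun v hv => (a0 v ⟨ha.trans hv.1, hv.2.trans hb⟩).continuousAt.continuousWithinAt
  have far : ∀ a b, x ≤ a → b ≤ y → a ≤ b → (∀ v ∈ Set.Icc a b, d ≤ |v - z|) → ‖∫ v in a..b, e (φ v)‖ ≤ d := by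
    intro a b ha hb hab h
    have sub : ∀ v ∈ Set.Icc a b, v ∈ Set.Icc x y := fun v hv => ⟨ha.trans hv.1, hv.2.trans hb⟩
    have := FD φ φ1 φ2 a b (√l) hab hs (fun v hv => a0 v (sub v hv)) (fun v hv => a1 v (sub v hv)) (a2.mono sub) (fun v hv => p2 v (sub v hv))
      (fun v hv => by rw [← hld]; exact (mul_le_mul_of_nonneg_left (h v hv) hl.le).trans (hφ v (sub v hv)))
    exact this
  set a := max x (min y (z - d)) with ha
  set b := max x (min y (z + d)) with hb
  have xa : x ≤ a := le_max_left _ _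
  have ab : a ≤ b := max_le_max le_rfl (min_le_min le_rfl (by linarith))
  have bY : b ≤ y := max_le hxy (min_le_left _ _)
  have split : ∫ v in x..y, e (φ v) = (∫ v in x..a, e (φ v)) + (∫ v in a..b, e (φ v)) + ∫ v in b..y, e (φ v) := by
    rw [intervalIntegral.integral_add_adjacent_intervals (hci _ _ le_rfl (ab.trans bY) xa) (hci _ _ xa bY ab),
      intervalIntegral.integral_add_adjacent_intervals (hci _ _ le_rfl bY (xa.trans ab)) (hci _ _ (xa.trans ab) le_rfl bY)]
  have f1 : ‖∫ v in x..a, e (φ v)‖ ≤ d := by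
    rcases le_total (z - d) x with h | h
    · rw [ha, max_eq_left ((min_le_right _ _).trans h)]; simp [hd0.le]
    · refine far _ _ le_rfl (ab.trans bY) xa fun v hv => ?_
      have : v ≤ z - d := hv.2.trans (max_le h (min_le_right _ _))
      rw [abs_of_nonpos (by linarith)]; linarith
  have f3 : ‖∫ v in b..y, e (φ v)‖ ≤ d := by
    rcases le_total y (z + d) with h | h
    · rw [hb, min_eq_left h, max_eq_right hxy]; simp [hd0.le]
    · refine far _ _ (xa.trans ab) le_rfl bY fun v hv => ?_
      have : z + d ≤ v := le_trans (by rw [hb, min_eq_right h]; exact le_max_right _ _) hv.1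
      rw [abs_of_nonneg (by linarith)]; linarith
  have f2 : ‖∫ v in a..b, e (φ v)‖ ≤ 2 * d := by
    have h1 := int_le (fun v => e (φ v)) a b 1 ab fun v _ => (e_norm _).le
    have : b - a ≤ 2 * d := by
      have : b ≤ a + 2 * d := by
        apply max_le (by linarith)
        rcases le_total y (z - d) with h | h
        · have : y ≤ a := by rw [ha, min_eq_left h]; exact le_max_right _ _
          exact (min_le_left _ _).trans (by linarith)
        · have : z - d ≤ a := by rw [ha, min_eq_right h]; exact le_max_right _ _
          exact (min_le_right _ _).trans (by linarith)
      linarith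
    linarith
  rw [split]
  refine (norm_add₃_le).trans ?_
  rw [show 4 / √l = 4 * d by rw [hd]; ring]; linarith

theorem WT (φ g g1 : ℝ → ℝ) (x y M E : ℝ) (hxy : x ≤ y) (hM : 0 ≤ M) (hc : ContinuousOn φ (Set.Icc x y)) (hE : ∀ v ∈ Set.Icc x y, ‖∫ u in x..v, e (φ u)‖ ≤ E)
    (b0 : ∀ v ∈ Set.Icc x y, HasDerivAt g (g1 v) v) (b1 : ContinuousOn g1 (Set.Icc x y)) (z1 : g y = 0) (hg : ∀ v ∈ Set.Icc x y, |g1 v| ≤ M) :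
    ‖∫ v in x..y, (g v : ℂ) * e (φ v)‖ ≤ M * E * (y - x) := by
  have hu : Set.uIcc x y = Set.Icc x y := Set.uIcc_of_le hxy
  have ce : ContinuousOn (fun v => e (φ v)) (Set.Icc x y) := e_cont.comp_continuousOn hc
  have ii : IntervalIntegrable (fun v => e (φ v)) volume x y := ContinuousOn.intervalIntegrable (hu ▸ ce)
  have cp : ContinuousOn (fun v => ∫ u in x..v, e (φ u)) (Set.uIcc x y) := intervalIntegral.continuousOn_primitive_interval (by rw [hu]; exact ce.integrableOn_Icc)
  have := intervalIntegral.integral_mul_deriv_eq_deriv_mul_of_hasDeriv_right (a := x) (b := y) (u := fun v => (g v : ℂ)) (u' := fun v => (g1 v : ℂ)) (v := fun v => ∫ u in x..v, e (φ u))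
    (v' := fun v => e (φ v)) (fun v hv => (b0 v (hu ▸ hv)).ofReal_comp.continuousAt.continuousWithinAt)
    cp
    (fun v hv => (b0 v (Set.Ioo_subset_Icc_self (by rwa [min_eq_left hxy, max_eq_right hxy] at hv))).ofReal_comp.hasDerivWithinAt)
    (fun v hv => by
      rw [min_eq_left hxy, max_eq_right hxy] at hv
      have hn : Set.Icc x y ∈ nhds v := Icc_mem_nhds hv.1 hv.2
      refine (intervalIntegral.integral_hasDerivAt_right (ii.mono_set ?_) ?_ (ce.continuousAt hn)).hasDerivWithinAt
      · rw [hu, Set.uIcc_of_le hv.1.le]; exact Set.Icc_subset_Icc le_rfl hv.2.le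
      · exact (ce.mono Set.Ioo_subset_Icc_self).stronglyMeasurableAtFilter isOpen_Ioo v hv)
    (ContinuousOn.intervalIntegrable (hu ▸ Complex.continuous_ofReal.comp_continuousOn b1)) ii
  rw [this, z1, intervalIntegral.integral_same]
  simp only [Complex.ofReal_zero, zero_mul, mul_zero, sub_zero, zero_sub, norm_neg]
  refine int_le _ x y _ hxy fun v hv => ?_
  rw [norm_mul, Complex.norm_real, Real.norm_eq_abs]
  exact mul_le_mul (hg v hv) (hE v hv) (norm_nonneg _) hM


theorem rpow_lip (r p q : ℝ) (hr : 0 < r) (hp : 0 < p) (hpq : p ≤ q) : ∃ m > 0, ∃ M > 0, ∀ u y : ℝ, p ≤ u → u ≤ y → y ≤ q →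
    m * (y - u) ≤ y ^ r - u ^ r ∧ y ^ r - u ^ r ≤ M * (y - u) := by
  have hc : ContinuousOn (fun v : ℝ => r * v ^ (r - 1)) (Set.Icc p q) := fun v hv =>
    (continuousAt_const.mul (Real.continuousAt_rpow_const v (r-1) (Or.inl (by have := hv.1; linarith)))).continuousWithinAt
  obtain ⟨a, ha, h1⟩ := isCompact_Icc.exists_isMinOn (Set.nonempty_Icc.2 hpq) hc
  obtain ⟨b, hb, h2⟩ := isCompact_Icc.exists_isMaxOn (Set.nonempty_Icc.2 hpq) hc
  have pa : 0 < a := lt_of_lt_of_le hp ha.1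
  have pb : 0 < b := lt_of_lt_of_le hp hb.1
  refine ⟨_, mul_pos hr (Real.rpow_pos_of_pos pa (r-1)), _, mul_pos hr (Real.rpow_pos_of_pos pb (r-1)), fun u y hu huy hy => ?_⟩
  rcases huy.eq_or_lt with rfl | hlt
  · simp
  obtain ⟨z, hz, he⟩ := exists_hasDerivAt_eq_slope (fun v : ℝ => v ^ r) (fun v => r * v ^ (r-1)) hlt
    (fun v hv => (Real.continuousAt_rpow_const v r (Or.inl (by have := hv.1; linarith))).continuousWithinAt)
    (fun v hv => Real.hasDerivAt_rpow_const (Or.inl (by have := hv.1; linarith)))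
  have hz' : z ∈ Set.Icc p q := ⟨by linarith [hz.1], by linarith [hz.2]⟩
  have g1 := h1 hz'
  have g2 := h2 hz'
  simp only [Set.mem_ofPred_eq] at g1 g2
  rw [eq_div_iff (by linarith)] at he
  constructor <;> rw [← he] <;> gcongr

theorem sfun (c : ℝ) (hc : 1 < c) : ∃ s s1 s2 : ℝ → ℝ, ∀ v > 0, HasDerivAt s (s1 v) v ∧ HasDerivAt s1 (s2 v) v ∧ ContinuousAt s2 v ∧
    v - 1 = c * (v ^ (c - 1) - 1) * s v := by
  set f : ℝ → ℝ := fun v => c * v ^ (c - 1) with hf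
  have an : ∀ v > 0, AnalyticAt ℝ f v := fun v hv => analyticAt_const.mul (by
    have : AnalyticAt ℝ (fun v : ℝ => Real.exp (Real.log v * (c-1))) v := by
      have h1 : AnalyticAt ℝ Real.log v := analyticAt_log hv
      fun_prop
    exact this.congr (by filter_upwards [lt_mem_nhds hv] with u hu; rw [Real.rpow_def_of_pos hu]))
  have sl : ∀ v, v ≠ 1 → dslope f 1 v = (f v - f 1) / (v - 1) := fun v hv => by rw [dslope_of_ne _ hv, slope_def_field]
  have d1 : dslope f 1 1 = c * (c - 1) := by
    rw [dslope_same]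
    have := ((Real.hasDerivAt_rpow_const (x := 1) (p := c - 1) (Or.inl one_ne_zero)).const_mul c).deriv
    rw [hf, this]; simp
  have ne : ∀ v > 0, dslope f 1 v ≠ 0 := fun v hv => by
    by_cases h : v = 1
    · rw [h, d1]; exact mul_ne_zero (by linarith) (by linarith)
    · rw [sl v h]
      refine div_ne_zero (fun h0 => h ?_) (sub_ne_zero.2 h)
      have : v ^ (c-1) = 1 ^ (c-1) := mul_left_cancel₀ (show c ≠ 0 by linarith) (sub_eq_zero.1 h0)
      exact (Real.rpow_left_inj hv.le zero_le_one (by linarith)).1 this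
  have ad : ∀ v > 0, AnalyticAt ℝ (dslope f 1) v := fun v hv => by
    by_cases h : v = 1
    · obtain ⟨p, hp⟩ := an 1 one_pos
      rw [h]; exact ⟨_, hp.has_fpower_series_dslope_fslope⟩
    · have : AnalyticAt ℝ (fun v => (f v - f 1) / (v - 1)) v := ((an v hv).sub analyticAt_const).div (analyticAt_id.sub analyticAt_const) (sub_ne_zero.2 h)
      exact this.congr (by filter_upwards [isOpen_ne.mem_nhds h] with u hu; exact (sl u hu).symm)
  have as : ∀ v > 0, AnalyticAt ℝ (fun v => (dslope f 1 v)⁻¹) v := fun v hv => (ad v hv).inv (ne v hv)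
  refine ⟨fun v => (dslope f 1 v)⁻¹, deriv fun v => (dslope f 1 v)⁻¹, deriv (deriv fun v => (dslope f 1 v)⁻¹), fun v hv => ⟨(as v hv).differentiableAt.hasDerivAt,
    (as v hv).deriv.differentiableAt.hasDerivAt, (as v hv).deriv.deriv.continuousAt, ?_⟩⟩
  by_cases h : v = 1
  · simp [h]
  · simp only []
    rw [sl v h, inv_div]; simp only [hf]
    have h0 : c * v ^ (c-1) - c * 1 ^ (c-1) ≠ 0 := fun h0 => ne v hv (by rw [sl v h, hf]; simp only [h0, zero_div])
    rw [Real.one_rpow] at h0 ⊢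
    have : c * (v ^ (c-1) - 1) ≠ 0 := by rwa [mul_sub]
    rw [← mul_sub, mul_div_assoc', mul_div_cancel_left₀ _ this]

noncomputable def amp (w : ℝ → ℝ) (α β c t y : ℝ) : ℂ := ∫ u in α..β, (w u : ℂ) * e (t * (u ^ c - c * y ^ (c-1) * u + (c - 1) * y ^ c))

theorem ph_d (c t y u : ℝ) (hu : 0 < u) : HasDerivAt (fun u => t * (u ^ c - c * y ^ (c-1) * u + (c - 1) * y ^ c)) (t * c * (u ^ (c-1) - y ^ (c-1))) u := by
  have := (((Real.hasDerivAt_rpow_const (x := u) (p := c) (Or.inl hu.ne')).sub ((hasDerivAt_id u).const_mul (c * y ^ (c-1)))).add_const ((c-1) * y ^ c)).const_mul t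
  exact this.congr_deriv (by simp; ring)

theorem ph_d2 (c t y u : ℝ) (hu : 0 < u) : HasDerivAt (fun u => t * c * (u ^ (c-1) - y ^ (c-1))) (t * c * ((c - 1) * u ^ (c-2))) u := by
  have := ((Real.hasDerivAt_rpow_const (x := u) (p := c-1) (Or.inl hu.ne')).sub_const (y ^ (c-1))).const_mul (t * c)
  exact this.congr_deriv (by rw [show c - 1 - 1 = c - 2 by ring])

/-- bound for weighted integrals with a quadratic stationary point -/
theorem amp_bd (c α β y0 y1 : ℝ) (hc : 1 < c) (hα : 0 < α) (hαβ : α ≤ β) (hy0 : 0 < y0) : ∃ C > 0, ∀ t > 0, ∀ y, y0 ≤ y → y ≤ y1 → ∀ (g g1 : ℝ → ℝ) (M : ℝ), 0 ≤ M →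
    (∀ v ∈ Set.Icc α β, HasDerivAt g (g1 v) v) → ContinuousOn g1 (Set.Icc α β) → g β = 0 → (∀ v ∈ Set.Icc α β, |g1 v| ≤ M) →
    ‖∫ u in α..β, (g u : ℂ) * e (t * (u ^ c - c * y ^ (c-1) * u + (c - 1) * y ^ c))‖ ≤ C * M / √t := by
  obtain ⟨m, hm, _, _, hL⟩ := rpow_lip (c-1) (min α y0) (max β y1) (by linarith) (lt_min hα hy0) ((min_le_left _ _).trans (hαβ.trans (le_max_left _ _)))
  refine ⟨4 / √(c * m) * (β - α) + 1, by have : 0 ≤ β - α := by linarith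
                                         positivity, fun t ht y h0 h1 g g1 M hM b0 b1 z1 hg => ?_⟩
  have hl : 0 < t * (c * m) := by positivity
  have key : ∀ v ∈ Set.Icc α β, ‖∫ u in α..v, e (t * (u ^ c - c * y ^ (c-1) * u + (c - 1) * y ^ c))‖ ≤ 4 / √(t * (c * m)) := fun v hv => by
    have pos : ∀ u ∈ Set.Icc α v, 0 < u := fun u hu => by linarith [hu.1]
    refine VC _ _ _ α v (t * (c * m)) y hv.1 hl (fun u hu => ph_d c t y u (pos u hu)) (fun u hu => ph_d2 c t y u (pos u hu)) ?_ (fun u hu => ?_) (fun u hu => ?_)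
    · exact fun u hu => (continuousAt_const.mul (continuousAt_const.mul (Real.continuousAt_rpow_const u _ (Or.inl (pos u hu).ne')))).continuousWithinAt
    · have := pos u hu
      have : 0 < c - 1 := by linarith
      positivity
    · have a1 : min α y0 ≤ u := (min_le_left _ _).trans hu.1
      have a2 : u ≤ max β y1 := (hu.2.trans hv.2).trans (le_max_left _ _)
      have a3 : min α y0 ≤ y := (min_le_right _ _).trans h0
      have a4 : y ≤ max β y1 := h1.trans (le_max_right _ _)
      have hk : m * |u - y| ≤ |u ^ (c-1) - y ^ (c-1)| := by
        rcases le_total u y with h | h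
        · rw [abs_sub_comm, abs_of_nonneg (by linarith), abs_sub_comm]; exact (hL u y a1 h a4).1.trans (le_abs_self _)
        · rw [abs_of_nonneg (by linarith)]; exact (hL y u a3 h a2).1.trans (le_abs_self _)
      rw [abs_mul, abs_of_pos (show 0 < t * c by positivity)]
      calc t * (c * m) * |u - y| = t * c * (m * |u - y|) := by ring
        _ ≤ _ := by gcongr
  refine (WT _ g g1 α β M _ hαβ hM (fun u hu => (ph_d c t y u (by linarith [hu.1])).continuousAt.continuousWithinAt) key b0 b1 z1 hg).trans ?_
  rw [Real.sqrt_mul ht.le]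
  have : 0 ≤ M / √t := by positivity
  calc M * (4 / (√t * √(c*m))) * (β - α) = 4 / √(c * m) * (β - α) * (M / √t) := by field_simp
    _ ≤ (4 / √(c * m) * (β - α) + 1) * (M / √t) := by gcongr; linarith
    _ = _ := by ring

theorem amp_lip (c α β y0 y1 : ℝ) (hc : 1 < c) (hα : 0 < α) (hαβ : α ≤ β) (hy0 : 0 < y0) (hy01 : y0 ≤ y1) (w w1 w2 : ℝ → ℝ) (b0 : ∀ v, HasDerivAt w (w1 v) v)
    (b1 : ∀ v, HasDerivAt w1 (w2 v) v) (b2 : Continuous w2) (z0 : w α = 0) (z1 : w β = 0) (z3 : w1 β = 0) : ∃ C > 0, ∀ t > 0,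
    (∀ y ∈ Set.Icc y0 y1, ‖amp w α β c t y‖ ≤ C / √t) ∧ (∀ y ∈ Set.Icc y0 y1, ∀ y' ∈ Set.Icc y0 y1, ‖amp w α β c t y - amp w α β c t y'‖ ≤ C / √t * |y - y'|) := by
  obtain ⟨C, hC, hA⟩ := amp_bd c α β y0 y1 hc hα hαβ hy0
  obtain ⟨s, s1, s2, hs⟩ := sfun c hc
  have cw : Continuous w := continuous_iff_continuousAt.2 fun v => (b0 v).continuousAt
  have cw1 : Continuous w1 := continuous_iff_continuousAt.2 fun v => (b1 v).continuousAt
  have bdw : ∀ f : ℝ → ℝ, Continuous f → ∃ M, 0 ≤ M ∧ ∀ v ∈ Set.Icc α β, |f v| ≤ M := fun f hf => by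
    obtain ⟨M, h⟩ := isCompact_Icc.exists_bound_of_continuousOn (s := Set.Icc α β) hf.continuousOn
    exact ⟨M, (abs_nonneg _).trans (h α ⟨le_rfl, hαβ⟩), h⟩
  have bds : ∀ f : ℝ → ℝ, (∀ v > 0, ContinuousAt f v) → ∃ M, 0 ≤ M ∧ ∀ v ∈ Set.Icc (α / y1) (β / y0), 0 < v → |f v| ≤ M := fun f hf => by
    have hp : 0 < α / y1 := div_pos hα (hy0.trans_le hy01)
    obtain ⟨M, h⟩ := isCompact_Icc.exists_bound_of_continuousOn (s := Set.Icc (α / y1) (β / y0)) (f := f) fun v hv => (hf v (hp.trans_le hv.1)).continuousWithinAt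
    exact ⟨|M|, abs_nonneg _, fun v hv _ => (h v hv).trans (le_abs_self _)⟩
  obtain ⟨M0, p0, m0⟩ := bdw w cw
  obtain ⟨M1, p1, m1⟩ := bdw w1 cw1
  obtain ⟨M2, p2, m2⟩ := bdw w2 b2
  obtain ⟨N0, q0, n0⟩ := bds s fun v hv => (hs v hv).1.continuousAt
  obtain ⟨N1, q1, n1⟩ := bds s1 fun v hv => (hs v hv).2.1.continuousAt
  obtain ⟨N2, q2, n2⟩ := bds s2 fun v hv => (hs v hv).2.2.1
  set M := M2 * N0 + 2 * (M1 * (N1 / y0)) + M0 * (N2 / y0 / y0) with hM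
  have hM0 : 0 ≤ M := by positivity
  have c1 : 0 < c * (c - 1) := mul_pos (by linarith) (by linarith)
  refine ⟨C * M1 + c * (c-1) * (C * M) + 1, by positivity, fun t ht => ⟨fun y hy => ?_, fun y hy y' hy' => ?_⟩⟩
  · refine (hA t ht y hy.1 hy.2 w w1 M1 p1 (fun v _ => b0 v) cw1.continuousOn z1 m1).trans ?_
    gcongr; nlinarith only [mul_nonneg c1.le (mul_nonneg hC.le hM0)]
  have hu : Set.uIcc α β = Set.Icc α β := Set.uIcc_of_le hαβ
  -- derivative in y
  set D : ℝ → ℝ → ℂ := fun y u => (w u : ℂ) * (2 * Real.pi * Complex.I * (((-(t * c * (c-1) * y ^ (c-2) * (u - y)) : ℝ) : ℂ) * e (t * (u ^ c - c * y ^ (c-1) * u + (c - 1) * y ^ c)))) with hD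
  have hder : ∀ y > 0, ∀ u : ℝ, HasDerivAt (fun y : ℝ => (w u : ℂ) * e (t * (u ^ c - c * y ^ (c-1) * u + (c - 1) * y ^ c))) (D y u) y := fun y hy u => by
    refine HasDerivAt.const_mul _ (e_comp ?_)
    have h1 := Real.hasDerivAt_rpow_const (x := y) (p := c-1) (Or.inl hy.ne')
    have h2 := Real.hasDerivAt_rpow_const (x := y) (p := c) (Or.inl hy.ne')
    have h3 := (((h1.const_mul c).mul_const u).const_sub (u ^ c)).add (h2.const_mul (c-1))
    refine (h3.const_mul t).congr_deriv ?_
    rw [show y ^ (c-1) = y ^ (c-2) * y by rw [← Real.rpow_add_one hy.ne']; ring_nf, show c - 1 - 1 = c - 2 by ring]; ring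
  have cph : ∀ y, ContinuousOn (fun u : ℝ => e (t * (u ^ c - c * y ^ (c-1) * u + (c - 1) * y ^ c))) (Set.Icc α β) := fun y =>
    e_cont.comp_continuousOn fun u hu => (ph_d c t y u (by linarith [hu.1])).continuousAt.continuousWithinAt
  have cD : ∀ y, ContinuousOn (D y) (Set.Icc α β) := fun y => by
    have := cph y
    simp only [hD]; fun_prop
  have dA : ∀ y ∈ Set.Icc y0 y1, HasDerivAt (fun y => amp w α β c t y) (∫ u in α..β, D y u) y := fun y hy => by
    have hyp : 0 < y := hy0.trans_le hy.1
    have ho : Set.Ioo (y/2) (2*y) ∈ nhds y := Ioo_mem_nhds (by linarith) (by linarith)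
    obtain ⟨Z, hZ⟩ := (isCompact_Icc (a := y/2) (b := 2*y)).exists_bound_of_continuousOn (f := fun y : ℝ => y ^ (c-2)) fun v hv =>
      (Real.continuousAt_rpow_const v _ (Or.inl (by linarith [hv.1]))).continuousWithinAt
    have hZ0 : 0 ≤ Z := (norm_nonneg _).trans (hZ y ⟨by linarith, by linarith⟩)
    refine (intervalIntegral.hasDerivAt_integral_of_dominated_loc_of_deriv_le (F' := D) (bound := fun _ => M0 * (2 * Real.pi * (t * c * (c-1) * Z * (β + 2 * y)))) ho ?_ ?_ ?_ ?_ ?_ ?_).2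
    · refine Filter.Eventually.of_forall fun x => ?_
      rw [Set.uIoc_of_le hαβ]
      exact (((Complex.continuous_ofReal.comp cw).continuousOn.mul (cph x)).mono Set.Ioc_subset_Icc_self).aestronglyMeasurable measurableSet_Ioc
    · exact ContinuousOn.intervalIntegrable (by rw [hu]; exact (Complex.continuous_ofReal.comp cw).continuousOn.mul (cph y))
    · rw [Set.uIoc_of_le hαβ]
      exact ((cD y).mono Set.Ioc_subset_Icc_self).aestronglyMeasurable measurableSet_Ioc
    · refine Filter.Eventually.of_forall fun u huu x hx => ?_
      rw [Set.uIoc_of_le hαβ] at huu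
      have hux : u ∈ Set.Icc α β := Set.Ioc_subset_Icc_self huu
      simp only [hD]
      rw [norm_mul, norm_mul (2 * Real.pi * Complex.I : ℂ), tpi_norm, norm_mul, e_norm, mul_one, Complex.norm_real, Complex.norm_real, Real.norm_eq_abs, Real.norm_eq_abs, abs_neg, abs_mul, abs_mul,
        abs_of_pos (show 0 < t * c * (c-1) by nlinarith only [c1, ht])]
      have e1 : |u - x| ≤ β + 2 * y := by rw [abs_le]; constructor <;> linarith only [hα, hux.1, hux.2, hx.1, hx.2]
      have e2 : |x ^ (c-2)| ≤ Z := hZ x ⟨hx.1.le, hx.2.le⟩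
      have e3 := m0 u hux
      have e4 : 0 < t * c * (c-1) := by nlinarith only [c1, ht]
      gcongr
    · exact intervalIntegrable_const
    · exact Filter.Eventually.of_forall fun u _ x hx => hder x (by linarith [hx.1]) u
  have dB : ∀ y ∈ Set.Icc y0 y1, ‖∫ u in α..β, D y u‖ ≤ c * (c-1) * (C * M / √t) := fun y hy => by
    have hyp : 0 < y := hy0.trans_le hy.1
    have hv : ∀ u ∈ Set.Icc α β, 0 < u / y ∧ u / y ∈ Set.Icc (α / y1) (β / y0) := fun u hu => ⟨div_pos (by linarith [hu.1]) hyp,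
      div_le_div₀ (by linarith [hu.1]) hu.1 hyp hy.2, div_le_div₀ (by linarith) hu.2 hy0 hy.1⟩
    have hd : ∀ u : ℝ, HasDerivAt (fun u => u / y) (1 / y) u := fun u => (hasDerivAt_id u).div_const y
    have ds : ∀ u ∈ Set.Icc α β, HasDerivAt (fun u => s (u / y)) (s1 (u / y) * (1 / y)) u := fun u hu => (hs _ (hv u hu).1).1.comp u (hd u)
    have ds1 : ∀ u ∈ Set.Icc α β, HasDerivAt (fun u => s1 (u / y)) (s2 (u / y) * (1 / y)) u := fun u hu => (hs _ (hv u hu).1).2.1.comp u (hd u)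
    have dg : ∀ u ∈ Set.Icc α β, HasDerivAt (fun u => w u * s (u / y)) (w1 u * s (u / y) + w u * (s1 (u / y) * (1 / y))) u := fun u hu => (b0 u).mul (ds u hu)
    have dg1 : ∀ u ∈ Set.Icc α β, HasDerivAt (fun u => w1 u * s (u / y) + w u * (s1 (u / y) * (1 / y))) (w2 u * s (u / y) + w1 u * (s1 (u / y) * (1 / y)) +
        (w1 u * (s1 (u / y) * (1 / y)) + w u * (s2 (u / y) * (1 / y) * (1 / y)))) u := fun u hu => ((b1 u).mul (ds u hu)).add ((b0 u).mul ((ds1 u hu).mul_const _))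
    have ib := IBP _ _ (fun u => ((w u * s (u / y) : ℝ) : ℂ)) (fun u => ((w1 u * s (u / y) + w u * (s1 (u / y) * (1 / y)) : ℝ) : ℂ)) α β hαβ
      (fun u hu => ph_d c t y u (by linarith [hu.1])) (fun u hu => (dg u hu).ofReal_comp)
      (fun u hu => (ph_d2 c t y u (by linarith [hu.1])).continuousAt.continuousWithinAt)
      (fun u hu => (dg1 u hu).ofReal_comp.continuousAt.continuousWithinAt)
    rw [z0, z1] at ib
    simp only [zero_mul, Complex.ofReal_zero, sub_self, zero_sub] at ib
    have eq : ∫ u in α..β, D y u = -((c * (c-1) : ℝ) : ℂ) * (2 * Real.pi * Complex.I * ∫ v in α..β, ((w v * s (v / y) : ℝ) : ℂ) *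
        (((t * c * (v ^ (c-1) - y ^ (c-1)) : ℝ) : ℂ) * e (t * (v ^ c - c * y ^ (c-1) * v + (c - 1) * y ^ c)))) := by
      rw [← intervalIntegral.integral_const_mul, ← intervalIntegral.integral_const_mul]
      refine intervalIntegral.integral_congr fun u huu => ?_
      rw [hu] at huu
      have k := (hs _ (hv u huu).1).2.2.2
      have hup : 0 < u := by linarith only [hα, huu.1]
      rw [Real.div_rpow hup.le hyp.le] at k
      have hy1 : y ^ (c-1) = y ^ (c-2) * y := by rw [← Real.rpow_add_one hyp.ne']; ring_nf
      have hyc : 0 < y ^ (c-2) := Real.rpow_pos_of_pos hyp _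
      have k2 : y ^ (c-2) * (u - y) = c * (u ^ (c-1) - y ^ (c-1)) * s (u / y) := by
        rw [hy1] at k ⊢
        field_simp at k
        linear_combination k
      simp only [hD]
      rw [show -(t * c * (c-1) * y ^ (c-2) * (u - y)) = -(t * c * (c-1)) * (y ^ (c-2) * (u - y)) by ring, k2]
      push_cast; ring
    rw [eq, ib, norm_mul, norm_neg, norm_neg, Complex.norm_real, Real.norm_eq_abs, abs_of_pos c1]
    refine mul_le_mul_of_nonneg_left ?_ c1.le
    refine hA t ht y hy.1 hy.2 _ _ M hM0 dg1 ?_ (by rw [z1, z3]; ring) fun u hu => ?_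
    · have k0 : ContinuousOn (fun u => s (u / y)) (Set.Icc α β) := fun u hu => (ds u hu).continuousAt.continuousWithinAt
      have k1 : ContinuousOn (fun u => s1 (u / y)) (Set.Icc α β) := fun u hu => (ds1 u hu).continuousAt.continuousWithinAt
      have k2 : ContinuousOn (fun u => s2 (u / y)) (Set.Icc α β) := fun u hu => (ContinuousAt.comp (f := fun u : ℝ => u / y) (hs _ (hv u hu).1).2.2.1 (hd u).continuousAt).continuousWithinAt
      exact ((b2.continuousOn.mul k0).add (cw1.continuousOn.mul (k1.mul continuousOn_const))).add ((cw1.continuousOn.mul (k1.mul continuousOn_const)).add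
        (cw.continuousOn.mul ((k2.mul continuousOn_const).mul continuousOn_const)))
    · obtain ⟨h1, h2⟩ := hv u hu
      have yi : |1 / y| ≤ 1 / y0 := by rw [abs_of_pos (by positivity)]; exact one_div_le_one_div_of_le hy0 hy.1
      have f0 := m0 u hu
      have f1 := m1 u hu
      have f2 := m2 u hu
      have f3 := n0 _ h2 h1
      have f4 := n1 _ h2 h1
      have f5 := n2 _ h2 h1
      have B1 : |w2 u * s (u / y)| ≤ M2 * N0 := by rw [abs_mul]; gcongr
      have B2 : |w1 u * (s1 (u / y) * (1 / y))| ≤ M1 * (N1 * (1 / y0)) := by rw [abs_mul, abs_mul]; gcongr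
      have B3 : |w u * (s2 (u / y) * (1 / y) * (1 / y))| ≤ M0 * (N2 * (1 / y0) * (1 / y0)) := by rw [abs_mul, abs_mul, abs_mul]; gcongr
      refine (abs_add_le _ _).trans (((add_le_add (abs_add_le _ _) (abs_add_le _ _))).trans ?_)
      rw [hM]
      simp only [mul_one_div] at B1 B2 B3 ⊢
      linarith only [B1, B2, B3]
  have := Convex.norm_image_sub_le_of_norm_hasDerivWithin_le (s := Set.Icc y0 y1) (fun v hv => (dA v hv).hasDerivWithinAt) dB (convex_Icc y0 y1) hy' hy
  refine this.trans ?_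
  rw [Real.norm_eq_abs]
  gcongr
  rw [mul_div_assoc', div_le_div_iff_of_pos_right (Real.sqrt_pos.2 ht)]
  nlinarith only [mul_nonneg hC.le p1]


theorem ns_bd (c α β : ℝ) (hc : 1 < c) (hα : 0 < α) (hαβ : α ≤ β) (w w1 w2 : ℝ → ℝ) (b0 : ∀ v, HasDerivAt w (w1 v) v)
    (b1 : ∀ v, HasDerivAt w1 (w2 v) v) (b2 : Continuous w2) (z0 : w α = 0) (z1 : w β = 0) (z2 : w1 α = 0) (z3 : w1 β = 0) : ∃ C > 0, ∀ t μ D : ℝ, 0 < t →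
    (μ ≤ t * (c * α ^ (c-1)) / 2 ∨ 2 * (t * (c * β ^ (c-1))) ≤ μ) → 0 < D → (D ≤ t ∨ D ≤ |μ|) → ‖∫ u in α..β, (w u : ℂ) * e (t * u ^ c - μ * u)‖ ≤ C / D ^ 2 := by
  have cw : Continuous w := continuous_iff_continuousAt.2 fun v => (b0 v).continuousAt
  have cw1 : Continuous w1 := continuous_iff_continuousAt.2 fun v => (b1 v).continuousAt
  have bdw : ∀ f : ℝ → ℝ, ContinuousOn f (Set.Icc α β) → ∃ M, 0 ≤ M ∧ ∀ v ∈ Set.Icc α β, |f v| ≤ M := fun f hf => by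
    obtain ⟨M, h⟩ := isCompact_Icc.exists_bound_of_continuousOn (s := Set.Icc α β) hf
    exact ⟨M, (abs_nonneg _).trans (h α ⟨le_rfl, hαβ⟩), h⟩
  have rc : ∀ r : ℝ, ContinuousOn (fun u : ℝ => u ^ r) (Set.Icc α β) := fun r u hu =>
    (Real.continuousAt_rpow_const u r (Or.inl (by linarith [hu.1]))).continuousWithinAt
  obtain ⟨M0, p0, m0⟩ := bdw w cw.continuousOn
  obtain ⟨M1, p1, m1⟩ := bdw w1 cw1.continuousOn
  obtain ⟨M2, p2, m2⟩ := bdw w2 b2.continuousOn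
  obtain ⟨q2, r2, n2⟩ := bdw (fun u => c * ((c-1) * u ^ (c-2))) (continuousOn_const.mul (continuousOn_const.mul (rc _)))
  obtain ⟨q3, r3, n3⟩ := bdw (fun u => c * ((c-1) * ((c-2) * u ^ (c-3)))) (continuousOn_const.mul (continuousOn_const.mul (continuousOn_const.mul (rc _))))
  have hβ : 0 < β := by linarith
  have hP0 : 0 < c * α ^ (c-1) := by have := Real.rpow_pos_of_pos hα (c-1); positivity
  have hP1 : 0 < c * β ^ (c-1) := by have := Real.rpow_pos_of_pos hβ (c-1); positivity
  have hP01 : c * α ^ (c-1) ≤ c * β ^ (c-1) := by have := Real.rpow_le_rpow hα.le hαβ (show 0 ≤ c - 1 by linarith); gcongr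
  set P0 := c * α ^ (c-1)
  set P1 := c * β ^ (c-1)
  set κ := min (P0 / 2) (1 / 2) with hκ
  have k1 : κ ≤ P0 / 2 := min_le_left _ _
  have k2 : κ ≤ 1 / 2 := min_le_right _ _
  have hκ0 : 0 < κ := lt_min (by linarith) (by norm_num)
  set Q := (q2 + q3) / κ with hQ
  have hQ0 : 0 ≤ Q := by positivity
  refine ⟨(M0 + M1 + M2) * (1 / κ) ^ 2 * (1 + 4 * Q + 3 * Q ^ 2) * (β - α) + 1, by have : 0 ≤ β - α := by linarith
                                                                                   positivity, fun t μ D ht hμ hD hDt => ?_⟩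
  have pos : ∀ u ∈ Set.Icc α β, 0 < u := fun u hu => by linarith [hu.1]
  set E := max t |μ| with hE
  have hE0 : 0 < E := lt_max_of_lt_left ht
  have hDE : D ≤ E := hDt.elim (fun h => h.trans (le_max_left _ _)) (fun h => h.trans (le_max_right _ _))
  have d0 : ∀ v ∈ Set.Icc α β, HasDerivAt (fun u => t * u ^ c - μ * u) (t * (c * v ^ (c-1)) - μ) v := fun v hv => by
    have := ((Real.hasDerivAt_rpow_const (x := v) (p := c) (Or.inl (pos v hv).ne')).const_mul t).sub ((hasDerivAt_id v).const_mul μ)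
    exact this.congr_deriv (by simp)
  have d1 : ∀ v ∈ Set.Icc α β, HasDerivAt (fun v => t * (c * v ^ (c-1)) - μ) (t * (c * ((c-1) * v ^ (c-2)))) v := fun v hv => by
    have := ((((Real.hasDerivAt_rpow_const (x := v) (p := c-1) (Or.inl (pos v hv).ne')).const_mul c).const_mul t).sub_const μ)
    exact this.congr_deriv (by rw [show c - 1 - 1 = c - 2 by ring])
  have d2 : ∀ v ∈ Set.Icc α β, HasDerivAt (fun v => t * (c * ((c-1) * v ^ (c-2)))) (t * (c * ((c-1) * ((c-2) * v ^ (c-3))))) v := fun v hv => by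
    have := ((((Real.hasDerivAt_rpow_const (x := v) (p := c-2) (Or.inl (pos v hv).ne')).const_mul (c-1)).const_mul c).const_mul t)
    exact this.congr_deriv (by rw [show c - 2 - 1 = c - 3 by ring])
  have main := NS2 w w1 w2 _ _ _ _ α β (M0 + M1 + M2) (1 / (κ * E)) Q hαβ (by positivity) (by positivity) d0 d1 d2
    (continuousOn_const.mul (continuousOn_const.mul (continuousOn_const.mul (continuousOn_const.mul (rc _))))) (fun v _ => b0 v) (fun v _ => b1 v) b2.continuousOn z0 z1 z2 z3
    (fun v hv => ⟨by linarith only [p1, p2, m0 v hv], by linarith [m1 v hv], by linarith only [p0, p1, m2 v hv]⟩) (fun v hv => by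
      have f1 : P0 ≤ c * v ^ (c-1) := by have := Real.rpow_le_rpow hα.le hv.1 (show 0 ≤ c - 1 by linarith); simp only [P0]; gcongr
      have f2 : c * v ^ (c-1) ≤ P1 := by have := Real.rpow_le_rpow (pos v hv).le hv.2 (show 0 ≤ c - 1 by linarith only [hc]); simp only [P1]; gcongr
      have g1 := mul_le_mul_of_nonneg_left f1 ht.le
      have g2 := mul_le_mul_of_nonneg_left f2 ht.le
      have g3 := mul_le_mul_of_nonneg_left hP01 ht.le
      have hle : ∀ q : ℝ, 0 ≤ q → 1 / (κ * E) * (t * q) ≤ q / κ := fun q hq => by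
        rw [div_mul_eq_mul_div, one_mul, div_le_div_iff₀ (by positivity) hκ0]
        nlinarith only [mul_le_mul_of_nonneg_right (le_max_left t |μ|) (mul_nonneg hq hκ0.le)]
      refine ⟨?_, ?_, ?_⟩
      · rw [div_mul_eq_mul_div, one_mul, le_div_iff₀ (by positivity), one_mul]
        have h1 : κ * t ≤ |t * (c * v ^ (c-1)) - μ| := by
          have := mul_le_mul_of_nonneg_right k1 ht.le
          rcases hμ with h | h
          · exact le_trans (by linarith only [g1, this, h]) (le_abs_self _)
          · exact le_trans (by linarith [mul_pos ht hP0]) (neg_le_abs _)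
        have h2 : κ * |μ| ≤ |t * (c * v ^ (c-1)) - μ| := by
          have := mul_le_mul_of_nonneg_right k2 (abs_nonneg μ)
          have hn := abs_nonneg μ
          rcases hμ with h | h
          · refine le_trans ?_ (le_abs_self _)
            rcases abs_cases μ with ⟨h3, _⟩ | ⟨h3, _⟩ <;> linarith [mul_pos ht hP0]
          · have : 0 < μ := by linarith only [h, mul_pos ht hP1]
            rw [abs_of_pos this] at *
            exact le_trans (by linarith) (neg_le_abs _)
        rcases max_choice t |μ| with h | h <;> rw [hE, h] <;> assumption
      · rw [abs_mul, abs_of_pos ht]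
        refine (hle _ (abs_nonneg _)).trans ?_
        rw [hQ]; gcongr; linarith only [r3, n2 v hv]
      · rw [abs_mul, abs_of_pos ht]
        refine (hle _ (abs_nonneg _)).trans ?_
        rw [hQ]; gcongr; linarith only [r2, n3 v hv])
  refine main.trans ?_
  have hβα : 0 ≤ β - α := by linarith only [hαβ]
  calc _ = (M0 + M1 + M2) * (1 / κ) ^ 2 * (1 + 4 * Q + 3 * Q ^ 2) * (β - α) / E ^ 2 := by field_simp
    _ ≤ _ := by gcongr; linarith only []

theorem POI (c α β : ℝ) (hc : 1 < c) (hα : 0 < α) (hαβ : α ≤ β) (w w1 w2 : ℝ → ℝ) (b0 : ∀ v, HasDerivAt w (w1 v) v)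
    (b1 : ∀ v, HasDerivAt w1 (w2 v) v) (b2 : Continuous w2) (z0 : ∀ v, v ≤ α → w v = 0) (z1 : ∀ v, β ≤ v → w v = 0) (z2 : w1 α = 0) (z3 : w1 β = 0) : ∃ C > 0,
    ∀ X t : ℝ, 1 ≤ X → X ≤ t → ∀ L : ℕ, β * X < L → ∀ R : Finset ℕ, (∀ ν : ℕ, ν ∉ R → ν * X ≤ t * (c * α ^ (c-1)) / 2 ∨ 2 * (t * (c * β ^ (c-1))) ≤ ν * X) →
    ‖∑ n ∈ Finset.range L, (w (n / X) : ℂ) * e (t * (n / X) ^ c) - X * ∑ ν ∈ R, ∫ u in α..β, (w u : ℂ) * e (t * u ^ c - ν * X * u)‖ ≤ C := by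
  obtain ⟨C, hC, hJ⟩ := ns_bd c α β hc hα hαβ w w1 w2 b0 b1 b2 (z0 α le_rfl) (z1 β le_rfl) z2 z3
  have cw : Continuous w := continuous_iff_continuousAt.2 fun v => (b0 v).continuousAt
  set b : ℤ → ℝ := fun ν => 1 / (ν : ℝ) ^ 2 + (if ν = 0 then 1 else 0) with hb
  have sb : Summable b := (Real.summable_one_div_int_pow.2 one_lt_two).add (summable_of_ne_finset_zero (s := {0}) fun ν hν => by simp at hν; simp [hν])
  refine ⟨C * (∑' ν, b ν) + 1, by have : 0 ≤ ∑' ν, b ν := tsum_nonneg fun ν => by simp only [hb]; positivity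
                                  positivity, fun X t hX ht L hL R hR => ?_⟩
  have hX0 : 0 < X := by linarith
  set f : ℝ → ℂ := fun x => (w (x / X) : ℂ) * e (t * (x / X) ^ c) with hf
  set J : ℝ → ℂ := fun μ => ∫ u in α..β, (w u : ℂ) * e (t * u ^ c - μ * u) with hJd
  have cf : Continuous f := by
    have h1 : Continuous fun x : ℝ => (x / X) ^ c := (Real.continuous_rpow_const (by linarith)).comp (continuous_id.div_const X)
    exact (Complex.continuous_ofReal.comp (cw.comp (continuous_id.div_const X))).mul (e_cont.comp (continuous_const.mul h1))
  have f0 : ∀ x, x ∉ Set.Ioc (α * X) (β * X) → f x = 0 := fun x hx => by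
    have : w (x / X) = 0 := by
      rw [Set.mem_Ioc, not_and_or, not_lt, not_le] at hx
      rcases hx with h | h
      · exact z0 _ ((div_le_iff₀ hX0).2 h)
      · exact z1 _ ((le_div_iff₀ hX0).2 h.le)
    simp [hf, this]
  have ff : ∀ ν : ℤ, FourierTransform.fourier f ν = X * J (ν * X) := fun ν => by
    rw [Real.fourier_real_eq_integral_exp_smul]
    have s1 : ∀ v : ℝ, Complex.exp (((-2 * Real.pi * v * (ν : ℝ) : ℝ) : ℂ) * Complex.I) • f v = (Set.Ioc (α * X) (β * X)).indicator
        (fun v => (w (v / X) : ℂ) * e (t * (v / X) ^ c - ν * X * (v / X))) v := fun v => by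
      by_cases hv : v ∈ Set.Ioc (α * X) (β * X)
      · rw [Set.indicator_of_mem hv, sub_eq_add_neg, e_add, smul_eq_mul]
        have : Complex.exp (((-2 * Real.pi * v * (ν : ℝ) : ℝ) : ℂ) * Complex.I) = e (-(ν * X * (v / X))) := by
          rw [mul_assoc (ν : ℝ), mul_div_cancel₀ _ hX0.ne']
          unfold e; congr 1; push_cast; ring
        rw [this, hf]; ring
      · rw [Set.indicator_of_notMem hv, f0 v hv, smul_zero]
    simp_rw [s1]
    rw [integral_indicator measurableSet_Ioc, ← intervalIntegral.integral_of_le (by gcongr),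
      intervalIntegral.integral_comp_div (fun u => (w u : ℂ) * e (t * u ^ c - ν * X * u)) hX0.ne', mul_div_cancel_right₀ _ hX0.ne', mul_div_cancel_right₀ _ hX0.ne', Complex.real_smul]
  set R' : Finset ℤ := R.map Nat.castEmbedding with hR'
  have hbd : ∀ ν : ℤ, ν ∉ R' → ‖FourierTransform.fourier f ν‖ ≤ C * b ν := fun ν hν => by
    have hcase : (ν : ℝ) * X ≤ t * (c * α ^ (c-1)) / 2 ∨ 2 * (t * (c * β ^ (c-1))) ≤ ν * X := by
      rcases lt_or_ge ν 0 with h | h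
      · left
        have h1 : (ν : ℝ) ≤ 0 := by exact_mod_cast h.le
        have h2 := Real.rpow_pos_of_pos hα (c-1)
        have : 0 < t * (c * α ^ (c-1)) := mul_pos (by linarith) (by positivity)
        nlinarith only [h1, this, hX]
      · obtain ⟨n, rfl⟩ := Int.eq_ofNat_of_zero_le h
        have := hR n fun h => hν (by rw [hR']; simpa using h)
        simpa using this
    rw [ff, norm_mul, Complex.norm_real, Real.norm_eq_abs, abs_of_pos hX0]
    by_cases h : ν = 0
    · have := hJ t (ν * X) t (by linarith) hcase (by linarith) (Or.inl le_rfl)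
      have hb1 : b ν = 1 := by simp [hb, h]
      rw [hb1, mul_one]
      calc X * ‖J (ν * X)‖ ≤ X * (C / t ^ 2) := by gcongr
        _ ≤ t * (C / t ^ 2) := by gcongr
        _ = C / t := by field_simp
        _ ≤ C := div_le_self hC.le (by linarith)
    · have h1 : 1 ≤ |(ν : ℝ)| := by exact_mod_cast Int.one_le_abs h
      have := hJ t (ν * X) |ν * X| (by linarith) hcase (by rw [abs_mul, abs_of_pos hX0]; positivity) (Or.inr le_rfl)
      have hb1 : b ν = 1 / (ν : ℝ) ^ 2 := by simp [hb, h]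
      rw [sq_abs] at this
      rw [hb1]
      calc X * ‖J (ν * X)‖ ≤ X * (C / (ν * X) ^ 2) := by gcongr
        _ = C * (1 / (ν : ℝ) ^ 2) / X := by field_simp
        _ ≤ _ := div_le_self (by positivity) hX
  set h : ℤ → ℂ := fun ν => if ν ∈ R' then 0 else FourierTransform.fourier f ν with hh
  set k : ℤ → ℂ := fun ν => if ν ∈ R' then FourierTransform.fourier f ν else 0 with hk
  have hhb : ∀ ν, ‖h ν‖ ≤ C * b ν := fun ν => by
    simp only [hh]
    split_ifs with h1
    · simp only [norm_zero, hb]; positivity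
    · exact hbd ν h1
  have sh : Summable h := Summable.of_norm_bounded (sb.mul_left C) hhb
  have hks : HasSum k (∑ ν ∈ R', k ν) := hasSum_sum_of_ne_finset_zero fun ν hν => by simp [hk, hν]
  have hhk : (fun ν : ℤ => FourierTransform.fourier f ν) = fun ν => h ν + k ν := by
    funext ν; simp only [hh, hk]; split_ifs <;> simp
  have P := Real.tsum_eq_tsum_fourier_of_rpow_decay_of_summable cf one_lt_two (Asymptotics.IsBigO.of_bound 1 (by
    filter_upwards [(isCompact_Icc (a := α * X) (b := β * X)).compl_mem_cocompact] with x hx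
    rw [f0 x fun h => hx (Set.Ioc_subset_Icc_self h), norm_zero]; positivity)) (by rw [hhk]; exact sh.add hks.summable) 0
  simp only [zero_add, QuotientAddGroup.mk_zero, fourier_eval_zero, mul_one] at P
  rw [hhk, (sh.hasSum.add hks).tsum_eq] at P
  have Q1 : ∑' n : ℤ, f n = ∑ n ∈ Finset.range L, (w (n / X) : ℂ) * e (t * (n / X) ^ c) := by
    rw [tsum_eq_sum (s := (Finset.range L).map Nat.castEmbedding) fun n hn => ?_, Finset.sum_map]
    · simp [hf]
    · refine f0 _ fun hm => hn ?_
      have hn0 : 0 ≤ n := by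
        have : (0 : ℝ) < n := lt_trans (by positivity) hm.1
        exact_mod_cast this.le
      obtain ⟨m, rfl⟩ := Int.eq_ofNat_of_zero_le hn0
      have : (m : ℝ) < L := lt_of_le_of_lt (by simpa using hm.2) hL
      exact Finset.mem_map.2 ⟨m, Finset.mem_range.2 (by exact_mod_cast this), rfl⟩
  have Q2 : ∑ ν ∈ R', k ν = X * ∑ ν ∈ R, J (ν * X) := by
    rw [hR', Finset.sum_map, Finset.mul_sum]
    refine Finset.sum_congr rfl fun ν hν => ?_
    simp only [hk, hR']
    rw [if_pos (Finset.mem_map_of_mem _ hν), ff]; simp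
  rw [← Q1, P, Q2]
  simp only [hJd, add_sub_cancel_right]
  refine (tsum_of_norm_bounded (sb.mul_left C).hasSum hhb).trans ?_
  rw [tsum_mul_left]; linarith


theorem four_add (x y : ℝ) (hx : 0 ≤ x) (hy : 0 ≤ y) : (x + y) ^ 4 ≤ 8 * (x ^ 4 + y ^ 4) := by
  have := add_pow_le hx hy 4; norm_num at this; exact this

theorem MMx (c τ : ℝ) (h : MM c τ) (B δ : ℝ) (hB : 1 ≤ B) (hδ : 0 < δ) : ∃ C > 0, ∀ X T : ℝ, 1 ≤ X → 0 ≤ T → ∀ A : Finset ℕ,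
    (∀ n ∈ A, X ≤ n ∧ n ≤ B * X) → ∀ z : ℕ → ℂ, (∀ n ∈ A, ‖z n‖ ≤ 1) → ∀ t₀ : ℝ,
    ∫ t in t₀..(t₀ + T), ‖∑ n ∈ A, z n * e (t * ((n : ℝ) / X) ^ c)‖ ^ 4 ≤ C * ((1 + T / X ^ τ) * X ^ (4 + δ)) := by
  obtain ⟨C, hC, H⟩ := h B δ hB hδ
  refine ⟨C, hC, fun X T hX hT A hA z hz t₀ => ?_⟩
  have hl : 0 < X ^ τ := Real.rpow_pos_of_pos (by linarith) _
  have cf : Continuous fun t : ℝ => ‖∑ n ∈ A, z n * e (t * ((n : ℝ) / X) ^ c)‖ ^ 4 := (cont_es A (fun n => ((n : ℝ) / X) ^ c) z).norm.pow 4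
  have ind : ∀ k : ℕ, ∫ t in t₀..(t₀ + k * X ^ τ), ‖∑ n ∈ A, z n * e (t * ((n : ℝ) / X) ^ c)‖ ^ 4 ≤ k * (C * X ^ (4 + δ)) := fun k => by
    induction k with
    | zero => simp
    | succ k ih =>
      rw [← intervalIntegral.integral_add_adjacent_intervals (b := t₀ + k * X ^ τ) (cf.intervalIntegrable _ _) (cf.intervalIntegrable _ _)]
      have := H X (X ^ τ) hX hl le_rfl A hA z hz (t₀ + k * X ^ τ)
      rw [show t₀ + (k + 1 : ℕ) * X ^ τ = t₀ + k * X ^ τ + X ^ τ by push_cast; ring]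
      push_cast; linarith
  have hk := Nat.lt_floor_add_one (T / X ^ τ)
  have hk2 := Nat.floor_le (show 0 ≤ T / X ^ τ by positivity)
  rw [div_lt_iff₀ hl] at hk
  have hle : T ≤ (⌊T / X ^ τ⌋₊ + 1 : ℕ) * X ^ τ := by push_cast; exact hk.le
  calc _ ≤ ∫ t in t₀..(t₀ + (⌊T / X ^ τ⌋₊ + 1 : ℕ) * X ^ τ), ‖∑ n ∈ A, z n * e (t * ((n : ℝ) / X) ^ c)‖ ^ 4 :=
        intervalIntegral.integral_mono_interval le_rfl (by linarith only [hT]) (by linarith) (Filter.Eventually.of_forall fun x => by positivity) (cf.intervalIntegrable _ _)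
    _ ≤ _ := ind _
    _ ≤ (1 + T / X ^ τ) * (C * X ^ (4 + δ)) := by
        have : 0 ≤ X ^ (4 + δ) := Real.rpow_nonneg (by linarith) _
        gcongr; push_cast; linarith only [hk2]
    _ = _ := by ring

theorem abel4 (n : ℕ) (a b : ℕ → ℂ) (E d : ℝ) (hE : 0 ≤ E) (hd : 0 ≤ d) (ha : ∀ i < n, ‖a i‖ ≤ E) (hda : ∀ i, i + 1 < n → ‖a (i+1) - a i‖ ≤ E * d) :
    ‖∑ i ∈ Finset.range n, a i * b i‖ ^ 4 ≤ 8 * E ^ 4 * (‖∑ i ∈ Finset.range n, b i‖ ^ 4 + d ^ 4 * n ^ 3 * ∑ k ∈ Finset.range n, ‖∑ i ∈ Finset.range (k+1), b i‖ ^ 4) := by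
  rcases n.eq_zero_or_pos with rfl | hn
  · simp
  have h := Finset.sum_range_by_parts a b n
  simp only [smul_eq_mul] at h
  have h1 : ‖∑ i ∈ Finset.range n, a i * b i‖ ≤ E * ‖∑ i ∈ Finset.range n, b i‖ + E * d * ∑ k ∈ Finset.range n, ‖∑ i ∈ Finset.range (k+1), b i‖ := by
    rw [h]
    refine (norm_sub_le _ _).trans (add_le_add ?_ ?_)
    · rw [norm_mul]; gcongr; exact ha _ (by omega)
    · rw [Finset.mul_sum]
      refine (norm_sum_le _ _).trans ((Finset.sum_le_sum fun i hi => ?_).trans (Finset.sum_le_sum_of_subset_of_nonneg (Finset.range_mono (by omega : n - 1 ≤ n)) fun i _ _ => by positivity))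
      rw [norm_mul]; gcongr; exact hda i (by have := Finset.mem_range.1 hi; omega)
  have h2 := pow_sum_le_card_mul_sum_pow (s := Finset.range n) (f := fun k => ‖∑ i ∈ Finset.range (k+1), b i‖) (fun _ _ => norm_nonneg _) 3
  rw [Finset.card_range] at h2
  calc _ ≤ _ := pow_le_pow_left₀ (norm_nonneg _) h1 4
    _ ≤ _ := four_add _ _ (by positivity) (by positivity)
    _ = 8 * E ^ 4 * (‖∑ i ∈ Finset.range n, b i‖ ^ 4 + d ^ 4 * (∑ k ∈ Finset.range n, ‖∑ i ∈ Finset.range (k+1), b i‖) ^ 4) := by ring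
    _ ≤ 8 * E ^ 4 * (‖∑ i ∈ Finset.range n, b i‖ ^ 4 + d ^ 4 * ((n : ℝ) ^ 3 * ∑ k ∈ Finset.range n, ‖∑ i ∈ Finset.range (k+1), b i‖ ^ 4)) := by gcongr
    _ = _ := by ring

/-- the dual sums on a dyadic block -/
theorem dualB (c τ δ q : ℝ) (hc : 1 < c) (hq : 0 < q) (B : ℝ) (hB : 1 ≤ B) (hδ : 0 < δ) (hM : MM (c / (c-1)) τ) : ∃ C > 0, ∀ Y U : ℝ, 1 ≤ Y → 0 < U → ∀ A : Finset ℕ, (∀ n ∈ A, Y ≤ n ∧ n ≤ B * Y) →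
    ∫ t in U..(2 * U), ‖∑ n ∈ A, e (-((c-1) * t * (n * (U * q / Y) / (c * t)) ^ (c / (c-1))))‖ ^ 4 ≤ C * ((1 + U / Y ^ τ) * Y ^ (4 + δ)) := by
  obtain ⟨C, hC, H⟩ := MMx _ τ hM B δ hB hδ
  set d := c / (c-1) with hd
  have hc1 : 0 < c - 1 := by linarith
  have hd1 : (d - 1) * (c - 1) = 1 := by rw [hd]; field_simp; ring
  have hd0 : 0 < d := by positivity
  set κ := (q / (2 * c)) ^ d with hκ
  have hκ0 : 0 < κ := by positivity
  set m := (c-1) * (q / c) ^ d with hm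
  have hm0 : 0 < m := by positivity
  refine ⟨C * (1 + m) / κ, by positivity, fun Y U hY hU A hA => ?_⟩
  set s : ℝ → ℝ := fun t => (c-1) * (U * q / c) ^ d * t ^ (1 - d) with hs
  set s1 : ℝ → ℝ := fun t => (c-1) * (U * q / c) ^ d * ((1 - d) * t ^ (-d)) with hs1
  set G : ℝ → ℝ := fun x => ‖∑ n ∈ A, (1 : ℂ) * e (x * ((n : ℝ) / Y) ^ d)‖ ^ 4 with hG
  have cG : Continuous G := (cont_es A (fun n => ((n : ℝ) / Y) ^ d) fun _ => 1).norm.pow 4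
  have hIcc : Set.uIcc U (2 * U) = Set.Icc U (2 * U) := Set.uIcc_of_le (by linarith)
  have ds : ∀ t ∈ Set.uIcc U (2 * U), HasDerivAt s (s1 t) t := fun t ht => by
    rw [hIcc] at ht
    have := (Real.hasDerivAt_rpow_const (x := t) (p := 1 - d) (Or.inl (by linarith only [hU, ht.1]))).const_mul ((c-1) * (U * q / c) ^ d)
    exact this.congr_deriv (by rw [hs1]; simp only []; rw [show 1 - d - 1 = -d by ring])
  have cs1 : ContinuousOn s1 (Set.uIcc U (2 * U)) := fun t ht => by
    rw [hIcc] at ht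
    exact (continuousAt_const.mul (continuousAt_const.mul (Real.continuousAt_rpow_const t _ (Or.inl (by linarith only [hU, ht.1]))))).continuousWithinAt
  have sub := intervalIntegral.integral_comp_mul_deriv ds cs1 cG
  have eqG : ∀ t > 0, ‖∑ n ∈ A, e (-((c-1) * t * (n * (U * q / Y) / (c * t)) ^ d))‖ ^ 4 = G (s t) := fun t ht => by
    rw [hG]; simp only [one_mul]
    have e1 : ∀ n : ℕ, (c-1) * t * (n * (U * q / Y) / (c * t)) ^ d = s t * ((n : ℝ) / Y) ^ d := fun n => by
      rw [show n * (U * q / Y) / (c * t) = (U * q / c) * (n / Y) / t by field_simp, Real.div_rpow (by positivity) ht.le, Real.mul_rpow (by positivity) (by positivity), hs]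
      simp only []
      rw [Real.rpow_sub ht, Real.rpow_one]; ring
    simp only [e1]
    rw [e_sum_neg]
  have s1neg : ∀ t ∈ Set.Icc U (2 * U), κ ≤ -s1 t := fun t ht => by
    have h0 : 0 < t := by linarith only [hU, ht.1]
    have : -s1 t = (U * q / c / t) ^ d := by
      rw [Real.div_rpow (by positivity) h0.le, hs1]; simp only []
      rw [Real.rpow_neg h0.le]
      linear_combination ((U * q / c) ^ d * (t ^ d)⁻¹) * hd1
    rw [this, hκ]
    refine Real.rpow_le_rpow (by positivity) ?_ hd0.le
    rw [div_div, div_le_div_iff₀ (by positivity) (by positivity)]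
    nlinarith only [mul_le_mul_of_nonneg_left ht.2 (mul_pos hq (by linarith only [hc] : (0:ℝ) < c)).le]
  have sU : s (2 * U) ≤ s U ∧ s U ≤ m * U ∧ 0 ≤ s (2 * U) := by
    simp only [hs]
    refine ⟨?_, ?_, by positivity⟩
    · gcongr ?_ * ?_
      refine Real.rpow_le_rpow_of_nonpos hU (by linarith only [hU]) ?_
      nlinarith only [hd1, hc]
    · rw [hm, show U * q / c = U * (q / c) by ring, Real.mul_rpow hU.le (by positivity), Real.rpow_sub hU, Real.rpow_one]
      apply le_of_eq; field_simp
  have main := H Y (s U - s (2 * U)) hY (by linarith) A hA (fun _ => 1) (fun _ _ => by simp) (s (2 * U))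
  rw [add_sub_cancel] at main
  have low : κ * ∫ t in U..(2 * U), G (s t) ≤ ∫ x in s (2 * U)..s U, G x := by
    rw [intervalIntegral.integral_symm (s U) (s (2 * U)), ← sub, ← intervalIntegral.integral_const_mul, ← intervalIntegral.integral_neg]
    have cgs : ContinuousOn (fun t => G (s t)) (Set.uIcc U (2 * U)) := cG.comp_continuousOn fun t ht => (ds t ht).continuousAt.continuousWithinAt
    refine intervalIntegral.integral_mono_on (by linarith only [hU]) (continuousOn_const.mul cgs).intervalIntegrable (cgs.mul cs1).neg.intervalIntegrable fun t ht => ?_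
    have := mul_le_mul_of_nonneg_right (s1neg t ht) (show 0 ≤ G (s t) by rw [hG]; positivity)
    simp only [Function.comp_apply]; linarith only [this]
  rw [intervalIntegral.integral_congr (g := fun t => G (s t)) fun t ht => eqG t (by rw [hIcc] at ht; linarith only [hU, ht.1])]
  have hYp : 0 < Y ^ τ := Real.rpow_pos_of_pos (by linarith only [hY]) _
  have hYq : 0 ≤ Y ^ (4 + δ) := Real.rpow_nonneg (by linarith only [hY]) _
  rw [div_mul_eq_mul_div, le_div_iff₀ hκ0, mul_comm]
  refine low.trans (main.trans ?_)
  have : 1 + (s U - s (2 * U)) / Y ^ τ ≤ (1 + m) * (1 + U / Y ^ τ) := by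
    have h1 : (s U - s (2 * U)) / Y ^ τ ≤ m * (U / Y ^ τ) := by rw [mul_div_assoc']; gcongr; linarith
    have : 0 ≤ U / Y ^ τ := by positivity
    nlinarith only [hm0, h1, this]
  calc _ ≤ C * ((1 + m) * (1 + U / Y ^ τ) * Y ^ (4 + δ)) := by gcongr
    _ = _ := by ring


set_option maxHeartbeats 1000000 in
theorem BLK (c τ δ α β : ℝ) (hc : 1 < c) (hα : 0 < α) (hαβ : α ≤ β) (hδ : 0 < δ) (hM : MM (c / (c-1)) τ) (w w1 w2 : ℝ → ℝ) (b0 : ∀ v, HasDerivAt w (w1 v) v)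
    (b1 : ∀ v, HasDerivAt w1 (w2 v) v) (b2 : Continuous w2) (z0 : ∀ v, v ≤ α → w v = 0) (z1 : ∀ v, β ≤ v → w v = 0) (z2 : w1 α = 0) (z3 : w1 β = 0) : ∃ q > 0, ∃ C > 0,
    ∀ X U : ℝ, 1 ≤ X → X ≤ U → 1 ≤ U / X * q → ∀ L : ℕ, β * X < L →
    ∫ t in U..(2 * U), ‖∑ n ∈ Finset.range L, (w (n / X) : ℂ) * e (t * (n / X) ^ c)‖ ^ 4 ≤
      C * (U + X ^ 4 / U ^ 2 * ((1 + U / (U / X * q) ^ τ) * (U / X * q) ^ (4 + δ))) := by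
  have hc1 : 0 < c - 1 := by linarith
  have hβ : 0 < β := by linarith
  set p0 := c * α ^ (c-1) with hp0
  set p1 := c * β ^ (c-1) with hp1
  have p0p : 0 < p0 := by positivity
  have p01 : p0 ≤ p1 := by rw [hp0, hp1]; gcongr
  set q := p0 / 2 with hq
  have qp : 0 < q := by positivity
  set r := 1 / (c-1) with hr
  have rp : 0 < r := by positivity
  set lo := q / (2 * c) with hlo
  set hi := 4 * p1 / c with hhi
  have lop : 0 < lo := by positivity
  have lohi : lo ≤ hi := by
    rw [hlo, hhi, div_le_div_iff₀ (by positivity) (by positivity), hq]; linarith [mul_le_mul_of_nonneg_right p01 (by linarith : 0 ≤ c), mul_pos p0p (by linarith : 0 < c)]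
  obtain ⟨_, _, M, Mp, hL⟩ := rpow_lip r lo hi rp lop lohi
  obtain ⟨C1, C1p, hamp⟩ := amp_lip c α β (lo ^ r) (hi ^ r) hc hα hαβ (by positivity) (by gcongr) w w1 w2 b0 b1 b2 (z0 α le_rfl) (z1 β le_rfl) z3
  obtain ⟨C2, C2p, hP⟩ := POI c α β hc hα hαβ w w1 w2 b0 b1 b2 z0 z1 z2 z3
  obtain ⟨C3, C3p, hD⟩ := dualB c τ δ q hc qp (4 * p1 / q) (by rw [le_div_iff₀ qp]; linarith only [p0p, p01, hq]) hδ hM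
  set G := M / c * (4 * p1 + q) with hG
  refine ⟨q, qp, 8 * C2 ^ 4 + 64 * C1 ^ 4 * (1 + G ^ 4) * C3, by positivity, fun X U hX hXU hY L hβL => ?_⟩
  have X0 : 0 < X := by linarith only [hX]
  have U0 : 0 < U := by linarith
  set Y := U / X * q with hYd
  set d := M / c / (U / X) with hd
  set dd := c / (c-1) with hdd
  set a := ⌈Y⌉₊ with ha
  set b := ⌊4 * p1 * (U / X)⌋₊ + 1 with hb
  set n := b - a with hn
  set g : ℝ → ℕ → ℂ := fun t ν => e (-((c-1) * t * (ν * (U * q / Y) / (c * t)) ^ dd)) with hg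
  have UqY : U * q / Y = X := by rw [hYd]; field_simp
  have mem : ∀ k ≤ n, ∀ ν ∈ Finset.Ico a (a + k), Y ≤ ν ∧ ν ≤ 4 * p1 / q * Y := fun k hk ν hν => by
    have h := Finset.mem_Ico.1 hν
    refine ⟨(Nat.le_ceil _).trans (by exact_mod_cast h.1), ?_⟩
    have h1 : ν ≤ ⌊4 * p1 * (U / X)⌋₊ := by omega
    have h2 := (Nat.le_floor_iff (by positivity)).1 h1
    refine h2.trans (le_of_eq ?_); rw [hYd]; field_simp
  set W := C3 * ((1 + U / Y ^ τ) * Y ^ (4 + δ)) with hW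
  have W0 : 0 ≤ W := by positivity
  have dual : ∀ k ≤ n, ∫ t in U..(2 * U), ‖∑ i ∈ Finset.range k, g t (a + i)‖ ^ 4 ≤ W := fun k hk => by
    have := hD Y U hY U0 (Finset.Ico a (a + k)) (mem k hk)
    simp only [Finset.sum_Ico_eq_sum_range, Nat.add_sub_cancel_left] at this
    exact this
  have hIcc : Set.uIcc U (2 * U) = Set.Icc U (2 * U) := Set.uIcc_of_le (by linarith only [hX, hXU])
  have cg : ∀ k, ContinuousOn (fun t => ‖∑ i ∈ Finset.range k, g t (a + i)‖ ^ 4) (Set.uIcc U (2 * U)) := fun k => by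
    refine ContinuousOn.pow (ContinuousOn.norm (continuousOn_finsetSum _ fun i _ => e_cont.comp_continuousOn ?_)) 4
    intro t ht
    rw [hIcc] at ht
    have t0 : t ≠ 0 := by linarith only [hX, hXU, ht.1]
    have c0 : c * t ≠ 0 := by positivity
    refine ContinuousAt.continuousWithinAt (((continuousAt_const.mul continuousAt_id).mul (ContinuousAt.rpow_const (continuousAt_const.div (continuousAt_const.mul continuousAt_id) c0) (Or.inr ?_))).neg)
    positivity
  have n1 : (n : ℝ) ≤ (4 * p1 + q) * (U / X) := by
    have h1 : (n : ℝ) ≤ b := by exact_mod_cast Nat.sub_le _ _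
    have h2 := Nat.floor_le (show 0 ≤ 4 * p1 * (U / X) by positivity)
    have h3 : (b : ℝ) = ⌊4 * p1 * (U / X)⌋₊ + 1 := by rw [hb]; push_cast; ring
    linarith only [hY, h1, h2, h3]
  have dn : d * n ≤ G := by
    calc d * n ≤ d * ((4 * p1 + q) * (U / X)) := by gcongr
      _ = G := by rw [hd, hG]; field_simp
  have pt : ∀ t ∈ Set.Icc U (2 * U), ‖∑ n ∈ Finset.range L, (w (n / X) : ℂ) * e (t * (n / X) ^ c)‖ ^ 4 ≤
      8 * C2 ^ 4 + 8 * X ^ 4 * (8 * (C1 / √U) ^ 4 * (‖∑ i ∈ Finset.range n, g t (a + i)‖ ^ 4 + d ^ 4 * n ^ 3 * ∑ k ∈ Finset.range n, ‖∑ i ∈ Finset.range (k+1), g t (a + i)‖ ^ 4)) := fun t ht => by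
    have t0 : 0 < t := by linarith only [hX, hXU, ht.1]
    set y : ℕ → ℝ := fun i => (((a + i : ℕ) : ℝ) * X / (c * t)) with hy
    have ym : ∀ i < n, y i ∈ Set.Icc lo hi := fun i hi' => by
      obtain ⟨h1, h2⟩ := mem n le_rfl (a + i) (Finset.mem_Ico.2 ⟨by omega, by omega⟩)
      have e1 : Y * X = U * q := by rw [hYd]; field_simp
      have e2 : 4 * p1 / q * Y * X = 4 * p1 * U := by rw [hYd]; field_simp
      have h1' := mul_le_mul_of_nonneg_right h1 X0.le
      have h2' := mul_le_mul_of_nonneg_right h2 X0.le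
      rw [e1] at h1'; rw [e2] at h2'
      constructor
      · rw [hlo, hy, div_le_div_iff₀ (by positivity) (by positivity)]
        have := mul_le_mul_of_nonneg_left ht.2 (mul_pos qp (by linarith only [hc] : 0 < c)).le
        linarith only [this, mul_le_mul_of_nonneg_right h1' (by linarith only [hc] : 0 ≤ 2 * c)]
      · rw [hhi, hy, div_le_div_iff₀ (by positivity) (by positivity)]
        have := mul_le_mul_of_nonneg_left ht.1 (show 0 ≤ 4 * p1 * c by positivity)
        linarith only [this, mul_le_mul_of_nonneg_right h2' (by linarith only [hc] : 0 ≤ c)]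
    have yr : ∀ i < n, y i ^ r ∈ Set.Icc (lo ^ r) (hi ^ r) := fun i hi' => by
      have := ym i hi'
      exact ⟨by gcongr; exact this.1, Real.rpow_le_rpow (by linarith only [lop, this.1]) this.2 rp.le⟩
    have J : ∀ i < n, ∫ u in α..β, (w u : ℂ) * e (t * u ^ c - ((a + i : ℕ) : ℝ) * X * u) = amp w α β c t (y i ^ r) * g t (a + i) := fun i hi' => by
      have yp : 0 < y i := lop.trans_le (ym i hi').1
      rw [amp, ← intervalIntegral.integral_mul_const]
      refine intervalIntegral.integral_congr fun u _ => ?_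
      rw [mul_assoc (w u : ℂ), hg]; simp only []
      rw [← e_add, UqY, ← Real.rpow_mul yp.le, ← Real.rpow_mul yp.le, show r * (c - 1) = 1 by rw [hr]; field_simp, show r * c = dd by rw [hr, hdd]; field_simp, Real.rpow_one]
      congr 2
      have : c * t * y i = ((a + i : ℕ) : ℝ) * X := by simp only [hy]; field_simp
      change _ = _ + -((c-1) * t * (y i) ^ dd)
      linear_combination u * this
    have hR := hP X t hX (by linarith only [hXU, ht.1]) L hβL (Finset.Ico a b) fun ν hν => by
      rw [Finset.mem_Ico, not_and_or, not_le, not_lt] at hν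
      rcases hν with h | h
      · left
        have h1 := mul_lt_mul_of_pos_right (Nat.lt_ceil.1 h) X0
        have e1 : Y * X = U * q := by rw [hYd]; field_simp
        rw [e1, hq] at h1
        linarith only [h1, mul_le_mul_of_nonneg_right ht.1 p0p.le]
      · right
        have h1 := mul_lt_mul_of_pos_right ((Nat.floor_lt (by positivity)).1 (show ⌊4 * p1 * (U / X)⌋₊ < ν by omega)) X0
        have e1 : 4 * p1 * (U / X) * X = 4 * p1 * U := by field_simp
        linarith only [h1, e1, mul_le_mul_of_nonneg_right ht.2 (p0p.le.trans p01)]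
    rw [Finset.sum_Ico_eq_sum_range, Finset.sum_congr rfl fun i hi' => J i (Finset.mem_range.1 hi')] at hR
    have sU : C1 / √t ≤ C1 / √U := by gcongr; exact ht.1
    have ab := abel4 n (fun i => amp w α β c t (y i ^ r)) (fun i => g t (a + i)) (C1 / √U) d (by positivity) (by positivity)
      (fun i hi' => ((hamp t t0).1 _ (yr i hi')).trans sU) fun i hi' => by
        refine ((hamp t t0).2 _ (yr _ hi') _ (yr i (by omega))).trans ?_
        have h1 := ym _ hi'
        have h0 := ym i (by omega)
        have e1 : y (i+1) - y i = X / (c * t) := by simp only [hy]; push_cast; ring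
        have h2 := hL (y i) (y (i+1)) h0.1 (by linarith only [e1, show 0 < X / (c * t) by positivity]) h1.2
        have h3 : y i ^ r ≤ y (i+1) ^ r := Real.rpow_le_rpow (by linarith only [lop, h0.1]) (by linarith only [e1, show 0 < X / (c * t) by positivity]) rp.le
        rw [abs_of_nonneg (by linarith only [h3])]
        have h4 : M * (X / (c * t)) ≤ d := by
          rw [hd, show M / c / (U / X) = M * (X / (c * U)) by field_simp]
          gcongr; exact ht.1
        rw [e1] at h2
        gcongr
        linarith only [h4, h2.2]
    have tri := norm_le_norm_add_norm_sub' (∑ n ∈ Finset.range L, (w (n / X) : ℂ) * e (t * (n / X) ^ c)) (X * ∑ i ∈ Finset.range n, amp w α β c t (y i ^ r) * g t (a + i))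
    rw [norm_mul, Complex.norm_real, Real.norm_of_nonneg X0.le] at tri
    calc _ ≤ (X * ‖∑ i ∈ Finset.range n, amp w α β c t (y i ^ r) * g t (a + i)‖ + C2) ^ 4 := by gcongr; exact tri.trans (add_le_add_right hR _)
      _ ≤ _ := four_add _ _ (by positivity) C2p.le
      _ = 8 * C2 ^ 4 + 8 * X ^ 4 * ‖∑ i ∈ Finset.range n, amp w α β c t (y i ^ r) * g t (a + i)‖ ^ 4 := by ring
      _ ≤ _ := by gcongr
  have cF : Continuous fun t : ℝ => ‖∑ n ∈ Finset.range L, (w (n / X) : ℂ) * e (t * (n / X) ^ c)‖ ^ 4 := (cont_es (Finset.range L) (fun n => ((n : ℝ) / X) ^ c) fun n => (w (n / X) : ℂ)).norm.pow 4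
  have i1 : ∀ k, IntervalIntegrable (fun t => ‖∑ i ∈ Finset.range k, g t (a + i)‖ ^ 4) volume U (2 * U) := fun k => (cg k).intervalIntegrable
  have i2 : IntervalIntegrable (fun t => d ^ 4 * n ^ 3 * ∑ k ∈ Finset.range n, ‖∑ i ∈ Finset.range (k+1), g t (a + i)‖ ^ 4) volume U (2 * U) :=
    (continuousOn_const.mul (continuousOn_finsetSum _ fun k _ => cg (k+1))).intervalIntegrable
  refine (intervalIntegral.integral_mono_on (by linarith only [hX, hXU]) (cF.intervalIntegrable _ _) (intervalIntegrable_const.add ((((i1 n).add i2).const_mul _).const_mul _)) pt).trans ?_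
  rw [intervalIntegral.integral_add intervalIntegrable_const ((((i1 n).add i2).const_mul _).const_mul _), intervalIntegral.integral_const, intervalIntegral.integral_const_mul, intervalIntegral.integral_const_mul,
    intervalIntegral.integral_add (i1 n) i2, intervalIntegral.integral_const_mul, intervalIntegral.integral_finsetSum fun k _ => i1 (k+1)]
  have s1 : ∑ k ∈ Finset.range n, ∫ t in U..(2 * U), ‖∑ i ∈ Finset.range (k+1), g t (a + i)‖ ^ 4 ≤ n * W := by
    refine (Finset.sum_le_card_nsmul _ _ W fun k hk => dual (k+1) (by have := Finset.mem_range.1 hk; omega)).trans ?_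
    simp
  have hE : (C1 / √U) ^ 4 = C1 ^ 4 / U ^ 2 := by
    rw [div_pow, show (√U) ^ 4 = ((√U) ^ 2) ^ 2 by ring, Real.sq_sqrt U0.le]
  rw [hE]
  have dn4 : d ^ 4 * n ^ 3 * (n * W) ≤ G ^ 4 * W := by
    rw [show d ^ 4 * (n:ℝ) ^ 3 * (n * W) = (d * n) ^ 4 * W by ring]; gcongr
  calc _ ≤ (2 * U - U) • (8 * C2 ^ 4) + 8 * X ^ 4 * (8 * (C1 ^ 4 / U ^ 2) * (W + d ^ 4 * n ^ 3 * (n * W))) := by gcongr; exact dual n le_rfl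
    _ ≤ (2 * U - U) • (8 * C2 ^ 4) + 8 * X ^ 4 * (8 * (C1 ^ 4 / U ^ 2) * (W + G ^ 4 * W)) := by gcongr
    _ = 8 * C2 ^ 4 * U + 64 * C1 ^ 4 * (1 + G ^ 4) * C3 * (X ^ 4 / U ^ 2 * ((1 + U / Y ^ τ) * Y ^ (4 + δ))) := by
        rw [hW, smul_eq_mul]; ring
    _ ≤ _ := by
        have : 0 ≤ X ^ 4 / U ^ 2 * ((1 + U / Y ^ τ) * Y ^ (4 + δ)) := by positivity
        have h5 : 0 ≤ 64 * C1 ^ 4 * (1 + G ^ 4) * C3 := by positivity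
        have h6 : 0 ≤ 8 * C2 ^ 4 := by positivity
        linarith only [mul_nonneg h6 this, mul_nonneg h5 U0.le]


theorem bump (B : ℝ) (hB : 1 ≤ B) : ∃ w w1 w2 : ℝ → ℝ, (∀ v, HasDerivAt w (w1 v) v) ∧ (∀ v, HasDerivAt w1 (w2 v) v) ∧ Continuous w2 ∧ (∀ v, v ≤ 1 / 2 → w v = 0) ∧
    (∀ v, B + 1 / 2 ≤ v → w v = 0) ∧ w1 (1 / 2) = 0 ∧ w1 (B + 1 / 2) = 0 ∧ (∀ v, 1 ≤ v → v ≤ B → w v = 1) ∧ (∀ v, 0 ≤ w v ∧ w v ≤ 1) := by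
  let f : ContDiffBump ((B + 1) / 2 : ℝ) := ⟨B / 2 - 1 / 4, B / 2, by linarith, by linarith⟩
  have hf : ContDiff ℝ 2 f := f.contDiff
  have hf1 : ContDiff ℝ 1 (deriv f) := hf.deriv' 
  have z0 : ∀ v, v ≤ 1 / 2 → f v = 0 := fun v hv => f.zero_of_le_dist (by
    rw [Real.dist_eq]; change B / 2 ≤ _; exact le_trans (by linarith) (neg_le_abs _))
  have z1 : ∀ v, B + 1 / 2 ≤ v → f v = 0 := fun v hv => f.zero_of_le_dist (by
    rw [Real.dist_eq]; change B / 2 ≤ _; exact le_trans (by linarith) (le_abs_self _))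
  have dz : ∀ v, f v = 0 → deriv f v = 0 := fun v hv => IsLocalMin.deriv_eq_zero (Filter.Eventually.of_forall fun u => by rw [hv]; exact f.nonneg)
  refine ⟨f, deriv f, deriv (deriv f), fun v => (hf.differentiable (by norm_num) v).hasDerivAt, fun v => (hf1.differentiable (by norm_num) v).hasDerivAt, hf1.continuous_deriv (by norm_num), z0, z1,
    dz _ (z0 _ le_rfl), dz _ (z1 _ le_rfl), fun v h1 h2 => f.one_of_mem_closedBall ?_, fun v => ⟨f.nonneg, f.le_one⟩⟩
  rw [Metric.mem_closedBall, Real.dist_eq]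
  change _ ≤ B / 2 - 1 / 4
  rw [abs_le]; constructor <;> linarith

theorem M2s (c : ℝ) (hc : 1 < c) (κ X : ℝ) (hκ : 0 < κ) (hX : 0 < X) (A : Finset ℕ) (hA : ∀ n ∈ A, κ * X ≤ n) (z : ℕ → ℂ) (hz : ∀ n ∈ A, ‖z n‖ ≤ 1) :
    ∫ t in (0:ℝ)..(κ ^ (1 - c) * X), ‖∑ n ∈ A, z n * e (t * ((n : ℝ) / X) ^ c)‖ ^ 2 ≤ κ ^ (-c) * (8 * A.card * (κ * X)) := by
  have h := M2 c hc (κ * X) 1 (by positivity) zero_le_one A hA z hz 0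
  have hk : 0 < κ ^ c := by positivity
  have e1 : ∀ t : ℝ, ‖∑ n ∈ A, z n * e (t * ((n : ℝ) / X) ^ c)‖ ^ 2 = (fun s : ℝ => ‖∑ n ∈ A, z n * e (s * ((n : ℝ) / (κ * X)) ^ c)‖ ^ 2) (t * κ ^ c) := fun t => by
    simp only []
    congr 2
    refine Finset.sum_congr rfl fun n _ => ?_
    rw [mul_assoc, ← Real.mul_rpow hκ.le (by positivity)]; congr 4; field_simp
  simp only [e1]
  rw [intervalIntegral.integral_comp_mul_right (fun s : ℝ => ‖∑ n ∈ A, z n * e (s * ((n : ℝ) / (κ * X)) ^ c)‖ ^ 2) hk.ne', zero_mul, show κ ^ (1 - c) * X * κ ^ c = 0 + κ * X by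
    rw [Real.rpow_sub hκ, Real.rpow_one]; field_simp; ring, smul_eq_mul, Real.rpow_neg hκ.le]
  gcongr
  simpa using h

theorem blk_bd (X U q τ δ σ : ℝ) (hX : 1 ≤ X) (hXU : X ≤ U) (hq : 0 < q) (h1 : 1 ≤ τ) (h2 : τ < 2) (hδ : 0 < δ) (hσ : σ = 1 + 1 / (3 - τ)) (hU : U ≤ X ^ σ) :
    U + X ^ 4 / U ^ 2 * ((1 + U / (U / X * q) ^ τ) * (U / X * q) ^ (4 + δ)) ≤ (1 + q ^ (4 + δ) + q ^ (4 + δ - τ)) * X ^ (4 + δ) := by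
  have X0 : 0 < X := by linarith
  obtain ⟨v, rfl⟩ : ∃ v, U = v * X := ⟨U / X, by field_simp⟩
  have v1 : 1 ≤ v := by by_contra h; push Not at h; nlinarith only [hXU, h, hX]
  have v0 : 0 < v := by linarith
  have vs : v ≤ X ^ (1 / (3 - τ)) := by
    rw [hσ, Real.rpow_add X0, Real.rpow_one] at hU; nlinarith only [hU, hX]
  have vX : v ≤ X := by
    refine vs.trans ?_
    conv_rhs => rw [← Real.rpow_one X]
    refine Real.rpow_le_rpow_of_exponent_le hX ?_
    rw [div_le_one (by linarith)]; linarith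
  have vt : v ^ (3 - τ) ≤ X := by
    calc _ ≤ (X ^ (1 / (3 - τ))) ^ (3 - τ) := Real.rpow_le_rpow v0.le vs (by linarith)
      _ = X := by rw [← Real.rpow_mul X0.le, one_div_mul_cancel (by linarith), Real.rpow_one]
  have e1 : X ^ 4 / (v * X) ^ 2 * ((1 + v * X / (v * X / X * q) ^ τ) * (v * X / X * q) ^ (4 + δ)) =
      q ^ (4 + δ) * (X ^ 2 * (v ^ 2 * v ^ δ)) + q ^ (4 + δ - τ) * (X ^ 3 * (v ^ (3 - τ) * v ^ δ)) := by
    rw [show v * X / X * q = v * q by field_simp, Real.mul_rpow v0.le hq.le, Real.mul_rpow v0.le hq.le, Real.rpow_sub hq, Real.rpow_sub v0, Real.rpow_add v0,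
      show (4:ℝ) = (4:ℕ) by norm_num, show (3:ℝ) = (3:ℕ) by norm_num, Real.rpow_natCast, Real.rpow_natCast]
    have : 0 < v ^ τ := by positivity
    have : 0 < q ^ τ := by positivity
    field_simp
  rw [e1]
  have hd : v ^ δ ≤ X ^ δ := Real.rpow_le_rpow v0.le vX hδ.le
  have hX4 : X ^ (4 + δ) = X ^ 4 * X ^ δ := by rw [Real.rpow_add X0]; norm_cast
  have b1 : X ^ 2 * (v ^ 2 * v ^ δ) ≤ X ^ (4 + δ) := by
    rw [hX4]; calc _ ≤ X ^ 2 * (X ^ 2 * X ^ δ) := by gcongr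
      _ = _ := by ring
  have b2 : X ^ 3 * (v ^ (3 - τ) * v ^ δ) ≤ X ^ (4 + δ) := by
    rw [hX4]; calc _ ≤ X ^ 3 * (X * X ^ δ) := by gcongr
      _ = _ := by ring
  have b3 : v * X ≤ X ^ (4 + δ) := by
    rw [hX4]; calc _ ≤ X * X := by gcongr
      _ = X ^ 2 * 1 := by ring
      _ ≤ X ^ 4 * X ^ δ := mul_le_mul (pow_le_pow_right₀ hX (by norm_num)) (Real.one_le_rpow hX hδ.le) zero_le_one (by positivity)
  have := mul_le_mul_of_nonneg_left b1 (show 0 ≤ q ^ (4 + δ) by positivity)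
  have := mul_le_mul_of_nonneg_left b2 (show 0 ≤ q ^ (4 + δ - τ) by positivity)
  linarith

set_option maxHeartbeats 1000000 in
theorem MM_succ (τ : ℝ) (h1 : 1 ≤ τ) (h2 : τ < 2) (H : ∀ c, 1 < c → MM c τ) (c : ℝ) (hc : 1 < c) : MM c (1 + 1 / (3 - τ)) := by
  intro B δ₂ hB hδ₂
  set σ := 1 + 1 / (3 - τ) with hσ
  set δ := δ₂ / 2 with hδd
  have hδ : 0 < δ := by positivity
  obtain ⟨w, w1, w2, b0, b1, b2, z0, z1, z2, z3, wone, w01⟩ := bump B hB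
  set β := B + 1 / 2 with hβ
  obtain ⟨q, hq, C, hC, hb⟩ := BLK c τ δ (1/2) β hc (by norm_num) (by linarith) hδ (H _ (by rw [lt_div_iff₀] <;> linarith only [hc])) w w1 w2 b0 b1 b2 z0 z1 z2 z3
  set C0 := 1 + 1 / q with hC0
  have C0p : 0 < C0 := by positivity
  obtain ⟨κ, hκ, hκ2, hκ3⟩ : ∃ κ : ℝ, 0 < κ ∧ κ ≤ 1 / 2 ∧ 2 * C0 ≤ κ ^ (1 - c) := by
    have := ((tendsto_rpow_neg_nhdsGT_zero (show 1 - c < 0 by linarith only [hc])).eventually_ge_atTop (2 * C0)).and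
      (Ioo_mem_nhdsGT (show (0:ℝ) < 1 / 2 by norm_num))
    obtain ⟨κ, h, h'⟩ := this.exists
    exact ⟨κ, h'.1, h'.2.le, h⟩
  set D := (2 * β) ^ 2 * (κ ^ (-c) * (8 * (2 * β) * κ)) with hD
  set E := C * (1 + q ^ (4 + δ) + q ^ (4 + δ - τ)) with hE
  have Dp : 0 ≤ D := by positivity
  have Ep : 0 ≤ E := by positivity
  refine ⟨4 * (D + E + 4 * E / δ + 1), by positivity, fun X T hX hT0 hT A hA z hz t₀ => ?_⟩
  have X0 : 0 < X := by linarith only [hX]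
  set L := ⌊β * X⌋₊ + 1 with hL
  have hβL : β * X < L := by rw [hL]; push_cast; exact Nat.lt_floor_add_one _
  set F : ℝ → ℂ := fun t => ∑ n ∈ Finset.range L, (w (n / X) : ℂ) * e (t * ((n : ℝ) / X) ^ c) with hF
  have cF : Continuous fun t => ‖F t‖ ^ 4 := (cont_es (Finset.range L) (fun n => ((n : ℝ) / X) ^ c) fun n => (w (n / X) : ℂ)).norm.pow 4
  have iF : ∀ a b, IntervalIntegrable (fun t => ‖F t‖ ^ 4) volume a b := fun a b => cF.intervalIntegrable a b
  -- the small range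
  have small : ∀ V, 0 ≤ V → V ≤ 2 * C0 * X → ∫ t in (0:ℝ)..V, ‖F t‖ ^ 4 ≤ D * X ^ (4 + δ) := fun V hV hV2 => by
    set A' := (Finset.range L).filter fun n : ℕ => κ * X ≤ n with hA'
    have eF : ∀ t, F t = ∑ n ∈ A', (w (n / X) : ℂ) * e (t * ((n : ℝ) / X) ^ c) := fun t => by
      rw [hF, hA', Finset.sum_filter]
      refine Finset.sum_congr rfl fun n _ => ?_
      split_ifs with h
      · rfl
      · rw [z0, Complex.ofReal_zero, zero_mul]
        push Not at h
        rw [div_le_iff₀ X0]; linarith only [h, mul_le_mul_of_nonneg_right hκ2 X0.le]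
    have hcard : (A'.card : ℝ) ≤ 2 * (β * X) := card_le A' _ (by rw [hβ]; linarith only [hX, mul_le_mul hB hX zero_le_one (by linarith only [hB])]) fun n hn => by
      have h := Finset.mem_range.1 (Finset.mem_filter.1 hn).1
      exact (Nat.le_floor_iff (by positivity)).1 (by omega)
    have hz1 : ∀ n ∈ A', ‖(w (n / X) : ℂ)‖ ≤ 1 := fun n _ => by rw [Complex.norm_real, Real.norm_of_nonneg (w01 _).1]; exact (w01 _).2
    have sup : ∀ t, ‖F t‖ ≤ 2 * (β * X) := fun t => by
      rw [eF]
      refine (norm_sum_le_of_le A' (n := fun _ => 1) fun n hn => by rw [norm_mul, e_norm, mul_one]; exact hz1 n hn).trans ?_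
      simpa using hcard
    have c2 : Continuous fun t => ‖F t‖ ^ 2 := (cont_es (Finset.range L) (fun n => ((n : ℝ) / X) ^ c) fun n => (w (n / X) : ℂ)).norm.pow 2
    have m2 := M2s c hc κ X hκ X0 A' (fun n hn => (Finset.mem_filter.1 hn).2) (fun n => (w (n / X) : ℂ)) hz1
    simp only [← eF] at m2
    have hV3 : V ≤ κ ^ (1 - c) * X := hV2.trans (by gcongr)
    calc _ ≤ ∫ t in (0:ℝ)..(κ ^ (1 - c) * X), ‖F t‖ ^ 4 := intervalIntegral.integral_mono_interval le_rfl hV hV3 (Filter.Eventually.of_forall fun x => by positivity) (iF _ _)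
      _ ≤ ∫ t in (0:ℝ)..(κ ^ (1 - c) * X), (2 * (β * X)) ^ 2 * ‖F t‖ ^ 2 := by
        refine intervalIntegral.integral_mono_on (by positivity) (iF _ _) ((continuous_const.mul c2).intervalIntegrable _ _) fun t _ => ?_
        rw [show (4 : ℕ) = 2 + 2 by norm_num, pow_add]; gcongr; exact sup t
      _ ≤ (2 * (β * X)) ^ 2 * (κ ^ (-c) * (8 * (2 * (β * X)) * (κ * X))) := by
        rw [intervalIntegral.integral_const_mul]; gcongr; exact m2.trans (by gcongr)
      _ = D * X ^ (4 : ℝ) := by rw [hD]; norm_num; ring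
      _ ≤ _ := by gcongr; linarith only [hδ]
  have dy : ∀ m : ℕ, ∀ V, 0 ≤ V → V ≤ 2 ^ m * (2 * C0 * X) → V ≤ 2 * X ^ σ → ∫ t in (0:ℝ)..V, ‖F t‖ ^ 4 ≤ (D + m * E) * X ^ (4 + δ) := fun m => by
    induction m with
    | zero => intro V h0 h1 _; simpa using small V h0 (by simpa using h1)
    | succ m ih =>
      intro V hV0 hV1 hV2
      have ex : 0 ≤ X ^ (4 + δ) := by positivity
      by_cases h : V ≤ 2 * C0 * X
      · refine (small V hV0 h).trans ?_
        gcongr; have : 0 ≤ ((m+1 : ℕ) : ℝ) * E := by positivity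
        linarith only [this]
      push Not at h
      have i1 := ih (V / 2) (by linarith only [hV0]) (by rw [pow_succ] at hV1; linarith only [hV1]) (by linarith only [hT0, hT, hV2])
      have hU : C0 * X ≤ V / 2 := by linarith only [h]
      have hCq : C0 * q = q + 1 := by rw [hC0]; field_simp
      have hUX : X ≤ V / 2 := by
        refine le_trans ?_ hU; rw [hC0]; linarith only [mul_pos (show 0 < 1 / q by positivity) X0]
      have i2 := hb X (V / 2) hX hUX (by
        rw [div_mul_eq_mul_div, le_div_iff₀ X0]
        have u1 := mul_le_mul_of_nonneg_right hU hq.le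
        rw [show C0 * X * q = q * X + X by linear_combination X * hCq] at u1
        linarith only [u1, mul_pos hq X0]) L hβL
      have i3 := blk_bd X (V / 2) q τ δ σ hX hUX hq h1 h2 hδ hσ (by linarith only [hV2])
      rw [show 2 * (V / 2) = V by ring] at i2
      rw [← intervalIntegral.integral_add_adjacent_intervals (iF 0 (V/2)) (iF (V/2) V)]
      have i4 := (i2.trans (mul_le_mul_of_nonneg_left i3 hC.le)).trans_eq (show _ = E * X ^ (4 + δ) by rw [hE]; ring)
      push_cast
      linarith only [i1, i4]
  set m := ⌈4 * Real.log X⌉₊ with hm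
  have lX : 0 ≤ Real.log X := Real.log_nonneg hX
  have m1 : (m : ℝ) ≤ 4 * Real.log X + 1 := (Nat.ceil_lt_add_one (by positivity)).le
  have m2 : X ^ σ ≤ 2 ^ m := by
    have hs2 : σ ≤ 2 := by
      rw [hσ]; have : 1 / (3 - τ) ≤ 1 := by rw [div_le_one (by linarith only [h2])]; linarith only [h2]
      linarith only [this]
    rw [← Real.rpow_natCast, Real.rpow_def_of_pos X0, Real.rpow_def_of_pos two_pos]
    refine Real.exp_le_exp.2 ?_
    have := Nat.le_ceil (4 * Real.log X)
    have l2 : 1 / 2 ≤ Real.log 2 := by linarith only [Real.log_two_gt_d9]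
    have a1 := mul_le_mul_of_nonneg_left hs2 lX
    have a2 := mul_le_mul l2 this (by positivity) (by linarith only [l2])
    linarith only [a1, a2]
  have main := dy m (2 * T) (by linarith only [hT0]) (by
    have h3 : 2 * 1 ≤ 2 * C0 * X := by
      have : 1 ≤ C0 := by rw [hC0]; linarith only [show 0 < 1 / q by positivity]
      have := mul_le_mul this hX zero_le_one C0p.le
      linarith only [this]
    have h4 := mul_le_mul m2 h3 (by norm_num) (by positivity)
    linarith only [hT, h4]) (by linarith only [hT])
  have neg : ∫ t in (-(2 * T))..0, ‖F t‖ ^ 4 = ∫ t in (0:ℝ)..(2 * T), ‖F t‖ ^ 4 := by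
    have := intervalIntegral.integral_comp_neg (a := 0) (b := 2 * T) (fun t => ‖F t‖ ^ 4)
    rw [neg_zero] at this
    rw [← this]
    refine intervalIntegral.integral_congr fun t _ => ?_
    have : F (-t) = starRingEnd ℂ (F t) := by
      rw [hF]; simp only [map_sum, map_mul, Complex.conj_ofReal, ← e_neg, neg_mul]
    simp only [this, RCLike.norm_conj]
  have mj := MJ4 (Finset.range L) (fun n => ((n : ℝ) / X) ^ c) (fun n => if n ∈ A then z n else 0) (fun n => w (n / X)) (fun n _ => by
    split_ifs with h
    · rw [wone _ (by rw [le_div_iff₀ X0]; linarith only [(hA n h).1]) (by rw [div_le_iff₀ X0]; exact (hA n h).2)]; exact hz n h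
    · simpa using (w01 _).1) T t₀ hT0
  have eA : ∀ t : ℝ, ∑ n ∈ Finset.range L, (if n ∈ A then z n else 0) * e (t * ((n : ℝ) / X) ^ c) = ∑ n ∈ A, z n * e (t * ((n : ℝ) / X) ^ c) := fun t => by
    simp only [ite_mul, zero_mul]
    rw [← Finset.sum_filter]
    refine Finset.sum_congr (Finset.ext fun n => ?_) fun _ _ => rfl
    simp only [Finset.mem_filter, Finset.mem_range, and_iff_right_iff_imp]
    intro h
    have := (hA n h).2
    exact_mod_cast lt_of_le_of_lt (show (n : ℝ) ≤ β * X by rw [hβ]; linarith only [hX, this]) hβL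
  simp only [eA] at mj
  refine mj.trans ?_
  rw [← intervalIntegral.integral_add_adjacent_intervals (iF (-(2*T)) 0) (iF 0 (2*T)), neg]
  have lg := Real.log_le_rpow_div X0.le hδ
  have x1 : 1 ≤ X ^ δ := Real.one_le_rpow hX hδ.le
  have fin : D + m * E ≤ (D + E + 4 * E / δ) * X ^ δ := by
    have a1 : m * E ≤ (4 * (X ^ δ / δ) + 1) * E := by gcongr; linarith only [m1, lg]
    have a2 : (4 * (X ^ δ / δ) + 1) * E = 4 * E / δ * X ^ δ + E := by ring
    have := mul_le_mul_of_nonneg_left x1 Dp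
    have := mul_le_mul_of_nonneg_left x1 Ep
    linarith
  have e4 : X ^ (4 + δ₂) = X ^ δ * X ^ (4 + δ) := by rw [← Real.rpow_add X0]; congr 1; rw [hδd]; ring
  rw [e4]
  have x4 : 0 ≤ X ^ (4 + δ) := by positivity
  have := mul_le_mul_of_nonneg_right fin x4
  have : 0 ≤ X ^ δ * X ^ (4 + δ) := by positivity
  linarith

theorem MM_all (n : ℕ) : ∀ c, 1 < c → MM c (2 - 1 / (n + 1)) := by
  induction n with
  | zero => intro c hc; rw [show (2:ℝ) - 1 / ((0:ℕ) + 1) = 1 by norm_num]; exact MM_one c hc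
  | succ n ih =>
    intro c hc
    have h0 : (0:ℝ) < n + 1 := by positivity
    have := MM_succ _ (by have : 1 / ((n:ℝ) + 1) ≤ 1 := by rw [div_le_one h0]; linarith [show (0:ℝ) ≤ n by positivity]
                          linarith) (by have : 0 < 1 / ((n:ℝ) + 1) := by positivity
                                        linarith) ih c hc
    convert this using 1
    rw [show (3:ℝ) - (2 - 1 / (n + 1)) = (n + 2) / (n + 1) by field_simp; ring, one_div_div]
    push_cast; field_simp; ring


/-- a weighted Halász–Montgomery large value estimate -/
theorem HAL (B : Finset ℕ) (μ l : ℕ → ℝ) (a b V M Q D : ℝ) (k : ℝ → ℝ) (hab : a ≤ b) (hV : 0 < V) (hk : Continuous k) (k0 : ∀ u, 0 ≤ k u) (ke : ∀ u, k (-u) = k u)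
    (hF : ∀ u, |u| ≤ b - a → ‖∑ n ∈ B, e (u * μ n)‖ ≤ k u + M) (hD : ∀ t ∈ Set.Icc a b, ∫ s in a..b, k (t - s) ≤ D) (P : ℝ → ℂ) (hP : ∀ t, P t = ∑ n ∈ B, (l n : ℂ) * e (t * μ n))
    (hQ : ∀ t ∈ Set.Icc a b, ‖P t‖ ≤ Q) (hW : (∑ n ∈ B, l n ^ 2) * M ≤ V ^ 2 / 2) :
    ∫ t in a..b, ‖P t‖ ^ 6 ≤ V ^ 2 * (∫ t in a..b, ‖P t‖ ^ 4) + 2 * (∑ n ∈ B, l n ^ 2) * Q ^ 4 * D := by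
  set W := ∑ n ∈ B, l n ^ 2 with hWd
  have W0 : 0 ≤ W := Finset.sum_nonneg fun n _ => sq_nonneg _
  have cP : Continuous P := by rw [funext hP]; exact cont_es B μ fun n => (l n : ℂ)
  set A := Set.Icc a b ∩ {t | V < ‖P t‖} with hA
  have mA : MeasurableSet A := measurableSet_Icc.inter (isOpen_lt continuous_const cP.norm).measurableSet
  set m := volume.restrict A with hm
  have A1 : A ⊆ Set.Icc a b := Set.inter_subset_left
  have : IsFiniteMeasure m := ⟨by rw [hm, Measure.restrict_apply_univ]; exact (measure_mono A1).trans_lt measure_Icc_lt_top⟩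
  have igR : ∀ g : ℝ → ℝ, Continuous g → Integrable g m := fun g hg => (hg.integrableOn_Icc (a := a) (b := b)).mono_set A1
  have igC : ∀ g : ℝ → ℂ, Continuous g → Integrable g m := fun g hg => (hg.integrableOn_Icc (a := a) (b := b)).mono_set A1
  have pm : m.prod m = volume.restrict (A ×ˢ A) := by rw [hm, Measure.prod_restrict]; rfl
  have ipR : ∀ g : ℝ × ℝ → ℝ, Continuous g → Integrable g (m.prod m) := fun g hg => by
    rw [pm]; exact (hg.continuousOn.integrableOn_compact (isCompact_Icc.prod isCompact_Icc)).mono_set (Set.prod_mono A1 A1)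
  have ipC : ∀ g : ℝ × ℝ → ℂ, Continuous g → Integrable g (m.prod m) := fun g hg => by
    rw [pm]; exact (hg.continuousOn.integrableOn_compact (isCompact_Icc.prod isCompact_Icc)).mono_set (Set.prod_mono A1 A1)
  have aeA : ∀ᵐ t ∂m, t ∈ A := ae_restrict_mem mA
  set Z := ∫ t, ‖P t‖ ^ 6 ∂m with hZ
  have Z0 : 0 ≤ Z := integral_nonneg fun t => by positivity
  set h : ℝ → ℂ := fun t => starRingEnd ℂ (P t) * (‖P t‖ : ℂ) ^ 4 with hh
  have ch : Continuous h := (Complex.continuous_conj.comp cP).mul ((Complex.continuous_ofReal.comp cP.norm).pow 4)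
  have nh : ∀ t, ‖h t‖ = ‖P t‖ ^ 5 := fun t => by rw [hh]; simp [pow_succ]; ring
  set H : ℕ → ℂ := fun n => ∫ t, h t * e (t * μ n) ∂m with hH
  have ce : ∀ n, Continuous fun t : ℝ => e (t * μ n) := fun n => e_cont.comp (by fun_prop)
  have z1 : (Z : ℂ) = ∑ n ∈ B, (l n : ℂ) * H n := by
    have : ∀ t, ((‖P t‖ ^ 6 : ℝ) : ℂ) = ∑ n ∈ B, (l n : ℂ) * (h t * e (t * μ n)) := fun t => by
      have e1 : ∑ n ∈ B, (l n : ℂ) * (h t * e (t * μ n)) = h t * P t := by rw [hP t, Finset.mul_sum]; exact Finset.sum_congr rfl fun n _ => by ring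
      rw [e1, hh]; push_cast
      linear_combination (-(‖P t‖ : ℂ) ^ 4) * Complex.conj_mul' (P t)
    rw [hZ, ← integral_complex_ofReal]
    simp only [this]
    have ig : ∀ n ∈ B, Integrable (fun t => (l n : ℂ) * (h t * e (t * μ n))) m := fun n _ => (igC (fun t => h t * e (t * μ n)) (ch.mul (ce n))).const_mul _
    rw [integral_finsetSum _ ig]
    simp only [integral_const_mul, hH]
  have z2 : Z ^ 2 ≤ W * ∑ n ∈ B, ‖H n‖ ^ 2 := by
    have : Z ≤ ∑ n ∈ B, |l n| * ‖H n‖ := by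
      have h1 : Z = ‖(Z : ℂ)‖ := by rw [Complex.norm_real, Real.norm_of_nonneg Z0]
      rw [h1, z1]
      exact norm_sum_le_of_le _ fun n _ => by rw [norm_mul, Complex.norm_real, Real.norm_eq_abs]
    refine (pow_le_pow_left₀ Z0 this 2).trans ((Finset.sum_mul_sq_le_sq_mul_sq B _ _).trans_eq ?_)
    simp only [sq_abs, hWd]
  have z3 : ((∑ n ∈ B, ‖H n‖ ^ 2 : ℝ) : ℂ) = ∫ z, h z.1 * starRingEnd ℂ (h z.2) * ∑ n ∈ B, e ((z.1 - z.2) * μ n) ∂(m.prod m) := by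
    have : ∀ n, ((‖H n‖ ^ 2 : ℝ) : ℂ) = ∫ z, (h z.1 * e (z.1 * μ n)) * (starRingEnd ℂ (h z.2 * e (z.2 * μ n))) ∂(m.prod m) := fun n => by
      rw [integral_prod_mul (fun t => h t * e (t * μ n)) fun t => starRingEnd ℂ (h t * e (t * μ n)), integral_conj, Complex.mul_conj']; push_cast; rfl
    push_cast at this ⊢
    simp only [this]
    rw [← integral_finsetSum _ fun n _ => ipC (fun z : ℝ × ℝ => (h z.1 * e (z.1 * μ n)) * (starRingEnd ℂ (h z.2 * e (z.2 * μ n)))) (((ch.comp continuous_fst).mul ((ce n).comp continuous_fst)).mul (Complex.continuous_conj.comp ((ch.comp continuous_snd).mul ((ce n).comp continuous_snd))))]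
    congr 1; funext z
    rw [Finset.mul_sum]
    refine Finset.sum_congr rfl fun n _ => ?_
    rw [sub_mul, sub_eq_add_neg, e_add, e_neg, map_mul]; ring
  have ch2 : Continuous fun t => ‖h t‖ := ch.norm
  have ck : Continuous fun z : ℝ × ℝ => k (z.1 - z.2) := hk.comp (continuous_fst.sub continuous_snd)
  have i1 := ipR (fun z => ‖h z.1‖ ^ 2 * k (z.1 - z.2)) (((ch2.comp continuous_fst).pow 2).mul ck)
  have i2 := ipR (fun z => ‖h z.2‖ ^ 2 * k (z.1 - z.2)) (((ch2.comp continuous_snd).pow 2).mul ck)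
  have i3 := ipR (fun z => ‖h z.1‖ * ‖h z.2‖) ((ch2.comp continuous_fst).mul (ch2.comp continuous_snd))
  have z4 : ∑ n ∈ B, ‖H n‖ ^ 2 ≤ ∫ z, 2⁻¹ * (‖h z.1‖ ^ 2 * k (z.1 - z.2) + ‖h z.2‖ ^ 2 * k (z.1 - z.2)) + M * (‖h z.1‖ * ‖h z.2‖) ∂(m.prod m) := by
    have n0 : 0 ≤ ∑ n ∈ B, ‖H n‖ ^ 2 := by positivity
    calc _ = ‖((∑ n ∈ B, ‖H n‖ ^ 2 : ℝ) : ℂ)‖ := by rw [Complex.norm_real, Real.norm_of_nonneg n0]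
      _ ≤ _ := by
        rw [z3]
        refine norm_integral_le_of_norm_le (((i1.add i2).const_mul _).add (i3.const_mul _)) ?_
        have : ∀ᵐ z ∂(m.prod m), z ∈ A ×ˢ A := by rw [pm]; exact ae_restrict_mem (mA.prod mA)
        filter_upwards [this] with z hz
        have t1 := A1 hz.1
        have t2 := A1 hz.2
        rw [norm_mul, norm_mul, RCLike.norm_conj]
        have hf := hF (z.1 - z.2) (by rw [abs_le]; constructor <;> linarith only [t1.1, t1.2, t2.1, t2.2])
        have q1 := mul_le_mul_of_nonneg_left hf (show 0 ≤ ‖h z.1‖ * ‖h z.2‖ by positivity)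
        have q2 := mul_nonneg (sq_nonneg (‖h z.1‖ - ‖h z.2‖)) (k0 (z.1 - z.2))
        linarith
  have D1 : ∫ z, ‖h z.1‖ ^ 2 * k (z.1 - z.2) ∂(m.prod m) ≤ D * ∫ t, ‖h t‖ ^ 2 ∂m := by
    rw [integral_prod _ i1, ← integral_const_mul]
    refine integral_mono_ae i1.integral_prod_left ((igR _ (ch2.pow 2)).const_mul D) ?_
    filter_upwards [aeA] with t ht
    simp only [integral_const_mul]
    rw [mul_comm]
    have ckt : Continuous fun s => k (t - s) := hk.comp (continuous_const.sub continuous_id)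
    have : ∫ s, k (t - s) ∂m ≤ D := by
      refine le_trans ?_ (hD t (A1 ht))
      rw [intervalIntegral.integral_of_le hab, ← integral_Icc_eq_integral_Ioc]
      exact setIntegral_mono_set ckt.integrableOn_Icc (Filter.Eventually.of_forall fun s => k0 _) (Filter.Eventually.of_forall A1)
    gcongr
  have D2 : ∫ z, ‖h z.2‖ ^ 2 * k (z.1 - z.2) ∂(m.prod m) = ∫ z, ‖h z.1‖ ^ 2 * k (z.1 - z.2) ∂(m.prod m) := by
    rw [← integral_prod_swap]
    refine integral_congr_ae (Filter.Eventually.of_forall fun z => ?_)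
    simp only [Prod.fst_swap, Prod.snd_swap]
    rw [← ke, neg_sub]
  have i12 : Integrable (fun z : ℝ × ℝ => 2⁻¹ * (‖h z.1‖ ^ 2 * k (z.1 - z.2) + ‖h z.2‖ ^ 2 * k (z.1 - z.2))) (m.prod m) := (i1.add i2).const_mul _
  rw [integral_add i12 (i3.const_mul _), integral_const_mul, integral_const_mul, integral_add i1 i2, D2, integral_prod_mul (fun t => ‖h t‖) fun t => ‖h t‖] at z4
  have h2 : ∫ t, ‖h t‖ ^ 2 ∂m ≤ Q ^ 4 * Z := by
    rw [hZ, ← integral_const_mul]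
    refine integral_mono_ae (igR _ (ch2.pow 2)) ((igR _ (cP.norm.pow 6)).const_mul _) ?_
    filter_upwards [aeA] with t ht
    rw [nh, show (‖P t‖ ^ 5) ^ 2 = ‖P t‖ ^ 4 * ‖P t‖ ^ 6 by ring]
    gcongr; exact hQ t (A1 ht)
  have h3 : V * ∫ t, ‖h t‖ ∂m ≤ Z := by
    rw [hZ, ← integral_const_mul]
    refine integral_mono_ae ((igR _ ch2).const_mul _) (igR _ (cP.norm.pow 6)) ?_
    filter_upwards [aeA] with t ht
    rw [nh, show ‖P t‖ ^ 6 = ‖P t‖ * ‖P t‖ ^ 5 by ring]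
    gcongr; exact ht.2.le
  have j0 : 0 ≤ ∫ t, ‖h t‖ ∂m := integral_nonneg fun t => norm_nonneg _
  set J := ∫ t, ‖h t‖ ∂m with hJ
  have D0 : 0 ≤ D := (intervalIntegral.integral_nonneg hab fun s _ => k0 _).trans (hD a ⟨le_rfl, hab⟩)
  have z5 : Z ^ 2 ≤ W * D * Q ^ 4 * Z + Z ^ 2 / 2 := by
    have a1 : ∑ n ∈ B, ‖H n‖ ^ 2 ≤ D * (Q ^ 4 * Z) + M * (J * J) := by
      have := mul_le_mul_of_nonneg_left h2 D0
      linarith only [D1, z4, this]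
    have a2 := mul_le_mul_of_nonneg_left a1 W0
    have a3 := mul_le_mul_of_nonneg_right hW (mul_nonneg j0 j0)
    have a4 := pow_le_pow_left₀ (mul_nonneg hV.le j0) h3 2
    linarith only [z2, a2, a3, a4]
  have z6 : Z ≤ 2 * W * Q ^ 4 * D := by
    rcases Z0.eq_or_lt with h | h
    · rw [← h]; positivity
    · refine le_of_mul_le_mul_right ?_ h
      linarith only [z5]
  -- splitting
  have c6 : Continuous fun t => ‖P t‖ ^ 6 := cP.norm.pow 6
  have c4 : Continuous fun t => ‖P t‖ ^ 4 := cP.norm.pow 4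
  rw [intervalIntegral.integral_of_le hab, intervalIntegral.integral_of_le hab, ← integral_Icc_eq_integral_Ioc, ← integral_Icc_eq_integral_Ioc]
  have sp : ∫ t in Set.Icc a b, ‖P t‖ ^ 6 = Z + ∫ t in Set.Icc a b \ A, ‖P t‖ ^ 6 := by
    rw [setIntegral_sdiff mA c6.integrableOn_Icc A1]; ring
  have lo : ∫ t in Set.Icc a b \ A, ‖P t‖ ^ 6 ≤ V ^ 2 * ∫ t in Set.Icc a b, ‖P t‖ ^ 4 := by
    calc _ ≤ ∫ t in Set.Icc a b \ A, V ^ 2 * ‖P t‖ ^ 4 := by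
          refine setIntegral_mono_on (c6.integrableOn_Icc.mono_set Set.sdiff_subset) ((continuous_const.mul c4).integrableOn_Icc.mono_set Set.sdiff_subset) (measurableSet_Icc.diff mA) fun t ht => ?_
          have : ‖P t‖ ≤ V := by
            by_contra hc; exact ht.2 ⟨ht.1, not_le.1 hc⟩
          rw [show ‖P t‖ ^ 6 = ‖P t‖ ^ 2 * ‖P t‖ ^ 4 by ring]; gcongr
      _ ≤ ∫ t in Set.Icc a b, V ^ 2 * ‖P t‖ ^ 4 := setIntegral_mono_set (continuous_const.mul c4).integrableOn_Icc (Filter.Eventually.of_forall fun s => by simp only [Pi.zero_apply]; positivity) (Filter.Eventually.of_forall Set.sdiff_subset)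
      _ = _ := integral_const_mul _ _
  linarith only [z6, sp, lo]


theorem logpow (δ : ℝ) (hδ : 0 < δ) (k : ℕ) : ∃ C ≥ 1, ∀ X : ℝ, 1 ≤ X → (1 + Real.log X) ^ k ≤ C * X ^ δ := by
  have d0 : 0 < δ / (k + 1) := by positivity
  refine ⟨(1 + 1 / (δ / (k + 1))) ^ k, one_le_pow₀ (by linarith [show 0 < 1 / (δ / (k + 1)) by positivity]), fun X hX => ?_⟩
  have h1 := Real.log_le_rpow_div (by linarith : 0 ≤ X) d0
  have h2 := Real.one_le_rpow hX d0.le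
  have h3 := Real.log_nonneg hX
  calc (1 + Real.log X) ^ k ≤ ((1 + 1 / (δ / (k + 1))) * X ^ (δ / (k + 1))) ^ k := by gcongr; rw [add_mul, one_div_mul_eq_div]; linarith
    _ = (1 + 1 / (δ / (k + 1))) ^ k * X ^ (δ / (k + 1) * k) := by rw [mul_pow, ← Real.rpow_natCast (X ^ _), ← Real.rpow_mul (by linarith)]
    _ ≤ _ := by
      gcongr
      rw [div_mul_eq_mul_div, div_le_iff₀ (by positivity)]; linarith

theorem FB (c : ℝ) (hc : ∀ j : ℕ, c ≠ j) : ∃ C > 0, ∀ Y : ℝ, 1 ≤ Y → ∀ a M : ℕ, Y ≤ a → (a + M : ℝ) ≤ 4 * Y → ∀ u : ℝ, |u| ≤ Y ^ (2.08 : ℝ) →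
    ‖∑ n ∈ Finset.range M, e (u * ((a + n : ℝ) / Y) ^ c)‖ ≤ C * Y * (√(1 + u ^ 2))⁻¹ + C * Y ^ (0.9 : ℝ) := by
  obtain ⟨c₀, hc₀, C₁, hC₁, k1⟩ := ES1 c hc
  obtain ⟨C₂, hC₂, k2⟩ := ES0 c hc
  have w2 := PW_two (0.9 / 2) 1.6
  have w3 := PW_succ 2 0.9 1.6 _ (by norm_num) (by norm_num) (by norm_num) w2
  rw [show min (1 - 0.9 / 2) (min (0.9 / 4) (min (0.9 / 2 / 2) (1 - 1.6 / 2) / 2)) = (0.1:ℝ) by norm_num] at w3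
  obtain ⟨C₃, hC₃, k3⟩ := ES_step c 3 (pf_ne c hc 3) 0.9 1.6 0.1 0.02 (by norm_num) (by norm_num) (by norm_num) (by norm_num) (by norm_num) w3
  refine ⟨2 * C₁ + 6 + C₂ * (c₀ ^ (-(1 / 2) : ℝ) + 1) + C₃, by positivity, fun Y hY a M ha haM u hu => ?_⟩
  have Y0 : 0 < Y := by linarith
  have e1 : ∀ n ∈ Finset.range M, e (u * ((a + n : ℝ) / Y) ^ c) = e (u * Y ^ (-c) * (a + n : ℝ) ^ c) := fun n _ => by
    rw [Real.div_rpow (by positivity) Y0.le, Real.rpow_neg Y0.le]; congr 1; field_simp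
  rw [Finset.sum_congr rfl e1]
  have e2 : |u * Y ^ (-c)| * Y ^ c = |u| := by
    rw [abs_mul, abs_of_pos (Real.rpow_pos_of_pos Y0 _), mul_assoc, ← Real.rpow_add Y0]; simp
  have s0 : 0 < √(1 + u ^ 2) := by positivity
  have p9 : 0 < Y ^ (0.9 : ℝ) := by positivity
  have q0 : 0 < C₂ * (c₀ ^ (-(1 / 2) : ℝ) + 1) := by positivity
  set q := C₂ * (c₀ ^ (-(1 / 2) : ℝ) + 1) with hq
  have x0 : 0 < Y * (√(1 + u ^ 2))⁻¹ := by positivity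
  have fin : ‖∑ n ∈ Finset.range M, e (u * Y ^ (-c) * (a + n : ℝ) ^ c)‖ ≤ (2 * C₁ + 6) * (Y * (√(1 + u ^ 2))⁻¹) ∨ ‖∑ n ∈ Finset.range M, e (u * Y ^ (-c) * (a + n : ℝ) ^ c)‖ ≤ (q + C₃) * Y ^ (0.9 : ℝ) → ‖∑ n ∈ Finset.range M, e (u * Y ^ (-c) * (a + n : ℝ) ^ c)‖ ≤ (2 * C₁ + 6 + q + C₃) * Y * (√(1 + u ^ 2))⁻¹ + (2 * C₁ + 6 + q + C₃) * Y ^ (0.9 : ℝ) := by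
    rintro (h | h)
    · have := mul_nonneg (by positivity : 0 ≤ q + C₃) x0.le
      have := mul_nonneg (by positivity : 0 ≤ 2 * C₁ + 6 + q + C₃) p9.le
      linarith
    · have := mul_nonneg (by positivity : 0 ≤ 2 * C₁ + 6 + q + C₃) x0.le
      have := mul_nonneg (by positivity : 0 ≤ 2 * C₁ + 6) p9.le
      linarith
  apply fin
  rcases le_or_gt |u| 1 with h | h
  · left
    have : √(1 + u ^ 2) ≤ 2 := by
      rw [Real.sqrt_le_left (by norm_num)]
      have := pow_le_pow_left₀ (abs_nonneg u) h 2
      rw [sq_abs] at this; linarith only [this]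
    have h2 : ‖∑ n ∈ Finset.range M, e (u * Y ^ (-c) * (a + n : ℝ) ^ c)‖ ≤ M := by
      refine (norm_sum_le _ _).trans ?_
      simp [e_norm]
    have h3 : (2:ℝ)⁻¹ ≤ (√(1 + u ^ 2))⁻¹ := inv_anti₀ s0 this
    have h4 := mul_le_mul_of_nonneg_left h3 Y0.le
    have := mul_pos hC₁ x0
    linarith only [ha, haM, h2, h4, this]
  have u0 : u ≠ 0 := fun h' => by simp [h'] at h; linarith only [h]
  have y0 : u * Y ^ (-c) ≠ 0 := mul_ne_zero u0 (Real.rpow_pos_of_pos Y0 _).ne'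
  rcases le_or_gt |u| (c₀ * Y) with h1 | h1
  · left
    have := k1 Y hY a M ha haM _ y0 (by rw [e2]; exact h1)
    rw [e2] at this
    refine this.trans ?_
    have : √(1 + u ^ 2) ≤ 2 * |u| := by
      rw [Real.sqrt_le_left (by positivity), mul_pow, sq_abs]
      have := one_le_pow₀ h.le (n := 2)
      rw [sq_abs] at this; linarith only [this]
    have h3 : (2 * |u|)⁻¹ ≤ (√(1 + u ^ 2))⁻¹ := inv_anti₀ s0 this
    have h4 := mul_le_mul_of_nonneg_left h3 (by positivity : 0 ≤ 2 * C₁ * Y)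
    have h5 : 2 * C₁ * Y * (2 * |u|)⁻¹ = C₁ * (Y / |u|) := by field_simp
    linarith only [x0, h4, h5]
  right
  rcases le_or_gt |u| (Y ^ (3 / 2 : ℝ)) with h2 | h2
  · have := k2 Y hY a M ha haM _ y0 (by rw [e2]; exact h2)
    rw [e2] at this
    refine this.trans ?_
    have b1 : |u| ^ (-(1 / 2) : ℝ) ≤ c₀ ^ (-(1 / 2) : ℝ) * Y ^ (-(1 / 10) : ℝ) := by
      refine (Real.rpow_le_rpow_of_nonpos (by positivity) h1.le (by norm_num)).trans ?_
      rw [Real.mul_rpow hc₀.le Y0.le]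
      gcongr <;> norm_num
    have b2 : Y ^ (-(1 / 4) : ℝ) ≤ Y ^ (-(1 / 10) : ℝ) := by gcongr <;> norm_num
    have b3 : Y ^ (0.9 : ℝ) = Y * Y ^ (-(1 / 10) : ℝ) := by
      rw [← Real.rpow_one_add' Y0.le (by norm_num)]; norm_num
    calc _ ≤ C₂ * Y * (c₀ ^ (-(1 / 2) : ℝ) * Y ^ (-(1 / 10) : ℝ) + Y ^ (-(1 / 10) : ℝ)) := by gcongr
      _ = q * Y ^ (0.9 : ℝ) := by rw [b3, hq]; ring
      _ ≤ _ := by gcongr; linarith only [hC₃]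
  · have e3 : ∀ z : ℝ, Y ^ z * Y ^ (-((3:ℕ) : ℝ)) = Y ^ (z - 3) := fun z => by rw [← Real.rpow_add Y0]; norm_num; rfl
    have := k3 Y hY a M ha haM _ y0 (by
      rw [e2]
      refine le_trans ?_ (mul_le_mul_of_nonneg_right h2.le (by positivity))
      rw [e3]; exact Real.rpow_le_rpow_of_exponent_le hY (by norm_num)) (by
      rw [e2]
      refine (mul_le_mul_of_nonneg_right hu (by positivity)).trans ?_
      rw [e3]; exact Real.rpow_le_rpow_of_exponent_le hY (by norm_num))
    refine this.trans ?_
    have b3 : Y ^ (0.9 : ℝ) = Y * Y ^ (-0.1 : ℝ) := by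
      rw [← Real.rpow_one_add' Y0.le (by norm_num)]; norm_num
    rw [mul_assoc, ← b3]
    gcongr; linarith only [q0]


noncomputable def lw (n : ℕ) : ℝ := if n.Prime then Real.log n else 0

theorem S_eq (X c : ℝ) (hX : 0 < X) (t : ℝ) : S X c (t * (X / 2) ^ (-c)) = ∑ n ∈ Finset.Ico (⌊X / 2⌋₊ + 1) (⌊X⌋₊ + 1), (lw n : ℂ) * e (t * ((n : ℝ) / (X / 2)) ^ c) := by
  have : ∀ n ∈ Finset.Ico (⌊X / 2⌋₊ + 1) (⌊X⌋₊ + 1), (lw n : ℂ) * e (t * ((n : ℝ) / (X / 2)) ^ c) = if n.Prime then (Real.log n : ℂ) * e ((n : ℝ) ^ c * (t * (X / 2) ^ (-c))) else 0 := fun n _ => by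
    unfold lw
    split_ifs
    · rw [Real.div_rpow (by positivity) (by positivity), Real.rpow_neg (by positivity)]; congr 2; ring
    · simp
  rw [Finset.sum_congr rfl this, ← Finset.sum_filter, S]
  refine Finset.sum_congr ?_ fun _ _ => rfl
  ext n
  have h1 : (X / 2 < n) ↔ ⌊X / 2⌋₊ + 1 ≤ n := by rw [Nat.succ_le_iff, Nat.floor_lt (by positivity)]
  have h2 : ((n:ℝ) ≤ X) ↔ n < ⌊X⌋₊ + 1 := by rw [Nat.lt_succ_iff, Nat.le_floor_iff hX.le]
  simp only [Finset.mem_filter, Finset.mem_range, Finset.mem_Ico, h1, h2]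
  have := Nat.floor_le_ceil X
  constructor
  · tauto
  · rintro ⟨⟨a, b⟩, h⟩; exact ⟨by omega, h, a, b⟩

theorem lw_bd (X : ℝ) (hX : 1 ≤ X) (n : ℕ) (h : (n:ℝ) ≤ X) : 0 ≤ lw n ∧ lw n ≤ 1 + Real.log X := by
  have := Real.log_nonneg hX
  unfold lw
  split_ifs with hp
  · have h1 : (1:ℝ) ≤ n := by exact_mod_cast hp.one_lt.le
    exact ⟨Real.log_nonneg h1, by linarith [Real.log_le_log (by linarith) h]⟩
  · constructor <;> linarith

set_option maxHeartbeats 1000000 in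
/-- the sixth moment of `S` away from the origin -/
theorem LV (c : ℝ) (hc1 : 1 < c) (hc2 : c < 37 / 18) (hc3 : c ≠ 2) : ∃ σ > 0, ∃ C > 0, ∃ X₀ ≥ 1, ∀ X : ℝ, X₀ ≤ X →
    ∫ x in (X ^ (1 - c))..(Real.log X ^ 5), ‖S X c x‖ ^ 6 ≤ C * X ^ (6 - c - σ) := by
  have hcj : ∀ j : ℕ, c ≠ j := fun j hj => by
    have h3 : (j:ℝ) < (3:ℕ) := by push_cast; linarith
    have h1 : ((1:ℕ):ℝ) < j := by push_cast; linarith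
    have h3' := Nat.cast_lt.1 h3
    have h1' := Nat.cast_lt.1 h1
    have : j = 2 := by omega
    subst this; exact hc3 (by exact_mod_cast hj)
  obtain ⟨σ₁, hσ₁, C₁, hC₁, X₁, hX₁, vin⟩ := Vino c hc1 hcj
  obtain ⟨C₂, hC₂, fb⟩ := FB c hcj
  obtain ⟨C₃, hC₃, m4⟩ := MMx c _ (MM_all 24 c hc1) 2 0.0005 (by norm_num) (by norm_num)
  rw [show 2 - 1 / (((24:ℕ):ℝ) + 1) = 1.96 by norm_num] at m4
  set σ := min (1 / 1000) (min (1 / 4) σ₁) with hσ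
  have σ0 : 0 < σ := by positivity
  have σa : σ ≤ 1 / 1000 := min_le_left _ _
  have σb : σ ≤ 1 / 4 := by linarith
  have σc : σ ≤ σ₁ := (min_le_right _ _).trans (min_le_right _ _)
  obtain ⟨E, hE, lp⟩ := logpow σ σ0 15
  refine ⟨σ, σ0, (2:ℝ) ^ c * (8 * C₂ * C₃ * E + 512 * C₁ ^ 4 * C₂ * E), by positivity, max (max X₁ 3) (2 * (2 * E) ^ (50:ℕ)), (by norm_num : (1:ℝ) ≤ 3).trans ((le_max_right _ _).trans (le_max_left _ _)), fun X hX => ?_⟩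
  have x1 : X₁ ≤ X := (le_max_left _ _).trans ((le_max_left _ _).trans hX)
  have x3 : 3 ≤ X := (le_max_right _ _).trans ((le_max_left _ _).trans hX)
  have x4 : 2 * (2 * E) ^ (50:ℕ) ≤ X := (le_max_right _ _).trans hX
  have X0 : 0 < X := by linarith only [x3]
  have X1 : 1 ≤ X := by linarith only [x3]
  have el : (1:ℝ) ≤ Real.log X := by
    rw [Real.le_log_iff_exp_le X0]; exact Real.exp_one_lt_three.le.trans x3
  set ℓ := 1 + Real.log X with hℓ
  have ℓ1 : 1 ≤ ℓ := by linarith only [el]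
  have lpj : ∀ j ≤ 15, ℓ ^ j ≤ E * X ^ σ := fun j hj => (pow_le_pow_right₀ ℓ1 hj).trans (lp X X1)
  set Y := X / 2 with hY
  have Y1 : 1 ≤ Y := by linarith only [x3, hY]
  have Y0 : 0 < Y := by linarith only [x3, hY]
  have YX : Y ≤ X := by linarith only [x3, hY]
  have Yc : 0 < Y ^ c := by positivity
  have re : ∀ {p q : ℝ}, p ≤ q → X ^ p ≤ X ^ q := fun h => Real.rpow_le_rpow_of_exponent_le X1 h
  have hE2 : 2 * E ≤ Y ^ (1 / 50 : ℝ) := by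
    have := Real.rpow_le_rpow (by positivity) (by linarith only [x4, hY] : (2 * E) ^ (50:ℕ) ≤ Y) (by norm_num : (0:ℝ) ≤ 1 / 50)
    rwa [← Real.rpow_natCast (2 * E), ← Real.rpow_mul (by positivity), show ((50:ℕ):ℝ) * (1 / 50) = 1 by norm_num, Real.rpow_one] at this
  have big : ∀ Z, 1 ≤ Z → Y ≤ Z → X ≤ 2 * Z → Z ^ c * ℓ ^ 5 ≤ Z ^ (2.08 : ℝ) := fun Z hZ hYZ hXZ => by
    have Z0 : 0 < Z := by linarith only [x3, hY, hYZ]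
    have h1 : X ^ σ ≤ 2 * Z ^ σ := by
      refine (Real.rpow_le_rpow X0.le hXZ σ0.le).trans ?_
      rw [Real.mul_rpow (by norm_num) Z0.le]
      gcongr
      exact (Real.rpow_le_rpow_of_exponent_le (by norm_num) (by linarith only [σa] : σ ≤ 1)).trans_eq (Real.rpow_one 2)
    calc Z ^ c * ℓ ^ 5 ≤ Z ^ (37 / 18 : ℝ) * (E * (2 * Z ^ σ)) := by gcongr; exact (lpj 5 (by norm_num)).trans (by gcongr)
      _ = (2 * E) * (Z ^ (37 / 18 : ℝ) * Z ^ σ) := by ring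
      _ ≤ Z ^ (1 / 50 : ℝ) * (Z ^ (37 / 18 : ℝ) * Z ^ σ) := by gcongr; exact hE2.trans (by gcongr)
      _ = Z ^ (1 / 50 + (37 / 18 + σ)) := by rw [Real.rpow_add Z0, Real.rpow_add Z0]
      _ ≤ Z ^ (2.08 : ℝ) := by gcongr; linarith only [σa]
  have hab : Y ^ c * X ^ (1 - c) ≤ Y ^ c * Real.log X ^ 5 := by
    gcongr
    exact (Real.rpow_le_one_of_one_le_of_nonpos X1 (by linarith only [hc1])).trans (one_le_pow₀ el)
  have lo : ∫ x in (X ^ (1 - c))..(Real.log X ^ 5), ‖S X c x‖ ^ 6 = Y ^ (-c) * ∫ t in (Y ^ c * X ^ (1 - c))..(Y ^ c * Real.log X ^ 5), ‖S X c (t * Y ^ (-c))‖ ^ 6 := by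
    have := intervalIntegral.integral_comp_mul_right (a := Y ^ c * X ^ (1 - c)) (b := Y ^ c * Real.log X ^ 5) (fun x => ‖S X c x‖ ^ 6) (c := Y ^ (-c)) (by positivity)
    have h2 : ∀ z, Y ^ c * z * Y ^ (-c) = z := fun z => by rw [Real.rpow_neg Y0.le]; field_simp
    rw [this, h2, h2, smul_eq_mul, mul_inv_cancel_left₀ (by positivity)]
  rw [lo]
  set a := Y ^ c * X ^ (1 - c) with ha
  set b := Y ^ c * Real.log X ^ 5 with hb
  have a0 : 0 < a := by positivity
  have bU : b ≤ Y ^ c * ℓ ^ 5 := by rw [hb]; gcongr; linarith only []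
  have bX : b ≤ Y ^ (2.08 : ℝ) := bU.trans (big Y Y1 le_rfl (by linarith only [hY]))
  set B := Finset.Ico (⌊X / 2⌋₊ + 1) (⌊X⌋₊ + 1) with hB
  have Bm : ∀ n ∈ B, Y ≤ n ∧ (n:ℝ) ≤ X := fun n hn => by
    rw [hB, Finset.mem_Ico] at hn
    exact ⟨(Nat.lt_of_floor_lt hn.1).le, (Nat.le_floor_iff X0.le).1 (by omega)⟩
  have Wb : ∑ n ∈ B, lw n ^ 2 ≤ 2 * X * ℓ ^ 2 := by
    refine (Finset.sum_le_card_nsmul B _ (ℓ ^ 2) fun n hn => ?_).trans ?_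
    · obtain ⟨h1, h2⟩ := lw_bd X X1 n (Bm n hn).2
      exact pow_le_pow_left₀ h1 h2 2
    · rw [nsmul_eq_mul]; gcongr; exact card_le B X X1 fun n hn => (Bm n hn).2
  have W0 : 0 ≤ ∑ n ∈ B, lw n ^ 2 := by positivity
  have hPe := S_eq X c X0
  simp only [← hY] at hPe
  set Q := 2 * C₁ * X * ℓ ^ 3 * X ^ (-σ) with hQ
  have Qb : ∀ t ∈ Set.Icc a b, ‖S X c (t * Y ^ (-c))‖ ≤ Q := fun t ht => by
    have t0 : 0 < t := a0.trans_le ht.1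
    have e1 : |t * Y ^ (-c)| * X ^ c = t * (Y ^ (-c) * X ^ c) := by rw [abs_of_pos (by positivity)]; ring
    have e2 : Y ^ c * (Y ^ (-c) * X ^ c) = X ^ c := by rw [← mul_assoc, ← Real.rpow_add Y0]; simp
    have y0 : 0 < Y ^ (-c) * X ^ c := by positivity
    have h1 : X ≤ |t * Y ^ (-c)| * X ^ c := by
      rw [e1]
      refine le_trans (le_of_eq ?_) (mul_le_mul_of_nonneg_right ht.1 y0.le)
      rw [ha, mul_right_comm, e2, ← Real.rpow_add X0]; simp
    have h2 : |t * Y ^ (-c)| * X ^ c ≤ X ^ (7 / 2 : ℝ) := by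
      rw [e1]
      refine (mul_le_mul_of_nonneg_right (ht.2.trans bU) y0.le).trans ?_
      rw [mul_right_comm, e2]
      exact (big X X1 YX (by linarith only [x3])).trans (re (by norm_num))
    refine (vin X x1 _ (X1.trans h1) h2).trans ?_
    have h3 : (|t * Y ^ (-c)| * X ^ c) ^ (-(1 / 4) : ℝ) ≤ X ^ (-σ) := (Real.rpow_le_rpow_of_nonpos X0 h1 (by norm_num)).trans (re (by linarith only [σa]))
    have h4 : X ^ (-σ₁) ≤ X ^ (-σ) := re (by linarith only [σc])
    calc _ ≤ C₁ * X * ℓ ^ 3 * (X ^ (-σ) + X ^ (-σ)) := by gcongr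
      _ = Q := by rw [hQ]; ring
  have kc : Continuous fun u : ℝ => C₂ * Y * (√(1 + u ^ 2))⁻¹ := continuous_const.mul ((by fun_prop : Continuous fun u : ℝ => √(1 + u ^ 2)).inv₀ fun u => by positivity)
  have DD : ∀ t ∈ Set.Icc a b, ∫ s in a..b, C₂ * Y * (√(1 + (t - s) ^ 2))⁻¹ ≤ C₂ * Y * (8 * ℓ) := fun t ht => by
    have hd : ∀ s ∈ Set.uIcc a b, HasDerivAt (fun s => -(C₂ * Y * Real.arsinh (t - s))) (C₂ * Y * (√(1 + (t - s) ^ 2))⁻¹) s := fun s _ => by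
      have := (((hasDerivAt_id s).const_sub t).arsinh.const_mul (C₂ * Y)).neg
      refine this.congr_deriv ?_
      simp
    rw [intervalIntegral.integral_eq_sub_of_hasDerivAt hd ((kc.comp (continuous_const.sub continuous_id)).intervalIntegrable _ _)]
    have ar : ∀ v, 0 ≤ v → v ≤ b → Real.arsinh v ≤ 4 * ℓ := fun v v0 hv => by
      have hv3 : v ≤ X ^ 3 := by
        rw [← Real.rpow_natCast]
        exact (hv.trans bX).trans ((Real.rpow_le_rpow Y0.le YX (by norm_num)).trans (re (by norm_num)))
      have hs : √(1 + v ^ 2) ≤ 1 + v := by rw [Real.sqrt_le_left (by linarith only [v0])]; linarith only [v0, sq_nonneg v]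
      have h4 : v + √(1 + v ^ 2) ≤ X ^ 4 := by
        have h5 := mul_le_mul_of_nonneg_right x3 (pow_nonneg X0.le 3)
        have h6 := one_le_pow₀ X1 (n := 3)
        linarith only [hv3, hs, h5, h6]
      refine (Real.log_le_log (by positivity) h4).trans ?_
      rw [Real.log_pow]; push_cast; linarith only []
    have h1 := ar (t - a) (by linarith only [ht.1]) (by linarith only [a0, ht.2])
    have h2 := ar (b - t) (by linarith only [ht.2]) (by linarith only [a0, ht.1])
    rw [show t - b = -(b - t) by ring, Real.arsinh_neg]
    have := mul_le_mul_of_nonneg_left (add_le_add h1 h2) (by positivity : 0 ≤ C₂ * Y)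
    linarith only [this]
  have M0 : 0 < C₂ * Y ^ (0.9 : ℝ) := by positivity
  have key := HAL B (fun n => ((n : ℝ) / Y) ^ c) lw a b (√(4 * X * ℓ ^ 2 * (C₂ * Y ^ (0.9 : ℝ)))) (C₂ * Y ^ (0.9 : ℝ)) Q (C₂ * Y * (8 * ℓ)) (fun u => C₂ * Y * (√(1 + u ^ 2))⁻¹) hab (by positivity) kc (fun u => by positivity) (fun u => by simp) (fun u hu => by
      rw [hB, Finset.sum_Ico_eq_sum_range]
      have := fb Y Y1 (⌊X / 2⌋₊ + 1) (⌊X⌋₊ + 1 - (⌊X / 2⌋₊ + 1)) (by push_cast; exact (Nat.lt_floor_add_one _).le) ?_ u ?_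
      · push_cast at this ⊢; exact this
      · have h1 : ⌊X / 2⌋₊ ≤ ⌊X⌋₊ := Nat.floor_mono YX
        rw [Nat.cast_sub (by omega)]; push_cast
        linarith only [x3, hY, Nat.floor_le X0.le]
      · linarith only [a0, bX, hu]) DD (fun t => S X c (t * Y ^ (-c))) hPe Qb (by
      rw [Real.sq_sqrt (by positivity)]
      have := mul_le_mul_of_nonneg_right Wb M0.le
      linarith only [this])
  rw [Real.sq_sqrt (by positivity)] at key
  have m4' : ∫ t in a..b, ‖S X c (t * Y ^ (-c))‖ ^ 4 ≤ ℓ ^ 4 * (C₃ * ((1 + (b - a) / Y ^ (1.96 : ℝ)) * Y ^ (4 + 0.0005 : ℝ))) := by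
    have := m4 Y (b - a) Y1 (by linarith only [hab]) B (fun n hn => ⟨(Bm n hn).1, by linarith only [hY, (Bm n hn).2]⟩) (fun n => ((lw n / ℓ : ℝ) : ℂ)) (fun n hn => by
      obtain ⟨h1, h2⟩ := lw_bd X X1 n (Bm n hn).2
      rw [Complex.norm_real, Real.norm_of_nonneg (by positivity), div_le_one (by positivity)]; exact h2) a
    rw [add_sub_cancel] at this
    refine le_trans (le_of_eq ?_) (mul_le_mul_of_nonneg_left this (by positivity))
    rw [← intervalIntegral.integral_const_mul]
    congr 1; funext t
    have en : ∀ z : ℂ, ℓ * ‖z‖ = ‖(ℓ : ℂ) * z‖ := fun z => by rw [norm_mul, Complex.norm_real, Real.norm_of_nonneg (by linarith only [el])]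
    rw [← mul_pow, en, hPe, Finset.mul_sum]
    congr 2
    refine Finset.sum_congr rfl fun n _ => ?_
    have : (ℓ : ℂ) ≠ 0 := by exact_mod_cast (by linarith only [el] : ℓ ≠ 0)
    push_cast; field_simp
  have U : 1 + (b - a) / Y ^ (1.96 : ℝ) ≤ 2 * X ^ (0.0956 : ℝ) * ℓ ^ 5 := by
    have h1 : (b - a) / Y ^ (1.96 : ℝ) ≤ X ^ (0.0956 : ℝ) * ℓ ^ 5 := by
      rw [div_le_iff₀ (by positivity)]
      calc b - a ≤ Y ^ c * ℓ ^ 5 := by linarith only [a0, bU]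
        _ ≤ Y ^ (0.0956 + 1.96 : ℝ) * ℓ ^ 5 := by gcongr; linarith only [hc2]
        _ = Y ^ (0.0956 : ℝ) * ℓ ^ 5 * Y ^ (1.96 : ℝ) := by rw [Real.rpow_add Y0]; ring
        _ ≤ _ := by gcongr
    have h2 : 1 ≤ X ^ (0.0956 : ℝ) * ℓ ^ 5 := one_le_mul_of_one_le_of_one_le (Real.one_le_rpow X1 (by norm_num)) (one_le_pow₀ ℓ1)
    linarith only [h1, h2]
  have T1 : 4 * X * ℓ ^ 2 * (C₂ * Y ^ (0.9 : ℝ)) * ∫ t in a..b, ‖S X c (t * Y ^ (-c))‖ ^ 4 ≤ 8 * C₂ * C₃ * E * X ^ (6 - σ) := by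
    calc _ ≤ 4 * X * ℓ ^ 2 * (C₂ * X ^ (0.9 : ℝ)) * (ℓ ^ 4 * (C₃ * ((2 * X ^ (0.0956 : ℝ) * ℓ ^ 5) * X ^ (4 + 0.0005 : ℝ)))) := by
          refine mul_le_mul (by gcongr) (m4'.trans (by gcongr)) (intervalIntegral.integral_nonneg hab fun _ _ => by positivity) (by positivity)
      _ = 8 * C₂ * C₃ * ℓ ^ 11 * (X ^ (1:ℝ) * X ^ (0.9 : ℝ) * X ^ (0.0956 : ℝ) * X ^ (4 + 0.0005 : ℝ)) := by rw [Real.rpow_one]; ring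
      _ ≤ 8 * C₂ * C₃ * (E * X ^ σ) * (X ^ (1:ℝ) * X ^ (0.9 : ℝ) * X ^ (0.0956 : ℝ) * X ^ (4 + 0.0005 : ℝ)) := by gcongr; exact lpj 11 (by norm_num)
      _ = 8 * C₂ * C₃ * E * X ^ (σ + 1 + 0.9 + 0.0956 + (4 + 0.0005)) := by simp only [Real.rpow_add X0]; ring
      _ ≤ _ := by gcongr; linarith only [σa]
  have T2 : 2 * (∑ n ∈ B, lw n ^ 2) * Q ^ 4 * (C₂ * Y * (8 * ℓ)) ≤ 512 * C₁ ^ 4 * C₂ * E * X ^ (6 - σ) := by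
    have Q0 : 0 ≤ Q := by positivity
    calc _ ≤ 2 * (2 * X * ℓ ^ 2) * Q ^ 4 * (C₂ * X * (8 * ℓ)) := by gcongr
      _ = 512 * C₁ ^ 4 * C₂ * ℓ ^ 15 * (X ^ (6:ℕ) * (X ^ (-σ)) ^ 4) := by rw [hQ]; ring
      _ ≤ 512 * C₁ ^ 4 * C₂ * (E * X ^ σ) * (X ^ (6:ℕ) * (X ^ (-σ)) ^ 4) := by gcongr; exact lpj 15 le_rfl
      _ = 512 * C₁ ^ 4 * C₂ * E * X ^ (σ + 6 + (-σ) * (4:ℕ)) := by rw [Real.rpow_add X0, Real.rpow_add X0, Real.rpow_mul X0.le, Real.rpow_natCast, ← Real.rpow_natCast X 6]; push_cast; ring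
      _ ≤ _ := by gcongr; push_cast; linarith only [σ0]
  have e5 : Y ^ (-c) = (2:ℝ) ^ c * X ^ (-c) := by
    rw [hY, Real.div_rpow X0.le (by norm_num), Real.rpow_neg (by norm_num : (0:ℝ) ≤ 2), div_inv_eq_mul, mul_comm]
  calc _ ≤ Y ^ (-c) * (8 * C₂ * C₃ * E * X ^ (6 - σ) + 512 * C₁ ^ 4 * C₂ * E * X ^ (6 - σ)) := by gcongr; linarith only [key, T1, T2]
    _ = _ := by rw [e5, show 6 - c - σ = 6 - σ + -c by ring, Real.rpow_add X0]; ring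


theorem BC (f : ℂ → ℂ) (R M : ℝ) (hR : 0 < R) (hM : 0 < M) (hf : DifferentiableOn ℂ f (Metric.ball 0 R)) (h0 : ∀ z ∈ Metric.ball (0:ℂ) R, f z ≠ 0)
    (hb : ∀ z ∈ Metric.ball (0:ℂ) R, ‖f z‖ ≤ Real.exp M * ‖f 0‖) (z : ℂ) (hz : ‖z‖ ≤ R / 2) : ‖deriv f z / f z‖ ≤ 24 * M / R := by
  have ob : IsOpen (Metric.ball (0:ℂ) R) := Metric.isOpen_ball
  have o0 : (0:ℂ) ∈ Metric.ball (0:ℂ) R := Metric.mem_ball_self hR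
  obtain ⟨F, hF⟩ := ((hf.deriv ob).div hf h0).isExactOn_ball.with_val_at 0 0
  obtain ⟨hF0, hF⟩ := hF
  have Fd : DifferentiableOn ℂ F (Metric.ball 0 R) := fun w hw => (hF w hw).differentiableAt.differentiableWithinAt
  have hfF : ∀ w ∈ Metric.ball (0:ℂ) R, f w = f 0 * Complex.exp (F w) := fun w hw => by
    have := ob.is_const_of_deriv_eq_zero (f := fun w => f w * Complex.exp (-F w)) (convex_ball 0 R).isPreconnected (hf.mul (Fd.neg.cexp)) (fun v hv => by
      have d1 := (hf.differentiableAt (ob.mem_nhds hv)).hasDerivAt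
      have := (d1.mul (hF v hv).neg.cexp).deriv
      rw [show (fun w => f w * Complex.exp (-F w)) = f * fun w => Complex.exp ((-F) w) from rfl, this]
      have := h0 v hv
      simp only [Pi.div_apply, Pi.neg_apply, Pi.zero_apply]
      field_simp; ring) hw o0
    simp only [hF0, neg_zero, Complex.exp_zero, mul_one] at this
    rw [← this, mul_assoc, ← Complex.exp_add]; simp
  have Fr : Set.MapsTo F (Metric.ball 0 R) {z | z.re ≤ M} := fun w hw => by
    have h1 := hb w hw
    rw [hfF w hw, norm_mul, Complex.norm_exp, mul_comm] at h1
    exact Real.exp_le_exp.1 (le_of_mul_le_mul_right h1 (norm_pos_iff.2 (h0 0 o0)))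
  have zb : z ∈ Metric.ball (0:ℂ) R := by rw [mem_ball_zero_iff]; linarith
  have := Complex.norm_deriv_le_of_forall_mem_sphere_norm_le (c := z) (R := R / 4) (C := 6 * M) (f := F) (by positivity) ?_ ?_
  · rw [(hF z zb).deriv] at this
    exact this.trans_eq (by field_simp; norm_num)
  · refine (Fd.mono ?_).diffContOnCl
    rw [closure_ball _ (by positivity)]
    intro w hw
    rw [mem_closedBall_iff_norm] at hw; rw [mem_ball_zero_iff]
    have := norm_add_le (w - z) z; rw [sub_add_cancel] at this; linarith
  · intro w hw
    rw [mem_sphere_iff_norm] at hw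
    have w1 : ‖w‖ ≤ 3 * R / 4 := by have := norm_add_le (w - z) z; rw [sub_add_cancel] at this; linarith
    refine (Complex.borelCaratheodory_zero hM Fd Fr hR (by rw [mem_ball_zero_iff]; linarith) hF0).trans ?_
    rw [div_le_iff₀ (by linarith)]
    have := mul_le_mul_of_nonneg_left w1 hM.le
    linarith

theorem DIV (f : ℂ → ℂ) (R R' : ℝ) (hR : 0 < R) (hR' : R < R') (hf : DifferentiableOn ℂ f (Metric.ball 0 R')) (f0 : f 0 ≠ 0) (ρ : ℂ) (hρ : f ρ = 0) (hρR : ‖ρ‖ ≤ R / 2) :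
    ∃ g : ℂ → ℂ, DifferentiableOn ℂ g (Metric.ball 0 R') ∧ (∀ z, ‖z‖ = R → ‖g z‖ = ‖f z‖) ∧ 2 * ‖f 0‖ ≤ ‖g 0‖ ∧ (∀ z, ‖z‖ ≤ R / 2 → g z = 0 → f z = 0) ∧
      deriv f 0 / f 0 = deriv g 0 / g 0 - 1 / ρ + starRingEnd ℂ ρ / R ^ 2 := by
  have ob : IsOpen (Metric.ball (0:ℂ) R') := Metric.isOpen_ball
  have o0 : (0:ℂ) ∈ Metric.ball (0:ℂ) R' := Metric.mem_ball_self (by linarith)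
  have ρ0 : ρ ≠ 0 := fun h => f0 (h ▸ hρ)
  have Rc : (R:ℂ) ≠ 0 := by exact_mod_cast hR.ne'
  set h := dslope f ρ with hh
  have hd : DifferentiableOn ℂ h (Metric.ball 0 R') := (Complex.differentiableOn_dslope (ob.mem_nhds (by rw [mem_ball_zero_iff]; linarith))).2 hf
  have fe : ∀ z, f z = (z - ρ) * h z := fun z => by
    have := sub_smul_dslope f ρ z
    rw [hρ, sub_zero, smul_eq_mul] at this; exact this.symm
  set q : ℂ → ℂ := fun z => (R ^ 2 - starRingEnd ℂ ρ * z) / R with hq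
  have qd : ∀ z, HasDerivAt q (-(starRingEnd ℂ ρ) / R) z := fun z => by
    have := (((hasDerivAt_id z).const_mul (starRingEnd ℂ ρ)).const_sub ((R:ℂ) ^ 2)).div_const (R:ℂ)
    simpa using this
  have h0 : h 0 ≠ 0 := fun h' => f0 (by rw [fe, h', mul_zero])
  refine ⟨fun z => h z * q z, hd.mul fun z _ => (qd z).differentiableAt.differentiableWithinAt, fun z hz => ?_, ?_, fun z hz hg => ?_, ?_⟩
  · rw [fe z, norm_mul, norm_mul, mul_comm]
    congr 1
    have e1 : (R:ℂ) ^ 2 - starRingEnd ℂ ρ * z = z * starRingEnd ℂ (z - ρ) := by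
      rw [map_sub, mul_sub, Complex.mul_conj', hz]; ring
    rw [hq]; simp only [e1]
    rw [norm_div, norm_mul, RCLike.norm_conj, hz, Complex.norm_real, Real.norm_of_nonneg hR.le]; field_simp
  · rw [fe 0]
    simp only [hq, zero_sub, mul_zero, sub_zero, norm_mul, norm_neg, norm_div, norm_pow, Complex.norm_real, Real.norm_of_nonneg hR.le]
    rw [show R ^ 2 / R = R by field_simp]
    have := mul_le_mul_of_nonneg_right hρR (norm_nonneg (h 0))
    linarith
  · rcases mul_eq_zero.1 hg with h1 | h1
    · rw [fe, h1, mul_zero]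
    · exfalso
      rw [hq] at h1
      simp only [div_eq_zero_iff, Rc, or_false] at h1
      have h2 := congrArg norm (sub_eq_zero.1 h1)
      rw [norm_mul, RCLike.norm_conj, norm_pow, Complex.norm_real, Real.norm_of_nonneg hR.le] at h2
      have := mul_le_mul hρR hz (norm_nonneg _) (by linarith only [hR])
      have := pow_pos hR 2
      linarith
  · have d1 : HasDerivAt h (deriv h 0) 0 := (hd.differentiableAt (ob.mem_nhds o0)).hasDerivAt
    have d2 := (d1.mul (qd 0)).deriv
    rw [show (h * q : ℂ → ℂ) = fun z => h z * q z from rfl] at d2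
    have d3 := (((hasDerivAt_id (0:ℂ)).sub_const ρ).mul d1).deriv
    rw [show ((fun x => id x - ρ) * h) = f from funext fun z => (fe z).symm] at d3
    rw [d2, d3, fe 0, hq]
    simp only [id, zero_sub, mul_zero, sub_zero]
    field_simp; ring

theorem LAN (R R' K M : ℝ) (hR : 0 < R) (hR' : R < R') (hM : 0 < M) (n : ℕ) : ∀ f : ℂ → ℂ, DifferentiableOn ℂ f (Metric.ball 0 R') → f 0 ≠ 0 → (∀ z, ‖z‖ = R → ‖f z‖ ≤ K) → K ≤ Real.exp M * ‖f 0‖ →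
    (∀ z, ‖z‖ ≤ R / 2 → f z = 0 → z.re ≤ 0) → K ≤ 2 ^ n * ‖f 0‖ → -(deriv f 0 / f 0).re ≤ 48 * M / R := by
  have mx : ∀ f : ℂ → ℂ, DifferentiableOn ℂ f (Metric.ball 0 R') → (∀ z, ‖z‖ = R → ‖f z‖ ≤ K) → ∀ z, ‖z‖ ≤ R → ‖f z‖ ≤ K := fun f hf hK z hz => by
    refine Complex.norm_le_of_forall_mem_frontier_norm_le (U := Metric.ball 0 R) Metric.isBounded_ball ((hf.mono ?_).diffContOnCl) (fun w hw => hK w ?_) ?_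
    · rw [closure_ball _ hR.ne']; exact Metric.closedBall_subset_ball hR'
    · rwa [frontier_ball _ hR.ne', mem_sphere_zero_iff_norm] at hw
    · rwa [closure_ball _ hR.ne', mem_closedBall_zero_iff]
  have nz : ∀ f : ℂ → ℂ, DifferentiableOn ℂ f (Metric.ball 0 R') → (∀ z, ‖z‖ = R → ‖f z‖ ≤ K) → K ≤ Real.exp M * ‖f 0‖ → (∀ z, ‖z‖ ≤ R / 2 → f z ≠ 0) → -(deriv f 0 / f 0).re ≤ 48 * M / R := fun f hf hK hM0 h0 => by
    have := BC f (R / 2) M (by positivity) hM (hf.mono (Metric.ball_subset_ball (by linarith))) (fun z hz => h0 z (mem_ball_zero_iff.1 hz).le) (fun z hz => (mx f hf hK z (by rw [mem_ball_zero_iff] at hz; linarith)).trans hM0) 0 (by simp; positivity)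
    have h2 := (abs_le.1 (Complex.abs_re_le_norm (deriv f 0 / f 0))).1
    have : 24 * M / (R / 2) = 48 * M / R := by field_simp; norm_num
    linarith
  induction n with
  | zero =>
    intro f hf f0 hK hM0 hz hn
    refine nz f hf hK hM0 fun ρ hρ hfρ => ?_
    obtain ⟨g, gd, gn, g0, -⟩ := DIV f R R' hR hR' hf f0 ρ hfρ hρ
    have h1 := mx g gd (fun z h => (gn z h).trans_le (hK z h)) 0 (by simp; positivity)
    have := norm_pos_iff.2 f0
    rw [pow_zero, one_mul] at hn
    linarith
  | succ n ih =>
    intro f hf f0 hK hM0 hz hn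
    by_cases hex : ∃ ρ, ‖ρ‖ ≤ R / 2 ∧ f ρ = 0
    · obtain ⟨ρ, hρ, hfρ⟩ := hex
      obtain ⟨g, gd, gn, g0, gz, ge⟩ := DIV f R R' hR hR' hf f0 ρ hfρ hρ
      have fp := norm_pos_iff.2 f0
      have := ih g gd (norm_pos_iff.1 (by linarith)) (fun z h => (gn z h).trans_le (hK z h)) (hM0.trans (by gcongr; linarith)) (fun z h h' => hz z h (gz z h h')) (hn.trans (by rw [pow_succ, mul_assoc]; gcongr))
      have ρ0 : ρ ≠ 0 := fun h => f0 (h ▸ hfρ)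
      have np : 0 < Complex.normSq ρ := Complex.normSq_pos.2 ρ0
      have h3 : (1 / ρ - starRingEnd ℂ ρ / R ^ 2).re = ρ.re * (1 / Complex.normSq ρ - 1 / R ^ 2) := by
        rw [Complex.sub_re, one_div, Complex.inv_re, ← Complex.ofReal_pow, Complex.div_ofReal_re, Complex.conj_re]; ring
      have h4 : ρ.re * (1 / Complex.normSq ρ - 1 / R ^ 2) ≤ 0 := by
        refine mul_nonpos_of_nonpos_of_nonneg (hz ρ hρ hfρ) (sub_nonneg.2 ?_)
        rw [Complex.normSq_eq_norm_sq]
        have : ‖ρ‖ ≤ R := by linarith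
        have : 0 < ‖ρ‖ := norm_pos_iff.2 ρ0
        gcongr
      have h5 : -(deriv f 0 / f 0).re = -(deriv g 0 / g 0).re + (1 / ρ - starRingEnd ℂ ρ / R ^ 2).re := by rw [ge]; simp only [Complex.add_re, Complex.sub_re]; ring
      linarith
    · push Not at hex
      exact nz f hf hK hM0 hex

theorem LAN1 (R R' K M : ℝ) (hR : 0 < R) (hR' : R < R') (hM : 0 < M) (f : ℂ → ℂ) (hf : DifferentiableOn ℂ f (Metric.ball 0 R')) (f0 : f 0 ≠ 0) (hK : ∀ z, ‖z‖ = R → ‖f z‖ ≤ K) (hM0 : K ≤ Real.exp M * ‖f 0‖)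
    (hz : ∀ z, ‖z‖ ≤ R / 2 → f z = 0 → z.re ≤ 0) : -(deriv f 0 / f 0).re ≤ 48 * M / R ∧ ∀ d : ℝ, 0 < d → d ≤ R / 2 → f (-d) = 0 → -(deriv f 0 / f 0).re ≤ 48 * M / R - 1 / d + d / R ^ 2 := by
  have mn : ∀ g : ℂ → ℂ, g 0 ≠ 0 → ∃ n : ℕ, K ≤ 2 ^ n * ‖g 0‖ := fun g hg => by
    obtain ⟨n, hn⟩ := pow_unbounded_of_one_lt (K / ‖g 0‖) (by norm_num : (1:ℝ) < 2)
    exact ⟨n, (div_le_iff₀ (norm_pos_iff.2 hg)).1 hn.le⟩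
  obtain ⟨n, hn⟩ := mn f f0
  refine ⟨LAN R R' K M hR hR' hM n f hf f0 hK hM0 hz hn, fun d d0 dR hfd => ?_⟩
  obtain ⟨g, gd, gn, g0, gz, ge⟩ := DIV f R R' hR hR' hf f0 (-d) hfd (by rw [norm_neg, Complex.norm_real, Real.norm_of_nonneg d0.le]; exact dR)
  have fp := norm_pos_iff.2 f0
  have g1 := norm_pos_iff.1 (by linarith : 0 < ‖g 0‖)
  obtain ⟨m, hm⟩ := mn g g1
  have := LAN R R' K M hR hR' hM m g gd g1 (fun z h => (gn z h).trans_le (hK z h)) (hM0.trans (by gcongr; linarith)) (fun z h h' => hz z h (gz z h h')) hm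
  have h5 : -(deriv f 0 / f 0).re = -(deriv g 0 / g 0).re - 1 / d + d / R ^ 2 := by
    rw [ge, show deriv g 0 / g 0 - 1 / -(d:ℂ) + starRingEnd ℂ (-(d:ℂ)) / R ^ 2 = deriv g 0 / g 0 + ((1 / d - d / R ^ 2 : ℝ) : ℂ) by rw [map_neg, Complex.conj_ofReal]; push_cast; ring, Complex.add_re, Complex.ofReal_re]; ring
  linarith


noncomputable def frc (t : ℝ) : ℂ := if 1 < t then ((Int.fract t : ℝ) : ℂ) else 0

noncomputable def GG (s : ℂ) : ℂ := mellin frc (-s)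

/-- the entire-type function `(s-1)ζ(s)` on `Re s > 0` -/
noncomputable def ZZ (s : ℂ) : ℂ := s - s * (s - 1) * GG s

theorem frc_norm (t : ℝ) : ‖frc t‖ ≤ 1 := by
  unfold frc
  split_ifs
  · rw [Complex.norm_real, Real.norm_of_nonneg (Int.fract_nonneg _)]; exact (Int.fract_lt_one _).le
  · simp

theorem frc_meas : Measurable frc := Measurable.ite measurableSet_Ioi (Complex.measurable_ofReal.comp measurable_fract) measurable_const

theorem GG_eq (s : ℂ) : GG s = ∫ t in Set.Ioi (1:ℝ), ((Int.fract t : ℝ) : ℂ) * (t:ℂ) ^ (-(s + 1)) := by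
  rw [GG, mellin]
  refine (setIntegral_eq_of_subset_of_forall_sdiff_eq_zero (s := Set.Ioi (1:ℝ)) (f := fun t : ℝ => (t:ℂ) ^ (-s - 1) • frc t) measurableSet_Ioi (Set.Ioi_subset_Ioi zero_le_one) ?_).trans ?_
  rotate_left
  · refine setIntegral_congr_fun measurableSet_Ioi fun t ht => ?_
    simp only [frc, if_pos (Set.mem_Ioi.1 ht), smul_eq_mul]
    rw [mul_comm]; congr 2; ring
  · intro t ht
    have h : ¬ 1 < t := ht.2
    simp only [frc, if_neg h, smul_zero]

theorem GG_norm (s : ℂ) (hs : 0 < s.re) : ‖GG s‖ ≤ 1 / s.re := by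
  rw [GG_eq]
  have := integral_Ioi_rpow_of_lt (show -(s.re + 1) < -1 by linarith) one_pos
  rw [Real.one_rpow, show -1 / (-(s.re + 1) + 1) = 1 / s.re by rw [show -(s.re + 1) + 1 = -s.re by ring, neg_div_neg_eq]] at this
  rw [← this]
  refine norm_integral_le_of_norm_le (integrableOn_Ioi_rpow_of_lt (by linarith) one_pos) ((ae_restrict_mem measurableSet_Ioi).mono fun t ht => ?_)
  have t0 : 0 < t := one_pos.trans ht
  rw [norm_mul, Complex.norm_cpow_eq_rpow_re_of_pos t0, Complex.norm_real, Real.norm_of_nonneg (Int.fract_nonneg _)]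
  simp only [Complex.neg_re, Complex.add_re, Complex.one_re]
  exact mul_le_of_le_one_left (by positivity) (Int.fract_lt_one _).le

theorem GG_diff (s : ℂ) (hs : 0 < s.re) : DifferentiableAt ℂ GG s := by
  have : DifferentiableAt ℂ (mellin frc) (-s) := by
    refine mellin_differentiableAt_of_isBigO_rpow (a := 0) (b := -s.re - 1) ?_ ?_ (by simpa using hs) ?_ (by simp)
    · exact ((memLp_top_of_bound frc_meas.aestronglyMeasurable 1 (Filter.Eventually.of_forall frc_norm)).locallyIntegrable le_top).locallyIntegrableOn _
    · refine Asymptotics.IsBigO.of_bound 1 (Filter.Eventually.of_forall fun t => ?_)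
      simpa using frc_norm t
    · refine Asymptotics.IsBigO.of_bound 1 ?_
      filter_upwards [mem_nhdsWithin_of_mem_nhds (Iio_mem_nhds one_pos)] with t ht
      rw [frc, if_neg (not_lt.2 (le_of_lt ht)), norm_zero]; positivity
  exact this.comp s differentiableAt_id.neg

theorem ZZ_diff (s : ℂ) (hs : 0 < s.re) : DifferentiableAt ℂ ZZ s := by
  have := GG_diff s hs
  unfold ZZ
  fun_prop

theorem ZZ_zeta (s : ℂ) (hs : 1 < s.re) : ZZ s = (s - 1) * riemannZeta s := by
  have h0 : s ≠ 0 := fun h => by simp [h] at hs; linarith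
  have h1 : s - 1 ≠ 0 := fun h => by rw [sub_eq_zero.1 h] at hs; simp at hs
  have hO : (fun n : ℕ ↦ ∑ k ∈ Finset.Icc 1 n, ‖(1 : ℕ → ℂ) k‖) =O[Filter.atTop] fun n ↦ (n : ℝ) ^ (1:ℝ) := by
    refine Asymptotics.IsBigO.of_bound 1 (Filter.Eventually.of_forall fun n => ?_)
    simp
  have := LSeries_eq_mul_integral' (1 : ℕ → ℂ) zero_le_one hs hO
  rw [LSeries_one_eq_riemannZeta hs] at this
  have i1 : IntegrableOn (fun t : ℝ => (t:ℂ) ^ (-s)) (Set.Ioi 1) := integrableOn_Ioi_cpow_of_lt (by simpa using hs) one_pos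
  have i2 : IntegrableOn (fun t : ℝ => ((Int.fract t : ℝ) : ℂ) * (t:ℂ) ^ (-(s + 1))) (Set.Ioi 1) := by
    refine Integrable.mono' (integrableOn_Ioi_rpow_of_lt (show -(s.re + 1) < -1 by linarith) one_pos) ?_ ((ae_restrict_mem measurableSet_Ioi).mono fun t ht => ?_)
    · exact ((Complex.measurable_ofReal.comp measurable_fract).mul (Complex.measurable_ofReal.pow_const (-(s + 1)))).aestronglyMeasurable
    have t0 : 0 < t := one_pos.trans ht
    rw [norm_mul, Complex.norm_cpow_eq_rpow_re_of_pos t0, Complex.norm_real, Real.norm_of_nonneg (Int.fract_nonneg _)]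
    simp only [Complex.neg_re, Complex.add_re, Complex.one_re]
    exact mul_le_of_le_one_left (by positivity) (Int.fract_lt_one _).le
  have e1 : ∫ t in Set.Ioi (1 : ℝ), (∑ k ∈ Finset.Icc 1 ⌊t⌋₊, (1 : ℕ → ℂ) k) * t ^ (-(s + 1)) = (∫ t in Set.Ioi (1:ℝ), (t:ℂ) ^ (-s)) - ∫ t in Set.Ioi (1:ℝ), ((Int.fract t : ℝ) : ℂ) * (t:ℂ) ^ (-(s + 1)) := by
    rw [← integral_sub i1 i2]
    refine setIntegral_congr_fun measurableSet_Ioi fun t ht => ?_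
    have t0 : 0 < t := one_pos.trans ht
    have tc : (t:ℂ) ≠ 0 := by exact_mod_cast t0.ne'
    have : (t:ℂ) ^ (-s) = t * (t:ℂ) ^ (-(s + 1)) := by rw [neg_add, Complex.cpow_add _ _ tc, Complex.cpow_neg_one]; field_simp
    simp only [Pi.one_apply, Finset.sum_const, Nat.card_Icc, add_tsub_cancel_right, nsmul_eq_mul, mul_one]
    rw [this, ← sub_mul]
    congr 1
    have h3 : ((⌊t⌋₊:ℕ):ℝ) = t - Int.fract t := by rw [natCast_floor_eq_intCast_floor t0.le, Int.self_sub_fract]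
    exact_mod_cast congrArg (fun x : ℝ => (x:ℂ)) h3
  rw [e1, integral_Ioi_cpow_of_lt (by simpa using hs) one_pos, ← GG_eq] at this
  rw [this, ZZ]
  have h2 : -s + 1 ≠ 0 := fun h => h1 (by linear_combination -h)
  simp only [Complex.ofReal_one, Complex.one_cpow]
  field_simp; ring


theorem ZZ_bd (s : ℂ) (hs : 1 / 4 ≤ s.re) : ‖ZZ s‖ ≤ ‖s‖ + 4 * ‖s‖ * ‖s - 1‖ := by
  have h1 := GG_norm s (by linarith)
  have h2 : 1 / s.re ≤ 4 := by rw [div_le_iff₀ (by linarith)]; linarith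
  unfold ZZ
  refine (norm_sub_le _ _).trans (add_le_add le_rfl ?_)
  rw [norm_mul, norm_mul]
  linarith [mul_le_mul_of_nonneg_left (h1.trans h2) (mul_nonneg (norm_nonneg s) (norm_nonneg (s - 1)))]

theorem ZZ_near (s : ℂ) (hs : ‖s - 1‖ ≤ 1 / 4) : ZZ s ≠ 0 := by
  have r : 3 / 4 ≤ s.re := by have := (Complex.abs_re_le_norm (s - 1)).trans hs; rw [Complex.sub_re, Complex.one_re, abs_le] at this; linarith
  have h1 := GG_norm s (by linarith)
  have h2 : 1 / s.re ≤ 4 / 3 := by rw [div_le_iff₀ (by linarith)]; linarith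
  have h3 : ‖s‖ ≤ 5 / 4 := by have := norm_add_le (s - 1) 1; rw [sub_add_cancel, norm_one] at this; linarith
  intro h
  have h4 : (1:ℂ) = (s - 1) * (s * GG s - 1) := by unfold ZZ at h; linear_combination h
  have h5 := congrArg norm h4
  have h6 : ‖s * GG s - 1‖ ≤ 5 / 3 + 1 := (norm_sub_le _ _).trans (by
    rw [norm_mul, norm_one]
    linarith only [mul_le_mul h3 (h1.trans h2) (norm_nonneg _) (by norm_num)])
  rw [norm_mul, norm_one] at h5
  linarith only [h5, mul_le_mul hs h6 (norm_nonneg _) (by norm_num)]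

theorem zsum (σ : ℝ) (h1 : 1 < σ) (h2 : σ ≤ 2) : ∑' n : ℕ, 1 / (n:ℝ) ^ σ ≤ 10 / (σ - 1) := by
  have e1 : riemannZeta (σ:ℂ) = ((∑' n : ℕ, 1 / (n:ℝ) ^ σ : ℝ) : ℂ) := by
    rw [zeta_eq_tsum_one_div_nat_cpow (by simpa using h1), Complex.ofReal_tsum]
    refine tsum_congr fun n => ?_
    push_cast
    rw [Complex.ofReal_cpow (Nat.cast_nonneg _)]; simp
  have e2 := ZZ_zeta σ (by simpa using h1)
  have e3 := ZZ_bd σ (by simp; linarith)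
  rw [e2, e1, ← Complex.ofReal_one, ← Complex.ofReal_sub, ← Complex.ofReal_mul, Complex.norm_real, Complex.norm_real, Complex.norm_real, Real.norm_of_nonneg (by linarith : 0 ≤ σ), Real.norm_of_nonneg (by linarith : 0 ≤ σ - 1)] at e3
  rw [le_div_iff₀ (by linarith), mul_comm]
  refine (le_abs_self _).trans (e3.trans ?_)
  linarith [mul_le_mul (by linarith : 4 * σ ≤ 8) (by linarith : σ - 1 ≤ 1) (by linarith) (by norm_num)]

theorem ZZ_ne (s : ℂ) (hs : 1 < s.re) : ZZ s ≠ 0 := by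
  rw [ZZ_zeta s hs]
  refine mul_ne_zero (fun h => ?_) (riemannZeta_ne_zero_of_one_lt_re hs)
  rw [sub_eq_zero.1 h] at hs; simp at hs

theorem ZZ_low (s : ℂ) (h1 : 1 < s.re) (h2 : s.re ≤ 2) : (s.re - 1) ^ 2 / 10 ≤ ‖ZZ s‖ := by
  have hm := LSeries_one_mul_Lseries_moebius h1
  rw [LSeries_one_eq_riemannZeta h1] at hm
  have hs := (Real.summable_one_div_nat_rpow (p := s.re)).2 h1
  have hb : ‖LSeries (fun n => ((ArithmeticFunction.moebius n : ℤ) : ℂ)) s‖ ≤ 10 / (s.re - 1) := by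
    refine (tsum_of_norm_bounded hs.hasSum fun n => ?_).trans (zsum _ h1 h2)
    rw [LSeries.norm_term_eq]
    split_ifs with h
    · positivity
    · gcongr
      have := ArithmeticFunction.abs_moebius_le_one (n := n)
      rw [Complex.norm_intCast]; exact_mod_cast this
  have h3 := congrArg norm hm
  rw [norm_mul, norm_one] at h3
  have d0 : 0 < s.re - 1 := by linarith
  have h4 : 1 ≤ ‖riemannZeta s‖ * (10 / (s.re - 1)) := h3.symm.le.trans (mul_le_mul_of_nonneg_left hb (norm_nonneg _))
  have h5 : (s.re - 1) / 10 ≤ ‖riemannZeta s‖ := by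
    rw [← mul_div_assoc, le_div_iff₀ d0] at h4; linarith
  have h6 : s.re - 1 ≤ ‖s - 1‖ := by simpa using Complex.re_le_norm (s - 1)
  rw [ZZ_zeta s h1, norm_mul, sq, mul_div_assoc]
  exact mul_le_mul h6 h5 (by positivity) (norm_nonneg _)

theorem VM_eq (s : ℂ) (h1 : 1 < s.re) : LSeries (fun n => (ArithmeticFunction.vonMangoldt n : ℂ)) s = 1 / (s - 1) - deriv ZZ s / ZZ s := by
  rw [ArithmeticFunction.LSeries_vonMangoldt_eq_deriv_riemannZeta_div h1]
  have s1 : s ≠ 1 := fun h => by rw [h] at h1; simp at h1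
  have z0 := riemannZeta_ne_zero_of_one_lt_re h1
  have ev : ZZ =ᶠ[nhds s] fun w => (w - 1) * riemannZeta w := by
    filter_upwards [(isOpen_lt continuous_const Complex.continuous_re).mem_nhds h1] with w hw using ZZ_zeta w hw
  have hd : HasDerivAt (fun w => (w - 1) * riemannZeta w) (1 * riemannZeta s + (s - 1) * deriv riemannZeta s) s :=
    ((hasDerivAt_id s).sub_const 1).mul (differentiableAt_riemannZeta s1).hasDerivAt
  rw [ev.deriv_eq, hd.deriv, ZZ_zeta s h1]
  have := sub_ne_zero.2 s1
  field_simp; ring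

theorem T341 (σ γ : ℝ) (h1 : 1 < σ) : 0 ≤ 3 * (LSeries (fun n => (ArithmeticFunction.vonMangoldt n : ℂ)) σ).re + 4 * (LSeries (fun n => (ArithmeticFunction.vonMangoldt n : ℂ)) (σ + γ * Complex.I)).re + (LSeries (fun n => (ArithmeticFunction.vonMangoldt n : ℂ)) (σ + 2 * γ * Complex.I)).re := by
  have H : ∀ t : ℝ, HasSum (fun n => (LSeries.term (fun n => (ArithmeticFunction.vonMangoldt n : ℂ)) (σ + t * Complex.I) n).re) (LSeries (fun n => (ArithmeticFunction.vonMangoldt n : ℂ)) (σ + t * Complex.I)).re := fun t =>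
    Complex.hasSum_re (ArithmeticFunction.LSeriesSummable_vonMangoldt (by simpa using h1)).hasSum
  have h := (((H 0).mul_left 3).add ((H γ).mul_left 4)).add (H (2 * γ))
  simp only [Complex.ofReal_zero, zero_mul, add_zero, Complex.ofReal_mul, Complex.ofReal_ofNat] at h
  refine h.nonneg fun n => ?_
  rcases Nat.eq_zero_or_pos n with rfl | hn
  · simp
  have nc : (n:ℂ) ≠ 0 := by exact_mod_cast hn.ne'
  simp only [LSeries.term_of_ne_zero hn.ne']
  set u : ℂ := Complex.exp (((-(γ * Real.log n) : ℝ) : ℂ) * Complex.I) with hu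
  have ur : ∀ k : ℕ, (n:ℂ) ^ (-(σ + k * γ * Complex.I)) = ((n:ℝ) ^ (-σ) : ℝ) * u ^ k := by
    intro k
    rw [neg_add, Complex.cpow_add _ _ nc, Complex.ofReal_cpow (Nat.cast_nonneg _), Complex.ofReal_natCast, Complex.ofReal_neg]
    congr 1
    rw [Complex.cpow_def_of_ne_zero nc, hu, ← Complex.exp_nat_mul, ← Complex.natCast_log]
    congr 1; push_cast; ring
  have nu : u.re ^ 2 + u.im ^ 2 = 1 := by
    have : Complex.normSq u = 1 := by rw [Complex.normSq_eq_norm_sq, hu, Complex.norm_exp_ofReal_mul_I]; norm_num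
    rw [← this, Complex.normSq_apply]; ring
  have u0 := ur 0
  have u1 := ur 1
  have u2 := ur 2
  simp only [Nat.cast_zero, zero_mul, add_zero, pow_zero, mul_one, Nat.cast_one, one_mul, pow_one, Nat.cast_ofNat] at u0 u1 u2
  rw [div_eq_mul_inv, div_eq_mul_inv, div_eq_mul_inv, ← Complex.cpow_neg, ← Complex.cpow_neg, ← Complex.cpow_neg, u0, u1, u2, Complex.re_ofReal_mul, Complex.re_ofReal_mul, Complex.re_ofReal_mul, Complex.ofReal_re, Complex.re_ofReal_mul, Complex.re_ofReal_mul]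
  have : (u ^ 2).re = 2 * u.re ^ 2 - 1 := by rw [sq, Complex.mul_re]; linarith
  rw [this]
  have hv := mul_nonneg (mul_nonneg (ArithmeticFunction.vonMangoldt_nonneg (n := n)) (by positivity : 0 ≤ (n:ℝ) ^ (-σ))) (sq_nonneg (1 + u.re))
  linarith

/-- bound for `-Re ZZ'/ZZ` to the right of `1`, with the contribution of a zero -/
theorem ZZ_LAN (T δ γ : ℝ) (hT : 3 ≤ T) (hδ : δ = 1 / 2 ^ 20 / Real.log T) (hγ : |γ| ≤ 2 * T) :
    -(deriv ZZ (((1 + δ : ℝ) : ℂ) + γ * Complex.I) / ZZ (((1 + δ : ℝ) : ℂ) + γ * Complex.I)).re ≤ 5088 * Real.log T ∧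
    ∀ d : ℝ, 0 < d → d ≤ 1 / 4 → ZZ (((1 + δ : ℝ) : ℂ) + γ * Complex.I - d) = 0 →
    -(deriv ZZ (((1 + δ : ℝ) : ℂ) + γ * Complex.I) / ZZ (((1 + δ : ℝ) : ℂ) + γ * Complex.I)).re ≤ 5088 * Real.log T - 1 / d + 4 * d := by
  set s : ℂ := ((1 + δ : ℝ) : ℂ) + γ * Complex.I with hs
  have sre : s.re = 1 + δ := by simp [hs]
  have sim : s.im = γ := by simp [hs]
  have T0 : 0 < T := by linarith
  have l1 : 1 ≤ Real.log T := by
    rw [Real.le_log_iff_exp_le T0]; linarith [Real.exp_one_lt_d9]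
  have lT : Real.log T ≤ T := (Real.log_le_sub_one_of_pos T0).trans (by linarith)
  have δ0 : 0 < δ := by rw [hδ]; positivity
  have δ1 : δ ≤ 1 / 2 ^ 20 := by rw [hδ]; exact div_le_self (by positivity) l1
  have δ2 : δ ≤ 1 / 100 := δ1.trans (by norm_num)
  have hd : deriv (fun w => ZZ (s + w)) 0 = deriv ZZ s := by rw [deriv_comp_const_add, add_zero]
  have key := LAN1 (1 / 2) (3 / 4) (45 * T ^ 2) (53 * Real.log T) (by norm_num) (by norm_num) (by linarith only [l1]) (fun w => ZZ (s + w)) ?_ ?_ ?_ ?_ ?_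
  · simp only [hd, add_zero] at key
    refine ⟨key.1.trans_eq (by ring), fun d d0 d1 hz => (key.2 d d0 (by linarith only [d1]) (by simpa [sub_eq_add_neg] using hz)).trans_eq (by ring)⟩
  · intro w hw
    rw [mem_ball_zero_iff] at hw
    have := Complex.abs_re_le_norm w
    have h : DifferentiableAt ℂ ZZ (s + w) := ZZ_diff _ (by rw [Complex.add_re, sre]; linarith only [δ0, hw, this, neg_abs_le w.re])
    exact (h.comp w ((differentiableAt_const s).add differentiableAt_id)).differentiableWithinAt
  · simpa using ZZ_ne s (by rw [sre]; linarith only [δ0])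
  · intro z hz
    have h1 := (abs_le.1 (Complex.abs_re_le_norm z))
    have h2 := (Complex.abs_im_le_norm z)
    rw [hz] at h1 h2
    have n1 : ‖s + z‖ ≤ 3 * T := by
      refine (Complex.norm_le_abs_re_add_abs_im _).trans ?_
      rw [Complex.add_re, Complex.add_im, sre, sim]
      have : |1 + δ + z.re| ≤ 2 := abs_le.2 ⟨by linarith, by linarith⟩
      linarith only [hT, hγ, h2, this, abs_add_le γ z.im]
    have n2 : ‖s + z - 1‖ ≤ 3 * T := by
      refine (Complex.norm_le_abs_re_add_abs_im _).trans ?_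
      rw [Complex.sub_re, Complex.sub_im, Complex.add_re, Complex.add_im, sre, sim, Complex.one_re, Complex.one_im, sub_zero]
      have : |1 + δ + z.re - 1| ≤ 2 := abs_le.2 ⟨by linarith, by linarith⟩
      linarith only [hT, hγ, h2, this, abs_add_le γ z.im]
    refine (ZZ_bd _ (by rw [Complex.add_re, sre]; linarith)).trans ?_
    have := mul_le_mul n1 n2 (norm_nonneg _) (by linarith only [hT])
    have h3 : T ≤ T ^ 2 := by rw [sq]; exact le_mul_of_one_le_left T0.le (by linarith only [hT])
    have h4 : 3 * T ≤ T ^ 2 := by rw [sq]; exact mul_le_mul_of_nonneg_right hT T0.le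
    linarith only [hT, n1, this, h4]
  · have lo := ZZ_low s (by rw [sre]; linarith) (by rw [sre]; linarith)
    rw [sre, add_sub_cancel_left, hδ] at lo
    have ex : T ^ 4 * 2 ^ 49 ≤ Real.exp (53 * Real.log T) := by
      have h1 : T ^ 4 = Real.exp (4 * Real.log T) := by rw [mul_comm, Real.exp_mul, Real.exp_log T0]; norm_cast
      have h2 : (2:ℝ) ^ 49 ≤ Real.exp (49 * Real.log T) := by
        rw [show 49 * Real.log T = ((49:ℕ):ℝ) * Real.log T by norm_num, Real.exp_nat_mul, Real.exp_log T0]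
        exact pow_le_pow_left₀ (by norm_num) (by linarith only [hT]) _
      rw [show 53 * Real.log T = 4 * Real.log T + 49 * Real.log T by ring, Real.exp_add, h1]
      exact mul_le_mul_of_nonneg_left h2 (Real.exp_pos _).le
    simp only [add_zero]
    refine le_trans ?_ (mul_le_mul ex lo (by positivity) (Real.exp_pos _).le)
    rw [div_div, div_pow, one_pow, div_div, ← mul_div_assoc, le_div_iff₀ (by positivity), mul_one]
    have : Real.log T ^ 2 ≤ T ^ 2 := pow_le_pow_left₀ (by linarith only [l1]) lT 2
    calc 45 * T ^ 2 * ((2 ^ 20 * Real.log T) ^ 2 * 10) = 450 * 2 ^ 40 * T ^ 2 * Real.log T ^ 2 := by ring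
      _ ≤ 2 ^ 49 * T ^ 2 * T ^ 2 := by gcongr; norm_num
      _ = _ := by ring
  · intro z _ hz
    by_contra h
    exact ZZ_ne (s + z) (by rw [Complex.add_re, sre]; push Not at h; linarith only [δ0, h]) hz

theorem inv_re (δ γ : ℝ) (h0 : 0 < δ) (h1 : δ ≤ 1 / 100) (hγ : 1 / 8 ≤ |γ|) : (1 / (((1 + δ : ℝ) : ℂ) + γ * Complex.I - 1)).re ≤ 1 := by
  have : (1 / (((1 + δ : ℝ) : ℂ) + γ * Complex.I - 1)).re = δ / (δ ^ 2 + γ ^ 2) := by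
    rw [Complex.div_re, Complex.normSq_apply]; simp; ring
  rw [this, div_le_one (by positivity)]
  have := pow_le_pow_left₀ (by norm_num) hγ 2
  rw [sq_abs] at this
  linarith [sq_nonneg δ]

theorem ZFR (T : ℝ) (hT : 3 ≤ T) (s : ℂ) (h1 : |s.im| ≤ T) (h2 : 1 - 1 / (10 * 2 ^ 20) / Real.log T < s.re) : ZZ s ≠ 0 := by
  intro hz
  have T0 : 0 < T := by linarith
  have l1 : 1 ≤ Real.log T := by
    rw [Real.le_log_iff_exp_le T0]; linarith [Real.exp_one_lt_d9]
  have b1 : s.re ≤ 1 := by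
    by_contra h; push Not at h; exact ZZ_ne s h hz
  obtain ⟨δ, hδ⟩ : ∃ δ, δ = 1 / 2 ^ 20 / Real.log T := ⟨_, rfl⟩
  have δ0 : 0 < δ := by rw [hδ]; positivity
  have δ1 : δ ≤ 1 / 100 := by rw [hδ]; exact (div_le_self (by positivity) l1).trans (by norm_num)
  have h2' : 1 - δ / 10 < s.re := by
    convert h2 using 2; rw [hδ]; ring
  obtain ⟨γ, hγ⟩ : ∃ γ, γ = s.im := ⟨_, rfl⟩
  rw [← hγ] at h1
  have g8 : 1 / 8 ≤ |γ| := by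
    by_contra h
    push Not at h
    refine ZZ_near s ?_ hz
    refine (Complex.norm_le_abs_re_add_abs_im _).trans ?_
    rw [Complex.sub_re, Complex.sub_im, Complex.one_re, Complex.one_im, sub_zero, ← hγ]
    have : |s.re - 1| ≤ 1 / 100 := abs_le.2 ⟨by linarith only [δ1, h2'], by linarith only [b1]⟩
    linarith
  have seq : ((1 + δ : ℝ) : ℂ) + γ * Complex.I - ((1 + δ - s.re : ℝ) : ℂ) = s := by
    rw [hγ]; apply Complex.ext <;> simp
  have k0 := (ZZ_LAN T δ 0 hT hδ (by simp; linarith only [hT])).1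
  have k1 := (ZZ_LAN T δ γ hT hδ (by linarith only [hT, h1])).2 (1 + δ - s.re) (by linarith only [b1, δ0]) (by linarith only [δ1, h2']) (by rw [seq]; exact hz)
  have k2 := (ZZ_LAN T δ (2 * γ) hT hδ (by rw [abs_mul, abs_two]; linarith only [h1])).1
  have m := T341 (1 + δ) γ (by linarith only [δ0])
  have i1 := inv_re δ γ δ0 δ1 g8
  have i2 := inv_re δ (2 * γ) δ0 δ1 (by rw [abs_mul, abs_two]; linarith only [g8])
  rw [VM_eq _ (by simp; linarith only [δ0]), VM_eq _ (by simp; linarith only [δ0]), VM_eq _ (by simp; linarith only [δ0]), Complex.sub_re, Complex.sub_re, Complex.sub_re] at m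
  push_cast at k0 k1 k2 i1 i2 m
  simp only [zero_mul, add_zero] at k0
  have i0 : (1 / (1 + (δ:ℂ) - 1)).re = 1 / δ := by rw [add_sub_cancel_left, ← Complex.ofReal_one, ← Complex.ofReal_div, Complex.ofReal_re]
  rw [i0] at m
  have d1 : 10 / 11 * (1 / δ) ≤ 1 / (1 + δ - s.re) := by
    rw [div_mul_div_comm, div_le_div_iff₀ (by linarith only [δ0]) (by linarith only [b1, δ0])]; linarith only [h2']
  have e1 : 1 / δ = 2 ^ 20 * Real.log T := by rw [hδ]; field_simp
  rw [e1] at m d1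
  linarith only [l1, δ1, h2', k1, k2, i1, i2, m, k0, d1]


theorem LD (T : ℝ) (hT : 3 ≤ T) (s : ℂ) (h1 : |s.im| ≤ T - 1) (h2 : |s.re - 1| ≤ 1 / (40 * 2 ^ 20) / Real.log T) :
    ‖deriv ZZ s / ZZ s‖ ≤ 2 ^ 34 * Real.log T ^ 2 := by
  have T0 : 0 < T := by linarith
  have l1 : 1 ≤ Real.log T := by
    rw [Real.le_log_iff_exp_le T0]; linarith [Real.exp_one_lt_d9]
  have lT : Real.log T ≤ T := (Real.log_le_sub_one_of_pos T0).trans (by linarith)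
  obtain ⟨η, hη⟩ : ∃ η, η = 1 / (10 * 2 ^ 20) / Real.log T := ⟨_, rfl⟩
  have η0 : 0 < η := by rw [hη]; positivity
  have η1 : η ≤ 1 / 100 := by rw [hη]; exact (div_le_self (by positivity) l1).trans (by norm_num)
  have h2' : |s.re - 1| ≤ η / 4 := by convert h2 using 1; rw [hη]; ring
  obtain ⟨q, hq⟩ : ∃ q : ℂ, q = ((1 + η / 4 : ℝ) : ℂ) + s.im * Complex.I := ⟨_, rfl⟩
  have qre : q.re = 1 + η / 4 := by simp [hq]
  have qim : q.im = s.im := by simp [hq]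
  have sq0 : s - q = ((s.re - 1 - η / 4 : ℝ) : ℂ) := by apply Complex.ext <;> simp [qre, qim]; ring
  have hsq : ‖s - q‖ ≤ η / 2 := by
    rw [sq0, Complex.norm_real, Real.norm_eq_abs]
    rw [abs_le] at h2' ⊢
    constructor <;> linarith
  have hd : ∀ w, deriv (fun w => ZZ (q + w)) w = deriv ZZ (q + w) := fun w => by rw [deriv_comp_const_add]
  have pos : ∀ z ∈ Metric.ball (0:ℂ) η, 1 - η < (q + z).re ∧ (q + z).re < 2 ∧ |(q + z).im| ≤ T := by
    intro z hz
    rw [mem_ball_zero_iff] at hz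
    have r1 := (abs_lt.1 ((Complex.abs_re_le_norm z).trans_lt hz))
    have r2 := (abs_lt.1 ((Complex.abs_im_le_norm z).trans_lt hz))
    have r3 := abs_le.1 h1
    rw [Complex.add_re, Complex.add_im, qre, qim, abs_le]
    refine ⟨by linarith, by linarith, by linarith, by linarith⟩
  have key := BC (fun w => ZZ (q + w)) η (64 * Real.log T) η0 (by linarith only [l1]) ?_ ?_ ?_ (s - q) hsq
  · rw [hd] at key
    simp only [add_sub_cancel] at key
    refine key.trans ?_
    rw [div_le_iff₀ η0, hη]
    have : Real.log T ^ 2 * (1 / (10 * 2 ^ 20) / Real.log T) = Real.log T * (1 / (10 * 2 ^ 20)) := by field_simp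
    rw [mul_assoc, this]
    linarith only [l1]
  · intro w hw
    have h : DifferentiableAt ℂ ZZ (q + w) := ZZ_diff _ (by linarith only [η1, (pos w hw).1])
    exact (h.comp w ((differentiableAt_const q).add differentiableAt_id)).differentiableWithinAt
  · intro w hw
    exact ZFR T hT _ (pos w hw).2.2 (by rw [← hη]; exact (pos w hw).1)
  · intro z hz
    obtain ⟨p1, p2, p3⟩ := pos z hz
    have n1 : ‖q + z‖ ≤ 2 * T := by
      refine (Complex.norm_le_abs_re_add_abs_im _).trans ?_
      rw [abs_of_pos (by linarith only [η1, p1])]; linarith only [hT, p2, p3]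
    have n2 : ‖q + z - 1‖ ≤ 2 * T := by
      refine (Complex.norm_le_abs_re_add_abs_im _).trans ?_
      rw [Complex.sub_re, Complex.sub_im, Complex.one_re, Complex.one_im, sub_zero]
      have : |(q + z).re - 1| ≤ 1 := abs_le.2 ⟨by linarith only [η1, p1], by linarith only [p2]⟩
      linarith only [hT, p3, this]
    have lo := ZZ_low q (by rw [qre]; linarith only [η0]) (by rw [qre]; linarith only [η1])
    rw [qre, add_sub_cancel_left, hη] at lo
    have ex : T ^ 4 * 2 ^ 60 ≤ Real.exp (64 * Real.log T) := by
      rw [show 64 * Real.log T = ((64:ℕ):ℝ) * Real.log T by norm_num, Real.exp_nat_mul, Real.exp_log T0]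
      rw [show T ^ 64 = T ^ 4 * T ^ 60 by ring]
      gcongr; linarith only [hT]
    simp only [add_zero]
    refine le_trans ?_ (mul_le_mul ex lo (by positivity) (Real.exp_pos _).le)
    refine (ZZ_bd _ (by linarith only [η1, p1])).trans ?_
    have h3 := mul_le_mul n1 n2 (norm_nonneg _) (by linarith only [hT])
    have h4 : 3 * T ≤ T ^ 2 := by rw [sq]; exact mul_le_mul_of_nonneg_right hT T0.le
    have h5 : ‖q + z‖ + 4 * ‖q + z‖ * ‖q + z - 1‖ ≤ 18 * T ^ 2 := by linarith only [hT, n1, h3, h4]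
    refine h5.trans ?_
    rw [show (1 / (10 * 2 ^ 20) / Real.log T / 4) ^ 2 / 10 = 1 / (16000 * 2 ^ 40 * Real.log T ^ 2) by field_simp; norm_num, mul_one_div, le_div_iff₀ (by positivity)]
    have : Real.log T ^ 2 ≤ T ^ 2 := pow_le_pow_left₀ (by linarith only [l1]) lT 2
    calc 18 * T ^ 2 * (16000 * 2 ^ 40 * Real.log T ^ 2) = (288000 * 2 ^ 40) * T ^ 2 * Real.log T ^ 2 := by ring
      _ ≤ 2 ^ 60 * T ^ 2 * T ^ 2 := by gcongr; norm_num
      _ = _ := by ring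

/-- analytic continuation of `∑ (Λ(n) - 1) n^{-s}` -/
noncomputable def AA (s : ℂ) : ℂ := -(deriv ZZ s / ZZ s) - 1 + s * GG s

noncomputable def gv (n : ℕ) : ℂ := (ArithmeticFunction.vonMangoldt n : ℂ) - 1

theorem gv_sum (s : ℂ) (h1 : 1 < s.re) : LSeriesSummable gv s :=
  (ArithmeticFunction.LSeriesSummable_vonMangoldt h1).sub (LSeriesSummable_one_iff.2 h1)

theorem AA_eq (s : ℂ) (h1 : 1 < s.re) : LSeries gv s = AA s := by
  have := LSeries_sub (ArithmeticFunction.LSeriesSummable_vonMangoldt h1) (LSeriesSummable_one_iff.2 h1)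
  have hz := ZZ_zeta s h1
  have s1 : s - 1 ≠ 0 := fun h => by rw [sub_eq_zero.1 h] at h1; simp at h1
  have hz' : riemannZeta s = (s - s * (s - 1) * GG s) / (s - 1) := by
    rw [eq_div_iff s1, mul_comm, ← hz, ZZ]
  refine this.trans ?_
  rw [VM_eq s h1, LSeries_one_eq_riemannZeta h1, hz', AA]
  field_simp; ring

theorem AA_bd (T : ℝ) (hT : 3 ≤ T) (s : ℂ) (h1 : |s.im| ≤ T - 1) (h2 : |s.re - 1| ≤ 1 / (40 * 2 ^ 20) / Real.log T) : ‖AA s‖ ≤ 2 ^ 36 * T := by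
  have := LD T hT s h1 h2
  have T0 : 0 < T := by linarith
  have l1 : 1 ≤ Real.log T := by
    rw [Real.le_log_iff_exp_le T0]; linarith [Real.exp_one_lt_d9]
  have h2' : |s.re - 1| ≤ 1 / 100 := h2.trans ((div_le_self (by positivity) l1).trans (by norm_num))
  have l2 : Real.log T ^ 2 ≤ 2 * T := by
    have := Real.quadratic_le_exp_of_nonneg (by linarith : 0 ≤ Real.log T)
    rw [Real.exp_log T0] at this; linarith
  have h3 := abs_le.1 h2'
  have g1 := GG_norm s (by linarith)
  have g2 : 1 / s.re ≤ 2 := by rw [div_le_iff₀ (by linarith)]; linarith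
  have n1 : ‖s‖ ≤ 2 * T := by
    refine (Complex.norm_le_abs_re_add_abs_im _).trans ?_
    rw [abs_of_pos (by linarith)]; linarith
  unfold AA
  refine (norm_add_le _ _).trans ((add_le_add (norm_sub_le _ _) le_rfl).trans ?_)
  rw [norm_neg, norm_one, norm_mul]
  linarith only [hT, this, l2, mul_le_mul n1 (g1.trans g2) (norm_nonneg _) (by linarith only [hT])]

theorem AA_diff (T : ℝ) (hT : 3 ≤ T) (s : ℂ) (h1 : |s.im| ≤ T - 1) (h2 : |s.re - 1| ≤ 1 / (40 * 2 ^ 20) / Real.log T) : DifferentiableAt ℂ AA s := by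
  have T0 : 0 < T := by linarith
  have l1 : 1 ≤ Real.log T := by
    rw [Real.le_log_iff_exp_le T0]; linarith [Real.exp_one_lt_d9]
  have h2' : |s.re - 1| ≤ 1 / 100 := h2.trans ((div_le_self (by positivity) l1).trans (by norm_num))
  have h3 := abs_le.1 h2'
  have o : IsOpen {w : ℂ | 0 < w.re} := isOpen_lt continuous_const Complex.continuous_re
  have sm : s ∈ {w : ℂ | 0 < w.re} := by show 0 < s.re; linarith
  have d1 : DifferentiableOn ℂ ZZ {w : ℂ | 0 < w.re} := fun w hw => (ZZ_diff w hw).differentiableWithinAt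
  have d2 := (d1.deriv o).differentiableAt (o.mem_nhds sm)
  have nz : ZZ s ≠ 0 := ZFR T hT s (by linarith only [h1]) (by
    have h4 := (abs_le.1 h2).1
    have : 1 / (40 * 2 ^ 20) / Real.log T < 1 / (10 * 2 ^ 20) / Real.log T := by gcongr; norm_num
    linarith only [h4, this])
  exact (((d2.div (ZZ_diff s sm) nz).neg).sub_const 1).add (differentiableAt_id.mul (GG_diff s sm))


noncomputable def tent (t : ℝ) : ℂ := Set.indicator (Set.Ioc 0 1) (fun _ => (1:ℂ)) t - Set.indicator (Set.Ioc 0 1) (fun t : ℝ => (t:ℂ) ^ (1:ℂ)) t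

theorem tent_eq (t : ℝ) (ht : 0 < t) : tent t = ((max (1 - t) 0 : ℝ) : ℂ) := by
  unfold tent
  by_cases h : t ≤ 1
  · have : t ∈ Set.Ioc (0:ℝ) 1 := ⟨ht, h⟩
    simp only [Set.indicator_of_mem this, Complex.cpow_one]
    rw [max_eq_left (by linarith)]; push_cast; ring
  · have : t ∉ Set.Ioc (0:ℝ) 1 := fun h' => h h'.2
    simp only [Set.indicator_of_notMem this]
    rw [max_eq_right (by linarith)]; simp

theorem tent_mellin (s : ℂ) (hs : 0 < s.re) : HasMellin tent s (1 / (s * (s + 1))) := by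
  have h1 := hasMellin_one_Ioc hs
  have h2 := hasMellin_cpow_Ioc 1 (show 0 < s.re + (1:ℂ).re by simp; linarith)
  have h := hasMellin_sub h1.1 h2.1
  have n1 : s ≠ 0 := fun h => by simp [h] at hs
  have n2 : s + 1 ≠ 0 := fun h => by have := congrArg Complex.re h; simp at this; linarith
  rw [h1.2, h2.2] at h
  have e : 1 / (s * (s + 1)) = 1 / s - 1 / (s + 1) := by field_simp; ring
  rw [e]; exact h

theorem line_bd (σ y : ℝ) (hσ : 1 ≤ σ) : ‖1 / (((σ:ℂ) + y * Complex.I) * ((σ:ℂ) + y * Complex.I + 1))‖ ≤ (1 + y ^ 2)⁻¹ := by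
  have n1 : ∀ a : ℝ, 1 ≤ a → Real.sqrt (1 + y ^ 2) ≤ ‖(a:ℂ) + y * Complex.I‖ := fun a ha => by
    rw [Complex.norm_add_mul_I]
    exact Real.sqrt_le_sqrt (by nlinarith)
  have h1 := n1 σ hσ
  have h2 := n1 (σ + 1) (by linarith)
  rw [norm_div, norm_one, norm_mul, one_div]
  refine inv_anti₀ (by positivity) ?_
  rw [← Real.mul_self_sqrt (by positivity : 0 ≤ 1 + y ^ 2)]
  refine mul_le_mul h1 ?_ (Real.sqrt_nonneg _) (norm_nonneg _)
  rw [show (σ:ℂ) + y * Complex.I + 1 = ((σ + 1 : ℝ):ℂ) + y * Complex.I by push_cast; ring]; exact h2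

theorem line_ne (σ y : ℝ) (hσ : 0 < σ) : ((σ:ℂ) + y * Complex.I) ≠ 0 ∧ ((σ:ℂ) + y * Complex.I + 1) ≠ 0 := by
  constructor <;> intro h <;> have := congrArg Complex.re h <;> simp at this <;> linarith

theorem line_cont (σ : ℝ) (hσ : 1 ≤ σ) : Continuous fun y : ℝ => 1 / (((σ:ℂ) + y * Complex.I) * ((σ:ℂ) + y * Complex.I + 1)) := by
  refine Continuous.div continuous_const (by fun_prop) fun y => ?_
  have := line_ne σ y (by linarith)
  exact mul_ne_zero this.1 this.2

theorem line_int (σ : ℝ) (hσ : 1 ≤ σ) : Integrable fun y : ℝ => 1 / (((σ:ℂ) + y * Complex.I) * ((σ:ℂ) + y * Complex.I + 1)) :=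
  integrable_inv_one_add_sq.mono' (line_cont σ hσ).aestronglyMeasurable (Filter.Eventually.of_forall fun y => line_bd σ y hσ)

theorem tent_inv (σ x : ℝ) (hσ : 1 ≤ σ) (hx : 0 < x) : ((max (1 - x) 0 : ℝ) : ℂ) = (1 / (2 * Real.pi)) * ∫ y : ℝ, (x:ℂ) ^ (-((σ:ℂ) + y * Complex.I)) * (1 / (((σ:ℂ) + y * Complex.I) * ((σ:ℂ) + y * Complex.I + 1))) := by
  have me : ∀ y : ℝ, mellin tent ((σ:ℂ) + y * Complex.I) = 1 / (((σ:ℂ) + y * Complex.I) * ((σ:ℂ) + y * Complex.I + 1)) := fun y => (tent_mellin _ (by simp; linarith)).2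
  have hc : ContinuousAt tent x := by
    have : Continuous fun t : ℝ => ((max (1 - t) 0 : ℝ) : ℂ) := by fun_prop
    refine this.continuousAt.congr ?_
    filter_upwards [Ioi_mem_nhds hx] with t ht using (tent_eq t ht).symm
  have := mellinInv_mellin_eq σ tent hx (tent_mellin σ (by simp; linarith)).1 (by
    show Integrable (fun y : ℝ => mellin tent ((σ:ℂ) + y * Complex.I))
    simp only [me]; exact line_int σ hσ) hc
  rw [← tent_eq x hx, ← this, mellinInv]
  simp only [me, smul_eq_mul]
  rw [Complex.real_smul]; push_cast; rfl

theorem PER (σ x : ℝ) (hσ : 1 < σ) (hx : 0 < x) : ∑ n ∈ Finset.Icc 1 ⌊x⌋₊, gv n * ((1 - n / x : ℝ) : ℂ) =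
    (1 / (2 * Real.pi)) * ∫ y : ℝ, AA ((σ:ℂ) + y * Complex.I) * (x:ℂ) ^ ((σ:ℂ) + y * Complex.I) * (1 / (((σ:ℂ) + y * Complex.I) * ((σ:ℂ) + y * Complex.I + 1))) := by
  set k : ℝ → ℂ := fun y => 1 / (((σ:ℂ) + y * Complex.I) * ((σ:ℂ) + y * Complex.I + 1)) with hk
  set F : ℕ → ℝ → ℂ := fun n y => LSeries.term gv ((σ:ℂ) + y * Complex.I) n * (x:ℂ) ^ ((σ:ℂ) + y * Complex.I) * k y with hF
  have xc : (x:ℂ) ≠ 0 := by exact_mod_cast hx.ne'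
  have ki : Integrable k := line_int σ hσ.le
  have nF : ∀ n y, ‖F n y‖ = ‖LSeries.term gv σ n‖ * x ^ σ * ‖k y‖ := by
    intro n y
    simp only [hF, norm_mul, Complex.norm_cpow_eq_rpow_re_of_pos hx, LSeries.norm_term_eq]
    simp
  have iF : ∀ n, Integrable (F n) := by
    intro n
    refine Integrable.mono' (ki.norm.const_mul (‖LSeries.term gv σ n‖ * x ^ σ)) ?_ (Filter.Eventually.of_forall fun y => (nF n y).le)
    rcases Nat.eq_zero_or_pos n with rfl | hn
    · simp only [hF, LSeries.term_zero, zero_mul]; exact aestronglyMeasurable_const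
    have nc : (n:ℂ) ≠ 0 := by exact_mod_cast hn.ne'
    have c2 : Continuous k := line_cont σ hσ.le
    have c3 : ∀ z : ℂ, z ≠ 0 → Continuous fun y : ℝ => z ^ ((σ:ℂ) + y * Complex.I) := fun z hz => by
      refine Continuous.const_cpow (by fun_prop) (Or.inl hz)
    have : Continuous (F n) := by
      simp only [hF, LSeries.term_of_ne_zero hn.ne']
      exact ((continuous_const.div (c3 n nc) fun y => (Complex.cpow_ne_zero_iff.2 (Or.inl nc))).mul (c3 x xc)).mul c2
    exact this.aestronglyMeasurable
  have hs := hasSum_integral_of_summable_integral_norm iF (by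
    simp only [nF, integral_const_mul]
    exact ((gv_sum σ (by simpa using hσ)).norm.mul_right _).mul_right _)
  have e1 : ∀ y : ℝ, ∑' n, F n y = AA ((σ:ℂ) + y * Complex.I) * (x:ℂ) ^ ((σ:ℂ) + y * Complex.I) * k y := by
    intro y
    simp only [hF, tsum_mul_right]
    rw [← AA_eq _ (by simpa using hσ)]; rfl
  simp only [e1] at hs
  have e2 : ∀ n : ℕ, 1 ≤ n → (1 / (2 * Real.pi) : ℂ) * ∫ y, F n y = gv n * ((max (1 - n / x) 0 : ℝ) : ℂ) := by
    intro n hn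
    have n0 : 0 < (n:ℝ) := by exact_mod_cast hn
    rw [tent_inv σ (n / x) hσ.le (by positivity), mul_left_comm, ← integral_const_mul (gv n)]
    congr 1
    refine integral_congr_ae (Filter.Eventually.of_forall fun y => ?_)
    simp only [hF, LSeries.term_of_ne_zero (by lia : n ≠ 0)]
    rw [Complex.cpow_neg, Complex.ofReal_div, Complex.div_cpow_ofReal_nonneg n0.le hx.le, inv_div, Complex.ofReal_natCast]
    ring
  rw [← hs.tsum_eq, tsum_eq_sum (s := Finset.Icc 1 ⌊x⌋₊), Finset.mul_sum]
  · refine Finset.sum_congr rfl fun n hn => ?_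
    rw [Finset.mem_Icc] at hn
    have : (n:ℝ) ≤ x := (Nat.le_floor_iff hx.le).1 hn.2
    rw [e2 n hn.1, max_eq_left]
    rw [sub_nonneg, div_le_one hx]; exact this
  · intro n hn
    rcases Nat.eq_zero_or_pos n with rfl | h0
    · simp only [hF, LSeries.term_zero, zero_mul, integral_zero]
    have : x < n := by
      by_contra h; push Not at h
      exact hn (Finset.mem_Icc.2 ⟨h0, Nat.le_floor h⟩)
    have h := e2 n h0
    rw [max_eq_right (by rw [sub_nonpos, one_le_div hx]; exact this.le), Complex.ofReal_zero, mul_zero] at h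
    refine (mul_eq_zero.1 h).resolve_left ?_
    have := Real.pi_ne_zero
    simp [this]


theorem AA_one (σ y : ℝ) (h1 : 1 < σ) (h2 : σ ≤ 2) : ‖AA ((σ:ℂ) + y * Complex.I)‖ ≤ 80 / (σ - 1) ^ 2 := by
  rw [← AA_eq _ (by simpa using h1)]
  obtain ⟨u, hu⟩ : ∃ u, u = (σ - 1) / 2 := ⟨_, rfl⟩
  have u0 : 0 < u := by linarith
  have u1 : 1 ≤ 1 / u := by rw [le_div_iff₀ u0]; linarith
  have hs := ((Real.summable_one_div_nat_rpow (p := σ - u)).2 (by linarith)).mul_left (2 / u)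
  have z := zsum (σ - u) (by linarith) (by linarith)
  refine (tsum_of_norm_bounded hs.hasSum fun n => ?_).trans ?_
  · rw [LSeries.norm_term_eq]
    split_ifs with h
    · positivity
    have n0 : 0 < (n:ℝ) := by exact_mod_cast Nat.pos_of_ne_zero h
    have n1 : 1 ≤ (n:ℝ) := by exact_mod_cast Nat.pos_of_ne_zero h
    have re : ((σ:ℂ) + y * Complex.I).re = σ := by simp
    rw [re]
    have b1 : ‖gv n‖ ≤ 2 / u * (n:ℝ) ^ u := by
      refine (norm_sub_le _ _).trans ?_
      rw [Complex.norm_real, Real.norm_of_nonneg ArithmeticFunction.vonMangoldt_nonneg, norm_one]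
      have l1 := (ArithmeticFunction.vonMangoldt_le_log (n := n)).trans (Real.log_le_rpow_div n0.le u0)
      have l2 := Real.one_le_rpow n1 u0.le
      have l3 : (1:ℝ) ≤ 1 / u * (n:ℝ) ^ u := one_le_mul_of_one_le_of_one_le u1 l2
      have : 2 / u * (n:ℝ) ^ u = (n:ℝ) ^ u / u + 1 / u * (n:ℝ) ^ u := by ring
      linarith
    rw [div_le_iff₀ (by positivity)]
    refine b1.trans_eq ?_
    rw [mul_assoc]; congr 1
    rw [one_div, ← Real.rpow_neg n0.le, ← Real.rpow_add n0]; congr 1; ring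
  · rw [tsum_mul_left]
    refine (mul_le_mul_of_nonneg_left z (by positivity)).trans_eq ?_
    rw [show σ - u - 1 = u by linarith, show σ - 1 = 2 * u by linarith]
    field_simp; norm_num

theorem RB (T δ σ x : ℝ) (hT : 3 ≤ T) (hδ : δ = 1 / (40 * 2 ^ 20) / Real.log T) (h1 : 1 < σ) (h2 : σ ≤ 1 + δ) (hx : 1 ≤ x) :
    ‖∫ y in (-(T - 1))..(T - 1), AA ((σ:ℂ) + y * Complex.I) * (x:ℂ) ^ ((σ:ℂ) + y * Complex.I) * (1 / (((σ:ℂ) + y * Complex.I) * ((σ:ℂ) + y * Complex.I + 1)))‖ ≤ 2 ^ 39 * x ^ σ / T + 2 ^ 39 * T ^ 2 * x ^ (1 - δ) := by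
  have T0 : 0 < T := by linarith
  have x0 : 0 < x := by linarith
  have xc : (x:ℂ) ≠ 0 := by exact_mod_cast x0.ne'
  have l1 : 1 ≤ Real.log T := by
    rw [Real.le_log_iff_exp_le T0]; linarith [Real.exp_one_lt_d9]
  have δ0 : 0 < δ := by rw [hδ]; positivity
  have δ1 : δ ≤ 1 / 100 := by rw [hδ]; exact (div_le_self (by positivity) l1).trans (by norm_num)
  set H := T - 1 with hH
  have H0 : 0 < H := by linarith only [hT]
  set f : ℂ → ℂ := fun s => AA s * (x:ℂ) ^ s * (1 / (s * (s + 1))) with hf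
  have nf : ∀ s : ℂ, |s.im| ≤ H → 1 - δ ≤ s.re → s.re ≤ σ → ‖f s‖ ≤ 2 ^ 36 * T * x ^ s.re * (1 / (‖s‖ * ‖s + 1‖)) := by
    intro s i1 i2 i3
    simp only [hf, norm_mul, norm_div, norm_one, Complex.norm_cpow_eq_rpow_re_of_pos x0]
    gcongr
    exact AA_bd T hT s i1 (by rw [← hδ, abs_le]; constructor <;> linarith only [i2, h2, i3])
  have R := Complex.integral_boundary_rect_eq_zero_of_differentiableOn f (((1 - δ : ℝ):ℂ) + ((-H : ℝ):ℂ) * Complex.I) ((σ:ℂ) + (H:ℂ) * Complex.I) (by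
    intro s hs
    simp only [Complex.add_re, Complex.add_im, Complex.mul_re, Complex.mul_im, Complex.ofReal_re, Complex.ofReal_im, Complex.I_re, Complex.I_im, mul_zero, mul_one, add_zero, zero_add, sub_self] at hs
    rw [Set.uIcc_of_le (by linarith only [h1, h2]), Set.uIcc_of_le (by linarith only [hT])] at hs
    obtain ⟨⟨a1, a2⟩, ⟨a3, a4⟩⟩ := Complex.mem_reProdIm.1 hs
    have d := AA_diff T hT s (abs_le.2 ⟨by linarith, by linarith⟩) (by rw [← hδ, abs_le]; constructor <;> linarith)
    have p1 : s ≠ 0 := fun h => by rw [h] at a1; simp at a1; linarith only [δ1, a1]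
    have p2 : s + 1 ≠ 0 := fun h => by have := congrArg Complex.re h; simp at this; linarith
    refine DifferentiableAt.differentiableWithinAt ?_
    refine (d.mul ((differentiableAt_id).const_cpow (Or.inl xc))).mul (DifferentiableAt.div (by fun_prop) (by fun_prop) (mul_ne_zero p1 p2)))
  simp only [Complex.add_re, Complex.add_im, Complex.mul_re, Complex.mul_im, Complex.ofReal_re, Complex.ofReal_im, Complex.I_re, Complex.I_im, mul_zero, mul_one, add_zero, zero_add, sub_self, smul_eq_mul] at R
  have hor : ∀ h : ℝ, |h| = H → ‖∫ u in (1 - δ)..σ, f ((u:ℂ) + (h:ℂ) * Complex.I)‖ ≤ 2 ^ 38 * x ^ σ / T := by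
    intro h hh
    refine (intervalIntegral.norm_integral_le_of_norm_le_const (C := 2 ^ 36 * T * x ^ σ * (1 / (H * H))) fun u hu => ?_).trans ?_
    · rw [Set.uIoc_of_le (by linarith only [h1, h2])] at hu
      have n1 : H ≤ ‖(u:ℂ) + (h:ℂ) * Complex.I‖ := by have := Complex.abs_im_le_norm ((u:ℂ) + (h:ℂ) * Complex.I); simpa [hh] using this
      have n2 : H ≤ ‖(u:ℂ) + (h:ℂ) * Complex.I + 1‖ := by have := Complex.abs_im_le_norm ((u:ℂ) + (h:ℂ) * Complex.I + 1); simpa [hh] using this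
      refine (nf _ (by simpa using hh.le) (by simpa using hu.1.le) (by simpa using hu.2)).trans ?_
      have e1 : ((u:ℂ) + (h:ℂ) * Complex.I).re = u := by simp
      rw [e1]
      gcongr
      exact hu.2
    · rw [abs_of_pos (by linarith only [h1, h2])]
      have w : σ - (1 - δ) ≤ 1 / 50 := by linarith only [h2, δ1]
      refine (mul_le_mul_of_nonneg_left w (by positivity)).trans ?_
      have h3 : 4 / 9 * (T * T) ≤ H * H := by
        have : 2 / 3 * T ≤ H := by linarith
        linarith [mul_le_mul this this (by positivity) (by linarith)]
      have h4 : 1 / (H * H) ≤ 9 / 4 / (T * T) := by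
        rw [div_le_div_iff₀ (by positivity) (by positivity)]; linarith
      have p : 0 ≤ 2 ^ 36 * T * x ^ σ := by positivity
      have h5 := mul_le_mul_of_nonneg_left h4 p
      have h6 : 2 ^ 36 * T * x ^ σ * (9 / 4 / (T * T)) = 9 / 4 * (2 ^ 36 * x ^ σ / T) := by field_simp
      have : 0 ≤ 2 ^ 36 * x ^ σ / T := by positivity
      have e2 : 2 ^ 38 * x ^ σ / T = 4 * (2 ^ 36 * x ^ σ / T) := by ring
      rw [e2]
      linarith only [h5, h6, this]
  have hl : ‖∫ y in (-H)..H, f (((1 - δ : ℝ):ℂ) + (y:ℂ) * Complex.I)‖ ≤ 2 ^ 39 * T ^ 2 * x ^ (1 - δ) := by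
    refine (intervalIntegral.norm_integral_le_of_norm_le_const (C := 2 ^ 36 * T * x ^ (1 - δ) * 4) fun u hu => ?_).trans ?_
    · rw [Set.uIoc_of_le (by linarith only [hT])] at hu
      have e1 : (((1 - δ : ℝ):ℂ) + (u:ℂ) * Complex.I).re = 1 - δ := by simp
      have n1 : 1 / 2 ≤ ‖((1 - δ : ℝ):ℂ) + (u:ℂ) * Complex.I‖ := by have := Complex.re_le_norm (((1 - δ : ℝ):ℂ) + (u:ℂ) * Complex.I); rw [e1] at this; linarith
      have n2 : 1 / 2 ≤ ‖((1 - δ : ℝ):ℂ) + (u:ℂ) * Complex.I + 1‖ := by have := Complex.re_le_norm (((1 - δ : ℝ):ℂ) + (u:ℂ) * Complex.I + 1); rw [Complex.add_re, e1, Complex.one_re] at this; linarith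
      refine (nf _ (by simpa using abs_le.2 ⟨hu.1.le, hu.2⟩) e1.ge (by rw [e1]; linarith only [h1, h2])).trans ?_
      rw [e1]
      refine mul_le_mul_of_nonneg_left ?_ (by positivity)
      rw [div_le_iff₀ (by positivity)]
      linarith only [mul_le_mul n1 n2 (by norm_num) (norm_nonneg _)]
    · rw [abs_of_pos (by linarith only [hT])]
      have p : 0 ≤ 2 ^ 36 * T * x ^ (1 - δ) * 4 := by positivity
      have := mul_le_mul_of_nonneg_left (by linarith : H - -H ≤ 2 * T) p
      refine this.trans_eq ?_
      ring
  have R1 : Complex.I * ∫ y in (-H)..H, f ((σ:ℂ) + (y:ℂ) * Complex.I) = Complex.I * (∫ y in (-H)..H, f (((1 - δ : ℝ):ℂ) + (y:ℂ) * Complex.I)) + (∫ u in (1 - δ)..σ, f ((u:ℂ) + (H:ℂ) * Complex.I)) - ∫ u in (1 - δ)..σ, f ((u:ℂ) + ((-H : ℝ):ℂ) * Complex.I) := by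
    linear_combination R
  have R2 := congrArg norm R1
  rw [norm_mul, Complex.norm_I, one_mul] at R2
  show ‖∫ y in (-H)..H, f ((σ:ℂ) + (y:ℂ) * Complex.I)‖ ≤ _
  rw [R2]
  have q1 := hor H (abs_of_pos (by linarith only [hT]))
  have q2 := hor (-H) (by rw [abs_neg]; exact abs_of_pos (by linarith))
  refine (norm_sub_le _ _).trans ((add_le_add (norm_add_le _ _) le_rfl).trans ?_)
  rw [norm_mul, Complex.norm_I, one_mul]
  have : 2 ^ 39 * x ^ σ / T = 2 ^ 38 * x ^ σ / T + 2 ^ 38 * x ^ σ / T := by ring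
  linarith

theorem tail_int (H : ℝ) (hH : 0 < H) : ∫ y in Set.Ioi H, (1 + y ^ 2)⁻¹ ≤ 1 / H := by
  rw [integral_Ioi_inv_one_add_sq, ← Real.arctan_inv_of_pos hH, one_div]
  have h0 : 0 < H⁻¹ := by positivity
  have := Real.le_tan (Real.arctan_nonneg.2 h0.le) (Real.arctan_lt_pi_div_two _)
  rwa [Real.tan_arctan] at this

theorem PS (T δ x : ℝ) (hT : 3 ≤ T) (hδ : δ = 1 / (40 * 2 ^ 20) / Real.log T) (hx : Real.exp 1 ≤ x) (h1 : 1 / Real.log x ≤ δ) :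
    ‖∑ n ∈ Finset.Icc 1 ⌊x⌋₊, gv n * ((1 - n / x : ℝ) : ℂ)‖ ≤ 2 ^ 42 * x * (Real.log x ^ 2 / T + T ^ 2 * x ^ (-δ)) := by
  have x0 : 0 < x := (Real.exp_pos 1).trans_le hx
  have x1 : 1 ≤ x := by linarith [Real.add_one_le_exp 1]
  have y1 : 1 ≤ Real.log x := (Real.le_log_iff_exp_le x0).2 hx
  have T0 : 0 < T := by linarith
  obtain ⟨σ, hσ⟩ : ∃ σ, σ = 1 + 1 / Real.log x := ⟨_, rfl⟩
  have i0 : 0 < 1 / Real.log x := by positivity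
  have i1 : 1 / Real.log x ≤ 1 := by rw [div_le_one (by linarith)]; exact y1
  have xs : x ^ σ ≤ 3 * x := by
    rw [hσ, Real.rpow_add x0, Real.rpow_one, Real.rpow_def_of_pos x0, mul_one_div_cancel (by linarith), mul_comm]
    exact mul_le_mul_of_nonneg_right (by linarith [Real.exp_one_lt_d9]) x0.le
  rw [PER σ x (by linarith) x0]
  set f : ℝ → ℂ := fun y => AA ((σ:ℂ) + y * Complex.I) * (x:ℂ) ^ ((σ:ℂ) + y * Complex.I) * (1 / (((σ:ℂ) + y * Complex.I) * ((σ:ℂ) + y * Complex.I + 1))) with hf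
  set H := T - 1 with hH
  have H0 : 0 < H := by linarith
  have rb := RB T δ σ x hT hδ (by linarith) (by linarith) x1
  have fb : ∀ y, ‖f y‖ ≤ 240 * Real.log x ^ 2 * x * (1 + y ^ 2)⁻¹ := by
    intro y
    simp only [hf]
    rw [norm_mul, norm_mul, Complex.norm_cpow_eq_rpow_re_of_pos x0]
    have a1 := AA_one σ y (by linarith only [hσ, i0]) (by linarith only [hσ, i1])
    have e1 : 80 / (σ - 1) ^ 2 = 80 * Real.log x ^ 2 := by rw [hσ, add_sub_cancel_left]; field_simp
    have re : ((σ:ℂ) + y * Complex.I).re = σ := by simp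
    rw [e1] at a1
    rw [re]
    refine mul_le_mul ((mul_le_mul a1 xs (by positivity) (by positivity)).trans_eq (by ring)) (line_bd σ y (by linarith only [hσ, i0])) (norm_nonneg _) (by positivity)
  have I0 : Integrable fun y : ℝ => 240 * Real.log x ^ 2 * x * (1 + y ^ 2)⁻¹ := integrable_inv_one_add_sq.const_mul _
  have t0 : ∫ y in Set.Ioi H, 240 * Real.log x ^ 2 * x * (1 + y ^ 2)⁻¹ ≤ 240 * Real.log x ^ 2 * x * (1 / H) := by
    rw [integral_const_mul]; exact mul_le_mul_of_nonneg_left (tail_int H H0) (by positivity)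
  have t1 : ‖∫ y in Set.Ioi H, f y‖ ≤ 240 * Real.log x ^ 2 * x * (1 / H) :=
    (norm_integral_le_of_norm_le I0.integrableOn (Filter.Eventually.of_forall fb)).trans t0
  have t2 : ‖∫ y in Set.Iic (-H), f y‖ ≤ 240 * Real.log x ^ 2 * x * (1 / H) := by
    refine (norm_integral_le_of_norm_le I0.integrableOn (Filter.Eventually.of_forall fb)).trans ?_
    refine le_trans (le_of_eq ?_) t0
    rw [← integral_comp_neg_Ioi]; simp
  by_cases If : Integrable f
  swap
  · rw [integral_undef If]; simp only [mul_zero, norm_zero]; positivity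
  have sp : ∫ y, f y = (∫ y in Set.Iic (-H), f y) + ((∫ y in (-H)..H, f y) + ∫ y in Set.Ioi H, f y) := by
    rw [intervalIntegral.integral_interval_add_Ioi If.integrableOn If.integrableOn, intervalIntegral.integral_Iic_add_Ioi If.integrableOn If.integrableOn]
  have hp : ‖(1 / (2 * Real.pi) : ℂ)‖ ≤ 1 := by
    rw [norm_div, norm_one, norm_mul, Complex.norm_real, Real.norm_of_nonneg Real.pi_pos.le, Complex.norm_ofNat]
    rw [div_le_one (by positivity)]; linarith only [Real.pi_gt_three]
  rw [norm_mul]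
  refine (mul_le_of_le_one_left (norm_nonneg _) hp).trans ?_
  rw [sp]
  refine (norm_add_le _ _).trans ((add_le_add le_rfl (norm_add_le _ _)).trans ?_)
  have h3 : 1 / H ≤ 3 / 2 * (1 / T) := by rw [mul_one_div, div_le_div_iff₀ H0 T0]; linarith only [hT]
  have p1 : 0 ≤ 240 * Real.log x ^ 2 * x := by positivity
  have h4 := mul_le_mul_of_nonneg_left h3 p1
  have h5 : x ^ (1 - δ) = x * x ^ (-δ) := by rw [sub_eq_add_neg, Real.rpow_add x0, Real.rpow_one]
  rw [h5] at rb
  have h6 : 2 ^ 39 * x ^ σ / T ≤ 2 ^ 41 * (x * Real.log x ^ 2 * (1 / T)) := by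
    rw [mul_one_div, ← mul_div_assoc]
    refine div_le_div_of_nonneg_right ?_ T0.le
    have : x ≤ x * Real.log x ^ 2 := le_mul_of_one_le_right x0.le (one_le_pow₀ y1)
    linarith only [x0, xs, this]
  have p2 : 0 ≤ x * (T ^ 2 * x ^ (-δ)) := by positivity
  have p3 : 0 ≤ x * Real.log x ^ 2 * (1 / T) := by positivity
  have e3 : 2 ^ 42 * x * (Real.log x ^ 2 / T + T ^ 2 * x ^ (-δ)) = 2 ^ 42 * (x * Real.log x ^ 2 * (1 / T)) + 2 ^ 42 * (x * (T ^ 2 * x ^ (-δ))) := by ring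
  rw [e3]
  linarith only [rb, t1, t2, h4, h6, p2, p3]


noncomputable def psi1 (x : ℝ) : ℝ := ∑ n ∈ Finset.Icc 1 ⌊x⌋₊, (ArithmeticFunction.vonMangoldt n - 1) * (x - n)
noncomputable def psi0 (x : ℝ) : ℝ := ∑ n ∈ Finset.Icc 1 ⌊x⌋₊, ArithmeticFunction.vonMangoldt n

theorem psi1_eq (u v : ℝ) (hu : 0 ≤ u) (huv : u ≤ v) : psi1 u = ∑ n ∈ Finset.Icc 1 ⌊v⌋₊, (ArithmeticFunction.vonMangoldt n - 1) * max (u - n) 0 := by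
  have : Finset.Icc 1 ⌊u⌋₊ ⊆ Finset.Icc 1 ⌊v⌋₊ := Finset.Icc_subset_Icc le_rfl (Nat.floor_mono huv)
  rw [← Finset.sum_subset this, psi1]
  · refine Finset.sum_congr rfl fun n hn => ?_
    rw [max_eq_left]
    rw [Finset.mem_Icc] at hn
    have := (Nat.le_floor_iff hu).1 hn.2
    linarith
  · intro n hn h
    have : u < n := by
      by_contra h'; push Not at h'
      exact h (Finset.mem_Icc.2 ⟨(Finset.mem_Icc.1 hn).1, Nat.le_floor h'⟩)
    rw [max_eq_right (by linarith), mul_zero]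

theorem psi_diff (u v : ℝ) (hu : 0 ≤ u) (huv : u ≤ v) : (v - u) * psi0 u - (v - u) * v ≤ psi1 v - psi1 u ∧ psi1 v - psi1 u ≤ (v - u) * psi0 v - (v - u) * (u - 1) := by
  have sub : Finset.Icc 1 ⌊u⌋₊ ⊆ Finset.Icc 1 ⌊v⌋₊ := Finset.Icc_subset_Icc le_rfl (Nat.floor_mono huv)
  set d : ℕ → ℝ := fun n => max (v - n) 0 - max (u - n) 0 with hd
  have v0 : 0 ≤ v := hu.trans huv
  have d0 : ∀ n, 0 ≤ d n := fun n => sub_nonneg.2 (max_le_max (by linarith) le_rfl)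
  have d1 : ∀ n, d n ≤ v - u := fun n => by
    simp only [hd]
    rcases le_total (v - n) 0 with h | h
    · rw [max_eq_right h]; linarith [le_max_right (u - n) 0]
    · rw [max_eq_left h]; linarith [le_max_left (u - n) 0]
  have d2 : ∀ n ∈ Finset.Icc 1 ⌊u⌋₊, d n = v - u := fun n hn => by
    rw [Finset.mem_Icc] at hn
    have := (Nat.le_floor_iff hu).1 hn.2
    simp only [hd]
    rw [max_eq_left (by linarith), max_eq_left (by linarith)]; ring
  have e : psi1 v - psi1 u = ∑ n ∈ Finset.Icc 1 ⌊v⌋₊, ArithmeticFunction.vonMangoldt n * d n - ∑ n ∈ Finset.Icc 1 ⌊v⌋₊, d n := by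
    rw [psi1_eq u v hu huv, psi1_eq v v v0 le_rfl, ← Finset.sum_sub_distrib, ← Finset.sum_sub_distrib]
    refine Finset.sum_congr rfl fun n _ => ?_
    simp only [hd]; ring
  have L0 : ∀ n, 0 ≤ ArithmeticFunction.vonMangoldt n := fun n => ArithmeticFunction.vonMangoldt_nonneg
  have a1 : (v - u) * psi0 u ≤ ∑ n ∈ Finset.Icc 1 ⌊v⌋₊, ArithmeticFunction.vonMangoldt n * d n := by
    refine le_trans (le_of_eq ?_) (Finset.sum_le_sum_of_subset_of_nonneg sub fun n _ _ => mul_nonneg (L0 n) (d0 n))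
    rw [psi0, Finset.mul_sum]
    exact Finset.sum_congr rfl fun n hn => by rw [d2 n hn, mul_comm]
  have a2 : ∑ n ∈ Finset.Icc 1 ⌊v⌋₊, ArithmeticFunction.vonMangoldt n * d n ≤ (v - u) * psi0 v := by
    rw [psi0, Finset.mul_sum]
    exact Finset.sum_le_sum fun n _ => by rw [mul_comm]; exact mul_le_mul_of_nonneg_right (d1 n) (L0 n)
  have a3 : ∑ n ∈ Finset.Icc 1 ⌊v⌋₊, d n ≤ (v - u) * v := by
    refine (Finset.sum_le_card_nsmul _ _ _ fun n _ => d1 n).trans ?_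
    rw [Nat.card_Icc, nsmul_eq_mul, add_tsub_cancel_right, mul_comm]
    exact mul_le_mul_of_nonneg_left (Nat.floor_le v0) (by linarith)
  have a4 : (v - u) * (u - 1) ≤ ∑ n ∈ Finset.Icc 1 ⌊v⌋₊, d n := by
    refine le_trans ?_ (Finset.sum_le_sum_of_subset_of_nonneg sub fun n _ _ => d0 n)
    rw [Finset.sum_congr rfl d2, Finset.sum_const, Nat.card_Icc, nsmul_eq_mul, add_tsub_cancel_right, mul_comm]
    exact mul_le_mul_of_nonneg_right (Nat.sub_one_lt_floor u).le (by linarith)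
  constructor <;> linarith

theorem psi1_bd : ∃ x₀ : ℝ, 1 ≤ x₀ ∧ ∀ x ≥ x₀, |psi1 x| ≤ x ^ 2 * Real.exp (-5 * Real.log x ^ ((1:ℝ) / 5)) := by
  obtain ⟨c₂, hc₂⟩ : ∃ c₂ : ℝ, c₂ = 1 / (40 * 2 ^ 20) := ⟨_, rfl⟩
  have c0 : 0 < c₂ := by rw [hc₂]; positivity
  have c1 : c₂ ≤ 1 := by rw [hc₂]; norm_num
  have ev := ((Real.tendsto_pow_mul_exp_neg_atTop_nhds_zero 40).eventually (gt_mem_nhds (by positivity : (0:ℝ) < 1 / 2 ^ 43)))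
  obtain ⟨w₀, hw₀⟩ := Filter.eventually_atTop.1 ev
  obtain ⟨w₁, hw₁⟩ : ∃ w₁ : ℝ, w₁ = max (max w₀ 10) (50 / c₂) := ⟨_, rfl⟩
  refine ⟨Real.exp (w₁ ^ 20), Real.one_le_exp (by rw [hw₁]; positivity), fun x hx => ?_⟩
  have x0 : 0 < x := (Real.exp_pos _).trans_le hx
  have w10 : 10 ≤ w₁ := hw₁ ▸ (le_max_right _ _).trans (le_max_left _ _)
  have hy : w₁ ^ 20 ≤ Real.log x := (Real.le_log_iff_exp_le x0).2 hx
  have y0 : 0 ≤ Real.log x := le_trans (by positivity) hy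
  obtain ⟨w, hw⟩ : ∃ w, w = Real.log x ^ ((1:ℝ) / 20) := ⟨_, rfl⟩
  have w0 : 0 ≤ w := hw ▸ Real.rpow_nonneg y0 _
  have wy : Real.log x = w ^ 20 := by
    rw [hw, ← Real.rpow_natCast, ← Real.rpow_mul y0]; norm_num
  have ww : w₁ ≤ w := by rw [wy] at hy; exact le_of_pow_le_pow_left₀ (by norm_num) w0 hy
  have w5 : Real.log x ^ ((1:ℝ) / 5) = w ^ 4 := by
    rw [hw, ← Real.rpow_natCast, ← Real.rpow_mul y0]; norm_num
  have b1 : w₀ ≤ w := le_trans (hw₁ ▸ (le_max_left _ _).trans (le_max_left _ _)) ww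
  have b2 : 50 / c₂ ≤ w := le_trans (hw₁ ▸ le_max_right _ _) ww
  have b3 : 10 ≤ w := w10.trans ww
  have b2' : 50 ≤ c₂ * w := by rw [div_le_iff₀ c0] at b2; linarith only [b2]
  have T3 : 3 ≤ Real.exp (w ^ 5) := by
    have : w ≤ w ^ 5 := le_self_pow₀ (by linarith only [w10, ww]) (by norm_num)
    linarith only [w10, ww, this, Real.add_one_le_exp (w ^ 5)]
  have h15 : c₂ * w * w ^ 5 ≤ c₂ * w ^ 15 := by
    have : w ^ 6 ≤ w ^ 15 := pow_le_pow_right₀ (by linarith only [w10, ww]) (by norm_num)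
    linarith only [mul_le_mul_of_nonneg_left this c0.le, show c₂ * w * w ^ 5 = c₂ * w ^ 6 by ring]
  have h16 := mul_le_mul_of_nonneg_right b2' (by positivity : 0 ≤ w ^ 5)
  have w4 : w ^ 4 ≤ w ^ 5 := pow_le_pow_right₀ (by linarith only [w10, ww]) (by norm_num)
  have w51 : 1 ≤ w ^ 5 := one_le_pow₀ (by linarith only [w10, ww])
  have ps := PS (Real.exp (w ^ 5)) (c₂ / w ^ 5) x T3 (by rw [Real.log_exp, hc₂]) (by
      rw [← Real.le_log_iff_exp_le x0, wy]; exact one_le_pow₀ (by linarith only [w10, ww])) (by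
      rw [wy, div_le_div_iff₀ (by positivity) (by positivity), one_mul]
      have : c₂ * w ^ 20 = c₂ * w ^ 15 * w ^ 5 := by ring
      rw [this]
      exact le_mul_of_one_le_left (by positivity) (by linarith only [h15, h16, w51]))
  have ee : ∑ n ∈ Finset.Icc 1 ⌊x⌋₊, gv n * ((1 - n / x : ℝ) : ℂ) = ((psi1 x / x : ℝ) : ℂ) := by
    rw [psi1, Finset.sum_div]
    push_cast
    refine Finset.sum_congr rfl fun n _ => ?_
    have : (x:ℂ) ≠ 0 := by exact_mod_cast x0.ne'
    rw [gv]; field_simp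
  rw [ee, Complex.norm_real, Real.norm_eq_abs, abs_div, abs_of_pos x0, div_le_iff₀ x0] at ps
  refine ps.trans ?_
  rw [w5, wy]
  have q1 : 2 ^ 42 * ((w ^ 20) ^ 2 / Real.exp (w ^ 5)) ≤ 1 / 2 * Real.exp (-5 * w ^ 4) := by
    have h := (hw₀ w b1).le
    have hw6 : Real.exp (-w ^ 5) ≤ Real.exp (-w) * Real.exp (-5 * w ^ 4) := by
      rw [← Real.exp_add]; apply Real.exp_le_exp.2
      have : w ≤ w ^ 4 := le_self_pow₀ (by linarith only [w10, ww]) (by norm_num)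
      have h10 := mul_le_mul_of_nonneg_right b3 (by positivity : 0 ≤ w ^ 4)
      have : w ^ 5 = w * w ^ 4 := by ring
      linarith
    rw [div_eq_mul_inv, ← Real.exp_neg, ← pow_mul]
    calc 2 ^ 42 * (w ^ 40 * Real.exp (-w ^ 5)) ≤ 2 ^ 42 * (w ^ 40 * (Real.exp (-w) * Real.exp (-5 * w ^ 4))) := by gcongr
      _ = 2 ^ 42 * (w ^ 40 * Real.exp (-w)) * Real.exp (-5 * w ^ 4) := by ring
      _ ≤ 2 ^ 42 * (1 / 2 ^ 43) * Real.exp (-5 * w ^ 4) := by gcongr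
      _ = _ := by norm_num
  have q2 : 2 ^ 42 * (Real.exp (w ^ 5) ^ 2 * x ^ (-(c₂ / w ^ 5))) ≤ 1 / 2 * Real.exp (-5 * w ^ 4) := by
    have e1 : x ^ (-(c₂ / w ^ 5)) = Real.exp (-(c₂ * w ^ 15)) := by
      rw [Real.rpow_def_of_pos x0, wy]; congr 1; field_simp
    have e2 : (2:ℝ) ^ 43 ≤ Real.exp 43 := by
      have h2 : (2:ℝ) ≤ Real.exp 1 := by linarith only [Real.add_one_le_exp (1:ℝ)]
      have := pow_le_pow_left₀ (by norm_num) h2 43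
      rw [← Real.exp_nat_mul] at this; simpa using this
    have e3 : Real.exp 43 * (Real.exp (w ^ 5) ^ 2 * Real.exp (-(c₂ * w ^ 15))) ≤ Real.exp (-5 * w ^ 4) := by
      rw [← Real.exp_nat_mul, ← Real.exp_add, ← Real.exp_add]; apply Real.exp_le_exp.2
      push_cast; linarith only [h15, h16, w4, w51]
    rw [e1]
    have p : 0 ≤ Real.exp (w ^ 5) ^ 2 * Real.exp (-(c₂ * w ^ 15)) := by positivity
    linarith only [e3, mul_le_mul_of_nonneg_right e2 p]
  have := mul_le_mul_of_nonneg_left (add_le_add q1 q2) (by positivity : 0 ≤ x ^ 2)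
  refine le_trans (le_of_eq ?_) (this.trans_eq ?_) <;> ring

theorem PNT : ∃ x₀ : ℝ, 1 ≤ x₀ ∧ ∀ x ≥ x₀, |psi0 x - x| ≤ 12 * x * Real.exp (-2 * Real.log x ^ ((1:ℝ) / 5)) := by
  obtain ⟨x₀, h0, H⟩ := psi1_bd
  refine ⟨max (2 * x₀) (Real.exp 32), by linarith [le_max_left (2 * x₀) (Real.exp 32)], fun x hx => ?_⟩
  have hx1 := (le_max_left _ _).trans hx
  have hx2 := (le_max_right _ _).trans hx
  have x0 : 0 < x := by linarith
  have y32 : 32 ≤ Real.log x := (Real.le_log_iff_exp_le x0).2 hx2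
  obtain ⟨z, hz⟩ : ∃ z, z = Real.log x ^ ((1:ℝ) / 5) := ⟨_, rfl⟩
  have z0 : 0 ≤ z := hz ▸ Real.rpow_nonneg (by linarith) _
  have zy : Real.log x = z ^ 5 := by
    rw [hz, ← Real.rpow_natCast, ← Real.rpow_mul (by linarith)]; norm_num
  have z2 : 2 ≤ z := le_of_pow_le_pow_left₀ (n := 5) (by norm_num) z0 (by rw [← zy]; norm_num; exact y32)
  rw [← hz]
  obtain ⟨E, hE⟩ : ∃ E, E = Real.exp (-2 * z) := ⟨_, rfl⟩
  have E0 : 0 < E := hE ▸ Real.exp_pos _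
  have E1 : E ≤ 1 := by rw [hE]; exact Real.exp_le_one_iff.2 (by linarith)
  have E2 : Real.exp (-4 * z) = E * E := by rw [hE, ← Real.exp_add]; congr 1; ring
  have xE : 1 ≤ x * E := by
    rw [hE]
    nth_rewrite 1 [← Real.exp_log x0]
    rw [← Real.exp_add, zy]
    apply Real.one_le_exp
    have : 2 ≤ z ^ 4 := le_trans (by norm_num) (pow_le_pow_left₀ (by norm_num) z2 4)
    linarith [mul_le_mul_of_nonneg_right this z0, show z ^ 5 = z ^ 4 * z by ring]
  rw [← hE]
  obtain ⟨h, hh⟩ : ∃ h, h = x * E / 2 := ⟨_, rfl⟩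
  have xE1 : x * E ≤ x := mul_le_of_le_one_right x0.le E1
  have hp : 0 < h := by rw [hh]; positivity
  have B : ∀ u, x / 2 ≤ u → u ≤ 3 * x / 2 → |psi1 u| ≤ 9 / 4 * x ^ 2 * (E * E) := by
    intro u u1 u2
    have u0 : 0 < u := by linarith
    refine (H u (by linarith)).trans ?_
    rw [← E2]
    refine mul_le_mul ?_ (Real.exp_le_exp.2 ?_) (Real.exp_pos _).le (by positivity)
    · refine (pow_le_pow_left₀ u0.le u2 2).trans_eq (by ring)
    · have l : (4 / 5 * z) ^ 5 ≤ Real.log u := by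
        have := Real.log_le_log (by positivity) u1
        rw [Real.log_div x0.ne' (by norm_num)] at this
        have := Real.log_two_lt_d9
        rw [mul_pow, ← zy]; norm_num; linarith
      have l2 := Real.rpow_le_rpow (by positivity) l (by norm_num : (0:ℝ) ≤ 1 / 5)
      have e1 : ((4 / 5 * z) ^ 5) ^ ((1:ℝ) / 5) = 4 / 5 * z := by
        rw [← Real.rpow_natCast, ← Real.rpow_mul (by positivity)]; norm_num
      rw [e1] at l2
      linarith only [l2]
  have b0 := abs_le.1 (B x (by linarith) (by linarith))
  have b1 := abs_le.1 (B (x + h) (by linarith only [h0, hx1, hp]) (by linarith only [hh, xE1]))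
  have b2 := abs_le.1 (B (x - h) (by linarith only [hh, xE1]) (by linarith only [h0, hx1, hp]))
  have d1 := (psi_diff x (x + h) x0.le (by linarith only [hp])).1
  have d2 := (psi_diff (x - h) x (by linarith only [h0, hx1, hh, xE1]) (by linarith only [hp])).2
  rw [add_sub_cancel_left] at d1
  rw [sub_sub_cancel] at d2
  have k : 9 / 4 * x ^ 2 * (E * E) = h * (9 / 2 * (x * E)) := by rw [hh]; ring
  rw [k] at b0 b1 b2
  have f1 : h * (psi0 x - x) ≤ h * (9 * (x * E) + h) := by linarith
  have f2 : h * (-(9 * (x * E) + h + 1)) ≤ h * (psi0 x - x) := by linarith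
  have g1 := le_of_mul_le_mul_left f1 hp
  have g2 := le_of_mul_le_mul_left f2 hp
  rw [abs_le]
  constructor <;> linarith only [xE, hh, g2, g1]


theorem fc_deriv (x c t : ℝ) (ht : 0 < t) : HasDerivAt (fun t : ℝ => e (x * t ^ c)) ((x * (c * t ^ (c - 1)) : ℝ) • (2 * Real.pi * Complex.I * e (x * t ^ c))) t :=
  HasDerivAt.scomp (g₁ := e) (h := fun t : ℝ => x * t ^ c) t (e_hasDerivAt (x * t ^ c)) ((Real.hasDerivAt_rpow_const (p := c) (Or.inl ht.ne')).const_mul x)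

theorem SI_gen (X c x D : ℝ) (hX : 2 ≤ X) (hc : 1 < c) (hD : ∀ t, X / 2 ≤ t → t ≤ X → |psi0 t - t| ≤ D) :
    ‖S X c x - I X c x‖ ≤ 2 * D + Real.pi * c * (|x| * X ^ c) * D + 2 * √X * Real.log X := by
  obtain ⟨f, hf⟩ : ∃ f : ℝ → ℂ, f = fun t : ℝ => e (x * t ^ c) := ⟨_, rfl⟩
  obtain ⟨g, hg⟩ : ∃ g : ℝ → ℂ, g = fun t : ℝ => ((x * (c * t ^ (c - 1)) : ℝ) • (2 * Real.pi * Complex.I * e (x * t ^ c))) := ⟨_, rfl⟩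
  have hX0 : 0 < X := by linarith
  have hab : X / 2 ≤ X := by linarith
  have hd : ∀ t, 0 < t → HasDerivAt f (g t) t := fun t ht => by rw [hf, hg]; exact fc_deriv x c t ht
  have hgc : Continuous g := by
    rw [hg]
    have h1 : Continuous fun t : ℝ => t ^ (c - 1) := Real.continuous_rpow_const (by linarith)
    have h2 : Continuous fun t : ℝ => t ^ c := Real.continuous_rpow_const (by linarith)
    have h3 := e_cont.comp (h2.const_mul x)
    exact ((h1.const_mul c).const_mul x).smul (h3.const_mul (2 * Real.pi * Complex.I))
  have hfn : ∀ t, ‖f t‖ = 1 := fun t => by rw [hf]; exact e_norm _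
  have hgn : ∀ t, X / 2 ≤ t → t ≤ X → ‖g t‖ ≤ 2 * Real.pi * c * |x| * X ^ (c - 1) := by
    intro t t1 t2
    have t0 : 0 < t := by linarith
    rw [hg]
    simp only [norm_smul, norm_mul, e_norm, Complex.norm_I, Complex.norm_real, Complex.norm_ofNat, Real.norm_eq_abs, abs_of_pos Real.pi_pos, abs_of_pos (show 0 < c by linarith), abs_of_pos (Real.rpow_pos_of_pos t0 _)]
    have := Real.rpow_le_rpow t0.le t2 (show 0 ≤ c - 1 by linarith)
    calc |x| * (c * t ^ (c - 1)) * (2 * Real.pi * 1 * 1) = 2 * Real.pi * c * |x| * t ^ (c - 1) := by ring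
      _ ≤ _ := by gcongr
  have hdf : ∀ t ∈ Set.Icc (X / 2) X, DifferentiableAt ℝ f t := fun t ht => (hd t (by linarith [ht.1])).differentiableAt
  have hde : ∀ t ∈ Set.Icc (X / 2) X, deriv f t = g t := fun t ht => (hd t (by linarith [ht.1])).deriv
  have A := sum_mul_eq_sub_sub_integral_mul (fun k : ℕ => ((ArithmeticFunction.vonMangoldt k : ℝ) : ℂ)) (by linarith : 0 ≤ X / 2) hab hdf
    (hgc.integrableOn_Icc.congr_fun (fun t ht => (hde t ht).symm) measurableSet_Icc)
  have hps : ∀ t : ℝ, ∑ k ∈ Finset.Icc 0 ⌊t⌋₊, ((ArithmeticFunction.vonMangoldt k : ℝ) : ℂ) = (psi0 t : ℂ) := by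
    intro t
    rw [← Finset.sum_subset (s₁ := Finset.Icc 1 ⌊t⌋₊) (Finset.Icc_subset_Icc_left zero_le_one), psi0]
    · push_cast; rfl
    · intro k h1 h2
      have : k = 0 := by rw [Finset.mem_Icc] at h1 h2; omega
      rw [this]; simp
  have hint := integrableOn_mul_sum_Icc (m := 0) (fun k : ℕ => ((ArithmeticFunction.vonMangoldt k : ℝ) : ℂ)) (by linarith only [hX] : 0 ≤ X / 2) (b := X) hgc.integrableOn_Icc
  simp only [hps] at A hint
  rw [setIntegral_congr_fun measurableSet_Ioc (g := fun t => g t * (psi0 t : ℂ)) (fun t ht => by simp only [hde t ⟨ht.1.le, ht.2⟩]), ← intervalIntegral.integral_of_le hab] at A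
  have B := intervalIntegral.integral_mul_deriv_eq_deriv_mul (a := X / 2) (b := X) (u := f) (v := fun t : ℝ => (t : ℂ)) (u' := g) (v' := fun _ => 1)
    (fun t ht => hd t (by rw [Set.uIcc_of_le hab] at ht; linarith only [hX, ht.1])) (fun t _ => Complex.ofRealCLM.hasDerivAt) (hgc.intervalIntegrable _ _) (continuous_const.intervalIntegrable _ _)
  simp only [mul_one] at B
  have hI : I X c x = ∫ t in (X / 2)..X, f t := by
    rw [I, hf]; refine intervalIntegral.integral_congr fun t _ => ?_
    simp only [mul_comm]
  have hi1 : IntervalIntegrable (fun t => g t * (psi0 t : ℂ)) volume (X / 2) X := (hint.mono_set (by rw [Set.uIcc_of_le hab])).intervalIntegrable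
  have hi2 : IntervalIntegrable (fun t : ℝ => g t * (t : ℂ)) volume (X / 2) X := (hgc.mul Complex.continuous_ofReal).intervalIntegrable _ _
  have Q : (∑ k ∈ Finset.Ioc ⌊X / 2⌋₊ ⌊X⌋₊, f k * ((ArithmeticFunction.vonMangoldt k : ℝ) : ℂ)) - I X c x = f X * ((psi0 X - X : ℝ) : ℂ) - f (X / 2) * ((psi0 (X / 2) - X / 2 : ℝ) : ℂ) - ∫ t in (X / 2)..X, g t * ((psi0 t - t : ℝ) : ℂ) := by
    have : ∫ t in (X / 2)..X, g t * ((psi0 t - t : ℝ) : ℂ) = (∫ t in (X / 2)..X, g t * (psi0 t : ℂ)) - ∫ t in (X / 2)..X, g t * (t : ℂ) := by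
      rw [← intervalIntegral.integral_sub hi1 hi2]
      refine intervalIntegral.integral_congr fun t _ => ?_
      push_cast; ring
    rw [A, hI, B, this]; push_cast; ring
  have D0 : 0 ≤ D := (abs_nonneg _).trans (hD X hab le_rfl)
  have hn : ∀ r : ℝ, ‖(r : ℂ)‖ = |r| := fun r => by rw [Complex.norm_real, Real.norm_eq_abs]
  have E : ‖∫ t in (X / 2)..X, g t * ((psi0 t - t : ℝ) : ℂ)‖ ≤ (2 * Real.pi * c * |x| * X ^ (c - 1) * D) * |X - X / 2| := by
    refine intervalIntegral.norm_integral_le_of_norm_le_const fun t ht => ?_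
    rw [Set.uIoc_of_le hab] at ht
    rw [norm_mul, hn]
    have := hgn t ht.1.le ht.2
    exact mul_le_mul this (hD t ht.1.le ht.2) (abs_nonneg _) ((norm_nonneg _).trans this)
  have E2 : (2 * Real.pi * c * |x| * X ^ (c - 1) * D) * |X - X / 2| = Real.pi * c * (|x| * X ^ c) * D := by
    rw [show X - X / 2 = X / 2 by ring, abs_of_pos (half_pos hX0), Real.rpow_sub hX0, Real.rpow_one]; field_simp
  have P := S_psi X c x hX
  have e1 : ∑ k ∈ Finset.Ioc (⌊X⌋₊ / 2) ⌊X⌋₊, ((ArithmeticFunction.vonMangoldt k : ℝ) : ℂ) * e (x * (k : ℝ) ^ c) = ∑ k ∈ Finset.Ioc ⌊X / 2⌋₊ ⌊X⌋₊, f k * ((ArithmeticFunction.vonMangoldt k : ℝ) : ℂ) := by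
    rw [Nat.floor_div_ofNat, hf]
    exact Finset.sum_congr rfl fun k _ => mul_comm _ _
  rw [e1] at P
  have q1 : ‖f X * ((psi0 X - X : ℝ) : ℂ)‖ ≤ D := by rw [norm_mul, hfn, hn, one_mul]; exact hD X hab le_rfl
  have q2 : ‖f (X / 2) * ((psi0 (X / 2) - X / 2 : ℝ) : ℂ)‖ ≤ D := by rw [norm_mul, hfn, hn, one_mul]; exact hD _ le_rfl hab
  rw [E2] at E
  have T : ‖(∑ k ∈ Finset.Ioc ⌊X / 2⌋₊ ⌊X⌋₊, f k * ((ArithmeticFunction.vonMangoldt k : ℝ) : ℂ)) - I X c x‖ ≤ D + D + Real.pi * c * (|x| * X ^ c) * D := by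
    rw [Q]
    exact (norm_sub_le _ _).trans (add_le_add ((norm_sub_le _ _).trans (add_le_add q1 q2)) E)
  rw [norm_sub_rev] at P
  have := norm_sub_le_norm_sub_add_norm_sub (S X c x) (∑ k ∈ Finset.Ioc ⌊X / 2⌋₊ ⌊X⌋₊, f k * ((ArithmeticFunction.vonMangoldt k : ℝ) : ℂ)) (I X c x)
  linarith only [P, T, this]

theorem R1 (c : ℝ) (hc : 1 < c) : ∃ C > 0, ∃ X₀ : ℝ, 1 ≤ X₀ ∧ ∀ X, X₀ ≤ X → ∀ x, ‖S X c x - I X c x‖ ≤ C * (1 + |x| * X ^ c) * X * Real.exp (-(8 / 5) * Real.log X ^ ((1:ℝ) / 5)) := by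
  obtain ⟨x₀, h0, H⟩ := PNT
  refine ⟨2 * 12 + Real.pi * c * 12 + 8, by positivity, max (2 * x₀) (Real.exp 1024), by linarith [le_max_left (2 * x₀) (Real.exp 1024)], fun X hX x => ?_⟩
  have hx1 := (le_max_left _ _).trans hX
  have hx2 := (le_max_right _ _).trans hX
  have x0 : 0 < X := by linarith
  have y32 : 1024 ≤ Real.log X := (Real.le_log_iff_exp_le x0).2 hx2
  obtain ⟨z, hz⟩ : ∃ z, z = Real.log X ^ ((1:ℝ) / 5) := ⟨_, rfl⟩
  have z0 : 0 ≤ z := hz ▸ Real.rpow_nonneg (by linarith) _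
  have zy : Real.log X = z ^ 5 := by
    rw [hz, ← Real.rpow_natCast, ← Real.rpow_mul (by linarith)]; norm_num
  have z2 : 4 ≤ z := le_of_pow_le_pow_left₀ (n := 5) (by norm_num) z0 (by rw [← zy]; norm_num; exact y32)
  rw [← hz]
  obtain ⟨E, hE⟩ : ∃ E, E = Real.exp (-(8 / 5) * z) := ⟨_, rfl⟩
  have E0 : 0 < E := hE ▸ Real.exp_pos _
  have B : ∀ u, X / 2 ≤ u → u ≤ X → |psi0 u - u| ≤ 12 * X * E := by
    intro u u1 u2
    have u0 : 0 < u := by linarith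
    refine (H u (by linarith)).trans ?_
    rw [hE]
    refine mul_le_mul (by linarith only [u2]) (Real.exp_le_exp.2 ?_) (Real.exp_pos _).le (by positivity)
    have l : (4 / 5 * z) ^ 5 ≤ Real.log u := by
      have := Real.log_le_log (by positivity) u1
      rw [Real.log_div x0.ne' (by norm_num)] at this
      have := Real.log_two_lt_d9
      rw [mul_pow, ← zy]; norm_num; linarith
    have l2 := Real.rpow_le_rpow (by positivity) l (by norm_num : (0:ℝ) ≤ 1 / 5)
    have e1 : ((4 / 5 * z) ^ 5) ^ ((1:ℝ) / 5) = 4 / 5 * z := by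
      rw [← Real.rpow_natCast, ← Real.rpow_mul (by positivity)]; norm_num
    rw [e1] at l2
    linarith only [l2]
  have G := SI_gen X c x (12 * X * E) (by linarith) hc B
  have sq : 2 * √X * Real.log X ≤ 8 * (X * E) := by
    have e1 : X = Real.exp (z ^ 5 / 2) * Real.exp (z ^ 5 / 2) := by
      rw [← Real.exp_add, add_halves, ← zy, Real.exp_log x0]
    have e2 : √X = Real.exp (z ^ 5 / 2) := by
      rw [e1, Real.sqrt_mul_self (Real.exp_pos _).le]
    have e3 : Real.log X ≤ 4 * Real.exp (z ^ 5 / 4) := by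
      rw [zy]; linarith only [Real.add_one_le_exp (z ^ 5 / 4)]
    have e4 : Real.exp (z ^ 5 / 4) ≤ Real.exp (z ^ 5 / 2) * E := by
      rw [hE, ← Real.exp_add]
      refine Real.exp_le_exp.2 ?_
      have : 256 ≤ z ^ 4 := le_trans (by norm_num) (pow_le_pow_left₀ (by norm_num) z2 4)
      linarith only [z0, mul_le_mul_of_nonneg_right this z0, show z ^ 5 = z ^ 4 * z by ring]
    rw [e2]
    calc 2 * Real.exp (z ^ 5 / 2) * Real.log X ≤ 2 * Real.exp (z ^ 5 / 2) * (4 * (Real.exp (z ^ 5 / 2) * E)) := by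
          gcongr; linarith only [e3, e4]
      _ = 8 * ((Real.exp (z ^ 5 / 2) * Real.exp (z ^ 5 / 2)) * E) := by ring
      _ = _ := by rw [← e1]
  have T0 : 0 ≤ |x| * X ^ c := by positivity
  rw [← hE]
  refine G.trans ?_
  have k1 : 0 ≤ X * E := by positivity
  have k2 : 0 ≤ Real.pi * c * (X * E) := by positivity
  have k3 := mul_nonneg T0 k1
  calc _ ≤ 2 * (12 * X * E) + Real.pi * c * (|x| * X ^ c) * (12 * X * E) + 8 * (X * E) := by linarith
    _ ≤ _ := by linarith


theorem I_bd (X c x : ℝ) (hX : 0 < X) (hc : 1 < c) (hx : x ≠ 0) : ‖I X c x‖ ≤ 2 ^ c * X / (|x| * X ^ c) := by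
  obtain ⟨f, hf⟩ : ∃ f : ℝ → ℂ, f = fun t : ℝ => e (x * t ^ c) := ⟨_, rfl⟩
  have hab : X / 2 ≤ X := by linarith
  have X2 : 0 < X / 2 := by linarith
  have hfc : Continuous f := by
    rw [hf]; exact e_cont.comp ((Real.continuous_rpow_const (by linarith)).const_mul x)
  have hfn : ∀ t, ‖f t‖ = 1 := fun t => by rw [hf]; exact e_norm _
  have hI : I X c x = ∫ t in (X / 2)..X, f t := by
    rw [I, hf]; refine intervalIntegral.integral_congr fun t _ => ?_
    simp only [mul_comm]
  have hpos : ∀ t ∈ Set.uIcc (X / 2) X, 0 < t := fun t ht => by rw [Set.uIcc_of_le hab] at ht; linarith [ht.1]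
  have hu : ∀ t ∈ Set.uIcc (X / 2) X, HasDerivAt (fun t : ℝ => ((t ^ (1 - c) : ℝ) : ℂ)) (((1 - c) * t ^ (1 - c - 1) : ℝ) : ℂ) t := fun t ht =>
    (Real.hasDerivAt_rpow_const (Or.inl (hpos t ht).ne')).ofReal_comp
  have hv : ∀ t ∈ Set.uIcc (X / 2) X, HasDerivAt f ((x * (c * t ^ (c - 1)) : ℝ) • (2 * Real.pi * Complex.I * e (x * t ^ c))) t := fun t ht => by
    rw [hf]; exact fc_deriv x c t (hpos t ht)
  have hvc : Continuous fun t : ℝ => ((x * (c * t ^ (c - 1)) : ℝ) • (2 * Real.pi * Complex.I * e (x * t ^ c))) := by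
    have h1 : Continuous fun t : ℝ => t ^ (c - 1) := Real.continuous_rpow_const (by linarith)
    rw [hf] at hfc
    exact ((h1.const_mul c).const_mul x).smul (hfc.const_mul (2 * Real.pi * Complex.I))
  have huc : ContinuousOn (fun t : ℝ => (((1 - c) * t ^ (1 - c - 1) : ℝ) : ℂ)) (Set.uIcc (X / 2) X) := by
    refine Complex.continuous_ofReal.comp_continuousOn (continuousOn_const.mul ?_)
    exact fun t ht => (Real.continuousAt_rpow_const t _ (Or.inl (hpos t ht).ne')).continuousWithinAt
  have B := intervalIntegral.integral_mul_deriv_eq_deriv_mul hu hv huc.intervalIntegrable (hvc.intervalIntegrable _ _)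
  have e1 : ∫ t in (X / 2)..X, ((t ^ (1 - c) : ℝ) : ℂ) * ((x * (c * t ^ (c - 1)) : ℝ) • (2 * Real.pi * Complex.I * e (x * t ^ c))) = ((x * c : ℝ) : ℂ) * (2 * Real.pi * Complex.I) * I X c x := by
    rw [hI, ← intervalIntegral.integral_const_mul]
    refine intervalIntegral.integral_congr fun t ht => ?_
    have : t ^ (1 - c) * t ^ (c - 1) = 1 := by rw [← Real.rpow_add (hpos t ht)]; simp
    have h2 : ((t ^ (1 - c) : ℝ) : ℂ) * ((t ^ (c - 1) : ℝ) : ℂ) = 1 := by rw [← Complex.ofReal_mul, this, Complex.ofReal_one]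
    simp only [Complex.real_smul, Complex.ofReal_mul, hf]
    linear_combination (x * c * (2 * Real.pi * Complex.I) * e (x * t ^ c)) * h2
  rw [e1] at B
  have hn : ∀ r : ℝ, ‖(r : ℂ)‖ = |r| := fun r => by rw [Complex.norm_real, Real.norm_eq_abs]
  obtain ⟨A, hA⟩ : ∃ A, A = (X / 2) ^ (1 - c) := ⟨_, rfl⟩
  have A0 : 0 < A := by rw [hA]; positivity
  have E : ‖∫ t in (X / 2)..X, (((1 - c) * t ^ (1 - c - 1) : ℝ) : ℂ) * f t‖ ≤ ((c - 1) * (X / 2) ^ (1 - c - 1)) * |X - X / 2| := by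
    refine intervalIntegral.norm_integral_le_of_norm_le_const fun t ht => ?_
    rw [Set.uIoc_of_le hab] at ht
    rw [norm_mul, hn, hfn, mul_one, abs_mul, abs_sub_comm, abs_of_pos (by linarith only [hc]), abs_of_pos (Real.rpow_pos_of_pos (by linarith only [hX, ht.1]) _)]
    refine mul_le_mul_of_nonneg_left ?_ (by linarith only [hc])
    exact Real.rpow_le_rpow_of_nonpos X2 ht.1.le (by linarith only [hc])
  rw [show X - X / 2 = X / 2 by ring, abs_of_pos X2, mul_assoc, Real.rpow_sub_one X2.ne', div_mul_cancel₀ _ X2.ne', ← hA] at E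
  have q1 : ‖((X ^ (1 - c) : ℝ) : ℂ) * f X‖ ≤ A := by
    rw [norm_mul, hfn, hn, mul_one, abs_of_pos (by positivity), hA]
    exact Real.rpow_le_rpow_of_nonpos X2 hab (by linarith only [hc])
  have q2 : ‖(((X / 2) ^ (1 - c) : ℝ) : ℂ) * f (X / 2)‖ ≤ A := by
    rw [norm_mul, hfn, hn, mul_one, abs_of_pos (by positivity), hA]
  have N := congrArg norm B
  have N2 := (norm_sub_le _ _).trans (add_le_add ((norm_sub_le _ _).trans (add_le_add q1 q2)) E)
  rw [← N] at N2
  simp only [norm_mul, hn, abs_mul, Complex.norm_I, Complex.norm_ofNat, abs_of_pos Real.pi_pos, abs_of_pos (show 0 < c by linarith only [hc]), mul_one] at N2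
  have x0 : 0 < |x| := abs_pos.2 hx
  have A2 : A * (|x| * X ^ c) * 2 = |x| * (2 ^ c * X) := by
    rw [hA, Real.div_rpow hX.le (by norm_num), Real.rpow_sub hX, Real.rpow_sub (by norm_num : (0:ℝ) < 2), Real.rpow_one, Real.rpow_one]; field_simp
  rw [le_div_iff₀ (by positivity)]
  have k : |x| * ‖I X c x‖ ≤ A := by
    have k1 : c * (|x| * ‖I X c x‖) ≤ c * (A) := by
      have p1 : 0 ≤ |x| * ‖I X c x‖ := by positivity
      have := mul_le_mul_of_nonneg_right Real.pi_gt_three.le (mul_nonneg (show 0 ≤ c by linarith only [hc]) p1)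
      have h3 := mul_le_mul_of_nonneg_right hc.le A0.le
      linarith only [A0, N2, this, h3]
    exact le_of_mul_le_mul_left k1 (by linarith only [hc])
  have := mul_le_mul_of_nonneg_right k (show 0 ≤ X ^ c by positivity)
  refine le_of_mul_le_mul_left (?_ : |x| * _ ≤ |x| * _) x0
  have p : 0 ≤ A * (|x| * X ^ c) := by positivity
  rw [← A2]
  linarith only [p, mul_le_mul_of_nonneg_right this x0.le]

theorem I_triv (X c x : ℝ) (hX : 0 < X) : ‖I X c x‖ ≤ X := by
  rw [I]
  refine (intervalIntegral.norm_integral_le_of_norm_le_const (C := 1) fun t _ => (e_norm _).le).trans ?_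
  rw [show X - X / 2 = X / 2 by ring, abs_of_pos (half_pos hX)]; linarith

theorem S_conj (X c x : ℝ) : S X c (-x) = (starRingEnd ℂ) (S X c x) := by
  rw [S, S, map_sum]
  refine Finset.sum_congr rfl fun p _ => ?_
  rw [map_mul, Complex.conj_ofReal, mul_neg, e_neg]

theorem I_conj (X c x : ℝ) : I X c (-x) = (starRingEnd ℂ) (I X c x) := by
  simp only [I, intervalIntegral, mul_neg, e_neg, map_sub, integral_conj]

theorem S_cont (X c : ℝ) : Continuous (S X c) := by
  unfold S
  exact continuous_finsetSum _ fun p _ => (e_cont.comp (continuous_const.mul continuous_id)).const_mul _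

theorem I_cont (X c : ℝ) (hc : 1 < c) : Continuous (I X c) := by
  unfold I
  refine intervalIntegral.continuous_parametric_intervalIntegral_of_continuous' ?_ _ _
  have : Continuous fun t : ℝ => t ^ c := Real.continuous_rpow_const (by linarith)
  exact e_cont.comp ((this.comp continuous_snd).mul continuous_fst)

theorem S_triv (X c x : ℝ) (hX : 2 ≤ X) : ‖S X c x‖ ≤ 2 * X * (1 + Real.log X) := by
  have h := S_eq X c (by linarith) (x * (X / 2) ^ c)
  rw [mul_assoc, ← Real.rpow_add (by linarith), add_neg_cancel, Real.rpow_zero, mul_one] at h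
  rw [h]
  have L0 := Real.log_nonneg (by linarith : 1 ≤ X)
  refine (norm_sum_le_of_le (f := fun n : ℕ => (lw n : ℂ) * e (x * (X / 2) ^ c * ((n : ℝ) / (X / 2)) ^ c)) (n := fun _ => 1 + Real.log X) _ fun n hn => ?_).trans ?_
  · rw [Finset.mem_Ico] at hn
    have := lw_bd X (by linarith only [hX]) n ((Nat.le_floor_iff (by linarith only [hX])).1 (by omega))
    rw [norm_mul, e_norm, mul_one, Complex.norm_real, Real.norm_eq_abs, abs_of_nonneg this.1]; exact this.2
  · rw [Finset.sum_const, nsmul_eq_mul]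
    refine mul_le_mul_of_nonneg_right ?_ (by linarith)
    exact card_le _ X (by linarith) (fun n hn => by
      rw [Finset.mem_Ico] at hn; exact (Nat.le_floor_iff (by linarith only [hX])).1 (by omega))

theorem S_sq (X c : ℝ) (hX : 2 ≤ X) (hc : 1 < c) : ∫ x in (0:ℝ)..(X ^ (1 - c)), ‖S X c x‖ ^ 2 ≤ 8 * 2 ^ c * (1 + Real.log X) ^ 2 * X ^ (2 - c) := by
  have X0 : 0 < X := by linarith
  have X2 : 0 < X / 2 := by linarith
  have L0 := Real.log_nonneg (by linarith : 1 ≤ X)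
  have hm : ∀ n ∈ Finset.Ico (⌊X / 2⌋₊ + 1) (⌊X⌋₊ + 1), (n : ℝ) ≤ X := fun n hn => by
    rw [Finset.mem_Ico] at hn; exact (Nat.le_floor_iff (by linarith only [hX])).1 (by omega)
  have h := M2 c hc (X / 2) (1 + Real.log X) X2 (by linarith) (Finset.Ico (⌊X / 2⌋₊ + 1) (⌊X⌋₊ + 1)) (fun n hn => by
      rw [Finset.mem_Ico] at hn
      have := Nat.lt_of_floor_lt (show ⌊X / 2⌋₊ < n by omega)
      exact this.le) (fun n => (lw n : ℂ)) (fun n hn => by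
      have := lw_bd X (by linarith) n (hm n hn)
      rw [Complex.norm_real, Real.norm_eq_abs, abs_of_nonneg this.1]; exact this.2) 0
  simp only [← S_eq X c X0, zero_add] at h
  have p0 : 0 < (X / 2) ^ (-c) := by positivity
  rw [intervalIntegral.integral_comp_mul_right (fun s : ℝ => ‖S X c s‖ ^ 2) p0.ne', zero_mul, smul_eq_mul, inv_mul_le_iff₀ p0] at h
  have e1 : X / 2 * (X / 2) ^ (-c) = (X / 2) ^ (1 - c) := by
    rw [sub_eq_add_neg, Real.rpow_add X2, Real.rpow_one]
  rw [e1] at h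
  refine le_trans ?_ (h.trans ?_)
  · refine intervalIntegral.integral_mono_interval le_rfl (by positivity) (Real.rpow_le_rpow_of_nonpos X2 (by linarith only [hX]) (by linarith only [hc])) ?_ (((S_cont X c).norm.pow 2).intervalIntegrable _ _)
    exact Filter.Eventually.of_forall fun _ => by positivity
  · have hcard := card_le (Finset.Ico (⌊X / 2⌋₊ + 1) (⌊X⌋₊ + 1)) X (by linarith only [hX]) hm
    have e2 : (X / 2) ^ (-c) = 2 ^ c * X ^ (-c) := by
      rw [Real.div_rpow X0.le (by norm_num), Real.rpow_neg (by norm_num : (0:ℝ) ≤ 2)]; field_simp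
    have e3 : X ^ (2 - c) = X ^ (-c) * X ^ 2 := by
      rw [show (2 - c) = -c + (2:ℕ) by push_cast; ring, Real.rpow_add X0, Real.rpow_natCast]
    rw [e2, e3]
    calc 2 ^ c * X ^ (-c) * (8 * (1 + Real.log X) ^ 2 * ((Finset.Ico (⌊X / 2⌋₊ + 1) (⌊X⌋₊ + 1)).card : ℝ) * (X / 2)) ≤ 2 ^ c * X ^ (-c) * (8 * (1 + Real.log X) ^ 2 * (2 * X) * (X / 2)) := by gcongr
      _ = _ := by ring


theorem swp (f h : ℝ → ℂ) (hf : Integrable f) (hh : Integrable h) :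
    ∫ R, (∫ x, f x * e (-(R * x))) * h R = ∫ x, f x * ∫ R, h R * e (-(R * x)) := by
  have hi : Integrable (fun p : ℝ × ℝ => f p.2 * e (-(p.1 * p.2)) * h p.1) (volume.prod volume) := by
    have h1 : Integrable (fun p : ℝ × ℝ => h p.1 * f p.2) (volume.prod volume) := hh.mul_prod hf
    have hc : Continuous fun p : ℝ × ℝ => e (-(p.1 * p.2)) := e_cont.comp (by fun_prop)
    refine (h1.bdd_mul hc.aestronglyMeasurable (Filter.Eventually.of_forall fun p => (e_norm _).le)).congr (Filter.Eventually.of_forall fun p => ?_)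
    simp only []; ring
  calc _ = ∫ R, ∫ x, f x * e (-(R * x)) * h R := by simp only [integral_mul_const]
    _ = ∫ x, ∫ R, f x * e (-(R * x)) * h R := integral_integral_swap hi
    _ = _ := by
      refine integral_congr_ae (Filter.Eventually.of_forall fun x => ?_)
      simp only []
      rw [← integral_const_mul]
      refine integral_congr_ae (Filter.Eventually.of_forall fun R => ?_)
      simp only []; ring

theorem gK (s : ℝ) (hs : 0 < s) (u : ℝ) : ∫ R : ℝ, ((Real.exp (-(Real.pi * s ^ 2) * R ^ 2) : ℝ) : ℂ) * e (-(R * u)) = ((1 / s * Real.exp (-(Real.pi / s ^ 2) * u ^ 2) : ℝ) : ℂ) := by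
  have h := congrFun (fourier_gaussian_pi (b := ((s ^ 2 : ℝ) : ℂ)) (by rw [Complex.ofReal_re]; positivity)) u
  rw [Real.fourier_real_eq_integral_exp_smul] at h
  have e1 : ((s ^ 2 : ℝ) : ℂ) ^ (1 / 2 : ℂ) = (s : ℂ) := by
    rw [show (1 / 2 : ℂ) = ((1 / 2 : ℝ) : ℂ) by push_cast; rfl, ← Complex.ofReal_cpow (by positivity), ← Real.sqrt_eq_rpow, Real.sqrt_sq hs.le]
  rw [e1] at h
  push_cast at h ⊢
  rw [show (1 / (s:ℂ) * Complex.exp (-(Real.pi / s ^ 2) * u ^ 2)) = 1 / (s:ℂ) * Complex.exp (-Real.pi / s ^ 2 * u ^ 2) by rw [neg_div], ← h]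
  refine integral_congr_ae (Filter.Eventually.of_forall fun R => ?_)
  simp only [smul_eq_mul, e]
  rw [mul_comm]; congr 2
  · push_cast; ring
  · ring

theorem gK_int (s : ℝ) (hs : 0 < s) : Integrable (fun u : ℝ => 1 / s * Real.exp (-(Real.pi / s ^ 2) * u ^ 2)) ∧ ∫ u : ℝ, 1 / s * Real.exp (-(Real.pi / s ^ 2) * u ^ 2) = 1 := by
  refine ⟨(integrable_exp_neg_mul_sq (by positivity)).const_mul _, ?_⟩
  rw [integral_const_mul, integral_gaussian, show Real.pi / (Real.pi / s ^ 2) = s ^ 2 by field_simp, Real.sqrt_sq hs.le]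
  field_simp

set_option maxHeartbeats 1000000 in
theorem bessel_w (g : ℝ → ℂ) (hg : Integrable g) (hg2 : Integrable fun x => ‖g x‖ ^ 2) (s : ℝ) (hs : 0 < s) :
    (Integrable fun R : ℝ => ‖∫ x, g x * e (-(R * x))‖ ^ 2 * Real.exp (-(Real.pi * s ^ 2) * R ^ 2)) ∧
    (Continuous fun R : ℝ => ∫ x, g x * e (-(R * x))) ∧
    ∫ R : ℝ, ‖∫ x, g x * e (-(R * x))‖ ^ 2 * Real.exp (-(Real.pi * s ^ 2) * R ^ 2) ≤ ∫ x, ‖g x‖ ^ 2 := by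
  obtain ⟨G, hG⟩ : ∃ G : ℝ → ℂ, G = fun R => ∫ x, g x * e (-(R * x)) := ⟨_, rfl⟩
  have hGR : ∀ R, ∫ x, g x * e (-(R * x)) = G R := fun R => by rw [hG]
  obtain ⟨w, hw⟩ : ∃ w : ℝ → ℝ, w = fun R => Real.exp (-(Real.pi * s ^ 2) * R ^ 2) := ⟨_, rfl⟩
  obtain ⟨K, hK⟩ : ∃ K : ℝ → ℝ, K = fun u => 1 / s * Real.exp (-(Real.pi / s ^ 2) * u ^ 2) := ⟨_, rfl⟩
  have hwi : Integrable w := by rw [hw]; exact integrable_exp_neg_mul_sq (by positivity)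
  have hwc : Continuous w := by rw [hw]; fun_prop
  have hKc : Continuous K := by rw [hK]; fun_prop
  have hK0 : ∀ u, 0 ≤ K u := fun u => by rw [hK]; positivity
  have hKe : ∀ u, K (-u) = K u := fun u => by rw [hK]; simp
  have hKi : Integrable K ∧ ∫ u, K u = 1 := by rw [hK]; exact gK_int s hs
  have hwK : ∀ u, ∫ R : ℝ, (w R : ℂ) * e (-(R * u)) = (K u : ℂ) := fun u => by rw [hw, hK]; exact gK s hs u
  have hGc : Continuous G := by
    rw [hG]
    refine continuous_of_dominated (bound := fun x => ‖g x‖) ?_ ?_ hg.norm ?_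
    · intro R
      exact hg.aestronglyMeasurable.mul (e_cont.comp (by fun_prop : Continuous fun x : ℝ => -(R * x))).aestronglyMeasurable
    · exact fun R => Filter.Eventually.of_forall fun x => by rw [norm_mul, e_norm, mul_one]
    · exact Filter.Eventually.of_forall fun x => (e_cont.comp (by fun_prop : Continuous fun R : ℝ => -(R * x))).const_mul _
  have hGb : ∀ R, ‖G R‖ ≤ ∫ x, ‖g x‖ := fun R => by
    rw [hG]
    refine (norm_integral_le_integral_norm _).trans_eq ?_
    simp only [norm_mul, e_norm, mul_one]
  have hwiC : Integrable fun R => (w R : ℂ) := hwi.ofReal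
  have hh : Integrable fun R => (starRingEnd ℂ) (G R) * (w R : ℂ) :=
    hwiC.bdd_mul (Complex.continuous_conj.comp hGc).aestronglyMeasurable (Filter.Eventually.of_forall fun R => (RCLike.norm_conj _).trans_le (hGb R))
  have hin : ∀ x, ∫ R, (starRingEnd ℂ) (G R) * (w R : ℂ) * e (-(R * x)) = (starRingEnd ℂ) (∫ y, g y * (K (y - x) : ℂ)) := by
    intro x
    have hh2 : Integrable fun R => (w R : ℂ) * e (R * x) := by
      refine (hwiC.bdd_mul (e_cont.comp (by fun_prop : Continuous fun R : ℝ => R * x)).aestronglyMeasurable (Filter.Eventually.of_forall fun R => (e_norm _).le)).congr (Filter.Eventually.of_forall fun R => mul_comm _ _)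
    have := swp g _ hg hh2
    simp only [hGR] at this
    have e2 : ∀ y, ∫ R, (w R : ℂ) * e (R * x) * e (-(R * y)) = (K (y - x) : ℂ) := fun y => by
      rw [← hwK]
      refine integral_congr_ae (Filter.Eventually.of_forall fun R => ?_)
      simp only []
      rw [mul_assoc, ← e_add]; congr 2; ring
    simp only [e2] at this
    rw [← this, ← integral_conj]
    refine integral_congr_ae (Filter.Eventually.of_forall fun R => ?_)
    simp only [map_mul, Complex.conj_ofReal, e_neg, mul_assoc]
  have sw := swp g _ hg hh
  simp only [hGR, hin] at sw
  simp only [hGR]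
  have hJ : ∫ R, G R * ((starRingEnd ℂ) (G R) * (w R : ℂ)) = ((∫ R, ‖G R‖ ^ 2 * w R : ℝ) : ℂ) := by
    rw [← integral_complex_ofReal]
    refine integral_congr_ae (Filter.Eventually.of_forall fun R => ?_)
    simp only []
    rw [← mul_assoc, Complex.mul_conj, Complex.normSq_eq_norm_sq]; push_cast; rfl
  rw [hJ] at sw
  have hcv := hg2.integrable_convolution (ContinuousLinearMap.mul ℝ ℝ) hKi.1
  have hcvi := integral_convolution (ContinuousLinearMap.mul ℝ ℝ) hg2 hKi.1
  rw [hKi.2] at hcvi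
  simp only [ContinuousLinearMap.mul_apply', mul_one] at hcvi
  have hpt : ∀ x, ‖g x * (starRingEnd ℂ) (∫ y, g y * (K (y - x) : ℂ))‖ ≤ 1 / 2 * ‖g x‖ ^ 2 + 1 / 2 * (convolution (fun x => ‖g x‖ ^ 2) K (ContinuousLinearMap.mul ℝ ℝ) volume) x := by
    intro x
    have kb : ∃ B, ∀ u, ‖K u‖ ≤ B := ⟨1 / s, fun u => by
      rw [Real.norm_eq_abs, abs_of_nonneg (hK0 u), hK]
      refine mul_le_of_le_one_right (by positivity) (Real.exp_le_one_iff.2 ?_)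
      rw [neg_mul, neg_nonpos]; positivity⟩
    obtain ⟨B, hB⟩ := kb
    have hci : Integrable fun y => ‖g y‖ ^ 2 * K (x - y) := by
      refine (hg2.bdd_mul (hKc.comp (by fun_prop : Continuous fun y : ℝ => x - y)).aestronglyMeasurable (Filter.Eventually.of_forall fun y => hB _)).congr (Filter.Eventually.of_forall fun y => mul_comm _ _)
    have hKx : Integrable fun y => K (x - y) := hKi.1.comp_sub_left x
    have hKx1 : ∫ y, K (x - y) = 1 := by rw [integral_sub_left_eq_self K volume x, hKi.2]
    rw [convolution_def]
    simp only [ContinuousLinearMap.mul_apply']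
    rw [norm_mul, RCLike.norm_conj]
    calc ‖g x‖ * ‖∫ y, g y * (K (y - x) : ℂ)‖ ≤ ‖g x‖ * ∫ y, ‖g y * (K (y - x) : ℂ)‖ := by
          gcongr; exact norm_integral_le_integral_norm _
      _ = ∫ y, ‖g x‖ * ‖g y * (K (y - x) : ℂ)‖ := (integral_const_mul _ _).symm
      _ ≤ ∫ y, (1 / 2 * ‖g x‖ ^ 2 * K (x - y) + 1 / 2 * (‖g y‖ ^ 2 * K (x - y))) := by
          refine integral_mono_of_nonneg (Filter.Eventually.of_forall fun y => by positivity) ((hKx.const_mul _).add (hci.const_mul _)) (Filter.Eventually.of_forall fun y => ?_)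
          simp only []
          rw [norm_mul, Complex.norm_real, Real.norm_eq_abs, abs_of_nonneg (hK0 _), ← hKe (y - x), neg_sub]
          linarith [mul_nonneg (sq_nonneg (‖g x‖ - ‖g y‖)) (hK0 (x - y))]
      _ = _ := by
          rw [integral_add (f := fun y => 1 / 2 * ‖g x‖ ^ 2 * K (x - y)) (g := fun y => 1 / 2 * (‖g y‖ ^ 2 * K (x - y))) (hKx.const_mul _) (hci.const_mul _), integral_const_mul, integral_const_mul, hKx1, mul_one]
  refine ⟨?_, hGc, ?_⟩
  · have : Continuous fun R => ‖G R‖ ^ 2 := hGc.norm.pow 2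
    rw [hw] at hwi
    refine hwi.bdd_mul (c := (∫ x, ‖g x‖) ^ 2) this.aestronglyMeasurable (Filter.Eventually.of_forall fun R => ?_)
    rw [Real.norm_eq_abs, abs_of_nonneg (by positivity)]
    exact pow_le_pow_left₀ (norm_nonneg _) (hGb R) 2
  have hfin : ‖((∫ R, ‖G R‖ ^ 2 * w R : ℝ) : ℂ)‖ ≤ ∫ x, ‖g x‖ ^ 2 := by
    rw [sw]
    refine (norm_integral_le_integral_norm _).trans ((integral_mono_of_nonneg (Filter.Eventually.of_forall fun y => norm_nonneg _) ((hg2.const_mul _).add (hcv.const_mul _)) (Filter.Eventually.of_forall hpt)).trans_eq ?_)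
    simp only [Pi.add_apply]
    rw [integral_add (f := fun x => 1 / 2 * ‖g x‖ ^ 2) (hg2.const_mul _) (hcv.const_mul _), integral_const_mul, integral_const_mul, hcvi]
    ring
  rw [Complex.norm_real, hw] at hfin
  exact (le_abs_self _).trans hfin

theorem bessel (g : ℝ → ℂ) (hg : Integrable g) (hg2 : Integrable fun x => ‖g x‖ ^ 2) (N : ℝ) (hN : 0 < N) :
    ∫ R in N..(2 * N), ‖∫ x, g x * e (-(R * x))‖ ^ 2 ≤ 3 * ∫ x, ‖g x‖ ^ 2 := by
  obtain ⟨h1, h2, h3⟩ := bessel_w g hg hg2 (1 / (4 * N)) (by positivity)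
  have hp : ∀ R ∈ Set.Ioc N (2 * N), 1 ≤ 3 * Real.exp (-(Real.pi * (1 / (4 * N)) ^ 2) * R ^ 2) := by
    intro R hR
    have : (1 / (4 * N)) ^ 2 * R ^ 2 ≤ 1 / 4 := by
      rw [← mul_pow, show (1 / 4 : ℝ) = (1 / 2) ^ 2 by norm_num]
      refine pow_le_pow_left₀ (mul_nonneg (by positivity) (by linarith [hR.1])) ?_ 2
      rw [one_div, inv_mul_le_iff₀ (by positivity)]; linarith [hR.2]
    have hE : Real.exp (-1) ≤ Real.exp (-(Real.pi * (1 / (4 * N)) ^ 2) * R ^ 2) := by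
      refine Real.exp_le_exp.2 ?_
      have := mul_le_mul_of_nonneg_left this Real.pi_pos.le
      linarith [Real.pi_le_four]
    have : 1 ≤ 3 * Real.exp (-1) := by
      have h := Real.exp_one_lt_d9
      rw [Real.exp_neg, ← div_eq_mul_inv, le_div_iff₀ (Real.exp_pos _)]; linarith only [h]
    linarith
  rw [intervalIntegral.integral_of_le (by linarith)]
  calc _ ≤ ∫ R in Set.Ioc N (2 * N), 3 * (‖∫ x, g x * e (-(R * x))‖ ^ 2 * Real.exp (-(Real.pi * (1 / (4 * N)) ^ 2) * R ^ 2)) := by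
        refine setIntegral_mono_on ((h2.norm.pow 2).integrableOn_Ioc) (h1.const_mul 3).integrableOn measurableSet_Ioc fun R hR => ?_
        have := mul_le_mul_of_nonneg_left (hp R hR) (show 0 ≤ ‖∫ x, g x * e (-(R * x))‖ ^ 2 by positivity)
        linarith
    _ ≤ ∫ R, 3 * (‖∫ x, g x * e (-(R * x))‖ ^ 2 * Real.exp (-(Real.pi * (1 / (4 * N)) ^ 2) * R ^ 2)) :=
        setIntegral_le_integral (h1.const_mul 3) (Filter.Eventually.of_forall fun R => by positivity)
    _ ≤ _ := by rw [integral_const_mul]; linarith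


theorem cube_sub (s i : ℂ) (M : ℝ) (hs : ‖s‖ ≤ M) (hi : ‖i‖ ≤ M) : ‖s ^ 3 - i ^ 3‖ ≤ 3 * M ^ 2 * ‖s - i‖ := by
  have M0 := (norm_nonneg s).trans hs
  rw [show s ^ 3 - i ^ 3 = (s ^ 2 + s * i + i ^ 2) * (s - i) by ring, norm_mul]
  refine mul_le_mul_of_nonneg_right ?_ (norm_nonneg _)
  refine (norm_add₃_le).trans ?_
  rw [norm_mul, norm_pow, norm_pow]
  have h1 := pow_le_pow_left₀ (norm_nonneg s) hs 2
  have h2 := pow_le_pow_left₀ (norm_nonneg i) hi 2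
  have h3 := mul_le_mul hs hi (norm_nonneg _) M0
  linarith

theorem cube_sq (s i : ℂ) : ‖s ^ 3 - i ^ 3‖ ^ 2 ≤ 2 * ‖s‖ ^ 6 + 2 * ‖i‖ ^ 6 := by
  have h := norm_sub_le (s ^ 3) (i ^ 3)
  rw [norm_pow, norm_pow] at h
  refine (pow_le_pow_left₀ (norm_nonneg _) h 2).trans ?_
  linarith [sq_nonneg (‖s‖ ^ 3 - ‖i‖ ^ 3), show (‖s‖ ^ 3) ^ 2 = ‖s‖ ^ 6 by ring, show (‖i‖ ^ 3) ^ 2 = ‖i‖ ^ 6 by ring, show (‖s‖ ^ 3 + ‖i‖ ^ 3) ^ 2 = 2 * (‖s‖ ^ 3) ^ 2 + 2 * (‖i‖ ^ 3) ^ 2 - (‖s‖ ^ 3 - ‖i‖ ^ 3) ^ 2 by ring]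

/-- low region -/
theorem regA (c : ℝ) (hc : 1 < c) : ∃ C > 0, ∃ X₀ : ℝ, 1 ≤ X₀ ∧ ∀ X, X₀ ≤ X →
    ∫ x in (0:ℝ)..(Real.exp (1 / 2 * Real.log X ^ ((1:ℝ) / 5)) * X ^ (-c)), ‖S X c x ^ 3 - I X c x ^ 3‖ ^ 2 ≤ C * X ^ (6 - c) * Real.exp (-(1 / 3) * Real.log X ^ ((1:ℝ) / 5)) := by
  obtain ⟨C, C0, X₀, h1, H⟩ := R1 c hc
  refine ⟨36 * C ^ 2 * (2 * C + 1) ^ 4, by positivity, X₀, h1, fun X hX => ?_⟩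
  have X1 : 1 ≤ X := h1.trans hX
  have X0 : 0 < X := by linarith
  obtain ⟨z, hz⟩ : ∃ z, z = Real.log X ^ ((1:ℝ) / 5) := ⟨_, rfl⟩
  have z0 : 0 ≤ z := hz ▸ Real.rpow_nonneg (Real.log_nonneg X1) _
  have H' := H X hX
  rw [← hz] at H' ⊢
  obtain ⟨T, hT⟩ : ∃ T, T = Real.exp (1 / 2 * z) := ⟨_, rfl⟩
  obtain ⟨E, hE⟩ : ∃ E, E = Real.exp (-(8 / 5) * z) := ⟨_, rfl⟩
  have T1 : 1 ≤ T := by rw [hT]; exact Real.one_le_exp (by positivity)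
  have E0 : 0 < E := hE ▸ Real.exp_pos _
  have TE : T * E ≤ 1 := by rw [hT, hE, ← Real.exp_add]; exact Real.exp_le_one_iff.2 (by linarith only [z0])
  rw [← hE] at H'
  rw [← hT]
  have pc : 0 < X ^ (-c) := by positivity
  have pcc : X ^ (-c) * X ^ c = 1 := by rw [← Real.rpow_add X0]; simp
  have hpt : ∀ x ∈ Set.uIoc 0 (T * X ^ (-c)), ‖‖S X c x ^ 3 - I X c x ^ 3‖ ^ 2‖ ≤ 36 * C ^ 2 * (2 * C + 1) ^ 4 * X ^ 6 * (T * E) ^ 2 := by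
    intro x hx
    rw [Set.uIoc_of_le (by positivity)] at hx
    have hT1 : |x| * X ^ c ≤ T := by
      rw [abs_of_pos hx.1]
      calc x * X ^ c ≤ T * X ^ (-c) * X ^ c := by gcongr; exact hx.2
        _ = T := by rw [mul_assoc, pcc, mul_one]
    have d : ‖S X c x - I X c x‖ ≤ 2 * C * X * (T * E) := by
      refine (H' x).trans ?_
      calc C * (1 + |x| * X ^ c) * X * E ≤ C * (2 * T) * X * E := by gcongr; linarith
        _ = _ := by ring
    have d2 : 2 * C * X * (T * E) ≤ 2 * C * X := mul_le_of_le_one_right (by positivity) TE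
    have i1 := I_triv X c x X0
    have s1 : ‖S X c x‖ ≤ (2 * C + 1) * X := by
      have := norm_le_norm_add_norm_sub' (S X c x) (I X c x)
      linarith
    have i2 : ‖I X c x‖ ≤ (2 * C + 1) * X := by linarith [mul_pos C0 X0]
    have q := (cube_sub _ _ _ s1 i2).trans (mul_le_mul_of_nonneg_left d (by positivity))
    rw [Real.norm_eq_abs, abs_of_nonneg (by positivity)]
    refine (pow_le_pow_left₀ (norm_nonneg _) q 2).trans_eq (by ring)
  have r := intervalIntegral.norm_integral_le_of_norm_le_const hpt
  refine (le_abs_self _).trans (r.trans ?_)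
  rw [sub_zero, abs_of_pos (by positivity), show (6 - c) = -c + (6:ℕ) by push_cast; ring, Real.rpow_add X0, Real.rpow_natCast]
  have fin : (T * E) ^ 2 * T ≤ Real.exp (-(1 / 3) * z) := by
    rw [hT, hE, ← Real.exp_add, ← Real.exp_nat_mul, ← Real.exp_add]
    exact Real.exp_le_exp.2 (by push_cast; linarith)
  calc _ = 36 * C ^ 2 * (2 * C + 1) ^ 4 * (X ^ (-c) * X ^ 6) * ((T * E) ^ 2 * T) := by ring
    _ ≤ _ := by gcongr

theorem small1 (σ : ℝ) (hσ : 0 < σ) : ∃ C ≥ 1, ∀ X, 1 ≤ X → X ^ (-σ) ≤ C * Real.exp (-(Real.log X ^ ((1:ℝ) / 5))) := by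
  refine ⟨Real.exp (max 1 (1 / σ)), Real.one_le_exp (by positivity), fun X hX => ?_⟩
  have X0 : 0 < X := by linarith
  obtain ⟨z, hz⟩ : ∃ z, z = Real.log X ^ ((1:ℝ) / 5) := ⟨_, rfl⟩
  have z0 : 0 ≤ z := hz ▸ Real.rpow_nonneg (Real.log_nonneg hX) _
  have zy : Real.log X = z ^ 5 := by
    rw [hz, ← Real.rpow_natCast, ← Real.rpow_mul (Real.log_nonneg hX)]; norm_num
  rw [← hz, Real.rpow_def_of_pos X0, ← Real.exp_add, zy]
  refine Real.exp_le_exp.2 ?_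
  have p5 : 0 ≤ z ^ 5 * σ := by positivity
  rcases le_total z (max 1 (1 / σ)) with h | h
  · linarith
  · have h1 := (le_max_left _ _).trans h
    have h2 := (le_max_right _ _).trans h
    rw [div_le_iff₀ hσ] at h2
    have h4 : 1 ≤ z ^ 3 := one_le_pow₀ h1
    have h5 : z * (z * σ) * 1 ≤ z * (z * σ) * z ^ 3 := mul_le_mul_of_nonneg_left h4 (by positivity)
    have h6 := mul_le_mul_of_nonneg_left h2 z0
    have : 0 ≤ max 1 (1 / σ) := by positivity
    linarith [show z ^ 5 * σ = z * (z * σ) * z ^ 3 by ring]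

theorem small2 : ∃ C ≥ 1, ∀ X, 1 ≤ X → (1 + Real.log X) ^ 14 * Real.exp (-(1 / 2) * Real.log X ^ ((1:ℝ) / 5)) ≤ C * Real.exp (-(1 / 3) * Real.log X ^ ((1:ℝ) / 5)) := by
  obtain ⟨C, hC, H⟩ := logpow (1 / 6) (by norm_num) 70
  refine ⟨C, hC, fun X hX => ?_⟩
  have X0 : 0 < X := by linarith
  obtain ⟨z, hz⟩ : ∃ z, z = Real.log X ^ ((1:ℝ) / 5) := ⟨_, rfl⟩
  have z0 : 0 ≤ z := hz ▸ Real.rpow_nonneg (Real.log_nonneg hX) _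
  have zy : Real.log X = z ^ 5 := by
    rw [hz, ← Real.rpow_natCast, ← Real.rpow_mul (Real.log_nonneg hX)]; norm_num
  have h := H (Real.exp z) (Real.one_le_exp z0)
  rw [Real.log_exp, ← Real.exp_mul] at h
  rw [← hz, zy]
  have h1 : 1 + z ^ 5 ≤ (1 + z) ^ 5 := by
    have : 0 ≤ 5 * z + 10 * z ^ 2 + 10 * z ^ 3 + 5 * z ^ 4 := by positivity
    linarith only [this, show (1 + z) ^ 5 = 1 + z ^ 5 + (5 * z + 10 * z ^ 2 + 10 * z ^ 3 + 5 * z ^ 4) by ring]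
  have h2 : (1 + z ^ 5) ^ 14 ≤ (1 + z) ^ 70 := (pow_le_pow_left₀ (by positivity) h1 14).trans_eq (by ring)
  calc _ ≤ C * Real.exp (z * (1 / 6)) * Real.exp (-(1 / 2) * z) := by gcongr; exact h2.trans h
    _ = C * Real.exp (-(1 / 3) * z) := by rw [mul_assoc, ← Real.exp_add]; congr 2; ring


theorem T0X (X : ℝ) (hX : Real.exp 1 ≤ X) : Real.exp (1 / 2 * Real.log X ^ ((1:ℝ) / 5)) ≤ X := by
  have X0 : 0 < X := (Real.exp_pos 1).trans_le hX
  have L1 : 1 ≤ Real.log X := (Real.le_log_iff_exp_le X0).2 hX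
  nth_rewrite 2 [← Real.exp_log X0]
  refine Real.exp_le_exp.2 ?_
  have := Real.rpow_le_rpow_of_exponent_le L1 (show (1:ℝ) / 5 ≤ 1 by norm_num)
  rw [Real.rpow_one] at this
  linarith

theorem regB (c : ℝ) (hc : 1 < c) (hj : ∀ j : ℕ, c ≠ j) : ∃ C > 0, ∃ X₀ : ℝ, 3 ≤ X₀ ∧ ∀ X, X₀ ≤ X →
    ∫ x in (Real.exp (1 / 2 * Real.log X ^ ((1:ℝ) / 5)) * X ^ (-c))..(X ^ (1 - c)), ‖S X c x‖ ^ 6 ≤ C * X ^ (6 - c) * Real.exp (-(1 / 3) * Real.log X ^ ((1:ℝ) / 5)) := by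
  obtain ⟨σ, hσ, C, C0, X₀, h1, H⟩ := Vino c hc hj
  obtain ⟨C1, hC1, H1⟩ := small2
  obtain ⟨C2, hC2, H2⟩ := small1 (2 * σ) (by positivity)
  obtain ⟨C3, hC3, H3⟩ := logpow (2 * σ) (by positivity) 14
  refine ⟨C ^ 4 * 8 * (8 * 2 ^ c) * (C1 + C3 * C2), by positivity, max 3 X₀, le_max_left _ _, fun X hX => ?_⟩
  have hX0 := (le_max_right _ _).trans hX
  have X3 : 3 ≤ X := (le_max_left _ _).trans hX
  have X0 : 0 < X := by linarith
  have Xe : Real.exp 1 ≤ X := by linarith [Real.exp_one_lt_d9]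
  have tx := T0X X Xe
  have q1 := H1 X (by linarith)
  have q2 := H2 X (by linarith only [X3])
  have q3 := H3 X (by linarith only [X3])
  have L0 := Real.log_nonneg (by linarith only [X3] : 1 ≤ X)
  obtain ⟨z, hz⟩ : ∃ z, z = Real.log X ^ ((1:ℝ) / 5) := ⟨_, rfl⟩
  have z0 : 0 ≤ z := hz ▸ Real.rpow_nonneg L0 _
  rw [← hz] at tx q1 q2 ⊢
  obtain ⟨T, hT⟩ : ∃ T, T = Real.exp (1 / 2 * z) := ⟨_, rfl⟩
  have T1 : 1 ≤ T := by rw [hT]; exact Real.one_le_exp (by positivity)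
  have T0 : 0 < T := by linarith only [T1]
  rw [← hT] at tx ⊢
  obtain ⟨L, hL⟩ : ∃ L, L = 1 + Real.log X := ⟨_, rfl⟩
  rw [← hL] at q1 q3
  have Lp : 0 < L := by linarith only [L0, hL]
  have pc : 0 < X ^ (-c) := by positivity
  have pcc : X ^ (-c) * X ^ c = 1 := by rw [← Real.rpow_add X0]; simp
  have e1 : X ^ (1 - c) = X * X ^ (-c) := by rw [sub_eq_add_neg, Real.rpow_add X0, Real.rpow_one]
  have hab : T * X ^ (-c) ≤ X ^ (1 - c) := by rw [e1]; gcongr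
  obtain ⟨M, hM⟩ : ∃ M, M = C * X * L ^ 3 * (T ^ (-(1 / 4) : ℝ) + X ^ (-σ)) := ⟨_, rfl⟩
  have hpt : ∀ x ∈ Set.Icc (T * X ^ (-c)) (X ^ (1 - c)), ‖S X c x‖ ^ 6 ≤ M ^ 4 * ‖S X c x‖ ^ 2 := by
    intro x hx
    have x0 : 0 < x := lt_of_lt_of_le (by positivity) hx.1
    have t1 : T ≤ |x| * X ^ c := by
      rw [abs_of_pos x0]
      calc T = T * X ^ (-c) * X ^ c := by rw [mul_assoc, pcc, mul_one]
        _ ≤ _ := by gcongr; exact hx.1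
    have t2 : |x| * X ^ c ≤ X := by
      rw [abs_of_pos x0]
      calc x * X ^ c ≤ X ^ (1 - c) * X ^ c := by gcongr; exact hx.2
        _ = X := by rw [e1, mul_assoc, pcc, mul_one]
    have t3 : X ≤ X ^ (7 / 2 : ℝ) := Real.self_le_rpow_of_one_le (by linarith only [X3]) (by norm_num)
    have v := H X hX0 x (by linarith only [T1, t1]) (by linarith only [t2, t3])
    rw [← hL] at v
    have v2 : ‖S X c x‖ ≤ M := by
      refine v.trans ?_
      rw [hM]
      have : (|x| * X ^ c) ^ (-(1 / 4) : ℝ) ≤ T ^ (-(1 / 4) : ℝ) := Real.rpow_le_rpow_of_nonpos T0 t1 (by norm_num)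
      gcongr
    rw [show ‖S X c x‖ ^ 6 = ‖S X c x‖ ^ 4 * ‖S X c x‖ ^ 2 by ring]
    gcongr
  have hSc := (S_cont X c).norm
  have a0 : 0 ≤ T * X ^ (-c) := by positivity
  have st1 : ∫ x in (T * X ^ (-c))..(X ^ (1 - c)), ‖S X c x‖ ^ 6 ≤ M ^ 4 * ∫ x in (0:ℝ)..(X ^ (1 - c)), ‖S X c x‖ ^ 2 := by
    refine (intervalIntegral.integral_mono_on hab ((hSc.pow 6).intervalIntegrable _ _) (((hSc.pow 2).const_mul (M ^ 4)).intervalIntegrable _ _) hpt).trans ?_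
    rw [intervalIntegral.integral_const_mul]
    refine mul_le_mul_of_nonneg_left ?_ (Even.pow_nonneg (by decide) M)
    refine intervalIntegral.integral_mono_interval a0 hab le_rfl ?_ ((hSc.pow 2).intervalIntegrable _ _)
    exact Filter.Eventually.of_forall fun x => pow_nonneg (norm_nonneg (S X c x)) 2
  have st2 := S_sq X c (by linarith only [X3]) hc
  rw [← hL] at st2
  have m4 : M ^ 4 ≤ C ^ 4 * X ^ 4 * L ^ 12 * (8 * (T⁻¹ + (X ^ (-(2 * σ))) ^ 2)) := by
    have := add_pow_le (show 0 ≤ T ^ (-(1 / 4) : ℝ) by positivity) (show 0 ≤ X ^ (-σ) by positivity) 4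
    have f1 : (T ^ (-(1 / 4) : ℝ)) ^ 4 = T⁻¹ := by
      rw [← Real.rpow_natCast, ← Real.rpow_mul T0.le, ← Real.rpow_neg_one]; norm_num
    have f2 : (X ^ (-σ)) ^ 4 = (X ^ (-(2 * σ))) ^ 2 := by
      rw [← Real.rpow_natCast, ← Real.rpow_natCast, ← Real.rpow_mul X0.le, ← Real.rpow_mul X0.le]; congr 1; push_cast; ring
    rw [f1, f2] at this
    norm_num at this
    calc M ^ 4 = C ^ 4 * X ^ 4 * L ^ 12 * (T ^ (-(1 / 4) : ℝ) + X ^ (-σ)) ^ 4 := by rw [hM]; ring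
      _ ≤ _ := by gcongr
  have e3 : X ^ (6 - c) = X ^ 4 * X ^ (2 - c) := by
    rw [show (6 - c) = (4:ℕ) + (2 - c) by push_cast; ring, Real.rpow_add X0, Real.rpow_natCast]
  have Ti : T⁻¹ = Real.exp (-(1 / 2) * z) := by rw [hT, ← Real.exp_neg]; congr 1; ring
  have g1 : L ^ 14 * T⁻¹ ≤ C1 * Real.exp (-(1 / 3) * z) := by rw [Ti]; exact q1
  have g2 : L ^ 14 * (X ^ (-(2 * σ))) ^ 2 ≤ C3 * C2 * Real.exp (-(1 / 3) * z) := by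
    have : X ^ (2 * σ) * X ^ (-(2 * σ)) = 1 := by rw [← Real.rpow_add X0]; simp
    have ez : Real.exp (-z) ≤ Real.exp (-(1 / 3) * z) := Real.exp_le_exp.2 (by linarith only [z0])
    calc L ^ 14 * (X ^ (-(2 * σ))) ^ 2 ≤ C3 * X ^ (2 * σ) * (X ^ (-(2 * σ))) ^ 2 := by gcongr
      _ = C3 * (X ^ (2 * σ) * X ^ (-(2 * σ))) * X ^ (-(2 * σ)) := by ring
      _ ≤ C3 * 1 * (C2 * Real.exp (-(1 / 3) * z)) := by
        rw [this]
        have : X ^ (-(2 * σ)) ≤ C2 * Real.exp (-(1 / 3) * z) := q2.trans (by gcongr)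
        gcongr
      _ = _ := by ring
  refine st1.trans ?_
  calc _ ≤ (C ^ 4 * X ^ 4 * L ^ 12 * (8 * (T⁻¹ + (X ^ (-(2 * σ))) ^ 2))) * (8 * 2 ^ c * L ^ 2 * X ^ (2 - c)) :=
        mul_le_mul m4 st2 (intervalIntegral.integral_nonneg (by positivity) fun _ _ => by positivity) (by positivity)
    _ = C ^ 4 * 8 * (8 * 2 ^ c) * (X ^ 4 * X ^ (2 - c)) * (L ^ 14 * T⁻¹ + L ^ 14 * (X ^ (-(2 * σ))) ^ 2) := by ring
    _ ≤ C ^ 4 * 8 * (8 * 2 ^ c) * (X ^ 4 * X ^ (2 - c)) * (C1 * Real.exp (-(1 / 3) * z) + C3 * C2 * Real.exp (-(1 / 3) * z)) := by gcongr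
    _ = _ := by rw [e3]; ring

theorem regI (c : ℝ) (hc : 1 < c) (X T K : ℝ) (hX : 0 < X) (hT : 0 < T) (hK : T * X ^ (-c) ≤ K) :
    ∫ x in (T * X ^ (-c))..K, ‖I X c x‖ ^ 6 ≤ (2 ^ c) ^ 6 * X ^ (6 - c) * (T ^ 5)⁻¹ := by
  have pc : 0 < X ^ (-c) := by positivity
  have a0 : 0 < T * X ^ (-c) := by positivity
  obtain ⟨B, hB⟩ : ∃ B, B = 2 ^ c * X / X ^ c := ⟨_, rfl⟩
  have B0 : 0 < B := by rw [hB]; positivity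
  have hn : (0:ℝ) ∉ Set.uIcc (T * X ^ (-c)) K := by
    rw [Set.uIcc_of_le hK]; intro h; linarith [h.1]
  have hcon : ContinuousOn (fun x : ℝ => B ^ 6 * x ^ (-6 : ℤ)) (Set.uIcc (T * X ^ (-c)) K) :=
    continuousOn_const.mul (fun x hx => (continuousAt_zpow₀ x _ (Or.inl fun h => hn (h ▸ hx))).continuousWithinAt)
  have h1 : ∫ x in (T * X ^ (-c))..K, ‖I X c x‖ ^ 6 ≤ ∫ x in (T * X ^ (-c))..K, B ^ 6 * x ^ (-6 : ℤ) := by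
    refine intervalIntegral.integral_mono_on hK (((I_cont X c hc).norm.pow 6).intervalIntegrable _ _) hcon.intervalIntegrable fun x hx => ?_
    have x0 : 0 < x := lt_of_lt_of_le a0 hx.1
    have := I_bd X c x hX hc x0.ne'
    rw [abs_of_pos x0] at this
    refine (pow_le_pow_left₀ (norm_nonneg _) this 6).trans_eq ?_
    rw [hB, zpow_neg]; norm_cast; field_simp
  rw [intervalIntegral.integral_const_mul, integral_zpow (Or.inr ⟨by norm_num, hn⟩)] at h1
  refine h1.trans ?_
  have K0 : 0 < K := by linarith only [hK, a0]
  have k1 : (K ^ (-6 + 1 : ℤ) - (T * X ^ (-c)) ^ (-6 + 1 : ℤ)) / ((-6 : ℤ) + 1) ≤ ((T * X ^ (-c)) ^ 5)⁻¹ := by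
    have p1 : 0 < K ^ (-5 : ℤ) := by positivity
    have p2 : 0 < (T * X ^ (-c)) ^ (-5 : ℤ) := by positivity
    have p3 : (T * X ^ (-c)) ^ (-5 : ℤ) = ((T * X ^ (-c)) ^ 5)⁻¹ := by rw [zpow_neg]; norm_cast
    rw [← p3, show (-6 + 1 : ℤ) = -5 by norm_num, show (((-6 : ℤ) : ℝ) + 1) = -5 by norm_num, div_le_iff_of_neg (by norm_num)]
    linarith only [p1, p2]
  push_cast at k1 ⊢
  refine (mul_le_mul_of_nonneg_left k1 (by positivity)).trans_eq ?_
  rw [hB, show (6 - c) = -c + (6:ℕ) by push_cast; ring, Real.rpow_add hX, Real.rpow_natCast, Real.rpow_neg hX.le]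
  field_simp

theorem MID (c : ℝ) (hc1 : 1 < c) (hc2 : c < 37 / 18) (hc3 : c ≠ 2) : ∃ C > 0, ∃ X₀ : ℝ, 3 ≤ X₀ ∧ ∀ X, X₀ ≤ X →
    ∫ x in (0:ℝ)..(Real.log X ^ 5), ‖S X c x ^ 3 - I X c x ^ 3‖ ^ 2 ≤ C * X ^ (6 - c) * Real.exp (-(1 / 3) * Real.log X ^ ((1:ℝ) / 5)) := by
  have hj : ∀ j : ℕ, c ≠ j := by
    intro j h
    have h1 : (1:ℝ) < j := h ▸ hc1
    have h2 : (j:ℝ) < 3 := by rw [← h]; linarith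
    have h1' : 1 < j := by exact_mod_cast h1
    have h2' : j < 3 := by exact_mod_cast h2
    have : j = 2 := by omega
    exact hc3 (by rw [h, this]; norm_num)
  obtain ⟨CA, CA0, XA, hXA, HA⟩ := regA c hc1
  obtain ⟨CB, CB0, XB, hXB, HB⟩ := regB c hc1 hj
  obtain ⟨σ, hσ, CL, CL0, XL, hXL, HL⟩ := LV c hc1 hc2 hc3
  obtain ⟨C2, hC2, H2⟩ := small1 σ hσ
  refine ⟨CA + (2 * (CB + CL * C2) + 2 * (2 ^ c) ^ 6), by positivity, max XB (max XA XL), hXB.trans (le_max_left _ _), fun X hX => ?_⟩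
  have xb := (le_max_left _ _).trans hX
  have xa := (le_max_left _ _).trans ((le_max_right _ _).trans hX)
  have xl := (le_max_right _ _).trans ((le_max_right _ _).trans hX)
  have X3 : 3 ≤ X := hXB.trans xb
  have X0 : 0 < X := by linarith
  have Xe : Real.exp 1 ≤ X := by linarith [Real.exp_one_lt_d9]
  have L1 : 1 ≤ Real.log X := (Real.le_log_iff_exp_le X0).2 Xe
  have tx := T0X X Xe
  have a := HA X xa
  have b := HB X xb
  have l := HL X xl
  have s := H2 X (by linarith only [hXB, xb])
  obtain ⟨z, hz⟩ : ∃ z, z = Real.log X ^ ((1:ℝ) / 5) := ⟨_, rfl⟩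
  have z0 : 0 ≤ z := hz ▸ Real.rpow_nonneg (by linarith only [L1]) _
  rw [← hz] at tx a b s ⊢
  obtain ⟨T, hT⟩ : ∃ T, T = Real.exp (1 / 2 * z) := ⟨_, rfl⟩
  rw [← hT] at tx a b
  have T0 : 0 < T := hT ▸ Real.exp_pos _
  have pc : 0 < X ^ (-c) := by positivity
  have e1 : X ^ (1 - c) = X * X ^ (-c) := by rw [sub_eq_add_neg, Real.rpow_add X0, Real.rpow_one]
  have hab : T * X ^ (-c) ≤ X ^ (1 - c) := by rw [e1]; gcongr
  have hbK : X ^ (1 - c) ≤ Real.log X ^ 5 :=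
    (Real.rpow_le_one_of_one_le_of_nonpos (by linarith only [hXB, xb]) (by linarith only [hc1])).trans (one_le_pow₀ L1)
  have haK := hab.trans hbK
  have i := regI c hc1 X T _ X0 T0 haK
  have cS := (S_cont X c)
  have cI := (I_cont X c hc1)
  have cF : Continuous fun x => ‖S X c x ^ 3 - I X c x ^ 3‖ ^ 2 := ((cS.pow 3).sub (cI.pow 3)).norm.pow 2
  have c6 : Continuous fun x => ‖S X c x‖ ^ 6 := cS.norm.pow 6
  have i6 : Continuous fun x => ‖I X c x‖ ^ 6 := cI.norm.pow 6
  rw [← intervalIntegral.integral_add_adjacent_intervals (cF.intervalIntegrable 0 (T * X ^ (-c))) (cF.intervalIntegrable _ _)]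
  have m : ∫ x in (T * X ^ (-c))..(Real.log X ^ 5), ‖S X c x ^ 3 - I X c x ^ 3‖ ^ 2 ≤ 2 * (∫ x in (T * X ^ (-c))..(Real.log X ^ 5), ‖S X c x‖ ^ 6) + 2 * ∫ x in (T * X ^ (-c))..(Real.log X ^ 5), ‖I X c x‖ ^ 6 := by
    rw [← intervalIntegral.integral_const_mul, ← intervalIntegral.integral_const_mul, ← intervalIntegral.integral_add ((c6.const_mul 2).intervalIntegrable _ _) ((i6.const_mul 2).intervalIntegrable _ _)]
    exact intervalIntegral.integral_mono_on haK (cF.intervalIntegrable _ _) (((c6.const_mul 2).add (i6.const_mul 2)).intervalIntegrable _ _) fun x _ => cube_sq _ _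
  rw [← intervalIntegral.integral_add_adjacent_intervals (c6.intervalIntegrable _ (X ^ (1 - c))) (c6.intervalIntegrable _ _)] at m
  obtain ⟨E, hE⟩ : ∃ E, E = Real.exp (-(1 / 3) * z) := ⟨_, rfl⟩
  have ez : Real.exp (-z) ≤ E := by rw [hE]; exact Real.exp_le_exp.2 (by linarith only [z0])
  have T5 : (T ^ 5)⁻¹ ≤ E := by
    rw [hT, hE, ← Real.exp_nat_mul, ← Real.exp_neg]; exact Real.exp_le_exp.2 (by push_cast; linarith only [z0])
  rw [← hE] at a b ⊢
  have l2 : CL * X ^ (6 - c - σ) ≤ CL * C2 * X ^ (6 - c) * E := by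
    rw [sub_eq_add_neg (6 - c) σ, Real.rpow_add X0]
    calc CL * (X ^ (6 - c) * X ^ (-σ)) ≤ CL * (X ^ (6 - c) * (C2 * E)) := by
          gcongr; exact s.trans (by gcongr)
      _ = _ := by ring
  have i2 : (2 ^ c) ^ 6 * X ^ (6 - c) * (T ^ 5)⁻¹ ≤ (2 ^ c) ^ 6 * X ^ (6 - c) * E := by gcongr
  linarith only [l, i, m, b, a, l2, i2]


theorem gsplit (D Φ : ℝ → ℂ) (hD : Continuous D) (hΦ : Continuous Φ) (K M α β : ℝ) (hK : 1 ≤ K) (hα : 0 ≤ α) (hβ : 0 ≤ β)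
    (h1 : ∀ x, ‖D x‖ ≤ M) (h2 : ∀ x, ‖Φ x‖ ≤ α) (h3 : ∀ x, K ≤ |x| → ‖Φ x‖ ≤ β / x ^ 2) (he : ∀ x, ‖D (-x)‖ = ‖D x‖) :
    Integrable Φ ∧ (Integrable fun x => D x * Φ x) ∧ (Integrable fun x => ‖D x * Φ x‖ ^ 2) ∧
    ∫ x, ‖D x * Φ x‖ ^ 2 ≤ 2 * α ^ 2 * (∫ x in (0:ℝ)..K, ‖D x‖ ^ 2) + 4 * Real.pi * M ^ 2 * β ^ 2 := by
  have b1 : ∀ x, K ≤ |x| → ‖Φ x‖ ≤ 2 * β * (1 + x ^ 2)⁻¹ := by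
    intro x hx
    have : 1 ≤ x ^ 2 := by rw [← sq_abs]; exact one_le_pow₀ (hK.trans hx)
    refine (h3 x hx).trans ?_
    rw [← div_eq_mul_inv, div_le_div_iff₀ (by linarith) (by linarith)]
    linarith [mul_le_mul_of_nonneg_left this hβ]
  have hiΦ : Integrable Φ := by
    refine (integrable_inv_one_add_sq.const_mul (α * (1 + K ^ 2) + 2 * β)).mono' hΦ.aestronglyMeasurable (Filter.Eventually.of_forall fun x => ?_)
    have p : 0 < (1 + x ^ 2)⁻¹ := by positivity
    rw [add_mul]
    rcases le_total K |x| with h | h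
    · have : 0 ≤ α * (1 + K ^ 2) * (1 + x ^ 2)⁻¹ := by positivity
      linarith [b1 x h]
    · have : α ≤ α * (1 + K ^ 2) * (1 + x ^ 2)⁻¹ := by
        rw [← div_eq_mul_inv, le_div_iff₀ (by positivity)]
        have := pow_le_pow_left₀ (abs_nonneg x) h 2
        rw [sq_abs] at this
        gcongr
      have : 0 ≤ 2 * β * (1 + x ^ 2)⁻¹ := by positivity
      linarith [h2 x]
  have hi : Integrable fun x => D x * Φ x := hiΦ.bdd_mul hD.aestronglyMeasurable (Filter.Eventually.of_forall h1)
  have cD : Continuous fun x => ‖D x‖ ^ 2 := hD.norm.pow 2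
  have pt : ∀ x, ‖D x * Φ x‖ ^ 2 ≤ (Set.Ioc (-K) K).indicator (fun x => α ^ 2 * ‖D x‖ ^ 2) x + 4 * M ^ 2 * β ^ 2 * (1 + x ^ 2)⁻¹ := by
    intro x
    rw [norm_mul, mul_pow]
    by_cases h : x ∈ Set.Ioc (-K) K
    · rw [Set.indicator_of_mem h]
      have : 0 ≤ 4 * M ^ 2 * β ^ 2 * (1 + x ^ 2)⁻¹ := by positivity
      have := mul_le_mul_of_nonneg_left (pow_le_pow_left₀ (norm_nonneg _) (h2 x) 2) (show 0 ≤ ‖D x‖ ^ 2 by positivity)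
      linarith
    · rw [Set.indicator_of_notMem h, zero_add]
      have hx : K ≤ |x| := by
        by_contra hh
        rw [not_le, abs_lt] at hh
        exact h ⟨hh.1, hh.2.le⟩
      have q1 := pow_le_pow_left₀ (norm_nonneg _) (b1 x hx) 2
      have q2 := pow_le_pow_left₀ (norm_nonneg _) (h1 x) 2
      have q3 : (1 + x ^ 2)⁻¹ ≤ 1 := inv_le_one_of_one_le₀ (by linarith [sq_nonneg x])
      have q0 : 0 < (1 + x ^ 2)⁻¹ := by positivity
      calc _ ≤ M ^ 2 * (2 * β * (1 + x ^ 2)⁻¹) ^ 2 := by gcongr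
        _ = 4 * M ^ 2 * β ^ 2 * (1 + x ^ 2)⁻¹ * (1 + x ^ 2)⁻¹ := by ring
        _ ≤ _ := mul_le_of_le_one_right (by positivity) q3
  have hii : Integrable ((Set.Ioc (-K) K).indicator (fun x => α ^ 2 * ‖D x‖ ^ 2)) :=
    (integrable_indicator_iff measurableSet_Ioc).2 (cD.const_mul _).integrableOn_Ioc
  have hi2 : Integrable fun x : ℝ => 4 * M ^ 2 * β ^ 2 * (1 + x ^ 2)⁻¹ := integrable_inv_one_add_sq.const_mul _
  have hi3 : Integrable fun x => ‖D x * Φ x‖ ^ 2 := by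
    refine (hii.add hi2).mono' ((hD.mul hΦ).norm.pow 2).aestronglyMeasurable (Filter.Eventually.of_forall fun x => ?_)
    rw [Real.norm_eq_abs, abs_of_nonneg (by positivity)]
    exact pt x
  refine ⟨hiΦ, hi, hi3, ?_⟩
  refine (integral_mono hi3 (hii.add hi2) pt).trans_eq ?_
  simp only [Pi.add_apply]
  rw [integral_add hii hi2, integral_const_mul, integral_univ_inv_one_add_sq, integral_indicator measurableSet_Ioc, integral_const_mul, ← intervalIntegral.integral_of_le (by linarith),
    ← intervalIntegral.integral_add_adjacent_intervals (cD.intervalIntegrable (-K) 0) (cD.intervalIntegrable 0 K)]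
  have := intervalIntegral.integral_comp_neg (a := -K) (b := 0) fun x => ‖D x‖ ^ 2
  simp only [he, neg_zero, neg_neg] at this
  rw [this]; ring

theorem Phi_tail (L ε b p x : ℝ) (k : ℕ) (hL : Real.exp 12 ≤ L) (hε : ε = (L ^ 2)⁻¹) (hk : k = ⌈L⌉₊) (hb : b = ε / 10) (hx : L ^ 5 ≤ |x|)
    (h : p ≤ min (1 / (Real.pi * |x|)) (1 / (Real.pi * |x|) * ((k : ℝ) / (2 * Real.pi * |x| * b)) ^ k)) :
    p ≤ Real.exp (-20 * L) * L ^ 5 / x ^ 2 := by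
  have L13 : 13 ≤ L := by linarith only [hL, Real.add_one_le_exp 12]
  have L0 : 0 < L := by linarith only [L13]
  have x0 : 0 < |x| := lt_of_lt_of_le (by positivity) hx
  have k1 : (k:ℝ) ≤ 2 * L := by rw [hk]; linarith only [L13, Nat.ceil_lt_add_one L0.le]
  have k2 : L ≤ k := by rw [hk]; exact Nat.le_ceil _
  have kp : k ≠ 0 := by rintro rfl; norm_num at k2; linarith only [L13, k2]
  have b0 : 0 < b := by rw [hb, hε]; positivity
  have q : (k : ℝ) / (2 * Real.pi * |x| * b) ≤ 4 / L ^ 2 * (L ^ 5 / |x|) := by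
    rw [div_le_iff₀ (by positivity)]
    calc (k:ℝ) ≤ 2 * L := k1
      _ ≤ 2 * L * (4 * Real.pi / 10) := le_mul_of_one_le_right (by positivity) (by linarith [Real.pi_gt_three])
      _ = _ := by rw [hb, hε]; field_simp
  have d : 4 / L ^ 2 ≤ Real.exp (-20) := by
    rw [div_le_iff₀ (by positivity)]
    have h1 := pow_le_pow_left₀ (Real.exp_pos _).le hL 2
    have h2 : Real.exp (-20) * Real.exp 12 ^ 2 = Real.exp 4 := by rw [← Real.exp_nat_mul, ← Real.exp_add]; norm_num
    have := mul_le_mul_of_nonneg_left h1 (Real.exp_pos (-20)).le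
    linarith only [h2, this, Real.add_one_le_exp 4]
  have r1 : L ^ 5 / |x| ≤ 1 := (div_le_one x0).2 hx
  have r2 : (L ^ 5 / |x|) ^ k ≤ L ^ 5 / |x| := pow_le_of_le_one (by positivity) r1 kp
  have r3 : Real.exp (-20) ^ k ≤ Real.exp (-20 * L) := by
    rw [← Real.exp_nat_mul]; exact Real.exp_le_exp.2 (by linarith)
  have q0 : 0 ≤ (k : ℝ) / (2 * Real.pi * |x| * b) := by positivity
  have s : ((k : ℝ) / (2 * Real.pi * |x| * b)) ^ k ≤ Real.exp (-20 * L) * (L ^ 5 / |x|) := by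
    calc _ ≤ (4 / L ^ 2 * (L ^ 5 / |x|)) ^ k := pow_le_pow_left₀ q0 q k
      _ = (4 / L ^ 2) ^ k * (L ^ 5 / |x|) ^ k := mul_pow _ _ _
      _ ≤ Real.exp (-20) ^ k * (L ^ 5 / |x|) := by gcongr
      _ ≤ _ := by gcongr
  have t : 1 / (Real.pi * |x|) ≤ 1 / |x| := one_div_le_one_div_of_le x0 (le_mul_of_one_le_left x0.le (by linarith only [Real.pi_gt_three]))
  refine (h.trans (min_le_right _ _)).trans ?_
  calc _ ≤ 1 / |x| * (Real.exp (-20 * L) * (L ^ 5 / |x|)) := mul_le_mul t s (pow_nonneg q0 k) (by positivity)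
    _ = _ := by rw [← sq_abs x]; field_simp

set_option maxHeartbeats 1000000 in
theorem FIN (c : ℝ) (hc1 : 1 < c) (hc2 : c < 37 / 18) (hc3 : c ≠ 2) : ∃ C > 0, ∃ X₀ : ℝ, 3 ≤ X₀ ∧ ∀ X, X₀ ≤ X → ∀ N : ℝ, 0 < N → ∀ ε : ℝ, ∀ k : ℕ, ∀ a b : ℝ,
    ε = ((Real.log X) ^ 2)⁻¹ → k = ⌈Real.log X⌉₊ → a = 9 * ε / 10 → b = ε / 10 →
    ∀ Φ : ℝ → ℂ, Continuous Φ → (∀ x, ‖Φ x‖ ≤ 2 * a) →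
      (∀ x : ℝ, x ≠ 0 → ‖Φ x‖ ≤
        min (1 / (Real.pi * |x|)) (1 / (Real.pi * |x|) * ((k : ℝ) / (2 * Real.pi * |x| * b)) ^ k)) →
      (∫ R in N..(2 * N),
          ‖(∫ x : ℝ, (S X c x) ^ 3 * e (-(R * x)) * Φ x) -
            (∫ x : ℝ, (I X c x) ^ 3 * e (-(R * x)) * Φ x)‖ ^ 2) ≤
        C * ε ^ 2 * X ^ (6 - c) * Real.exp (-(1 / 3) * Real.log X ^ ((1:ℝ) / 5)) := by
  obtain ⟨C, C0, X₀, hX₀, H⟩ := MID c hc1 hc2 hc3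
  obtain ⟨C1, hC1, H1⟩ := logpow 1 one_pos 20
  refine ⟨3 * (8 * C + 4 * Real.pi * 256 * C1), by positivity, max X₀ (Real.exp (Real.exp 12)), hX₀.trans (le_max_left _ _), ?_⟩
  intro X hX N hN ε k a b hε hk ha hb Φ hΦ hΦ1 hΦ2
  have xx := (le_max_left _ _).trans hX
  have X3 : 3 ≤ X := hX₀.trans xx
  have X0 : 0 < X := by linarith only [hX₀, xx]
  have L12 : Real.exp 12 ≤ Real.log X := (Real.le_log_iff_exp_le X0).2 ((le_max_right _ _).trans hX)
  have Xe : Real.exp 1 ≤ X := by linarith only [hX₀, xx, Real.exp_one_lt_d9]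
  have L1 : 1 ≤ Real.log X := (Real.le_log_iff_exp_le X0).2 Xe
  have m := H X xx
  have lp := H1 X (by linarith only [hX₀, xx])
  rw [Real.rpow_one] at lp
  have tx := T0X X Xe
  obtain ⟨z, hz⟩ : ∃ z, z = Real.log X ^ ((1:ℝ) / 5) := ⟨_, rfl⟩
  have z0 : 0 ≤ z := hz ▸ Real.rpow_nonneg (by linarith only [L1]) _
  rw [← hz] at tx m ⊢
  have cS := S_cont X c
  have cI := I_cont X c hc1
  obtain ⟨L, hL⟩ : ∃ L, L = Real.log X := ⟨_, rfl⟩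
  rw [← hL] at L12 L1 m lp hε hk
  have L0 : 0 < L := by linarith only [L1]
  have ε0 : 0 < ε := by rw [hε]; positivity
  have M1 : ∀ x, ‖S X c x‖ ^ 3 ≤ (2 * X * (1 + L)) ^ 3 := fun x => pow_le_pow_left₀ (norm_nonneg _) (hL ▸ S_triv X c x (by linarith only [hX₀, xx])) 3
  have XL : X ≤ 2 * X * (1 + L) := by linarith only [X0, mul_pos X0 (show 0 < L by linarith only [L1])]
  have M2' : ∀ x, ‖I X c x‖ ^ 3 ≤ (2 * X * (1 + L)) ^ 3 := fun x => pow_le_pow_left₀ (norm_nonneg _) ((I_triv X c x X0).trans XL) 3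
  have G := gsplit (fun x => S X c x ^ 3 - I X c x ^ 3) Φ ((cS.pow 3).sub (cI.pow 3)) hΦ (L ^ 5) (2 * (2 * X * (1 + L)) ^ 3) (2 * ε) (Real.exp (-20 * L) * L ^ 5)
    (one_le_pow₀ L1) (by linarith only [ε0]) (by positivity)
    (fun x => by
      refine (norm_sub_le _ _).trans ?_
      rw [norm_pow, norm_pow]; linarith only [M1 x, M2' x])
    (fun x => (hΦ1 x).trans (by rw [ha]; linarith only [ε0]))
    (fun x hx => Phi_tail L ε b _ x k L12 hε hk hb hx (hΦ2 x (by
      rintro rfl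
      rw [abs_zero] at hx
      have : 0 < L ^ 5 := by positivity
      linarith only [hx, this])))
    (fun x => by simp only [S_conj, I_conj]; rw [← map_pow, ← map_pow, ← map_sub, RCLike.norm_conj])
  obtain ⟨g1, g2, g3, g4⟩ := G
  have hB := bessel _ g2 g3 N hN
  have eqI : ∀ R : ℝ, (∫ x : ℝ, (S X c x) ^ 3 * e (-(R * x)) * Φ x) - (∫ x : ℝ, (I X c x) ^ 3 * e (-(R * x)) * Φ x) = ∫ x, (S X c x ^ 3 - I X c x ^ 3) * Φ x * e (-(R * x)) := by
    intro R
    have ce : Continuous fun x : ℝ => e (-(R * x)) := e_cont.comp (by fun_prop)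
    have i1 : Integrable fun x : ℝ => (S X c x) ^ 3 * e (-(R * x)) * Φ x :=
      g1.bdd_mul (c := (2 * X * (1 + L)) ^ 3) ((cS.pow 3).mul ce).aestronglyMeasurable (Filter.Eventually.of_forall fun x => by
        rw [norm_mul, e_norm, mul_one, norm_pow]; exact M1 x)
    have i2 : Integrable fun x : ℝ => (I X c x) ^ 3 * e (-(R * x)) * Φ x :=
      g1.bdd_mul (c := (2 * X * (1 + L)) ^ 3) ((cI.pow 3).mul ce).aestronglyMeasurable (Filter.Eventually.of_forall fun x => by
        rw [norm_mul, e_norm, mul_one, norm_pow]; exact M2' x)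
    rw [← integral_sub i1 i2]
    refine integral_congr_ae (Filter.Eventually.of_forall fun x => ?_)
    simp only []; ring
  simp only [eqI]
  refine hB.trans ?_
  obtain ⟨E, hE⟩ : ∃ E, E = Real.exp (-(1 / 3) * z) := ⟨_, rfl⟩
  rw [← hE] at m ⊢
  have XE : X⁻¹ ≤ E := by
    rw [hE]
    refine (inv_anti₀ (Real.exp_pos _) tx).trans ?_
    rw [← Real.exp_neg]; exact Real.exp_le_exp.2 (by linarith only [z0])
  have e20 : Real.exp (-20 * L) = (X ^ 20)⁻¹ := by
    rw [neg_mul, Real.exp_neg, hL, show (20:ℝ) = ((20:ℕ):ℝ) by norm_num, Real.exp_nat_mul, Real.exp_log X0]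
  have tail : 4 * Real.pi * (2 * (2 * X * (1 + L)) ^ 3) ^ 2 * (Real.exp (-20 * L) * L ^ 5) ^ 2 ≤ 4 * Real.pi * 256 * C1 * ε ^ 2 * X ^ (6 - c) * E := by
    have X6 : 1 ≤ X ^ (6 - c) := Real.one_le_rpow (by linarith only [hX₀, xx]) (by linarith only [hc2])
    have XX : X ^ 7 * X ≤ X ^ 40 := by rw [← pow_succ]; exact pow_le_pow_right₀ (by linarith only [hX₀, xx]) (by norm_num)
    have a1 : X ^ 7 * (X ^ 40)⁻¹ ≤ E := by
      refine le_trans ?_ XE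
      rw [← div_eq_mul_inv, ← one_div, div_le_div_iff₀ (by positivity) X0, one_mul]; exact XX
    have a2 : (1 + L) ^ 6 * L ^ 10 ≤ C1 * X * ε ^ 2 := by
      have : (1 + L) ^ 6 * L ^ 10 = ((1 + L) ^ 6 * L ^ 14) * ε ^ 2 := by rw [hε]; field_simp
      rw [this]
      refine mul_le_mul_of_nonneg_right (le_trans ?_ lp) (by positivity)
      calc (1 + L) ^ 6 * L ^ 14 ≤ (1 + L) ^ 6 * (1 + L) ^ 14 := by gcongr; linarith only []
        _ = _ := by ring
    calc _ = 4 * Real.pi * 256 * ((1 + L) ^ 6 * L ^ 10) * (X ^ 6 * (X ^ 40)⁻¹) := by rw [e20]; field_simp; ring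
      _ ≤ 4 * Real.pi * 256 * (C1 * X * ε ^ 2) * (X ^ 6 * (X ^ 40)⁻¹) := by gcongr
      _ = 4 * Real.pi * 256 * C1 * ε ^ 2 * 1 * (X ^ 7 * (X ^ 40)⁻¹) := by ring
      _ ≤ _ := by gcongr
  have mm := mul_le_mul_of_nonneg_left m (show 0 ≤ 2 * (2 * ε) ^ 2 by positivity)
  calc _ ≤ 3 * (2 * (2 * ε) ^ 2 * (C * X ^ (6 - c) * E) + 4 * Real.pi * 256 * C1 * ε ^ 2 * X ^ (6 - c) * E) := by linarith only [g4, tail, mm]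
    _ = _ := by ring

theorem stmt2 (c : ℝ) (hc1 : 1 < c) (hc2 : c < 37 / 18) (hc3 : c ≠ 2) :
    ∃ η₀ > 0, ∀ η : ℝ, 0 < η → η < η₀ →
    ∃ C > 0, ∃ N₁ : ℝ, ∀ N ≥ N₁,
    ∀ X ε : ℝ, ∀ k : ℕ, ∀ a b : ℝ,
      X = (2 * N / 3) ^ (1 / c) → ε = ((Real.log X) ^ 2)⁻¹ → k = ⌈Real.log X⌉₊ →
      a = 9 * ε / 10 → b = ε / 10 →
    ∀ φ : ℝ → ℝ, ∀ Φ : ℝ → ℂ,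
      ContDiff ℝ (k : ℕ∞) φ →
      (∀ y, |y| ≤ a - b → φ y = 1) →
      (∀ y, a - b < |y| → |y| < a + b → 0 < φ y ∧ φ y < 1) →
      (∀ y, a + b ≤ |y| → φ y = 0) →
      (∀ x, Φ x = ∫ y : ℝ, e (-(x * y)) * (φ y : ℂ)) →
      (∀ x, ‖Φ x‖ ≤ 2 * a) →
      (∀ x : ℝ, x ≠ 0 → ‖Φ x‖ ≤
        min (1 / (Real.pi * |x|)) (1 / (Real.pi * |x|) * ((k : ℝ) / (2 * Real.pi * |x| * b)) ^ k)) →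
      (∫ R in N..(2 * N),
          ‖(∫ x : ℝ, (S X c x) ^ 3 * e (-(R * x)) * Φ x) -
            (∫ x : ℝ, (I X c x) ^ 3 * e (-(R * x)) * Φ x)‖ ^ 2) ≤
        C * ε ^ 2 * N ^ (6 / c - 1) *
          Real.exp (-(1 / 3) * ((1 / c) * Real.log (2 * N / 3)) ^ ((1 : ℝ) / 5)) := by
  obtain ⟨C, C0, X₀, hX₀, H⟩ := FIN c hc1 hc2 hc3
  refine ⟨1, one_pos, fun η _ _ => ⟨C, C0, 3 / 2 * X₀ ^ c, ?_⟩⟩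
  intro N hN X ε k a b hX hε hk ha hb φ Φ hφ _ _ hφ0 hΦ hΦ1 hΦ2
  have c0 : 0 < c := by linarith only [hc1]
  have P0 : 0 < X₀ ^ c := Real.rpow_pos_of_pos (by linarith only [hX₀]) _
  have N0 : 0 < N := lt_of_lt_of_le (by positivity) hN
  have hN' : X₀ ^ c ≤ 2 * N / 3 := by linarith only [hN]
  have hX1 : X₀ ≤ X := by
    have := Real.rpow_le_rpow P0.le hN' (show 0 ≤ 1 / c by positivity)
    rw [← Real.rpow_mul (by linarith only [hX₀]), mul_one_div_cancel c0.ne', Real.rpow_one] at this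
    rw [hX]; exact this
  have hlog : Real.log X = (1 / c) * Real.log (2 * N / 3) := by rw [hX, Real.log_rpow (by positivity)]
  have hpow : X ^ (6 - c) ≤ N ^ (6 / c - 1) := by
    rw [hX, ← Real.rpow_mul (by positivity), show 1 / c * (6 - c) = 6 / c - 1 by field_simp]
    refine Real.rpow_le_rpow (by positivity) (by linarith only [hN, P0]) ?_
    rw [sub_nonneg, le_div_iff₀ c0]; linarith only [hc2]
  have cφ : Continuous φ := hφ.continuous
  have sup : HasCompactSupport φ := HasCompactSupport.intro (isCompact_Icc (a := -(a + b)) (b := a + b)) fun y hy => hφ0 y (by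
    by_contra h
    rw [not_le, abs_lt] at h
    exact hy ⟨h.1.le, h.2.le⟩)
  have iφ : Integrable fun y => (φ y : ℂ) := (cφ.integrable_of_hasCompactSupport sup).ofReal
  have iφ2 : Integrable fun y => ‖(φ y : ℂ)‖ ^ 2 := by
    refine Continuous.integrable_of_hasCompactSupport (by fun_prop) ?_
    refine sup.comp_left (g := fun t : ℝ => ‖(t : ℂ)‖ ^ 2) ?_
    simp
  have cΦ : Continuous Φ := by
    have := (bessel_w _ iφ iφ2 1 one_pos).2.1
    refine this.congr fun x => ?_
    rw [hΦ]
    exact integral_congr_ae (Filter.Eventually.of_forall fun y => mul_comm _ _)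
  refine (H X hX1 N N0 ε k a b hε hk ha hb Φ cΦ hΦ1 hΦ2).trans ?_
  rw [hlog]
  gcongr
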